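/- Let k be a finite field and let f, g ∈ k[x,y,z] be homogeneous polynomials of degrees 2 and 4 respectively such that the surface X in the weighted projective space P(1,1,1,2) given by w² + f·w = g is smooth; concretely, assume that over an algebraic closure k̄ of k there is no point (x₀,y₀,z₀,w₀) ∈ k̄⁴ with (x₀,y₀,z₀) ≠ (0,0,0) at which the polynomial F = w² + f·w − g ∈ k̄[x,y,z,w] and all four of its partial derivatives ∂F/∂x, ∂F/∂y, ∂F/∂z, ∂F/∂w vanish simultaneously. Then X is unirational over k: there exist elements u, v, ω of the rational function field k(s,t) in two variables over k such that u and v are algebraically independent over k and ω² + f(u,v,1)·ω = g(u,v,1). -/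

import Mathlib

open MvPolynomial

universe u

set_option linter.all false

section Smooth

variable {k : Type u} [Field k]

/-- The affine cone over `w² + f w = g` has no singular point off `x = y = z = 0`,
over any field extension. -/
def SmoothPair (f g : MvPolynomial (Fin 3) k) : Prop :=
  ∀ (Ω : Type u) [Field Ω] [Algebra k Ω] (P : Fin 3 → Ω) (w : Ω), P ≠ 0 →
    2 * w + aeval P f = 0 → w ^ 2 + aeval P f * w = aeval P g →
    (∀ i, aeval P (pderiv i f) * w = aeval P (pderiv i g)) → False

theorem SmoothPair.of_closure {f g : MvPolynomial (Fin 3) k}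
    {F : MvPolynomial (Fin 4) (AlgebraicClosure k)}
    (hF : F = (X 3) ^ 2
        + (aeval (fun i : Fin 3 => (X (Fin.castSucc i) : MvPolynomial (Fin 4) (AlgebraicClosure k)))) f * X 3
        - (aeval (fun i : Fin 3 => (X (Fin.castSucc i) : MvPolynomial (Fin 4) (AlgebraicClosure k)))) g)
    (hsmooth : ¬ ∃ P : Fin 4 → AlgebraicClosure k,
        ¬ (P 0 = 0 ∧ P 1 = 0 ∧ P 2 = 0) ∧
        eval P F = 0 ∧ ∀ i : Fin 4, eval P (pderiv i F) = 0) : SmoothPair f g := by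
  intro Ω _ _ P w hP h0 h1 h2
  have hre : ∀ p : MvPolynomial (Fin 3) k,
      aeval (fun i : Fin 3 => (X (Fin.castSucc i) : MvPolynomial (Fin 4) (AlgebraicClosure k))) p
        = rename Fin.castSucc (map (algebraMap k (AlgebraicClosure k)) p) := by
    intro p
    induction p using MvPolynomial.induction_on with
    | C a => simp [algebraMap_eq]
    | add p q hp hq => simp [hp, hq]
    | mul_X p j hp => simp [hp]
  have hev : ∀ (p : MvPolynomial (Fin 3) k) (Q : Fin 4 → AlgebraicClosure k),
      eval Q (rename Fin.castSucc (map (algebraMap k (AlgebraicClosure k)) p))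
        = aeval (fun i => Q (Fin.castSucc i)) p := by
    intro p Q
    rw [eval_rename, eval_map]; rfl
  let J : Ideal (MvPolynomial (Fin 4) k) :=
    Ideal.span ({X 3 ^ 2 + rename Fin.castSucc f * X 3 - rename Fin.castSucc g,
      2 * X 3 + rename Fin.castSucc f} ∪ Set.range (fun i : Fin 3 =>
        rename Fin.castSucc (pderiv i f) * X 3 - rename Fin.castSucc (pderiv i g)))
  obtain ⟨i, hi⟩ : ∃ i, P i ≠ 0 := by
    by_contra h; push Not at h; exact hP (funext h)
  have hXi : (X (Fin.castSucc i) : MvPolynomial (Fin 4) k) ∉ J.radical := by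
    rintro ⟨n, hn⟩
    have hle : J ≤ RingHom.ker (aeval (Fin.snoc P w : Fin 4 → Ω) : MvPolynomial (Fin 4) k →ₐ[k] Ω) := by
      refine Ideal.span_le.2 ?_
      have hc : (Fin.snoc P w : Fin 4 → Ω) ∘ Fin.castSucc = P := by
        funext i; simp
      have h3 : (Fin.snoc P w : Fin 4 → Ω) 3 = w := by
        exact Fin.snoc_last (α := fun _ => Ω) w P
      rintro x ((rfl | rfl) | ⟨j, rfl⟩)
      · simp [aeval_rename, hc, h3, h1]
      · simp [aeval_rename, hc, h3, h0]
      · simp [aeval_rename, hc, h3, h2]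
    have := hle hn
    simp at this
    exact hi this.1
  rw [← vanishingIdeal_zeroLocus_eq_radical (K := AlgebraicClosure k), mem_vanishingIdeal_iff] at hXi
  push Not at hXi
  obtain ⟨Q, hQ, hQi⟩ := hXi
  rw [zeroLocus_span] at hQ
  have e1 := hQ _ (Or.inl (Or.inl rfl))
  have e2 := hQ _ (Or.inl (Or.inr rfl))
  have e3 := fun j : Fin 3 => hQ _ (Or.inr ⟨j, rfl⟩)
  simp only [map_add, map_sub, map_mul, map_pow, aeval_X, aeval_rename, map_ofNat] at e1 e2 e3
  have hc : Q ∘ Fin.castSucc = fun i => Q (Fin.castSucc i) := rfl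
  rw [hc] at e1 e2
  refine hsmooth ⟨Q, ?_, ?_, ?_⟩
  · rintro ⟨q0, q1, q2⟩
    rw [aeval_X] at hQi
    fin_cases i
    · exact hQi q0
    · exact hQi q1
    · exact hQi q2
  · rw [hF, hre, hre]
    simp only [map_add, map_sub, map_mul, map_pow, eval_X, hev]
    exact e1
  · intro i
    rw [hF, hre, hre]
    refine Fin.lastCases ?_ (fun j => ?_) i
    · have hl : ∀ p : MvPolynomial (Fin 3) (AlgebraicClosure k),
          pderiv (Fin.last 3) (rename Fin.castSucc p) = 0 := by
        intro p
        refine pderiv_eq_zero_of_notMem_vars fun h => ?_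
        have := vars_rename Fin.castSucc p h
        simp at this
        obtain ⟨a, _, ha⟩ := this
        exact absurd ha (Fin.castSucc_lt_last a).ne
      have h3 : (3 : Fin 4) = Fin.last 3 := rfl
      rw [h3] at e2
      simp only [h3, map_add, map_sub, Derivation.leibniz, Derivation.leibniz_pow, hl, pderiv_X_self]
      simp [hev] at e2 ⊢
      linear_combination e2
    · have h3 : pderiv (Fin.castSucc j) (X 3 : MvPolynomial (Fin 4) (AlgebraicClosure k)) = 0 :=
        pderiv_X_of_ne (by intro h; exact absurd h.symm (Fin.castSucc_lt_last j).ne)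
      have := e3 j
      simp only [map_add, map_sub, Derivation.leibniz, Derivation.leibniz_pow, h3,
        pderiv_rename (Fin.castSucc_injective 3), pderiv_map]
      simp [hev, hc] at this ⊢
      linear_combination this

end Smooth

theorem aeval_mul_of_isHomogeneous {σ k A : Type*} [CommSemiring k] [CommSemiring A]
    [Algebra k A] {p : MvPolynomial σ k} {n : ℕ} (hp : p.IsHomogeneous n) (t : A) (v : σ → A) :
    aeval (fun i => t * v i) p = t ^ n * aeval v p := by
  conv_lhs => rw [p.as_sum]
  conv_rhs => rw [p.as_sum]
  rw [map_sum, map_sum, Finset.mul_sum]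
  refine Finset.sum_congr rfl fun d hd => ?_
  have hdeg : d.degree = n := by
    by_contra h
    exact (mem_support_iff.1 hd) (hp.coeff_eq_zero h)
  rw [aeval_monomial, aeval_monomial, Finsupp.prod, Finsupp.prod]
  simp only [mul_pow, Finset.prod_mul_distrib]
  rw [Finset.prod_pow_eq_pow_sum, ← Finsupp.degree_apply, hdeg]
  ring

/-- A nonzero product of polynomials over a domain is homogeneous only if the factors are. -/
theorem isHomogeneous_left_of_mul {σ R : Type*} [CommRing R] [IsDomain R]
    {p q : MvPolynomial σ R} {n : ℕ} (h : (p * q).IsHomogeneous n) (h0 : p * q ≠ 0) :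
    ∃ m, p.IsHomogeneous m := by
  classical
  obtain ⟨hp0, hq0⟩ := mul_ne_zero_iff.1 h0
  -- grade by an auxiliary variable
  let φ : MvPolynomial σ R →ₐ[R] Polynomial (MvPolynomial σ R) :=
    aeval (fun i => Polynomial.X * Polynomial.C (X i))
  have hφ : ∀ (r : MvPolynomial σ R) (j : ℕ), (φ r).coeff j = homogeneousComponent j r := by
    intro r j
    induction r using MvPolynomial.induction_on' with
    | monomial d a =>
      have : φ (monomial d a) = Polynomial.C (monomial d a) * Polynomial.X ^ d.degree := by
        simp only [φ, aeval_monomial, Finsupp.prod, mul_pow, Finset.prod_mul_distrib]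
        rw [Finset.prod_pow_eq_pow_sum, ← Finsupp.degree_apply, monomial_eq, Finsupp.prod]
        simp only [map_mul, map_prod, map_pow]
        rw [Polynomial.algebraMap_apply, algebraMap_eq]
        ring
      rw [this, Polynomial.coeff_C_mul, Polynomial.coeff_X_pow]
      have hm := isHomogeneous_monomial (σ := σ) a (d := d) rfl
      split_ifs with hj
      · rw [hj, homogeneousComponent_eq_self hm]; simp
      · rw [homogeneousComponent_of_mem hm, if_neg hj]; simp
    | add r s hr hs => simp [hr, hs]
  have hpq : φ p * φ q = Polynomial.monomial n (p * q) := by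
    rw [← map_mul]
    ext1 j
    rw [hφ, Polynomial.coeff_monomial, homogeneousComponent_of_mem h]
    simp [eq_comm]
  have hne : φ p * φ q ≠ 0 := by rw [hpq]; simpa using h0
  obtain ⟨hpn, hqn⟩ := mul_ne_zero_iff.1 hne
  have h1 : (φ p).natDegree + (φ q).natDegree = n := by
    rw [← Polynomial.natDegree_mul hpn hqn, hpq, Polynomial.natDegree_monomial_eq _ h0]
  have h2 : (φ p).natTrailingDegree + (φ q).natTrailingDegree = n := by
    rw [← Polynomial.natTrailingDegree_mul hpn hqn, hpq, Polynomial.natTrailingDegree_monomial h0]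
  have h3 := Polynomial.natTrailingDegree_le_natDegree (φ p)
  have h4 := Polynomial.natTrailingDegree_le_natDegree (φ q)
  refine ⟨(φ p).natDegree, ?_⟩
  have : p = homogeneousComponent (φ p).natDegree p := by
    conv_lhs => rw [← sum_homogeneousComponent p]
    by_cases hmem : (φ p).natDegree ∈ Finset.range (p.totalDegree + 1)
    · refine Finset.sum_eq_single_of_mem _ hmem fun j _ hj => ?_
      rw [← hφ]
      rcases lt_or_gt_of_ne hj with hlt | hlt
      · exact Polynomial.coeff_eq_zero_of_lt_natTrailingDegree (by omega)
      · exact Polynomial.coeff_eq_zero_of_natDegree_lt hlt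
    · exfalso
      have hz : homogeneousComponent (φ p).natDegree p = 0 :=
        homogeneousComponent_eq_zero _ p (by simpa using hmem)
      rw [← hφ] at hz
      exact hpn (Polynomial.leadingCoeff_eq_zero.1 hz)
  have hh := homogeneousComponent_isHomogeneous (φ p).natDegree p
  rwa [← this] at hh

/-- A binary form vanishing at `(a, b)` is divisible by the linear form `b x - a y`. -/
theorem linear_dvd_of_isHomogeneous {Ω : Type*} [Field Ω] {E : MvPolynomial (Fin 2) Ω}
    {n : ℕ} (hE : E.IsHomogeneous n) {a b : Ω} (hab : a ≠ 0 ∨ b ≠ 0) (h : aeval ![a, b] E = 0) :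
    (C b * X 0 - C a * X 1 : MvPolynomial (Fin 2) Ω) ∣ E := by
  set ℓ : MvPolynomial (Fin 2) Ω := C b * X 0 - C a * X 1
  rw [← Ideal.mem_span_singleton, ← Ideal.Quotient.eq_zero_iff_mem]
  set I := Ideal.span {ℓ}
  let mk := Ideal.Quotient.mkₐ Ω I
  change mk E = 0
  have hℓ : mk (C b * X 0) = mk (C a * X 1) := by
    rw [← sub_eq_zero, ← map_sub]
    exact Ideal.Quotient.eq_zero_iff_mem.2 (Ideal.mem_span_singleton_self ℓ)
  obtain ⟨t, ht0, ht1⟩ : ∃ t : MvPolynomial (Fin 2) Ω ⧸ I,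
      mk (X 0) = t * algebraMap Ω _ a ∧ mk (X 1) = t * algebraMap Ω _ b := by
    have hC : ∀ c : Ω, mk (C c) = algebraMap Ω _ c := fun c => mk.commutes c
    rw [map_mul, map_mul, hC, hC] at hℓ
    by_cases hb : b = 0
    · have ha : a ≠ 0 := by tauto
      have hai : algebraMap Ω (MvPolynomial (Fin 2) Ω ⧸ I) a * algebraMap Ω _ a⁻¹ = 1 := by
        rw [← map_mul, mul_inv_cancel₀ ha, map_one]
      refine ⟨mk (X 0) * algebraMap Ω _ a⁻¹, ?_, ?_⟩
      · linear_combination -mk (X 0) * hai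
      · rw [hb, map_zero] at hℓ ⊢
        linear_combination -mk (X 1) * hai - algebraMap Ω (MvPolynomial (Fin 2) Ω ⧸ I) a⁻¹ * hℓ
    · have hbi : algebraMap Ω (MvPolynomial (Fin 2) Ω ⧸ I) b * algebraMap Ω _ b⁻¹ = 1 := by
        rw [← map_mul, mul_inv_cancel₀ hb, map_one]
      refine ⟨mk (X 1) * algebraMap Ω _ b⁻¹, ?_, ?_⟩
      · linear_combination -mk (X 0) * hbi + algebraMap Ω (MvPolynomial (Fin 2) Ω ⧸ I) b⁻¹ * hℓ
      · linear_combination -mk (X 1) * hbi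
  have : mk E = aeval (fun i => t * algebraMap Ω _ ((![a, b] : Fin 2 → Ω) i)) E := by
    have : mk = aeval (fun i => t * algebraMap Ω _ ((![a, b] : Fin 2 → Ω) i)) := by
      ext i
      fin_cases i <;> simp [ht0, ht1]
    rw [← this]
  rw [this, aeval_mul_of_isHomogeneous hE]
  have h' : aeval (fun i => algebraMap Ω (MvPolynomial (Fin 2) Ω ⧸ I) ((![a, b] : Fin 2 → Ω) i)) E
      = algebraMap Ω _ (aeval ![a, b] E) := by
    rw [← aeval_algebraMap_apply]; rfl
  rw [h', h, map_zero, mul_zero]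

theorem exists_root_of_isHomogeneous {Ω : Type*} [Field Ω] [IsAlgClosed Ω]
    {E : MvPolynomial (Fin 2) Ω} {n : ℕ} (hE : E.IsHomogeneous n) (hn : n ≠ 0) :
    ∃ P : Fin 2 → Ω, P ≠ 0 ∧ aeval P E = 0 := by
  classical
  by_contra hcon
  push Not at hcon
  let e : Polynomial Ω := aeval ![Polynomial.X, 1] E
  have he : ∀ t : Ω, e.eval t = aeval ![t, 1] E := by
    intro t
    have : (Polynomial.aeval t : Polynomial Ω →ₐ[Ω] Ω).comp (aeval ![Polynomial.X, 1])
        = aeval ![t, 1] := by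
      ext i; fin_cases i <;> simp
    rw [← this]; rfl
  let e' : Polynomial Ω := aeval ![1, Polynomial.X] E
  have he' : ∀ t : Ω, e'.eval t = aeval ![1, t] E := by
    intro t
    have : (Polynomial.aeval t : Polynomial Ω →ₐ[Ω] Ω).comp (aeval ![1, Polynomial.X])
        = aeval ![1, t] := by
      ext i; fin_cases i <;> simp
    rw [← this]; rfl
  have hdeg : e.degree = 0 := by
    by_contra hd
    obtain ⟨t, ht⟩ := IsAlgClosed.exists_root e hd
    exact hcon ![t, 1] (fun h => one_ne_zero (congrFun h 1)) (by rw [← he]; exact ht)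
  have hc := Polynomial.eq_C_of_degree_eq_zero hdeg
  set c := e.coeff 0
  have heq : e' = Polynomial.C c * Polynomial.X ^ n := by
    have hinf : Set.Infinite {t : Ω | e'.eval t = (Polynomial.C c * Polynomial.X ^ n).eval t} := by
      have hfin : ({0}ᶜ : Set Ω).Infinite := Set.Finite.infinite_compl (Set.finite_singleton 0)
      refine hfin.mono fun t ht => ?_
      have ht0 : t ≠ 0 := ht
      simp only [Set.mem_ofPred_eq, he', Polynomial.eval_mul, Polynomial.eval_C,
        Polynomial.eval_pow, Polynomial.eval_X]
      have h1 := he t⁻¹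
      rw [hc, Polynomial.eval_C] at h1
      have h2 := aeval_mul_of_isHomogeneous hE t ![t⁻¹, 1]
      rw [← h1] at h2
      rw [mul_comm, ← h2]
      congr 2
      funext i; fin_cases i <;> simp [ht0]
    exact Polynomial.eq_of_infinite_eval_eq _ _ hinf
  have h0 := he' 0
  rw [heq] at h0
  refine hcon ![1, 0] (fun h => one_ne_zero (congrFun h 0)) ?_
  rw [← h0]; simp [hn]

/-- A form with zero directional derivative in a nonzero direction has a double root. -/
theorem exists_double_root_of_isHomogeneous {Ω : Type*} [Field Ω] [IsAlgClosed Ω]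
    {E : MvPolynomial (Fin 2) Ω} {n : ℕ} (hE : E.IsHomogeneous n)
    (hn : 2 ≤ n) {a b : Ω} (hab : a ≠ 0 ∨ b ≠ 0)
    (h : C a * pderiv 0 E + C b * pderiv 1 E = 0) :
    ∃ P : Fin 2 → Ω, P ≠ 0 ∧ aeval P E = 0 ∧ ∀ i, aeval P (pderiv i E) = 0 := by
  by_cases hE0 : E = 0
  · refine ⟨![1, 0], fun h => one_ne_zero (congrFun h 0), by simp [hE0], by simp [hE0]⟩
  -- a root off the direction `(a, b)` is a double root
  have off : ∀ P : Fin 2 → Ω, aeval P E = 0 → b * P 0 - a * P 1 ≠ 0 →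
      ∀ i, aeval P (pderiv i E) = 0 := by
    intro P hP hne
    have eu := congrArg (aeval P) hE.sum_X_mul_pderiv
    have hd := congrArg (aeval P) h
    simp only [Fin.sum_univ_two, map_add, map_mul, aeval_X, map_nsmul, hP, smul_zero, map_zero,
      aeval_C, Algebra.algebraMap_self, RingHom.id_apply] at eu hd
    have h0 : aeval P (pderiv 0 E) = 0 := by
      refine (mul_eq_zero.1 ?_).resolve_left hne
      linear_combination b * eu - P 1 * hd
    have h1 : aeval P (pderiv 1 E) = 0 := by
      refine (mul_eq_zero.1 ?_).resolve_left hne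
      linear_combination -a * eu + P 0 * hd
    intro i; fin_cases i
    · exact h0
    · exact h1
  by_cases hroot : aeval ![a, b] E = 0
  · obtain ⟨E', hE'⟩ := linear_dvd_of_isHomogeneous hE hab hroot
    obtain ⟨m, hm⟩ := isHomogeneous_left_of_mul (p := E') (q := C b * X 0 - C a * X 1) (n := n)
      (by rw [mul_comm, ← hE']; exact hE) (by rw [mul_comm, ← hE']; exact hE0)
    have hl : (C b * X 0 - C a * X 1 : MvPolynomial (Fin 2) Ω).IsHomogeneous 1 :=
      (isHomogeneous_C_mul_X b 0).sub (isHomogeneous_C_mul_X a 1)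
    have hmn : 1 + m = n := (hl.mul hm).inj_right (by rw [← hE']; exact hE) (by rw [← hE']; exact hE0)
    obtain ⟨P, hP, hPE⟩ := exists_root_of_isHomogeneous hm (by omega)
    have hEP : aeval P E = 0 := by rw [hE', map_mul, hPE, mul_zero]
    refine ⟨P, hP, hEP, ?_⟩
    by_cases hne : b * P 0 - a * P 1 = 0
    · intro i
      rw [hE', Derivation.leibniz]
      simp only [smul_eq_mul, map_add, map_mul, map_sub, aeval_C, aeval_X, hPE, zero_mul, add_zero,
        Algebra.algebraMap_self, RingHom.id_apply, hne]
    · exact off P hEP hne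
  · obtain ⟨P, hP, hEP⟩ := exists_root_of_isHomogeneous hE (by omega)
    refine ⟨P, hP, hEP, off P hEP fun hne => hroot ?_⟩
    obtain ⟨t, ht⟩ : ∃ t : Ω, ![a, b] = fun i => t * P i := by
      by_cases h0 : P 0 = 0
      · have h1 : P 1 ≠ 0 := fun h1 => hP (by funext i; fin_cases i <;> simp [h0, h1])
        refine ⟨b / P 1, ?_⟩
        funext i; fin_cases i
        · simp only [h0, mul_zero, zero_sub, neg_eq_zero] at hne ⊢
          simpa [h0] using (mul_eq_zero.1 hne).resolve_right h1
        · simp; field_simp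
      · refine ⟨a / P 0, ?_⟩
        funext i; fin_cases i
        · simp; field_simp
        · simp; field_simp; linear_combination hne
    rw [ht, aeval_mul_of_isHomogeneous hE, hEP, mul_zero]

theorem eq_zero_of_aeval_X_one {K : Type*} [Field K] {E : MvPolynomial (Fin 2) K} {n : ℕ}
    (hE : E.IsHomogeneous n) (h : aeval ![(Polynomial.X : Polynomial K), 1] E = 0) : E = 0 := by
  let F := FractionRing (MvPolynomial (Fin 2) K)
  let x : F := algebraMap (MvPolynomial (Fin 2) K) F (X 0)
  let y : F := algebraMap (MvPolynomial (Fin 2) K) F (X 1)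
  have hy : y ≠ 0 := by
    simp [y]
  have h1 : aeval ![x / y, 1] E = 0 := by
    have : (Polynomial.aeval (x / y) : Polynomial K →ₐ[K] F).comp (aeval ![Polynomial.X, 1])
        = aeval ![x / y, 1] := by
      ext i; fin_cases i <;> simp
    rw [← this, AlgHom.comp_apply, h, map_zero]
  have h2 := aeval_mul_of_isHomogeneous hE y ![x / y, 1]
  rw [h1, mul_zero] at h2
  have h3 : (fun i => y * (![x / y, 1] : Fin 2 → F) i)
      = fun i => algebraMap (MvPolynomial (Fin 2) K) F (X i) := by
    funext i; fin_cases i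
    · exact mul_div_cancel₀ x hy
    · simp [y]
  have h4 : (fun i => algebraMap (MvPolynomial (Fin 2) K) F (X i))
      = algebraMap (MvPolynomial (Fin 2) K) F ∘ X := rfl
  rw [h3, h4, aeval_algebraMap_apply, aeval_X_left_apply] at h2
  simpa using h2

theorem finSuccEquiv_rename_succ {K : Type*} [CommRing K] {N : ℕ} (q : MvPolynomial (Fin N) K) :
    finSuccEquiv K N (rename Fin.succ q) = Polynomial.C q := by
  induction q using MvPolynomial.induction_on with
  | C a => simp [finSuccEquiv_apply]
  | add p q hp hq => simp [hp, hq]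
  | mul_X p j hp => rw [map_mul, rename_X, map_mul, hp, finSuccEquiv_X_succ, map_mul]

/-- Expansion of a form in powers of the first variable. -/
theorem eq_sum_rename_succ {K : Type*} [CommRing K] {N n : ℕ} {p : MvPolynomial (Fin (N + 1)) K}
    (hp : p.IsHomogeneous n) :
    p = ∑ i ∈ Finset.range (n + 1),
      rename Fin.succ ((finSuccEquiv K N p).coeff i) * X 0 ^ i := by
  apply (finSuccEquiv K N).injective
  have hdeg : (finSuccEquiv K N p).natDegree < n + 1 := by
    rw [natDegree_finSuccEquiv]
    exact Nat.lt_succ_of_le ((degreeOf_le_totalDegree p 0).trans hp.totalDegree_le)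
  conv_lhs => rw [(finSuccEquiv K N p).as_sum_range' (n + 1) hdeg]
  rw [map_sum]
  refine Finset.sum_congr rfl fun i _ => ?_
  rw [map_mul, map_pow, finSuccEquiv_X_zero, finSuccEquiv_rename_succ, Polynomial.C_mul_X_pow_eq_monomial]

theorem eq_C_of_isHomogeneous_zero {σ K : Type*} [CommRing K] {p : MvPolynomial σ K}
    (hp : p.IsHomogeneous 0) : ∃ a, p = C a :=
  ⟨_, totalDegree_eq_zero_iff_eq_C.1 (Nat.le_zero.1 hp.totalDegree_le)⟩

theorem aeval_zero_of_isHomogeneous {σ K A : Type*} [CommRing K] [CommRing A] [Algebra K A]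
    {p : MvPolynomial σ K} {n : ℕ} (hp : p.IsHomogeneous n) (hn : n ≠ 0) :
    aeval (0 : σ → A) p = 0 := by
  have := aeval_mul_of_isHomogeneous hp (0 : A) (0 : σ → A)
  rw [zero_pow hn, zero_mul] at this
  rw [← this]; congr 1; simp; rfl

theorem aeval_rename_succ {K A : Type*} [CommRing K] [CommRing A] [Algebra K A] {N : ℕ}
    (q : MvPolynomial (Fin N) K) (v : Fin (N + 1) → A) :
    aeval v (rename Fin.succ q) = aeval (fun i => v i.succ) q := by
  rw [aeval_rename]; rfl

theorem exists_quadratic_expansion {K : Type*} [Field K] {f : MvPolynomial (Fin 3) K}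
    (hf : f.IsHomogeneous 2) : ∃ f₁ f₂ : MvPolynomial (Fin 2) K,
      f₁.IsHomogeneous 1 ∧ f₂.IsHomogeneous 2 ∧
      f = C (aeval ![1, 0, 0] f) * X 0 ^ 2 + rename Fin.succ f₁ * X 0 + rename Fin.succ f₂ := by
  have h := eq_sum_rename_succ hf
  have h0 := hf.finSuccEquiv_coeff_isHomogeneous 2 0 rfl
  have h1 := hf.finSuccEquiv_coeff_isHomogeneous 1 1 rfl
  have h2 := hf.finSuccEquiv_coeff_isHomogeneous 0 2 rfl
  obtain ⟨a, ha⟩ := eq_C_of_isHomogeneous_zero h0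
  refine ⟨_, _, h1, h2, ?_⟩
  have hv : (fun i : Fin 2 => (![1, 0, 0] : Fin 3 → K) i.succ) = 0 := by
    funext i; fin_cases i <;> rfl
  simp only [Finset.sum_range_succ, Finset.sum_range_zero, zero_add, ha, rename_C, pow_zero,
    pow_one, mul_one] at h
  have hc := congrArg (aeval (![1, 0, 0] : Fin 3 → K)) h
  simp only [map_add, map_mul, map_pow, aeval_rename_succ, hv, aeval_zero_of_isHomogeneous h1 one_ne_zero,
    aeval_zero_of_isHomogeneous h2 two_ne_zero, aeval_C, aeval_X] at hc
  rw [hc]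
  conv_lhs => rw [h]
  simp; ring

theorem exists_quartic_expansion {K : Type*} [Field K] {g : MvPolynomial (Fin 3) K}
    (hg : g.IsHomogeneous 4) : ∃ g₁ g₂ g₃ g₄ : MvPolynomial (Fin 2) K,
      g₁.IsHomogeneous 1 ∧ g₂.IsHomogeneous 2 ∧ g₃.IsHomogeneous 3 ∧ g₄.IsHomogeneous 4 ∧
      g = C (aeval ![1, 0, 0] g) * X 0 ^ 4 + rename Fin.succ g₁ * X 0 ^ 3 +
        rename Fin.succ g₂ * X 0 ^ 2 + rename Fin.succ g₃ * X 0 + rename Fin.succ g₄ := by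
  have h := eq_sum_rename_succ hg
  have h0 := hg.finSuccEquiv_coeff_isHomogeneous 4 0 rfl
  have h1 := hg.finSuccEquiv_coeff_isHomogeneous 3 1 rfl
  have h2 := hg.finSuccEquiv_coeff_isHomogeneous 2 2 rfl
  have h3 := hg.finSuccEquiv_coeff_isHomogeneous 1 3 rfl
  have h4 := hg.finSuccEquiv_coeff_isHomogeneous 0 4 rfl
  obtain ⟨a, ha⟩ := eq_C_of_isHomogeneous_zero h0
  refine ⟨_, _, _, _, h1, h2, h3, h4, ?_⟩
  have hv : (fun i : Fin 2 => (![1, 0, 0] : Fin 3 → K) i.succ) = 0 := by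
    funext i; fin_cases i <;> rfl
  simp only [Finset.sum_range_succ, Finset.sum_range_zero, zero_add, ha, rename_C, pow_zero,
    pow_one, mul_one] at h
  have hc := congrArg (aeval (![1, 0, 0] : Fin 3 → K)) h
  simp only [map_add, map_mul, map_pow, aeval_rename_succ, hv, aeval_zero_of_isHomogeneous h1 one_ne_zero,
    aeval_zero_of_isHomogeneous h2 two_ne_zero, aeval_zero_of_isHomogeneous h3 three_ne_zero,
    aeval_zero_of_isHomogeneous h4 four_ne_zero, aeval_C, aeval_X] at hc
  rw [hc]
  conv_lhs => rw [h]
  simp; ring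

/-- Near a point where `2 w + f` does not vanish, the surface is the graph of a quadratic form
up to terms of degree at most one in the coordinate of the point. -/
theorem exists_osculating {K : Type*} [Field K] {f g : MvPolynomial (Fin 3) K}
    (hf : f.IsHomogeneous 2) (hg : g.IsHomogeneous 4) {a : K}
    (ha : a ^ 2 + aeval ![1, 0, 0] f * a = aeval ![1, 0, 0] g)
    (hδ : 2 * a + aeval ![1, 0, 0] f ≠ 0) :
    ∃ l q A B : MvPolynomial (Fin 2) K, l.IsHomogeneous 1 ∧ q.IsHomogeneous 2 ∧
      A.IsHomogeneous 3 ∧ B.IsHomogeneous 4 ∧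
      (C a * X 0 ^ 2 + rename Fin.succ l * X 0 + rename Fin.succ q) ^ 2 +
        f * (C a * X 0 ^ 2 + rename Fin.succ l * X 0 + rename Fin.succ q) - g =
        rename Fin.succ A * X 0 + rename Fin.succ B := by
  obtain ⟨f₁, f₂, hf1, hf2, ef⟩ := exists_quadratic_expansion hf
  obtain ⟨g₁, g₂, g₃, g₄, hg1, hg2, hg3, hg4, eg⟩ := exists_quartic_expansion hg
  set φ : K := aeval ![1, 0, 0] f
  set γ : K := aeval ![1, 0, 0] g
  set d := (2 * a + φ)⁻¹
  have hd : (2 * C a + C φ) * C d = (1 : MvPolynomial (Fin 3) K) := by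
    rw [← C_1, ← mul_inv_cancel₀ hδ, C_mul, C_add, C_mul, map_ofNat C 2]
  have ha' : (C a ^ 2 + C φ * C a : MvPolynomial (Fin 3) K) = C γ := by
    rw [← ha]; simp
  let l := C d * (g₁ - C a * f₁)
  let q := C d * (g₂ - C a * f₂ - l * l - f₁ * l)
  have hl : l.IsHomogeneous 1 := (hg1.sub (hf1.C_mul a)).C_mul d
  have hq : q.IsHomogeneous 2 :=
    (((hg2.sub (hf2.C_mul a)).sub (hl.mul hl)).sub (hf1.mul hl)).C_mul d
  refine ⟨l, q, C 2 * (l * q) + f₁ * q + l * f₂ - g₃, q * q + f₂ * q - g₄, hl, hq,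
    ((((hl.mul hq).C_mul 2).add (hf1.mul hq)).add (hl.mul hf2)).sub hg3,
    ((hq.mul hq).add (hf2.mul hq)).sub hg4, ?_⟩
  rw [ef, eg]
  simp only [l, q, map_add, map_sub, map_mul, rename_C]
  have h2 : (C 2 : MvPolynomial (Fin 3) K) = 2 := map_ofNat C 2
  rw [h2]
  generalize rename Fin.succ f₁ = F1, rename Fin.succ f₂ = F2, rename Fin.succ g₁ = G1,
    rename Fin.succ g₂ = G2, rename Fin.succ g₃ = G3, rename Fin.succ g₄ = G4 at *
  linear_combination X 0 ^ 4 * ha' + (X 0 ^ 3 * (G1 - C a * F1) +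
    X 0 ^ 2 * (G2 - C a * F2 - (C d * (G1 - C a * F1)) ^ 2 - F1 * (C d * (G1 - C a * F1)))) * hd

theorem exists_double_point_of_forms {Ω : Type*} [Field Ω] [IsAlgClosed Ω]
    {A B j₁ j₂ : MvPolynomial (Fin 2) Ω} (hA : A.IsHomogeneous 3) (hB : B.IsHomogeneous 4) {δ : Ω}
    (hδ : δ ≠ 0) (h : C δ * (B * B) - j₁ * (A * B) + j₂ * (A * A) = 0) :
    ∃ P : Fin 3 → Ω, P ≠ 0 ∧
      aeval P (C δ * X 0 ^ 2 + rename Fin.succ j₁ * X 0 + rename Fin.succ j₂) = 0 ∧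
      aeval P (rename Fin.succ A * X 0 + rename Fin.succ B) = 0 ∧
      ∀ i, aeval P (pderiv i (rename Fin.succ A * X 0 + rename Fin.succ B)) = 0 := by
  obtain ⟨P, hP, hPA⟩ := exists_root_of_isHomogeneous hA three_ne_zero
  have hPB : aeval P B = 0 := by
    have := congrArg (aeval P) h
    simp only [map_sub, map_add, map_mul, map_zero, hPA, mul_zero, zero_mul, sub_zero, add_zero,
      aeval_C, mul_eq_zero, or_self, Algebra.algebraMap_self, RingHom.id_apply] at this
    exact this.resolve_left hδ
  have hP' : P = ![P 0, P 1] := by funext i; fin_cases i <;> rfl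
  have hP01 : P 0 ≠ 0 ∨ P 1 ≠ 0 := by
    by_contra hcon; push Not at hcon
    exact hP (by funext i; fin_cases i; exacts [hcon.1, hcon.2])
  obtain ⟨A', rfl⟩ := linear_dvd_of_isHomogeneous hA hP01 (by rw [← hP']; exact hPA)
  obtain ⟨B', rfl⟩ := linear_dvd_of_isHomogeneous hB hP01 (by rw [← hP']; exact hPB)
  set ℓ : MvPolynomial (Fin 2) Ω := C (P 1) * X 0 - C (P 0) * X 1 with hℓ
  have hℓ0 : ℓ ≠ 0 := by
    intro h0
    rcases hP01 with h1 | h1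
    · have := congrArg (aeval (![0, 1] : Fin 2 → Ω)) h0
      simp [ℓ] at this; exact h1 this
    · have := congrArg (aeval (![1, 0] : Fin 2 → Ω)) h0
      simp [ℓ] at this; exact h1 this
  have hℓP : aeval P ℓ = 0 := by
    simp only [ℓ, map_sub, map_mul, aeval_C, aeval_X, Algebra.algebraMap_self, RingHom.id_apply]; ring
  have h' : C δ * (B' * B') - j₁ * (A' * B') + j₂ * (A' * A') = 0 := by
    refine (mul_eq_zero.1 ?_).resolve_left (mul_ne_zero hℓ0 hℓ0)
    linear_combination h
  have hP'' := congrArg (aeval P) h'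
  simp only [map_sub, map_add, map_mul, map_zero, aeval_C, Algebra.algebraMap_self,
    RingHom.id_apply] at hP''
  obtain ⟨c, hc1, hc2⟩ : ∃ c : Ω, δ * c ^ 2 + aeval P j₁ * c + aeval P j₂ = 0 ∧
      aeval P A' * c + aeval P B' = 0 := by
    by_cases hA' : aeval P A' = 0
    · obtain ⟨c, hc⟩ := IsAlgClosed.exists_root (Polynomial.C δ * Polynomial.X ^ 2 +
          Polynomial.C (aeval P j₁) * Polynomial.X + Polynomial.C (aeval P j₂))
          (by rw [Polynomial.degree_quadratic hδ]; norm_num)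
      refine ⟨c, by simpa using hc, ?_⟩
      simp only [hA', zero_mul, mul_zero, sub_zero, add_zero, mul_eq_zero, or_self] at hP''
      rw [hA', hP''.resolve_left hδ]; ring
    · refine ⟨-aeval P B' / aeval P A', ?_, by field_simp; ring⟩
      field_simp
      linear_combination hP''
  have hs : (fun i : Fin 2 => (Fin.cons c P : Fin 3 → Ω) i.succ) = P := by funext i; simp
  have h0 : (Fin.cons c P : Fin 3 → Ω) 0 = c := rfl
  have hfac : rename Fin.succ (ℓ * A') * X 0 + rename Fin.succ (ℓ * B') =
      rename Fin.succ ℓ * (rename Fin.succ A' * X 0 + rename Fin.succ B') := by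
    simp only [map_mul]; ring
  have e1 : aeval (Fin.cons c P : Fin 3 → Ω) (rename Fin.succ ℓ) = 0 := by
    rw [aeval_rename_succ, hs, hℓP]
  have e2 : aeval (Fin.cons c P : Fin 3 → Ω) (rename Fin.succ A' * X 0 + rename Fin.succ B') = 0 := by
    simp only [map_add, map_mul, aeval_rename_succ, hs, aeval_X, h0, hc2]
  refine ⟨Fin.cons c P, ?_, ?_, ?_, fun i => ?_⟩
  · intro hcon
    exact hP (by rw [← hs, hcon]; rfl)
  · simp only [map_add, map_mul, map_pow, aeval_rename_succ, hs, aeval_X, h0, aeval_C,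
      Algebra.algebraMap_self, RingHom.id_apply, hc1]
  · rw [hfac, map_mul, e1, zero_mul]
  · rw [hfac, Derivation.leibniz, smul_eq_mul, smul_eq_mul, map_add, map_mul, map_mul, e1, e2,
      zero_mul, zero_mul, add_zero]

/-- The existence of a rational curve on `w² + f w = g`, neither constant in the plane nor contained
in the ramification locus. -/
def HasCurve {k : Type*} [Field k] (f g : MvPolynomial (Fin 3) k) : Prop :=
  ∃ (v : Fin 3 → Polynomial k) (w : Polynomial k), w ^ 2 + aeval v f * w = aeval v g ∧
    2 * w + aeval v f ≠ 0 ∧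
    ∃ i j, v i * Polynomial.derivative (v j) ≠ v j * Polynomial.derivative (v i)

section

variable {k : Type u} [Field k] {f g : MvPolynomial (Fin 3) k}

theorem SmoothPair.map (h : SmoothPair f g) (L : Type u) [Field L] [Algebra k L] :
    SmoothPair (MvPolynomial.map (algebraMap k L) f) (MvPolynomial.map (algebraMap k L) g) := by
  intro Ω _ _ P w hP h0 h1 h2
  let _ : Algebra k Ω := ((algebraMap L Ω).comp (algebraMap k L)).toAlgebra
  have _ : IsScalarTower k L Ω := IsScalarTower.of_algebraMap_eq fun _ => rfl
  simp only [pderiv_map, aeval_map_algebraMap] at h0 h1 h2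
  exact h Ω P w hP h0 h1 h2

theorem SmoothPair.false_of_factor (h : SmoothPair f g) (Q : MvPolynomial (Fin 3) k)
    {Ω : Type u} [Field Ω] [Algebra k Ω] {P : Fin 3 → Ω} (hP : P ≠ 0)
    (hJ : aeval P (2 * Q + f) = 0) (hG : aeval P (Q ^ 2 + f * Q - g) = 0)
    (hG' : ∀ i, aeval P (pderiv i (Q ^ 2 + f * Q - g)) = 0) : False := by
  simp only [map_add, map_mul, map_sub, map_pow, map_ofNat] at hJ hG
  refine h Ω P (aeval P Q) hP hJ (by linear_combination hG) fun i => ?_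
  have := hG' i
  simp only [map_add, map_mul, map_sub, Derivation.leibniz, Derivation.leibniz_pow, smul_eq_mul,
    nsmul_eq_mul, Nat.cast_ofNat, map_ofNat, map_pow] at this
  linear_combination this - aeval P (pderiv i Q) * hJ

/-- If `A ≠ 0`, the osculating curve at a rational point is a rational curve on the surface. -/
theorem HasCurve.of_osculating (hs : SmoothPair f g) (hf : f.IsHomogeneous 2) {a : k}
    (hδ : 2 * a + aeval ![1, 0, 0] f ≠ 0) {l q A B : MvPolynomial (Fin 2) k}
    (hl : l.IsHomogeneous 1) (hq : q.IsHomogeneous 2) (hA : A.IsHomogeneous 3)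
    (hB : B.IsHomogeneous 4)
    (hG : (C a * X 0 ^ 2 + rename Fin.succ l * X 0 + rename Fin.succ q) ^ 2 +
        f * (C a * X 0 ^ 2 + rename Fin.succ l * X 0 + rename Fin.succ q) - g =
        rename Fin.succ A * X 0 + rename Fin.succ B) (hA0 : A ≠ 0) : HasCurve f g := by
  set Q : MvPolynomial (Fin 3) k := C a * X 0 ^ 2 + rename Fin.succ l * X 0 + rename Fin.succ q with hQ
  let As : Polynomial k := aeval ![Polynomial.X, 1] A
  let Bs : Polynomial k := aeval ![Polynomial.X, 1] B
  have hAs : As ≠ 0 := fun h => hA0 (eq_zero_of_aeval_X_one hA h)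
  let v : Fin 3 → Polynomial k := ![-Bs, Polynomial.X * As, As]
  have hv : (fun i : Fin 2 => v i.succ) = fun i => As * (![Polynomial.X, 1] : Fin 2 → Polynomial k) i := by
    funext i; fin_cases i <;> simp [v, mul_comm]
  have ev : ∀ {E : MvPolynomial (Fin 2) k} {n : ℕ}, E.IsHomogeneous n →
      aeval v (rename Fin.succ E) = As ^ n * aeval ![Polynomial.X, 1] E := by
    intro E n hE
    rw [aeval_rename_succ, hv, aeval_mul_of_isHomogeneous hE]
  have hv0 : aeval v (X 0 : MvPolynomial (Fin 3) k) = -Bs := by simp [v]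
  obtain ⟨f₁, f₂, hf1, hf2, ef⟩ := exists_quadratic_expansion hf
  obtain ⟨δ, hδe⟩ : ∃ δ, δ = 2 * a + aeval ![1, 0, 0] f := ⟨_, rfl⟩
  rw [← hδe] at hδ
  refine ⟨v, aeval v Q, ?_, ?_, 1, 2, ?_⟩
  · have := congrArg (aeval v) hG
    simp only [map_sub, map_add, map_mul, map_pow, ev hA, ev hB, hv0] at this
    linear_combination this
  · intro h0
    -- the form `δ B² - j₁ A B + j₂ A²` vanishes
    set j₁ := 2 * l + f₁ with hj1
    set j₂ := 2 * q + f₂ with hj2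
    have hC2 : (2 : MvPolynomial (Fin 2) k) = C 2 := (map_ofNat C 2).symm
    have hj1' : j₁.IsHomogeneous 1 := by rw [hj1, hC2]; exact (hl.C_mul 2).add hf1
    have hj2' : j₂.IsHomogeneous 2 := by rw [hj2, hC2]; exact (hq.C_mul 2).add hf2
    have hJ : 2 * Q + f = C δ * X 0 ^ 2 + rename Fin.succ j₁ * X 0 + rename Fin.succ j₂ := by
      conv_lhs => rw [ef]
      simp only [hδe, hQ, hj1, hj2, map_add, map_mul, map_ofNat]
      ring
    have hzero : C δ * (B * B) - j₁ * (A * B) + j₂ * (A * A) = 0 := by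
      have hH : (C δ * (B * B) - j₁ * (A * B) + j₂ * (A * A)).IsHomogeneous 8 :=
        (((hB.mul hB).C_mul _).sub (hj1'.mul (hA.mul hB))).add (hj2'.mul (hA.mul hA))
      refine eq_zero_of_aeval_X_one hH ?_
      have : aeval v (2 * Q + f) = 0 := by
        rw [← h0]; simp
      rw [hJ] at this
      simp only [map_sub, map_add, map_mul, map_pow, ev hj1', ev hj2', hv0, aeval_C] at this ⊢
      change _ * (Bs * Bs) - _ * (As * Bs) + _ * (As * As) = 0
      linear_combination this
    let Ω := AlgebraicClosure k
    have hδΩ : algebraMap k Ω δ ≠ 0 := by simpa using hδ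
    have hz := congrArg (MvPolynomial.map (algebraMap k Ω)) hzero
    simp only [map_sub, map_add, map_mul (MvPolynomial.map (algebraMap k Ω)), map_zero,
      MvPolynomial.map_C] at hz
    obtain ⟨P, hP, hPJ, hPG, hPG'⟩ := exists_double_point_of_forms (hA.map (algebraMap k Ω))
      (hB.map (algebraMap k Ω)) hδΩ hz
    have hGΩ := congrArg (MvPolynomial.map (algebraMap k Ω)) hG
    simp only [map_add, map_sub, map_mul, map_pow, MvPolynomial.map_X, MvPolynomial.map_rename] at hGΩ
    refine (hs.map Ω).false_of_factor (MvPolynomial.map (algebraMap k Ω) Q) (P := P) hP ?_ ?_ ?_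
    · have := congrArg (MvPolynomial.map (algebraMap k Ω)) hJ
      simp only [map_add, map_mul, map_pow, MvPolynomial.map_C, MvPolynomial.map_X,
        MvPolynomial.map_rename, map_ofNat] at this
      rw [this]; exact hPJ
    · rw [hGΩ]; exact hPG
    · rw [hGΩ]; exact hPG'
  · simp only [v, Matrix.cons_val_one, Matrix.cons_val]
    rw [Polynomial.derivative_mul, Polynomial.derivative_X]
    intro h
    have : As ^ 2 = 0 := by linear_combination -h
    exact hAs (by simpa using this)
end

/-- Linear substitution in a polynomial. -/
noncomputable def linSubst {σ K : Type*} [Fintype σ] [CommRing K] (M : Matrix σ σ K) :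
    MvPolynomial σ K →ₐ[K] MvPolynomial σ K :=
  aeval fun i => ∑ j, C (M i j) * X j

section

variable {σ K : Type*} [Fintype σ] [CommRing K]

theorem aeval_linSubst {A : Type*} [CommRing A] [Algebra K A] (M : Matrix σ σ K) (v : σ → A)
    (p : MvPolynomial σ K) :
    aeval v (linSubst M p) = aeval (fun i => ∑ j, algebraMap K A (M i j) * v j) p := by
  have : (aeval v).comp (linSubst M) = aeval (fun i => ∑ j, algebraMap K A (M i j) * v j) := by
    ext i; simp [linSubst]
  rw [← this]; rfl

theorem linSubst_isHomogeneous {M : Matrix σ σ K} {p : MvPolynomial σ K} {n : ℕ}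
    (hp : p.IsHomogeneous n) : (linSubst M p).IsHomogeneous n := by
  have := hp.aeval (fun i => ∑ j, C (M i j) * X j) (n := 1) fun i =>
    IsHomogeneous.sum _ _ _ fun j _ => isHomogeneous_C_mul_X _ _
  rwa [one_mul] at this

theorem linSubst_linSubst [DecidableEq σ] {M N : Matrix σ σ K} (h : M * N = 1) (p : MvPolynomial σ K) :
    linSubst N (linSubst M p) = p := by
  have : (linSubst N).comp (linSubst M) = AlgHom.id K (MvPolynomial σ K) := by
    ext1 i
    have hi : ∀ j, ∑ x, M i x * N x j = if i = j then 1 else 0 := fun j => by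
      have := congrFun (congrFun h i) j
      rwa [Matrix.mul_apply, Matrix.one_apply] at this
    simp only [AlgHom.comp_apply, linSubst, aeval_X, map_sum, map_mul, aeval_C, algebraMap_eq,
      Finset.mul_sum, AlgHom.id_apply]
    rw [Finset.sum_comm]
    simp only [← mul_assoc, ← C_mul, ← Finset.sum_mul, ← map_sum C, hi]
    simp
  exact congrArg (fun φ => φ p) this

/-- Invertible linear substitutions as algebra automorphisms. -/
noncomputable def linSubstEquiv [DecidableEq σ] {M N : Matrix σ σ K} (h : M * N = 1) (h' : N * M = 1) :
    MvPolynomial σ K ≃ₐ[K] MvPolynomial σ K :=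
  AlgEquiv.ofAlgHom (linSubst M) (linSubst N) (AlgHom.ext fun p => linSubst_linSubst h' p)
    (AlgHom.ext fun p => linSubst_linSubst h p)

theorem pderiv_linSubst (M : Matrix σ σ K) (j : σ) (p : MvPolynomial σ K) :
    pderiv j (linSubst M p) = ∑ i, C (M i j) * linSubst M (pderiv i p) := by
  classical
  induction p using MvPolynomial.induction_on with
  | C a => simp [linSubst, algebraMap_eq]
  | add p q hp hq => simp [hp, hq, mul_add, Finset.sum_add_distrib]
  | mul_X p l hp =>
    have hX : pderiv j (linSubst M (X l)) = C (M l j) := by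
      simp [linSubst, Derivation.leibniz, pderiv_X, Pi.single_apply]
    rw [map_mul, Derivation.leibniz, hX, hp]
    simp only [Derivation.leibniz, map_add, smul_eq_mul, map_mul, mul_add, Finset.sum_add_distrib,
      Finset.mul_sum]
    have h1 : ∑ i, C (M i j) * (linSubst M p * linSubst M (pderiv i (X l))) =
        linSubst M p * C (M l j) := by
      rw [Finset.sum_eq_single l]
      · rw [pderiv_X_self, map_one]; ring
      · intro b _ hb; rw [pderiv_X_of_ne hb.symm, map_zero]; ring
      · intro h; exact absurd (Finset.mem_univ l) h
    rw [h1]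
    refine congrArg (_ + ·) (Finset.sum_congr rfl fun i _ => ?_)
    exact mul_left_comm _ _ _

end

section

variable {k : Type u} [Field k] {f g : MvPolynomial (Fin 3) k}

theorem SmoothPair.linSubst (h : SmoothPair f g) {M N : Matrix (Fin 3) (Fin 3) k} (hMN : M * N = 1) :
    SmoothPair (linSubst M f) (linSubst M g) := by
  intro Ω _ _ P w hP h0 h1 h2
  have hNM : N * M = 1 := mul_eq_one_comm.1 hMN
  let φ := algebraMap k Ω
  rw [aeval_linSubst] at h0 h1
  rw [aeval_linSubst] at h1
  have hinv : ∀ i j, ∑ x, φ (N i x) * φ (M x j) = if i = j then 1 else 0 := fun i j => by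
    have := congrArg φ (congrFun (congrFun hNM i) j)
    rw [Matrix.mul_apply, Matrix.one_apply] at this
    simpa [apply_ite φ] using this
  have hinv' : ∀ i j, ∑ x, φ (M i x) * φ (N x j) = if i = j then 1 else 0 := fun i j => by
    have := congrArg φ (congrFun (congrFun hMN i) j)
    rw [Matrix.mul_apply, Matrix.one_apply] at this
    simpa [apply_ite φ] using this
  refine h Ω _ w ?_ h0 h1 ?_
  · intro h0
    apply hP
    funext i
    have : ∑ x, φ (N i x) * (∑ j, φ (M x j) * P j) = P i := by
      simp only [Finset.mul_sum]
      rw [Finset.sum_comm]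
      simp only [← mul_assoc, ← Finset.sum_mul, hinv]
      simp
    rw [← this]
    refine Finset.sum_eq_zero fun x _ => ?_
    rw [show ∑ j, φ (M x j) * P j = 0 from congrFun h0 x, mul_zero]
  · set P' := fun i => ∑ j, φ (M i j) * P j
    set e : Fin 3 → Ω := fun i => aeval P' (pderiv i f) * w - aeval P' (pderiv i g) with he
    have h3 : ∀ j, ∑ i, φ (M i j) * e i = 0 := by
      intro j
      have := h2 j
      simp only [pderiv_linSubst, map_sum, map_mul, aeval_C, aeval_linSubst, Finset.sum_mul] at this
      rw [← sub_eq_zero, ← Finset.sum_sub_distrib] at this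
      rw [← this]
      refine Finset.sum_congr rfl fun i _ => ?_
      simp only [he, P', φ]; ring
    intro i
    have : ∑ j, φ (N j i) * (∑ l, φ (M l j) * e l) = e i := by
      simp only [Finset.mul_sum]
      rw [Finset.sum_comm]
      have : ∀ l, ∑ j, φ (N j i) * (φ (M l j) * e l) = (if l = i then 1 else 0) * e l := fun l => by
        rw [← hinv' l i, Finset.sum_mul]
        exact Finset.sum_congr rfl fun j _ => by ring
      simp [this]
    have h4 : e i = 0 := by rw [← this]; simp [h3]
    exact sub_eq_zero.1 h4

theorem HasCurve.of_linSubst {M N : Matrix (Fin 3) (Fin 3) k} (hMN : M * N = 1)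
    (h : HasCurve (linSubst M f) (linSubst M g)) : HasCurve f g := by
  obtain ⟨v, w, h1, h2, h3⟩ := h
  have hNM : N * M = 1 := mul_eq_one_comm.1 hMN
  rw [aeval_linSubst] at h1 h2
  rw [aeval_linSubst] at h1
  refine ⟨_, w, h1, h2, ?_⟩
  set v' : Fin 3 → Polynomial k := fun i => ∑ j, algebraMap k (Polynomial k) (M i j) * v j with hv'
  by_contra hcon
  push Not at hcon
  obtain ⟨i, j, hij⟩ := h3
  apply hij
  have hv : ∀ i, v i = ∑ j, Polynomial.C (N i j) * v' j := fun i => by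
    simp only [hv', Finset.mul_sum, Polynomial.algebraMap_eq]
    rw [Finset.sum_comm]
    have : ∀ l, ∑ x, Polynomial.C (N i x) * (Polynomial.C (M x l) * v l)
        = Polynomial.C (if i = l then 1 else 0) * v l := fun l => by
      rw [← Matrix.one_apply, ← hNM, Matrix.mul_apply, map_sum, Finset.sum_mul]
      exact Finset.sum_congr rfl fun j _ => by rw [Polynomial.C_mul]; ring
    simp only [this]
    simp
  rw [hv i, hv j]
  simp only [Polynomial.derivative_sum, Polynomial.derivative_C_mul, Finset.sum_mul_sum]
  rw [Finset.sum_comm]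
  refine Finset.sum_congr rfl fun a _ => Finset.sum_congr rfl fun b _ => ?_
  linear_combination Polynomial.C (N i b) * Polynomial.C (N j a) * hcon b a

/-- Reduction of the existence of a curve to other coordinates. -/
theorem hasCurve_of_linSubst {M N : Matrix (Fin 3) (Fin 3) k} (hMN : M * N = 1)
    (hs : SmoothPair f g)
    (h : SmoothPair (linSubst M f) (linSubst M g) → HasCurve (linSubst M f) (linSubst M g)) :
    HasCurve f g :=
  .of_linSubst hMN (h (hs.linSubst hMN))

end

/-- Primes remain prime after a purely transcendental extension of the constants. -/
theorem prime_map_fractionRing {σ k : Type*} [Field k] {Φ : MvPolynomial σ k} (h : Prime Φ) :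
    Prime (map (algebraMap k (FractionRing (Polynomial k))) Φ) := by
  set K := FractionRing (Polynomial k)
  -- prime in `k[s][σ]`
  have h1 : Prime (map (algebraMap k (Polynomial k)) Φ) := by
    have h2 : Prime (Polynomial.C Φ) := Polynomial.prime_C_iff.2 h
    let e := (optionEquivLeft k σ).symm.trans (optionEquivRight k σ)
    have h3 : ∀ p, e (Polynomial.C p) = map (algebraMap k (Polynomial k)) p := by
      intro p
      induction p using MvPolynomial.induction_on with
      | C a =>
        simp only [e, AlgEquiv.trans_apply, optionEquivLeft_symm_C_C, optionEquivRight_C, map_C,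
          Polynomial.algebraMap_eq]
      | add p q hp hq => rw [map_add, map_add, hp, hq, map_add]
      | mul_X p j hp =>
        rw [map_mul, map_mul, hp, map_mul, map_X]
        simp only [e, AlgEquiv.trans_apply, optionEquivLeft_symm_C_X, optionEquivRight_X_some]
    rw [← h3]
    exact (MulEquiv.prime_iff e.toMulEquiv).2 h2
  let _ : Algebra (MvPolynomial σ (Polynomial k)) (MvPolynomial σ K) := algebraMvPolynomial
  have hloc := MvPolynomial.isLocalization (σ := σ) (nonZeroDivisors (Polynomial k)) K
  have hmap : map (algebraMap k K) Φ =
      algebraMap (MvPolynomial σ (Polynomial k)) (MvPolynomial σ K)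
        (map (algebraMap k (Polynomial k)) Φ) := by
    rw [algebraMap_def, map_map, ← IsScalarTower.algebraMap_eq]
  have hne : map (algebraMap k K) Φ ≠ 0 := by
    rw [Ne, map_eq_zero_iff _ (map_injective _ (algebraMap k K).injective)]; exact h.ne_zero
  rw [← Ideal.span_singleton_prime hne, hmap, ← Set.image_singleton, ← Ideal.map_span]
  refine IsLocalization.isPrime_of_isPrime_disjoint
    ((nonZeroDivisors (Polynomial k)).map C) (MvPolynomial σ K) _
    ((Ideal.span_singleton_prime h1.ne_zero).2 h1) ?_
  rw [Set.disjoint_left]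
  rintro _ ⟨p, hp, rfl⟩ hmem
  obtain ⟨q, hq⟩ := Ideal.mem_span_singleton.1 hmem
  have hp0 : p ≠ 0 := nonZeroDivisors.ne_zero hp
  have hC : C (σ := σ) p ≠ 0 := by simpa using hp0
  have hq0 : q ≠ 0 := by rintro rfl; rw [mul_zero] at hq; exact hC hq
  have hdeg := congrArg totalDegree hq
  rw [totalDegree_mul_of_isDomain h1.ne_zero hq0, totalDegree_C] at hdeg
  have h0 : Φ.totalDegree = 0 := by
    rw [totalDegree_eq_zero_iff]
    intro d hd i
    have h00 := (totalDegree_eq_zero_iff _ (map (algebraMap k (Polynomial k)) Φ)).1 (by omega)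
    refine h00 d ?_ i
    simpa [mem_support_iff, coeff_map] using hd
  rw [totalDegree_eq_zero_iff_eq_C] at h0
  refine h.not_isUnit ?_
  rw [h0]
  refine (IsUnit.mk0 (coeff 0 Φ) fun hz => h.ne_zero ?_).map C
  rw [h0, hz, map_zero]

theorem eq_zero_of_rename_succ_sum {K : Type*} [CommRing K] {N : ℕ}
    {p₀ p₁ p₂ p₃ p₄ : MvPolynomial (Fin N) K}
    (h : rename Fin.succ p₀ + rename Fin.succ p₁ * X 0 + rename Fin.succ p₂ * X 0 ^ 2 +
      rename Fin.succ p₃ * X 0 ^ 3 + rename Fin.succ p₄ * X 0 ^ 4 = 0) :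
    p₀ = 0 ∧ p₁ = 0 ∧ p₂ = 0 ∧ p₃ = 0 ∧ p₄ = 0 := by
  have h' := congrArg (finSuccEquiv K N) h
  simp only [map_add, map_mul, map_pow, finSuccEquiv_rename_succ, finSuccEquiv_X_zero, map_zero] at h'
  have hc := fun i => congrArg (Polynomial.coeff · i) h'
  simp only [Polynomial.coeff_add, Polynomial.coeff_C_mul, Polynomial.coeff_X_pow,
    Polynomial.coeff_zero] at hc
  refine ⟨?_, ?_, ?_, ?_, ?_⟩
  · simpa [Polynomial.coeff_X, Polynomial.coeff_C] using hc 0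
  · simpa [Polynomial.coeff_X, Polynomial.coeff_C] using hc 1
  · simpa [Polynomial.coeff_X, Polynomial.coeff_C] using hc 2
  · simpa [Polynomial.coeff_X, Polynomial.coeff_C] using hc 3
  · simpa [Polynomial.coeff_X, Polynomial.coeff_C] using hc 4

theorem pderiv_zero_rename_succ {K : Type*} [CommRing K] {N : ℕ} (p : MvPolynomial (Fin N) K) :
    pderiv 0 (rename Fin.succ p) = 0 := by
  refine pderiv_eq_zero_of_notMem_vars fun h => ?_
  have := vars_rename Fin.succ p h
  simp at this

theorem SmoothPair.false_of_double_root {K : Type u} [Field K] {f g : MvPolynomial (Fin 3) K}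
    (hs : SmoothPair f g) {Q Z : MvPolynomial (Fin 3) K} {δ : K} (hδ : δ ≠ 0)
    {j₁ j₂ E : MvPolynomial (Fin 2) K}
    (hJ : 2 * Q + f = C δ * X 0 ^ 2 + rename Fin.succ j₁ * X 0 + rename Fin.succ j₂)
    (hG : Q ^ 2 + f * Q - g = rename Fin.succ E * Z)
    {n : ℕ} (hE : E.IsHomogeneous n) (hn : 2 ≤ n) {a b : K} (hab : a ≠ 0 ∨ b ≠ 0)
    (h : C a * pderiv 0 E + C b * pderiv 1 E = 0) : False := by
  let Ω := AlgebraicClosure K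
  obtain ⟨P, hP, hPE, hPE'⟩ := exists_double_root_of_isHomogeneous (hE.map (algebraMap K Ω)) hn
    (a := algebraMap K Ω a) (b := algebraMap K Ω b) (by simpa using hab) (by
      have := congrArg (MvPolynomial.map (algebraMap K Ω)) h
      simpa [pderiv_map] using this)
  simp only [pderiv_map, aeval_map_algebraMap] at hPE hPE'
  obtain ⟨c, hc⟩ : ∃ c : Ω, algebraMap K Ω δ * c ^ 2 + aeval P j₁ * c + aeval P j₂ = 0 := by
    generalize aeval P j₁ = r₁, aeval P j₂ = r₂
    obtain ⟨c, hc⟩ := IsAlgClosed.exists_root (Polynomial.C (algebraMap K Ω δ) * Polynomial.X ^ 2 +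
      Polynomial.C r₁ * Polynomial.X + Polynomial.C r₂)
      (by rw [Polynomial.degree_quadratic (by simpa using hδ)]; norm_num)
    exact ⟨c, by simpa using hc⟩
  have hcs : (fun i : Fin 2 => (Fin.cons c P : Fin 3 → Ω) i.succ) = P := by funext i; simp
  have h0 : (Fin.cons c P : Fin 3 → Ω) 0 = c := rfl
  have e1 : aeval (Fin.cons c P : Fin 3 → Ω) (rename Fin.succ E) = 0 := by
    rw [aeval_rename_succ, hcs, hPE]
  have e2 : ∀ i, aeval (Fin.cons c P : Fin 3 → Ω) (pderiv i (rename Fin.succ E)) = 0 := by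
    intro i
    refine Fin.cases ?_ (fun j => ?_) i
    · rw [pderiv_zero_rename_succ, map_zero]
    · rw [pderiv_rename (Fin.succ_injective 2), aeval_rename_succ, hcs, hPE']
  refine hs.false_of_factor Q (P := (Fin.cons c P : Fin 3 → Ω)) ?_ ?_ ?_ fun i => ?_
  · intro hcon
    exact hP (by rw [← hcs, hcon]; rfl)
  · rw [hJ]
    simp only [map_add, map_mul, map_pow, aeval_rename_succ, hcs, aeval_X, h0, aeval_C, hc]
  · rw [hG, map_mul, e1, zero_mul]
  · rw [hG, Derivation.leibniz, smul_eq_mul, smul_eq_mul, map_add, map_mul, map_mul, e1, e2,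
      zero_mul, mul_zero, add_zero]

/-- Extension of a derivation of `K`, given as a morphism to the dual numbers, to the deformation of
`c, x, y` for which the point `(c u + x, c v + y, c)` is constant. -/
theorem exists_deformation {k K : Type*} [Field k] [Field K] [Algebra k K]
    (θ : K →ₐ[k] DualNumber K) (hθ : ∀ a, (θ a).fst = a) (a b : K) :
    ∃ Θ : MvPolynomial (Fin 3) K →ₐ[k] DualNumber (MvPolynomial (Fin 3) K),
      (∀ a, Θ (C a) = TrivSqZeroExt.inl (C a) + TrivSqZeroExt.inr (C (θ a).snd)) ∧
      Θ (X 0) = TrivSqZeroExt.inl (X 0) ∧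
      Θ (X 1) = TrivSqZeroExt.inl (X 1) + TrivSqZeroExt.inr (-(C a * X 0)) ∧
      Θ (X 2) = TrivSqZeroExt.inl (X 2) + TrivSqZeroExt.inr (-(C b * X 0)) := by
  let j : K →+* DualNumber (MvPolynomial (Fin 3) K) :=
    { toFun := fun a => TrivSqZeroExt.inl (C a) + TrivSqZeroExt.inr (C (θ a).snd)
      map_one' := by ext1 <;> simp
      map_mul' := by
        intro x y
        ext1
        · simp
        · simp [hθ]
      map_zero' := by ext1 <;> simp
      map_add' := by
        intro x y
        ext1 <;> simp }
  let v : Fin 3 → DualNumber (MvPolynomial (Fin 3) K) :=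
    ![TrivSqZeroExt.inl (X 0), TrivSqZeroExt.inl (X 1) + TrivSqZeroExt.inr (-(C a * X 0)),
      TrivSqZeroExt.inl (X 2) + TrivSqZeroExt.inr (-(C b * X 0))]
  have hj : ∀ a, eval₂Hom j v (C a) = TrivSqZeroExt.inl (C a) + TrivSqZeroExt.inr (C (θ a).snd) :=
    fun a => eval₂Hom_C _ _ _
  refine ⟨{ eval₂Hom j v with commutes' := ?_ }, hj, ?_, ?_, ?_⟩
  · intro r
    change eval₂Hom j v (algebraMap k _ r) = _
    rw [IsScalarTower.algebraMap_apply k K (MvPolynomial (Fin 3) K), algebraMap_eq, hj, θ.commutes]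
    simp [TrivSqZeroExt.algebraMap_eq_inl']
  · exact eval₂Hom_X' _ _ _
  · exact eval₂Hom_X' _ _ _
  · exact eval₂Hom_X' _ _ _

theorem exists_deformation_rename {k K : Type*} [Field k] [Field K] [Algebra k K]
    {θ : K →ₐ[k] DualNumber K} {a b : K}
    {Θ : MvPolynomial (Fin 3) K →ₐ[k] DualNumber (MvPolynomial (Fin 3) K)}
    (hC : ∀ a, Θ (C a) = TrivSqZeroExt.inl (C a) + TrivSqZeroExt.inr (C (θ a).snd))
    (h1 : Θ (X 1) = TrivSqZeroExt.inl (X 1) + TrivSqZeroExt.inr (-(C a * X 0)))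
    (h2 : Θ (X 2) = TrivSqZeroExt.inl (X 2) + TrivSqZeroExt.inr (-(C b * X 0)))
    (A : MvPolynomial (Fin 2) K) :
    ∃ D : MvPolynomial (Fin 2) K, Θ (rename Fin.succ A) = TrivSqZeroExt.inl (rename Fin.succ A) +
      TrivSqZeroExt.inr (rename Fin.succ D -
        X 0 * rename Fin.succ (C a * pderiv 0 A + C b * pderiv 1 A)) := by
  induction A using MvPolynomial.induction_on with
  | C r => exact ⟨C (θ r).snd, by simp [hC]⟩
  | add p q hp hq =>
    obtain ⟨D, hD⟩ := hp
    obtain ⟨D', hD'⟩ := hq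
    refine ⟨D + D', ?_⟩
    rw [map_add, map_add, hD, hD']
    ext1
    · simp
    · simp; ring
  | mul_X p i hp =>
    obtain ⟨D, hD⟩ := hp
    refine ⟨D * X i, ?_⟩
    have hi : Θ (X i.succ) = TrivSqZeroExt.inl (X i.succ) +
        TrivSqZeroExt.inr (-(C (![a, b] i) * X 0)) := by
      fin_cases i
      · exact h1
      · exact h2
    rw [map_mul, map_mul, hD, rename_X, hi]
    ext1
    · simp
    · fin_cases i
      · simp [Derivation.leibniz]; ring
      · simp [Derivation.leibniz]; ring

theorem eq_zero_of_shift_eq {K : Type*} [Field K] {m : ℕ} (hm : 2 ≤ m) {α β α' β' : K}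
    (h : (Polynomial.X ^ m * Polynomial.C α + Polynomial.X ^ (m + 1) * Polynomial.C β : Polynomial K) =
      (1 + Polynomial.X) ^ m * Polynomial.C α' + (1 + Polynomial.X) ^ (m + 1) * Polynomial.C β') :
    α = 0 ∧ β = 0 := by
  obtain ⟨m, rfl⟩ : ∃ l, m = l + 2 := ⟨m - 2, by omega⟩
  have h0 := congrArg (Polynomial.eval 0) h
  have h1 := congrArg (Polynomial.eval (-1)) h
  simp at h0 h1
  have hαβ : α = β := by
    have hu : ((-1 : K) ^ (m + 2)) ≠ 0 := pow_ne_zero _ (by simp)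
    have : (-1 : K) ^ (m + 2) * (α - β) = 0 := by
      rw [pow_succ _ (m + 2)] at h1
      linear_combination h1
    exact sub_eq_zero.1 ((mul_eq_zero.1 this).resolve_left hu)
  have hα' : α' = -β' := by linear_combination -h0
  subst hαβ
  rw [hα', map_neg] at h
  have hne : (Polynomial.X * (1 + Polynomial.X) : Polynomial K) ≠ 0 := by
    refine mul_ne_zero Polynomial.X_ne_zero fun h => ?_
    simpa using congrArg (Polynomial.eval 0) h
  have h2 : (Polynomial.X ^ (m + 1) * Polynomial.C α : Polynomial K) =
      (1 + Polynomial.X) ^ (m + 1) * Polynomial.C β' := by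
    refine mul_left_cancel₀ hne ?_
    linear_combination h
  have h3 := congrArg (Polynomial.eval 0) h2
  simp at h3
  rw [← h3, map_zero, mul_zero] at h2
  have : α = 0 := by simpa using h2
  exact ⟨this, this⟩

/-- A curve of degree at least three cannot have points of multiplicity one less than its degree at
two points `(u, v, 1)` conjugate over the constants, unless it contains the line joining them. -/
theorem aeval_chord_eq_zero {k K L : Type*} [Field k] [Field K] [Field L] [Algebra k K] [Algebra k L]
    (τ σ : K →ₐ[k] L) {u v : K} {Φ : MvPolynomial (Fin 3) k} {A B : MvPolynomial (Fin 2) K} {m : ℕ}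
    (hm : 2 ≤ m) (hA : A.IsHomogeneous m) (hB : B.IsHomogeneous (m + 1))
    (h : aeval ![C u * X 0 + X 1, C v * X 0 + X 2, X 0] Φ =
      rename Fin.succ A * X 0 + rename Fin.succ B) :
    aeval ![τ u - σ u, τ v - σ v] (map τ.toRingHom A) = 0 ∧
    aeval ![τ u - σ u, τ v - σ v] (map τ.toRingHom B) = 0 := by
  set d : Fin 2 → L := ![τ u - σ u, τ v - σ v] with hd
  have core : ∀ (ρ : K →ₐ[k] L) (t : Polynomial L),
      aeval ![Polynomial.C (ρ u) + t * Polynomial.C (d 0), Polynomial.C (ρ v) + t * Polynomial.C (d 1), 1] Φ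
        = t ^ m * Polynomial.C (aeval d (map ρ.toRingHom A)) +
          t ^ (m + 1) * Polynomial.C (aeval d (map ρ.toRingHom B)) := by
    intro ρ t
    obtain ⟨x, x0, x1, x2⟩ : ∃ x : Fin 3 → Polynomial L, x 0 = 1 ∧
        x 1 = t * Polynomial.C (d 0) ∧ x 2 = t * Polynomial.C (d 1) :=
      ⟨![1, t * Polynomial.C (d 0), t * Polynomial.C (d 1)], rfl, rfl, rfl⟩
    obtain ⟨φ, hφ⟩ : ∃ φ : MvPolynomial (Fin 3) K →ₐ[k] Polynomial L,
        ∀ p, φ p = aeval x (map ρ.toRingHom p) :=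
      ⟨((aeval x : MvPolynomial (Fin 3) L →ₐ[L] Polynomial L).restrictScalars k).comp
        (mapAlgHom ρ), fun p => rfl⟩
    have hcomp : φ.comp (aeval ![C u * X 0 + X 1, C v * X 0 + X 2, X 0]) =
        aeval ![Polynomial.C (ρ u) + t * Polynomial.C (d 0),
          Polynomial.C (ρ v) + t * Polynomial.C (d 1), 1] := by
      ext1 i
      fin_cases i <;> simp [hφ, x0, x1, x2]
    have hx : (fun i : Fin 2 => x i.succ) = fun i => t * algebraMap L (Polynomial L) (d i) := by
      funext i; fin_cases i <;> simp [x1, x2]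
    have hr : ∀ {E : MvPolynomial (Fin 2) K} {n : ℕ}, E.IsHomogeneous n →
        φ (rename Fin.succ E) = t ^ n * Polynomial.C (aeval d (map ρ.toRingHom E)) := by
      intro E n hE
      rw [hφ, map_rename, aeval_rename_succ, hx, aeval_mul_of_isHomogeneous (hE.map _)]
      congr 1
      exact aeval_algebraMap_apply (Polynomial L) d _
    rw [← hcomp, AlgHom.comp_apply, h, map_add, map_mul, hr hA, hr hB]
    simp [hφ, x0]
  have h1 := core τ Polynomial.X
  have h2 := core σ (1 + Polynomial.X)
  refine eq_zero_of_shift_eq hm (h1.symm.trans (Eq.trans ?_ h2))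
  have e : ∀ a b : L, Polynomial.C a + Polynomial.X * Polynomial.C (a - b) =
      Polynomial.C b + (1 + Polynomial.X) * Polynomial.C (a - b) := fun a b => by
    rw [map_sub]; ring
  have d0 : d 0 = τ u - σ u := rfl
  have d1 : d 1 = τ v - σ v := rfl
  rw [d0, d1, e, e]

theorem exists_pseudo_division {K : Type*} [CommRing K] (A B : MvPolynomial (Fin 2) K)
    (p : MvPolynomial (Fin 3) K) :
    ∃ (n : ℕ) (H : MvPolynomial (Fin 3) K) (r : MvPolynomial (Fin 2) K),
      rename Fin.succ A ^ n * p =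
        (rename Fin.succ A * X 0 + rename Fin.succ B) * H + rename Fin.succ r := by
  induction p using MvPolynomial.induction_on with
  | C a => exact ⟨0, 0, C a, by simp⟩
  | add p q hp hq =>
    obtain ⟨n, H, r, h⟩ := hp
    obtain ⟨n', H', r', h'⟩ := hq
    refine ⟨n + n', rename Fin.succ A ^ n' * H + rename Fin.succ A ^ n * H', A ^ n' * r + A ^ n * r', ?_⟩
    simp only [map_add, map_mul, map_pow]
    linear_combination rename Fin.succ A ^ n' * h + rename Fin.succ A ^ n * h'
  | mul_X p i hp =>
    obtain ⟨n, H, r, h⟩ := hp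
    refine Fin.cases ?_ (fun j => ?_) i
    · refine ⟨n + 1, rename Fin.succ A * X 0 * H + rename Fin.succ r, -(r * B), ?_⟩
      simp only [map_neg, map_mul]
      linear_combination rename Fin.succ A * X 0 * h
    · refine ⟨n, H * X j.succ, r * X j, ?_⟩
      simp only [map_mul, rename_X]
      linear_combination X j.succ * h

theorem not_isUnit_of_isHomogeneous {σ K : Type*} [Field K] {p : MvPolynomial σ K} {n : ℕ}
    (hp : p.IsHomogeneous n) (hn : n ≠ 0) : ¬ IsUnit p := by
  intro h
  have := h.map (aeval (0 : σ → K) : MvPolynomial σ K →ₐ[K] K)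
  rw [aeval_zero_of_isHomogeneous hp hn] at this
  exact not_isUnit_zero this

/-- A form in a prime ideal has a prime factor in it, and this factor is a form. -/
theorem exists_prime_isHomogeneous {σ k F : Type*} [Field k] [Field F] [Algebra k F]
    {P : σ → F} {Φ : MvPolynomial σ k} {n : ℕ} (hΦ : Φ.IsHomogeneous n) (h0 : Φ ≠ 0)
    (hP : aeval P Φ = 0) :
    ∃ (Ψ : MvPolynomial σ k) (m : ℕ), Prime Ψ ∧ Ψ.IsHomogeneous m ∧ aeval P Ψ = 0 := by
  induction hd : Φ.totalDegree using Nat.strong_induction_on generalizing Φ n with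
  | _ d ih =>
    have hu : ¬ IsUnit Φ := fun hu => (hu.map (aeval P : MvPolynomial σ k →ₐ[k] F)).ne_zero hP
    obtain ⟨Ψ, hΨ, q, rfl⟩ := WfDvdMonoid.exists_irreducible_factor hu h0
    obtain ⟨hΨ0, hq0⟩ := mul_ne_zero_iff.1 h0
    obtain ⟨m, hm⟩ := isHomogeneous_left_of_mul hΦ h0
    rw [map_mul, mul_eq_zero] at hP
    rcases hP with hP | hP
    · exact ⟨Ψ, m, UniqueFactorizationMonoid.irreducible_iff_prime.1 hΨ, hm, hP⟩
    · rw [mul_comm] at hΦ h0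
      obtain ⟨m', hm'⟩ := isHomogeneous_left_of_mul hΦ h0
      refine ih q.totalDegree ?_ hm' hq0 hP rfl
      rw [← hd, totalDegree_mul_of_isDomain hΨ0 hq0]
      have : Ψ.totalDegree ≠ 0 := by
        intro hz
        rw [totalDegree_eq_zero_iff_eq_C] at hz
        refine hΨ.not_isUnit ?_
        rw [hz]
        refine (IsUnit.mk0 (coeff 0 Ψ) fun hz' => hΨ0 ?_).map C
        rw [hz, hz', map_zero]
      omega

/-- A linear polynomial in the first variable whose two coefficients have a common linear factor
is not prime if its degree is at least two. -/
theorem false_of_common_root {L : Type*} [Field L] {A B : MvPolynomial (Fin 2) L} {m : ℕ}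
    (hm : 1 ≤ m) (hA : A.IsHomogeneous m) (hB : B.IsHomogeneous (m + 1)) {a b : L}
    (hab : a ≠ 0 ∨ b ≠ 0) (hA0 : aeval ![a, b] A = 0) (hB0 : aeval ![a, b] B = 0)
    (h : Prime (rename Fin.succ A * X 0 + rename Fin.succ B)) : False := by
  obtain ⟨A', hA'⟩ := linear_dvd_of_isHomogeneous hA hab hA0
  obtain ⟨B', hB'⟩ := linear_dvd_of_isHomogeneous hB hab hB0
  set ℓ : MvPolynomial (Fin 2) L := C b * X 0 - C a * X 1
  have hℓ : ℓ.IsHomogeneous 1 := (isHomogeneous_C_mul_X b 0).sub (isHomogeneous_C_mul_X a 1)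
  have hfac : rename Fin.succ A * X 0 + rename Fin.succ B =
      rename Fin.succ ℓ * (rename Fin.succ A' * X 0 + rename Fin.succ B') := by
    rw [hA', hB']; simp only [map_mul]; ring
  have hhom : (rename Fin.succ A * X 0 + rename Fin.succ B).IsHomogeneous (m + 1) :=
    (hA.rename_isHomogeneous.mul (isHomogeneous_X _ 0)).add hB.rename_isHomogeneous
  rcases h.irreducible.isUnit_or_isUnit hfac with hu | hu
  · exact not_isUnit_of_isHomogeneous hℓ.rename_isHomogeneous one_ne_zero hu
  · obtain ⟨l, hl⟩ := isHomogeneous_left_of_mul (p := rename Fin.succ A' * X 0 + rename Fin.succ B')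
      (q := rename Fin.succ ℓ) (by rw [mul_comm, ← hfac]; exact hhom)
      (by rw [mul_comm, ← hfac]; exact h.ne_zero)
    have h1 : 1 + l = m + 1 := by
      refine IsHomogeneous.inj_right ((hℓ.rename_isHomogeneous (f := Fin.succ)).mul hl) ?_ ?_
      · rw [← hfac]; exact hhom
      · rw [← hfac]; exact h.ne_zero
    exact not_isUnit_of_isHomogeneous hl (by omega) hu

theorem exists_linear_of_prime {K : Type*} [Field K] {A B : MvPolynomial (Fin 2) K}
    (hA : A.IsHomogeneous 3) (hA0 : A ≠ 0) {Ψh : MvPolynomial (Fin 3) K} {m : ℕ}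
    (hΨhom : Ψh.IsHomogeneous m) (hΨprime : Prime Ψh)
    (hΨP : aeval (Fin.cons (-B) (fun i => A * X i) : Fin 3 → MvPolynomial (Fin 2) K) Ψh = 0) :
    ∃ (E A₁ B₁ : MvPolynomial (Fin 2) K) (e : ℕ),
      Ψh = rename Fin.succ A₁ * X 0 + rename Fin.succ B₁ ∧ A = A₁ * E ∧ B = B₁ * E ∧
      A₁.IsHomogeneous (m - 1) ∧ B₁.IsHomogeneous m ∧ 1 ≤ m ∧ E.IsHomogeneous e ∧ e + (m - 1) = 3 ∧
      ∀ μ : MvPolynomial (Fin 2) K, Ψh ∣ rename Fin.succ μ → μ = 0 := by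
  let L := FractionRing (MvPolynomial (Fin 2) K)
  let ι : MvPolynomial (Fin 2) K →ₐ[K] L := IsScalarTower.toAlgHom K _ L
  have hιinj : Function.Injective ι := IsFractionRing.injective (MvPolynomial (Fin 2) K) L
  have hι0 : ∀ {E}, ι E = 0 → E = 0 := fun {E} h => hιinj (h.trans (map_zero ι).symm)
  have hιA : ι A ≠ 0 := fun h => hA0 (hι0 h)
  let p' : Fin 3 → L := Fin.cons (-ι B / ι A) (fun i => ι (X i))
  have hp's : ∀ E : MvPolynomial (Fin 2) K, aeval p' (rename Fin.succ E) = ι E := by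
    intro E
    rw [aeval_rename_succ]
    have : (fun i : Fin 2 => p' i.succ) = fun i => ι (X i) := by funext i; simp [p']
    rw [this]
    exact DFunLike.congr_fun (aeval_unique ι).symm E
  have hp'0 : aeval p' (X 0 : MvPolynomial (Fin 3) K) = -ι B / ι A := by rw [aeval_X]; rfl
  have hp'G : aeval p' (rename Fin.succ A * X 0 + rename Fin.succ B) = 0 := by
    rw [map_add, map_mul, hp's, hp's, hp'0, mul_div_cancel₀ _ hιA, neg_add_cancel]
  have hΨp' : aeval p' Ψh = 0 := by
    have h4 := aeval_mul_of_isHomogeneous hΨhom (ι A) p'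
    have h5 : aeval (fun i => ι A * p' i) Ψh = ι (aeval (Fin.cons (-B) (fun i => A * X i) : Fin 3 → MvPolynomial (Fin 2) K) Ψh) := by
      have : ι.comp (aeval (Fin.cons (-B) (fun i => A * X i) : Fin 3 → MvPolynomial (Fin 2) K)) = aeval (fun i => ι A * p' i) := by
        ext1 i
        refine Fin.cases ?_ (fun j => ?_) i
        · simp only [AlgHom.comp_apply, aeval_X, p', Fin.cons_zero]
          rw [mul_div_cancel₀ _ hιA, map_neg]
        · simp [p']
      rw [← this]; rfl
    rw [h5, hΨP, map_zero] at h4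
    exact (mul_eq_zero.1 h4.symm).resolve_left (pow_ne_zero _ hιA)
  obtain ⟨E', hE'⟩ : Ψh ∣ rename Fin.succ A * X 0 + rename Fin.succ B := by
    obtain ⟨n, H, r, hr⟩ := exists_pseudo_division A B Ψh
    have hr0 : r = 0 := by
      have := congrArg (aeval p') hr
      rw [map_mul, hΨp', mul_zero, map_add, map_mul, hp'G, zero_mul, zero_add, hp's] at this
      exact hι0 this.symm
    rw [hr0, map_zero, add_zero] at hr
    rcases hΨprime.dvd_or_dvd ⟨rename Fin.succ A ^ n, by rw [← hr, mul_comm]⟩ with h | ⟨H', rfl⟩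
    · exact h
    · exfalso
      have h6 : rename Fin.succ A ^ n = (rename Fin.succ A * X 0 + rename Fin.succ B) * H' := by
        refine mul_right_cancel₀ hΨprime.ne_zero ?_
        rw [hr]; ring
      have := congrArg (aeval p') h6
      rw [map_mul, hp'G, zero_mul, map_pow, hp's] at this
      exact pow_ne_zero _ hιA this
  -- split into the parts of degree one and zero
  obtain ⟨E, A₁, B₁, hE, hΨh, hA₁, hB₁, hm⟩ : ∃ E A₁ B₁ : MvPolynomial (Fin 2) K,
      E' = rename Fin.succ E ∧ Ψh = rename Fin.succ A₁ * X 0 + rename Fin.succ B₁ ∧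
      A₁.IsHomogeneous (m - 1) ∧ B₁.IsHomogeneous m ∧ 1 ≤ m := by
    let e := finSuccEquiv K 2
    have hsymm : ∀ E, e.symm (Polynomial.C E) = rename Fin.succ E := fun E => by
      rw [AlgEquiv.symm_apply_eq, finSuccEquiv_rename_succ]
    have hX : e.symm Polynomial.X = X 0 := by
      rw [AlgEquiv.symm_apply_eq, finSuccEquiv_X_zero]
    have h1 := congrArg e hE'
    rw [map_mul, map_add, map_mul, finSuccEquiv_rename_succ, finSuccEquiv_rename_succ,
      finSuccEquiv_X_zero] at h1
    have hd1 := congrArg Polynomial.natDegree h1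
    have hl : (Polynomial.C A * Polynomial.X + Polynomial.C B).natDegree = 1 :=
      Polynomial.natDegree_linear hA0
    have hne : e Ψh * e E' ≠ 0 := by
      rw [← h1]; intro h0; rw [h0] at hl; simp at hl
    obtain ⟨hne1, hne2⟩ := mul_ne_zero_iff.1 hne
    rw [hl, Polynomial.natDegree_mul hne1 hne2] at hd1
    have hΨd : (e Ψh).natDegree ≠ 0 := by
      intro h0
      rw [Polynomial.natDegree_eq_zero] at h0
      obtain ⟨b, hb⟩ := h0
      have hb' : Ψh = rename Fin.succ b := by rw [← hsymm, hb]; simp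
      rw [hb', hp's] at hΨp'
      rw [hb', hι0 hΨp', map_zero] at hΨprime
      exact hΨprime.ne_zero rfl
    obtain ⟨E, hE⟩ := Polynomial.natDegree_eq_zero.1 (show (e E').natDegree = 0 by omega)
    have hΨd1 : (e Ψh).natDegree = 1 := by omega
    have hm : 1 ≤ m := by
      have h7 := natDegree_finSuccEquiv Ψh
      have h8 := degreeOf_le_totalDegree Ψh 0
      have h9 := hΨhom.totalDegree_le
      change (e Ψh).natDegree = _ at h7
      omega
    have hlin := Polynomial.eq_X_add_C_of_natDegree_le_one hΨd1.le
    refine ⟨E, (e Ψh).coeff 1, (e Ψh).coeff 0, ?_, ?_,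
      hΨhom.finSuccEquiv_coeff_isHomogeneous 1 (m - 1) (by omega),
      hΨhom.finSuccEquiv_coeff_isHomogeneous 0 m (by omega), hm⟩
    · rw [← hsymm, hE]; simp
    · have := congrArg e.symm hlin
      rwa [map_add, map_mul, hsymm, hsymm, hX, AlgEquiv.symm_apply_apply] at this
  subst hE
  obtain ⟨hBE, hAE, -, -, -⟩ := eq_zero_of_rename_succ_sum
    (p₀ := B - B₁ * E) (p₁ := A - A₁ * E) (p₂ := 0) (p₃ := 0) (p₄ := 0) (by
      rw [hΨh] at hE'
      simp only [map_sub, map_mul, map_zero]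
      linear_combination hE')
  rw [sub_eq_zero] at hBE hAE
  have hEA0 : E * A₁ ≠ 0 := by rw [mul_comm, ← hAE]; exact hA0
  obtain ⟨e, hEe⟩ := isHomogeneous_left_of_mul (p := E) (q := A₁) (n := 3)
    (by rw [mul_comm, ← hAE]; exact hA) hEA0
  have he : e + (m - 1) = 3 :=
    (hEe.mul hA₁).inj_right (by rw [mul_comm, ← hAE]; exact hA) hEA0
  refine ⟨E, A₁, B₁, e, hΨh, hAE, hBE, hA₁, hB₁, hm, hEe, he, ?_⟩
  rintro μ ⟨Z, hZ⟩
  have := congrArg (aeval p') hZ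
  rw [map_mul, hΨp', zero_mul, hp's] at this
  exact hι0 this

/-- The osculating curve has no component on the ramification curve. -/
theorem SmoothPair.false_of_dvd {K : Type u} [Field K] {f g : MvPolynomial (Fin 3) K}
    (hs : SmoothPair f g) {Q Z : MvPolynomial (Fin 3) K} {δ : K} (hδ : δ ≠ 0)
    {j₁ j₂ E A₁ B₁ : MvPolynomial (Fin 2) K}
    (hJ : 2 * Q + f = C δ * X 0 ^ 2 + rename Fin.succ j₁ * X 0 + rename Fin.succ j₂)
    (hZ : 2 * Q + f = (rename Fin.succ A₁ * X 0 + rename Fin.succ B₁) * Z)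
    (hG : Q ^ 2 + f * Q - g = (rename Fin.succ A₁ * X 0 + rename Fin.succ B₁) * rename Fin.succ E)
    {m e : ℕ} (hA₁ : A₁.IsHomogeneous m) (hA₁0 : A₁ ≠ 0) (hE : E.IsHomogeneous e)
    (he : e + m = 3) : False := by
  have hm : m = 0 := by
    have h1 := congrArg (finSuccEquiv K 2) (hJ.symm.trans hZ)
    have hC : (C δ : MvPolynomial (Fin 3) K) = rename Fin.succ (C δ) := (rename_C _ _).symm
    simp only [hC, map_add, map_mul, map_pow, finSuccEquiv_rename_succ, finSuccEquiv_X_zero] at h1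
    have h2 := congrArg Polynomial.leadingCoeff h1
    rw [Polynomial.leadingCoeff_quadratic (by simpa using hδ), Polynomial.leadingCoeff_mul,
      Polynomial.leadingCoeff_linear hA₁0] at h2
    by_contra hm
    refine not_isUnit_of_isHomogeneous hA₁ hm (isUnit_of_dvd_unit ⟨_, h2⟩ ?_)
    exact (IsUnit.mk0 δ hδ).map C
  subst hm
  obtain ⟨c, rfl⟩ := eq_C_of_isHomogeneous_zero hA₁
  have hc : c ≠ 0 := by simpa using hA₁0
  let Ω := AlgebraicClosure K
  obtain ⟨P, hP, hPE⟩ := exists_root_of_isHomogeneous (hE.map (algebraMap K Ω)) (by omega)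
  rw [aeval_map_algebraMap] at hPE
  let P' : Fin 3 → Ω := Fin.cons (-aeval P B₁ / algebraMap K Ω c) P
  have hcs : (fun i : Fin 2 => P' i.succ) = P := by funext i; simp [P']
  have h0 : P' 0 = -aeval P B₁ / algebraMap K Ω c := rfl
  have e1 : aeval P' (rename Fin.succ (C c) * X 0 + rename Fin.succ B₁) = 0 := by
    rw [map_add, map_mul, aeval_rename_succ, aeval_rename_succ, hcs, aeval_X, h0, aeval_C,
      mul_div_cancel₀ _ (by simpa using hc), neg_add_cancel]
  have e2 : aeval P' (rename Fin.succ E) = 0 := by rw [aeval_rename_succ, hcs, hPE]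
  refine hs.false_of_factor Q (P := P') ?_ ?_ ?_ fun i => ?_
  · intro hcon
    exact hP (by rw [← hcs, hcon]; rfl)
  · rw [hZ, map_mul, e1, zero_mul]
  · rw [hG, map_mul, e1, zero_mul]
  · rw [hG, Derivation.leibniz, smul_eq_mul, smul_eq_mul, map_add, map_mul, map_mul, e1, e2,
      zero_mul, zero_mul, add_zero]

set_option maxHeartbeats 1000000 in
theorem exists_dominant_point {k K K₂ : Type u} [Field k] [Field K] [Algebra k K] [Field K₂]
    [Algebra k K₂] [Algebra K K₂] [IsScalarTower k K K₂]
    {f g : MvPolynomial (Fin 3) k} (hf : f.IsHomogeneous 2) (hg : g.IsHomogeneous 4)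
    (hs : SmoothPair f g) (θ : K →ₐ[k] DualNumber K) (hθ : ∀ a, (θ a).fst = a) {u v a : K}
    (huv : (θ u).snd ≠ 0 ∨ (θ v).snd ≠ 0)
    (ha : a ^ 2 + aeval ![u, v, 1] f * a = aeval ![u, v, 1] g)
    (hδ : 2 * a + aeval ![u, v, 1] f ≠ 0)
    (hprime : ∀ Φ : MvPolynomial (Fin 3) k, Prime Φ → Prime (map (algebraMap k K) Φ))
    (σ : K →ₐ[k] K₂) (hσ : algebraMap K K₂ u ≠ σ u ∨ algebraMap K K₂ v ≠ σ v)
    (hprime₂ : ∀ Φ : MvPolynomial (Fin 3) K, Prime Φ → Prime (map (algebraMap K K₂) Φ))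
    {F : Type*} [Field F] [Algebra k F] [Algebra K F] [IsScalarTower k K F] (t : F)
    (ht : ∀ (E : MvPolynomial (Fin 2) K) (n : ℕ), E.IsHomogeneous n → aeval ![t, 1] E = 0 → E = 0) :
    ∃ (P : Fin 3 → F) (w : F), w ^ 2 + aeval P f * w = aeval P g ∧
      ∀ (Φ : MvPolynomial (Fin 3) k) (n : ℕ), Φ.IsHomogeneous n → Φ ≠ 0 → aeval P Φ ≠ 0 := by
  let V : Fin 3 → MvPolynomial (Fin 3) K := ![C u * X 0 + X 1, C v * X 0 + X 2, X 0]
  let M : Matrix (Fin 3) (Fin 3) K := !![u, 1, 0; v, 0, 1; 1, 0, 0]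
  let N : Matrix (Fin 3) (Fin 3) K := !![0, 0, 1; 1, 0, -u; 0, 1, -v]
  have hMN : M * N = 1 := by
    ext i j; fin_cases i <;> fin_cases j <;> simp [M, N, Matrix.mul_apply, Fin.sum_univ_three]
  have hNM : N * M = 1 := mul_eq_one_comm.1 hMN
  have hhat : ∀ p : MvPolynomial (Fin 3) k, linSubst M (map (algebraMap k K) p) = aeval V p := by
    intro p
    rw [linSubst, aeval_map_algebraMap]
    congr 2
    funext i
    fin_cases i <;> simp [M, V, Fin.sum_univ_three]
  have hpt : ∀ p : MvPolynomial (Fin 3) k, aeval (![1, 0, 0] : Fin 3 → K) (aeval V p)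
      = aeval ![u, v, 1] p := by
    intro p
    have : ((aeval (![1, 0, 0] : Fin 3 → K)).restrictScalars k).comp (aeval V) = aeval ![u, v, 1] := by
      ext1 i; fin_cases i <;> simp [V]
    rw [← this]; rfl
  have hsm := (hs.map K).linSubst hMN
  have hfh := linSubst_isHomogeneous (M := M) (hf.map (algebraMap k K))
  have hgh := linSubst_isHomogeneous (M := M) (hg.map (algebraMap k K))
  rw [hhat] at hfh hgh hsm
  rw [hhat] at hsm
  rw [← hpt, ← hpt] at ha
  rw [← hpt] at hδ
  obtain ⟨l, q, A, B, hl, hq, hA, hB, hG⟩ := exists_osculating hfh hgh ha hδ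
  obtain ⟨f₁, f₂, hf1, hf2, ef⟩ := exists_quadratic_expansion hfh
  set fh := aeval V f with hfhdef
  set gh := aeval V g with hghdef
  obtain ⟨δ, hδe⟩ : ∃ δ, δ = 2 * a + aeval ![1, 0, 0] fh := ⟨_, rfl⟩
  rw [← hδe] at hδ
  set Q : MvPolynomial (Fin 3) K := C a * X 0 ^ 2 + rename Fin.succ l * X 0 + rename Fin.succ q with hQ
  have hJ : 2 * Q + fh = C δ * X 0 ^ 2 + rename Fin.succ (2 * l + f₁) * X 0 +
      rename Fin.succ (2 * q + f₂) := by
    conv_lhs => rw [ef]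
    simp only [hδe, hQ, map_add, map_mul, map_ofNat]
    ring
  set j₁ := 2 * l + f₁
  set j₂ := 2 * q + f₂
  -- the deformation
  set u' := (θ u).snd
  set v' := (θ v).snd
  obtain ⟨Θ, hΘC, hΘ0, hΘ1, hΘ2⟩ := exists_deformation θ hθ u' v'
  have hder := exists_deformation_rename hΘC hΘ1 hΘ2
  have hΘV : ∀ p : MvPolynomial (Fin 3) k, Θ (aeval V p) = TrivSqZeroExt.inl (aeval V p) := by
    intro p
    have : Θ.comp (aeval V) =
        (TrivSqZeroExt.inlAlgHom k (MvPolynomial (Fin 3) K) (MvPolynomial (Fin 3) K)).comp (aeval V) := by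
      ext1 i
      fin_cases i
      · simp only [V, AlgHom.comp_apply, aeval_X, TrivSqZeroExt.inlAlgHom_apply]
        simp only [Fin.zero_eta, Matrix.cons_val_zero, map_add, map_mul, hΘC, hΘ0, hΘ1]
        ext1
        · simp
        · simp [u']
      · simp only [V, AlgHom.comp_apply, aeval_X, TrivSqZeroExt.inlAlgHom_apply]
        simp only [Fin.mk_one, Matrix.cons_val_one, Matrix.cons_val_zero, map_add, map_mul, hΘC, hΘ0, hΘ2]
        ext1
        · simp
        · simp [v']
      · simp [V, hΘ0]
    exact congrArg (fun φ => φ p) this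
  let dd : MvPolynomial (Fin 2) K → MvPolynomial (Fin 2) K :=
    fun E => C u' * pderiv 0 E + C v' * pderiv 1 E
  obtain ⟨Dl, hDl⟩ := hder l
  obtain ⟨μ, hDq⟩ := hder q
  obtain ⟨DA, hDA⟩ := hder A
  obtain ⟨DB, hDB⟩ := hder B
  have hcomp : (2 * Q + fh) * (C (θ a).snd * X 0 ^ 2 + (rename Fin.succ Dl - X 0 * rename Fin.succ (dd l)) * X 0
      + (rename Fin.succ μ - X 0 * rename Fin.succ (dd q))) =
      (rename Fin.succ DA - X 0 * rename Fin.succ (dd A)) * X 0 +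
        (rename Fin.succ DB - X 0 * rename Fin.succ (dd B)) := by
    have hΘQ : Θ Q = TrivSqZeroExt.inl Q + TrivSqZeroExt.inr (C (θ a).snd * X 0 ^ 2 +
        (rename Fin.succ Dl - X 0 * rename Fin.succ (dd l)) * X 0
      + (rename Fin.succ μ - X 0 * rename Fin.succ (dd q))) := by
      rw [hQ]
      simp only [map_add, map_mul, map_pow, hΘC, hΘ0, hDl, hDq, dd]
      ext1 <;> simp
    have h1 := congrArg (fun x => (Θ x).snd) hG
    simp only [map_sub, map_add Θ, map_mul Θ, map_pow, hΘQ, hΘV, hfhdef, hghdef, hDA, hDB, hΘ0] at h1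
    simp [dd] at h1
    simp only [dd, map_add, map_mul, rename_C]
    rw [hfhdef]
    linear_combination h1
  have hμ : (rename Fin.succ DA - X 0 * rename Fin.succ (dd A)) * X 0 +
        (rename Fin.succ DB - X 0 * rename Fin.succ (dd B)) = (2 * Q + fh) * rename Fin.succ μ := by
    obtain ⟨-, -, -, h3, h4⟩ := eq_zero_of_rename_succ_sum
      (p₀ := j₂ * μ - DB) (p₁ := j₂ * (Dl - dd q) + j₁ * μ - (DA - dd B))
      (p₂ := j₂ * (C (θ a).snd - dd l) + j₁ * (Dl - dd q) + C δ * μ + dd A)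
      (p₃ := j₁ * (C (θ a).snd - dd l) + C δ * (Dl - dd q)) (p₄ := C δ * (C (θ a).snd - dd l)) (by
        rw [hJ] at hcomp
        simp only [map_sub, map_add (rename Fin.succ), map_mul (rename Fin.succ), rename_C] at hcomp ⊢
        linear_combination hcomp)
    have hCδ : (C δ : MvPolynomial (Fin 2) K) ≠ 0 := by simpa using hδ
    have h5 := (mul_eq_zero.1 h4).resolve_left hCδ
    rw [h5, mul_zero, zero_add] at h3
    have h6 := (mul_eq_zero.1 h3).resolve_left hCδ
    rw [← hcomp]
    have h5' := congrArg (rename Fin.succ : MvPolynomial (Fin 2) K → MvPolynomial (Fin 3) K) h5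
    have h6' := congrArg (rename Fin.succ : MvPolynomial (Fin 2) K → MvPolynomial (Fin 3) K) h6
    rw [map_sub, map_zero, rename_C] at h5'
    rw [map_sub, map_zero] at h6'
    linear_combination (2 * Q + fh) * X 0 ^ 2 * h5' + (2 * Q + fh) * X 0 * h6'
  have hdbl : ∀ (E : MvPolynomial (Fin 2) K) (Z : MvPolynomial (Fin 3) K) (n : ℕ),
      E.IsHomogeneous n → 2 ≤ n → rename Fin.succ A * X 0 + rename Fin.succ B = rename Fin.succ E * Z →
      dd E = 0 → False := fun E Z n hE hn hZ h0 =>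
    hsm.false_of_double_root hδ hJ (hG.trans hZ) hE hn huv h0
  have hA0 : A ≠ 0 := by
    intro hA0
    obtain ⟨-, h1, h2, -, -⟩ := eq_zero_of_rename_succ_sum
      (p₀ := DB - j₂ * μ) (p₁ := DA - dd B - j₁ * μ) (p₂ := -dd A - C δ * μ) (p₃ := 0) (p₄ := 0) (by
        rw [hJ] at hμ
        simp only [map_sub, map_neg, map_mul (rename Fin.succ), rename_C, map_zero] at hμ ⊢
        linear_combination hμ)
    have hddA : dd A = 0 := by simp [dd, hA0]
    rw [hddA, neg_zero, zero_sub, neg_eq_zero] at h2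
    have hμ0 := (mul_eq_zero.1 h2).resolve_left (by simpa using hδ)
    have hDA0 : DA = 0 := by
      have := congrArg TrivSqZeroExt.snd hDA
      rw [hA0] at this
      simp at this
      exact rename_injective _ (Fin.succ_injective 2) (by rw [← this, map_zero])
    rw [hDA0, hμ0, mul_zero, sub_zero, zero_sub, neg_eq_zero] at h1
    refine hdbl B 1 4 hB (by norm_num) ?_ h1
    rw [hA0]; simp
  -- the generic point of the osculating curve
  set α : F := aeval ![t, 1] A with hα
  have hα0 : α ≠ 0 := fun h => hA0 (ht A 3 hA h)
  let p : Fin 3 → F := ![-aeval ![t, 1] B, α * t, α * 1]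
  have hps : (fun i : Fin 2 => p i.succ) = fun i => α * (![t, 1] : Fin 2 → F) i := by
    funext i; fin_cases i <;> simp [p]
  have hpr : ∀ {E : MvPolynomial (Fin 2) K} {n : ℕ}, E.IsHomogeneous n →
      aeval p (rename Fin.succ E) = α ^ n * aeval ![t, 1] E := by
    intro E n hE
    rw [aeval_rename_succ, hps, aeval_mul_of_isHomogeneous hE]
  have hp0 : p 0 = -aeval ![t, 1] B := rfl
  have hpV : ∀ Φ : MvPolynomial (Fin 3) k, aeval p (aeval V Φ) = aeval (fun i => aeval p (V i)) Φ := by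
    intro Φ
    have : ((aeval p).restrictScalars k).comp (aeval V) = aeval (fun i => aeval p (V i)) := by
      ext1 i; simp
    rw [← this]; rfl
  refine ⟨fun i => aeval p (V i), aeval p Q, ?_, ?_⟩
  · rw [← hpV, ← hpV]
    have := congrArg (aeval p) hG
    simp only [map_sub, map_add, map_mul, map_pow, hpr hA, hpr hB, aeval_X, hp0, ← hα] at this
    linear_combination this
  intro Φ n hΦ hΦ0 hΦP
  obtain ⟨Ψ, m, hΨ, hΨm, hΨP⟩ := exists_prime_isHomogeneous hΦ hΦ0 hΦP
  rw [← hpV] at hΨP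
  have hΨhom := linSubst_isHomogeneous (M := M) (hΨm.map (algebraMap k K))
  have hΨprime : Prime (linSubst M (map (algebraMap k K) Ψ)) :=
    (MulEquiv.prime_iff (linSubstEquiv hMN hNM).toMulEquiv).2 (hprime Ψ hΨ)
  rw [hhat] at hΨhom hΨprime
  have hΘΨ := hΘV Ψ
  have hVΨ : aeval V Ψ = aeval ![C u * X 0 + X 1, C v * X 0 + X 2, X 0] Ψ := rfl
  clear_value V
  set Ψh := aeval V Ψ
  have hΨ3 : aeval (Fin.cons (-B) (fun i => A * X i) : Fin 3 → MvPolynomial (Fin 2) K) Ψh = 0 := by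
    set h3 : Fin 3 → MvPolynomial (Fin 2) K := Fin.cons (-B) (fun i => A * X i)
    have hH : (aeval h3 Ψh).IsHomogeneous (4 * m) := by
      refine hΨhom.aeval h3 fun i => ?_
      refine Fin.cases ?_ (fun j => ?_) i
      · exact hB.neg
      · exact hA.mul (isHomogeneous_X _ j)
    refine ht _ _ hH ?_
    have : (aeval (![t, 1] : Fin 2 → F)).comp (aeval h3) = aeval p := by
      ext1 i
      refine Fin.cases ?_ (fun j => ?_) i
      · simp [h3, p]
      · simp only [AlgHom.comp_apply, aeval_X, h3, Fin.cons_succ, map_mul]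
        exact (congrFun hps j).symm
    rw [← hΨP, ← this]; rfl
  obtain ⟨E, A₁, B₁, e, hΨh, hAE, hBE, hA₁, hB₁, hm, hEe, he, hndvd⟩ :=
    exists_linear_of_prime hA hA0 hΨhom hΨprime hΨ3
  have hE' : rename Fin.succ A * X 0 + rename Fin.succ B = Ψh * rename Fin.succ E := by
    rw [hΨh, hAE, hBE]; simp only [map_mul]; ring
  obtain ⟨DE, hDE⟩ := hder E
  have hkey : Ψh * (rename Fin.succ DE - X 0 * rename Fin.succ (dd E)) =
      (2 * Q + fh) * rename Fin.succ μ := by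
    have := congrArg (fun x => (Θ x).snd) hE'
    simp only [map_add Θ, map_mul Θ, hDA, hDB, hΘ0, hDE, hΘΨ] at this
    simp at this
    rw [← hμ]
    simp only [dd, map_add, map_mul, rename_C]
    linear_combination -this
  by_cases hμ0 : μ = 0
  · rw [hμ0, map_zero, mul_zero] at hkey
    have h1 := (mul_eq_zero.1 hkey).resolve_left hΨprime.ne_zero
    obtain ⟨-, hdE, -, -, -⟩ := eq_zero_of_rename_succ_sum
      (p₀ := DE) (p₁ := -dd E) (p₂ := 0) (p₃ := 0) (p₄ := 0) (by
        simp only [map_neg, map_zero]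
        linear_combination h1)
    rw [neg_eq_zero] at hdE
    by_cases he2 : 2 ≤ e
    · exact hdbl E Ψh e hEe he2 (by rw [hE', mul_comm]) hdE
    · obtain ⟨r, rfl⟩ : ∃ r, m = r + 1 := ⟨m - 1, by omega⟩
      rw [Nat.add_sub_cancel] at hA₁
      obtain ⟨hc1, hc2⟩ := aeval_chord_eq_zero (IsScalarTower.toAlgHom k K K₂) σ (by omega) hA₁ hB₁
        (hVΨ.symm.trans hΨh)
      have hpr2 := hprime₂ Ψh hΨprime
      rw [hΨh, map_add, map_mul, map_X, map_rename, map_rename] at hpr2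
      refine false_of_common_root (by omega) (hA₁.map _) (hB₁.map _) ?_ hc1 hc2 hpr2
      simpa [sub_eq_zero] using hσ
  · rcases hΨprime.dvd_or_dvd ⟨_, hkey.symm⟩ with ⟨Z, hZ⟩ | hZ
    · refine hsm.false_of_dvd hδ hJ (Z := Z) (by rw [hZ, hΨh]) (hG.trans (by rw [hE', hΨh])) hA₁ ?_ hEe he
      rintro rfl
      exact hA0 (by rw [hAE, zero_mul])
    · exact hμ0 (hndvd μ hZ)

/-- The derivation of the field of rational functions, as a morphism to the dual numbers. -/
theorem exists_dual_derivation (k : Type*) [Field k] :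
    ∃ θ : FractionRing (Polynomial k) →ₐ[k] DualNumber (FractionRing (Polynomial k)),
      (∀ a, (θ a).fst = a) ∧ ∀ p : Polynomial k, θ (algebraMap _ _ p) =
        TrivSqZeroExt.inl (algebraMap _ _ p) +
          TrivSqZeroExt.inr (algebraMap _ _ (Polynomial.derivative p)) := by
  set K := FractionRing (Polynomial k)
  let φ : Polynomial k →ₐ[k] DualNumber K := Polynomial.aeval
    (TrivSqZeroExt.inl (algebraMap (Polynomial k) K Polynomial.X) + TrivSqZeroExt.inr 1)
  have hφ : ∀ p, φ p = TrivSqZeroExt.inl (algebraMap _ K p) +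
      TrivSqZeroExt.inr (algebraMap _ K (Polynomial.derivative p)) := by
    intro p
    induction p using Polynomial.induction_on with
    | C a =>
      rw [Polynomial.derivative_C, map_zero, TrivSqZeroExt.inr_zero, add_zero]
      simp only [φ, Polynomial.aeval_C, TrivSqZeroExt.algebraMap_eq_inl']
      rfl
    | add p q hp hq =>
      rw [map_add, hp, hq]
      ext1
      · simp
      · simp
    | monomial n a h =>
      rw [pow_succ, ← mul_assoc, map_mul, h]
      have : φ Polynomial.X = TrivSqZeroExt.inl (algebraMap _ K Polynomial.X) + TrivSqZeroExt.inr 1 :=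
        Polynomial.aeval_X _
      rw [this, Polynomial.derivative_mul (f := Polynomial.C a * Polynomial.X ^ n), Polynomial.derivative_X]
      ext1
      · simp
      · simp; ring
  let θ : K →ₐ[k] DualNumber K := IsLocalization.liftAlgHom (M := nonZeroDivisors (Polynomial k)) (f := φ)
    (by
      intro y
      rw [TrivSqZeroExt.isUnit_iff_isUnit_fst, hφ]
      refine IsUnit.mk0 _ ?_
      simp)
  have hθ : ∀ p, θ (algebraMap _ K p) = φ p := fun p => IsLocalization.lift_eq _ _
  refine ⟨θ, fun a => ?_, fun p => (hθ p).trans (hφ p)⟩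
  obtain ⟨p, q, hq, rfl⟩ := IsFractionRing.div_surjective (A := Polynomial k) a
  have hq0 : algebraMap (Polynomial k) K q ≠ 0 := by
    simpa using nonZeroDivisors.ne_zero hq
  have h1 : θ (algebraMap _ K p / algebraMap _ K q) * θ (algebraMap _ K q) = θ (algebraMap _ K p) := by
    rw [← map_mul, div_mul_cancel₀ _ hq0]
  have h2 := congrArg TrivSqZeroExt.fst h1
  rw [hθ, hθ, hφ, hφ] at h2
  simp at h2
  rw [eq_div_iff hq0, h2]

/-- A parametrisation over `k(s, t)` of a family of points dense in the plane. -/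
def DominantPair {k : Type*} [Field k] (f g : MvPolynomial (Fin 3) k) : Prop :=
  ∃ (P : Fin 3 → FractionRing (MvPolynomial (Fin 2) k)) (w : FractionRing (MvPolynomial (Fin 2) k)),
    w ^ 2 + aeval P f * w = aeval P g ∧
      ∀ (Φ : MvPolynomial (Fin 3) k) (n : ℕ), Φ.IsHomogeneous n → Φ ≠ 0 → aeval P Φ ≠ 0

theorem eq_zero_of_eval₂_X_zero {k : Type*} [Field k] {p : Polynomial (Polynomial k)}
    (h : Polynomial.eval₂ (Polynomial.aeval (X 0 : MvPolynomial (Fin 2) k) :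
      Polynomial k →ₐ[k] _).toRingHom (X 1) p = 0) : p = 0 := by
  let ψ : MvPolynomial (Fin 2) k →ₐ[k] Polynomial (Polynomial k) :=
    aeval ![Polynomial.C (Polynomial.X : Polynomial k), Polynomial.X]
  have h10 := Polynomial.hom_eval₂ p (Polynomial.aeval (X 0 : MvPolynomial (Fin 2) k) :
    Polynomial k →ₐ[k] _).toRingHom ψ.toRingHom (X 1)
  have h11 : ψ.toRingHom.comp (Polynomial.aeval (X 0 : MvPolynomial (Fin 2) k) :
      Polynomial k →ₐ[k] _).toRingHom = Polynomial.C := by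
    have hX : ψ.toRingHom (X 0) = Polynomial.C Polynomial.X := by simp [ψ]
    have hC : ∀ a, ψ.toRingHom (C a) = Polynomial.C (Polynomial.C a) := fun a => ψ.commutes a
    refine RingHom.ext fun q => ?_
    induction q using Polynomial.induction_on with
    | C a =>
      rw [RingHom.comp_apply]
      have : (Polynomial.aeval (X 0 : MvPolynomial (Fin 2) k) :
          Polynomial k →ₐ[k] _).toRingHom (Polynomial.C a) = C a :=
        Polynomial.aeval_C _ a
      rw [this, hC]
    | add p q hp hq => rw [map_add, hp, hq, map_add]
    | monomial n a h =>
      have : (Polynomial.aeval (X 0 : MvPolynomial (Fin 2) k) :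
          Polynomial k →ₐ[k] _).toRingHom Polynomial.X = X 0 :=
        Polynomial.aeval_X _
      rw [pow_succ, ← mul_assoc, map_mul, h, RingHom.comp_apply, this, hX, ← map_mul]
  have hX : ψ.toRingHom (X 1) = Polynomial.X := by simp [ψ]
  rw [h11, h, map_zero, hX, Polynomial.eval₂_C_X] at h10
  exact h10.symm

set_option maxHeartbeats 800000 in
theorem DominantPair.of_curve_aux {k : Type u} [Field k] {f g : MvPolynomial (Fin 3) k}
    (hf : f.IsHomogeneous 2) (hg : g.IsHomogeneous 4)
    (hs : SmoothPair f g) {v : Fin 3 → Polynomial k} {w : Polynomial k}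
    (h1 : w ^ 2 + aeval v f * w = aeval v g) (h2 : 2 * w + aeval v f ≠ 0)
    (h3 : ∃ i j, v i * Polynomial.derivative (v j) ≠ v j * Polynomial.derivative (v i))
    (hv2 : v 2 ≠ 0) : DominantPair f g := by
  let K := FractionRing (Polynomial k)
  obtain ⟨θ, hθ, hθp⟩ := exists_dual_derivation k
  let ι : Polynomial k →ₐ[k] K := IsScalarTower.toAlgHom k _ K
  have hι : Function.Injective ι := IsFractionRing.injective (Polynomial k) K
  have hθp' : ∀ p, θ (ι p) = TrivSqZeroExt.inl (ι p) + TrivSqZeroExt.inr (ι (Polynomial.derivative p)) :=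
    hθp
  have hz : ι (v 2) ≠ 0 := fun h => hv2 (hι (h.trans (map_zero ι).symm))
  have hquot : ∀ i, ι (v 2) * (θ (ι (v i) / ι (v 2))).snd =
      ι (Polynomial.derivative (v i)) - ι (v i) / ι (v 2) * ι (Polynomial.derivative (v 2)) := by
    intro i
    have e1 : θ (ι (v i) / ι (v 2)) * θ (ι (v 2)) = θ (ι (v i)) := by
      rw [← map_mul, div_mul_cancel₀ _ hz]
    have e2 := congrArg TrivSqZeroExt.snd e1
    rw [hθp', hθp', TrivSqZeroExt.snd_mul, hθ] at e2
    simp at e2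
    linear_combination e2
  have hev : ∀ {p : MvPolynomial (Fin 3) k} {n : ℕ}, p.IsHomogeneous n →
      ι (aeval v p) = ι (v 2) ^ n * aeval ![ι (v 0) / ι (v 2), ι (v 1) / ι (v 2), 1] p := by
    intro p n hp
    rw [← aeval_mul_of_isHomogeneous hp]
    have : ι.comp (aeval v) = aeval (fun i => ι (v 2) * ![ι (v 0) / ι (v 2), ι (v 1) / ι (v 2), 1] i) := by
      ext1 i
      fin_cases i
      · simp [mul_div_cancel₀ _ hz]
      · simp [mul_div_cancel₀ _ hz]
      · simp
    rw [← this]; rfl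
  let K₂ := FractionRing (Polynomial K)
  let ρ : Polynomial k →ₐ[k] K₂ :=
    (IsScalarTower.toAlgHom k (Polynomial K) K₂).comp (Polynomial.mapAlgHom (Algebra.ofId k K))
  have hρ : Function.Injective ρ := by
    refine (IsFractionRing.injective (Polynomial K) K₂).comp ?_
    exact Polynomial.map_injective _ (algebraMap k K).injective
  let σ : K →ₐ[k] K₂ := IsFractionRing.liftAlgHom (g := ρ) hρ
  have hσ : ∀ p, σ (ι p) = ρ p := fun p => IsFractionRing.lift_algebraMap hρ p
  have hconj : ∀ i, algebraMap K K₂ (ι (v i) / ι (v 2)) = σ (ι (v i) / ι (v 2)) →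
      v i * Polynomial.derivative (v 2) = v 2 * Polynomial.derivative (v i) := by
    intro i h
    have hzσ : σ (ι (v 2)) ≠ 0 := by simpa using hz
    rw [map_div₀ σ, eq_div_iff hzσ, hσ, hσ] at h
    have h5 : Polynomial.C (ι (v i) / ι (v 2)) * (v 2).map (algebraMap k K) = (v i).map (algebraMap k K) := by
      apply IsFractionRing.injective (Polynomial K) K₂
      rw [map_mul]
      exact h
    have h6 := congrArg (fun p => Polynomial.eval (ι Polynomial.X) (Polynomial.derivative p)) h5
    have h7 : ∀ p : Polynomial k, Polynomial.eval (ι Polynomial.X) (p.map (algebraMap k K)) = ι p := by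
      intro p
      rw [Polynomial.eval_map]
      change Polynomial.aeval (ι Polynomial.X) p = _
      rw [Polynomial.aeval_algHom_apply, Polynomial.aeval_X_left_apply]
    simp only [Polynomial.derivative_C_mul, Polynomial.eval_mul, Polynomial.eval_C,
      Polynomial.derivative_map, h7] at h6
    rw [div_mul_eq_mul_div, div_eq_iff hz] at h6
    apply hι
    rw [map_mul, map_mul, h6, mul_comm]
  let F := FractionRing (MvPolynomial (Fin 2) k)
  let κ : Polynomial k →ₐ[k] F := Polynomial.aeval (algebraMap (MvPolynomial (Fin 2) k) F (X 0))
  have hκ' : κ = (IsScalarTower.toAlgHom k (MvPolynomial (Fin 2) k) F).comp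
        (Polynomial.aeval (X 0 : MvPolynomial (Fin 2) k)) := by
    ext1; simp [κ]
  have hκ : Function.Injective κ := by
    rw [hκ']
    refine (IsFractionRing.injective (MvPolynomial (Fin 2) k) F).comp ?_
    refine Function.LeftInverse.injective (g := aeval ![(Polynomial.X : Polynomial k), 0]) fun p => ?_
    have : (aeval ![(Polynomial.X : Polynomial k), 0]).comp
        (Polynomial.aeval (X 0 : MvPolynomial (Fin 2) k)) = AlgHom.id k _ := by ext1; simp
    exact DFunLike.congr_fun this p
  let τ : K →ₐ[k] F := IsFractionRing.liftAlgHom (g := κ) hκ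
  have hτ : ∀ q, τ (algebraMap (Polynomial k) K q) = κ q := fun q => IsFractionRing.lift_algebraMap hκ q
  let _ : Algebra K F := τ.toRingHom.toAlgebra
  have _ : IsScalarTower k K F := IsScalarTower.of_algebraMap_eq fun x => (τ.commutes x).symm
  obtain ⟨i, j, hij⟩ := h3
  have hne : v 0 * Polynomial.derivative (v 2) ≠ v 2 * Polynomial.derivative (v 0) ∨
      v 1 * Polynomial.derivative (v 2) ≠ v 2 * Polynomial.derivative (v 1) := by
    by_contra hcon
    push Not at hcon
    obtain ⟨e0, e1⟩ := hcon
    have e : ∀ i, v i * Polynomial.derivative (v 2) = v 2 * Polynomial.derivative (v i) := by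
      intro i; fin_cases i
      exacts [e0, e1, rfl]
    apply hij
    refine mul_left_cancel₀ hv2 ?_
    linear_combination v j * e i - v i * e j
  refine exists_dominant_point hf hg hs θ hθ (u := ι (v 0) / ι (v 2)) (v := ι (v 1) / ι (v 2))
    (a := ι w / ι (v 2) ^ 2) ?_ ?_ ?_ (fun Φ => prime_map_fractionRing) σ ?_
    (fun Φ => prime_map_fractionRing) (F := F) (algebraMap (MvPolynomial (Fin 2) k) F (X 1)) ?_
  · have hd : ∀ i, (θ (ι (v i) / ι (v 2))).snd = 0 →
        v i * Polynomial.derivative (v 2) = v 2 * Polynomial.derivative (v i) := by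
      intro i h
      have h5 := hquot i
      rw [h, mul_zero, eq_comm, sub_eq_zero, div_mul_eq_mul_div, eq_div_iff hz] at h5
      apply hι
      rw [map_mul, map_mul, ← h5, mul_comm]
    exact hne.imp (fun h h' => h (hd 0 h')) (fun h h' => h (hd 1 h'))
  · have h5 := congrArg ι h1
    rw [map_add, map_mul, map_pow, hev hf, hev hg] at h5
    generalize aeval ![ι (v 0) / ι (v 2), ι (v 1) / ι (v 2), 1] f = fa at *
    generalize aeval ![ι (v 0) / ι (v 2), ι (v 1) / ι (v 2), 1] g = ga at *
    generalize ι w = w' at *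
    generalize ι (v 2) = z at *
    refine mul_left_cancel₀ (pow_ne_zero 4 hz) ?_
    rw [← h5]
    field_simp
  · intro h5
    apply h2
    apply hι
    rw [map_add, map_mul, hev hf, map_zero, map_ofNat]
    generalize aeval ![ι (v 0) / ι (v 2), ι (v 1) / ι (v 2), 1] f = fa at *
    generalize ι w = w' at *
    generalize ι (v 2) = z at *
    field_simp at h5
    linear_combination h5
  · exact hne.imp (fun h h' => h (hconj 0 h')) (fun h h' => h (hconj 1 h'))
  · intro E n hE hE0
    refine eq_zero_of_aeval_X_one hE ?_
    set t : F := algebraMap (MvPolynomial (Fin 2) k) F (X 1)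
    set e : Polynomial K := aeval ![Polynomial.X, 1] E
    have hx : Polynomial.aeval t e = 0 := by
      have : (Polynomial.aeval t : Polynomial K →ₐ[K] F).comp (aeval ![Polynomial.X, 1])
          = aeval ![t, 1] := by
        ext1 i; fin_cases i <;> simp
      rw [← hE0, ← this]; rfl
    have h5 := IsLocalization.integerNormalization_eval₂_eq_zero (nonZeroDivisors (Polynomial k))
      (algebraMap K F) e hx
    rw [← IsLocalization.integerNormalization_eq_zero_iff (le_refl (nonZeroDivisors (Polynomial k)))]
    set p := IsLocalization.integerNormalization (nonZeroDivisors (Polynomial k)) e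
    have h6 : (algebraMap K F).comp (algebraMap (Polynomial k) K) =
        (algebraMap (MvPolynomial (Fin 2) k) F).comp
          (Polynomial.aeval (X 0 : MvPolynomial (Fin 2) k) : Polynomial k →ₐ[k] _).toRingHom := by
      refine RingHom.ext fun q => ?_
      exact (hτ q).trans (DFunLike.congr_fun hκ' q)
    rw [h6, ← Polynomial.hom_eval₂] at h5
    have h8 := IsFractionRing.injective (MvPolynomial (Fin 2) k) F (h5.trans (map_zero _).symm)
    exact eq_zero_of_eval₂_X_zero h8

theorem DominantPair.of_curve {k : Type u} [Field k] {f g : MvPolynomial (Fin 3) k}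
    (hf : f.IsHomogeneous 2) (hg : g.IsHomogeneous 4) (hs : SmoothPair f g) (h : HasCurve f g) :
    DominantPair f g := by
  obtain ⟨v, w, h1, h2, h3⟩ := h
  obtain ⟨m, hm⟩ : ∃ m, v m ≠ 0 := by
    by_contra hcon
    push Not at hcon
    obtain ⟨i, j, hij⟩ := h3
    simp [hcon] at hij
  let s := Equiv.swap m 2
  have hss : ∀ i, s (s i) = i := fun i => by simp [s]
  have hc : (fun i => v (s i)) ∘ s = v := by funext i; simp [hss]
  have hsm : SmoothPair (rename s f) (rename s g) := by
    intro Ω _ _ P w hP e0 e1 e2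
    rw [aeval_rename] at e0 e1
    rw [aeval_rename] at e1
    refine hs Ω (P ∘ s) w ?_ e0 e1 fun i => ?_
    · intro hz
      apply hP
      funext i
      have := congrFun hz (s i)
      simpa [hss] using this
    · have := e2 (s i)
      rwa [pderiv_rename s.injective, pderiv_rename s.injective, aeval_rename, aeval_rename] at this
  obtain ⟨P, w', e1, e2⟩ := DominantPair.of_curve_aux (v := fun i => v (s i)) (w := w)
    hf.rename_isHomogeneous hg.rename_isHomogeneous hsm
    (by rw [aeval_rename, aeval_rename, hc]; exact h1) (by rw [aeval_rename, hc]; exact h2)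
    (by
      obtain ⟨i, j, hij⟩ := h3
      exact ⟨s i, s j, by simpa [hss] using hij⟩)
    (by simpa [s] using hm)
  rw [aeval_rename, aeval_rename] at e1
  refine ⟨P ∘ s, w', e1, fun Φ n hΦ h0 => ?_⟩
  rw [← aeval_rename]
  refine e2 _ n hΦ.rename_isHomogeneous ?_
  rwa [Ne, map_eq_zero_iff _ (rename_injective _ s.injective)]

theorem DominantPair.exists_algebraicIndependent {k : Type*} [Field k] {f g : MvPolynomial (Fin 3) k}
    (hf : f.IsHomogeneous 2) (hg : g.IsHomogeneous 4) (h : DominantPair f g) :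
    ∃ u v ω : FractionRing (MvPolynomial (Fin 2) k), AlgebraicIndependent k ![u, v] ∧
      ω ^ 2 + aeval ![u, v, 1] f * ω = aeval ![u, v, 1] g := by
  obtain ⟨P, w, h1, h2⟩ := h
  have hz : P 2 ≠ 0 := by
    have := h2 (X 2) 1 (isHomogeneous_X _ 2) (X_ne_zero 2)
    rwa [aeval_X] at this
  have hP : P = fun i => P 2 * ![P 0 / P 2, P 1 / P 2, 1] i := by
    funext i; fin_cases i
    · exact (mul_div_cancel₀ _ hz).symm
    · exact (mul_div_cancel₀ _ hz).symm
    · exact (mul_one _).symm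
  refine ⟨P 0 / P 2, P 1 / P 2, w / P 2 ^ 2, ?_, ?_⟩
  · rw [algebraicIndependent_iff]
    intro p hp
    by_contra hp0
    set N := p.totalDegree
    let Φ : MvPolynomial (Fin 3) k := ∑ j ∈ Finset.range (N + 1),
      rename Fin.castSucc (homogeneousComponent j p) * X 2 ^ (N - j)
    have hΦ : Φ.IsHomogeneous N := by
      refine IsHomogeneous.sum _ _ _ fun j hj => ?_
      have := ((homogeneousComponent_isHomogeneous j p).rename_isHomogeneous
        (f := Fin.castSucc)).mul ((isHomogeneous_X k (2 : Fin 3)).pow (N - j))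
      rwa [one_mul, Nat.add_sub_cancel' (Nat.lt_succ_iff.1 (Finset.mem_range.1 hj))] at this
    have hev : ∀ {A : Type _} [CommRing A] [Algebra k A] (x : Fin 3 → A), x 2 = 1 →
        aeval x Φ = aeval (x ∘ Fin.castSucc) p := by
      intro A _ _ x hx
      conv_rhs => rw [← sum_homogeneousComponent p]
      simp only [Φ, map_sum, map_mul, map_pow, aeval_X, hx, one_pow, mul_one, aeval_rename]
      rfl
    refine h2 Φ N hΦ ?_ ?_
    · intro hΦ0
      have := hev (A := MvPolynomial (Fin 2) k) ![X 0, X 1, 1] rfl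
      have hX : (![X 0, X 1, 1] : Fin 3 → MvPolynomial (Fin 2) k) ∘ Fin.castSucc = X := by
        funext i; fin_cases i <;> rfl
      rw [hΦ0, map_zero, hX, aeval_X_left_apply] at this
      exact hp0 this.symm
    · have hX : (![P 0 / P 2, P 1 / P 2, 1] : Fin 3 → _) ∘ Fin.castSucc = ![P 0 / P 2, P 1 / P 2] := by
        funext i; fin_cases i <;> rfl
      rw [hP, aeval_mul_of_isHomogeneous hΦ, hev _ rfl, hX, hp, mul_zero]
  · rw [hP, aeval_mul_of_isHomogeneous hf, aeval_mul_of_isHomogeneous hg] at h1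
    generalize aeval ![P 0 / P 2, P 1 / P 2, 1] f = fa at *
    generalize aeval ![P 0 / P 2, P 1 / P 2, 1] g = ga at *
    refine mul_left_cancel₀ (pow_ne_zero 4 hz) ?_
    rw [← h1]
    field_simp

theorem exists_mul_eq_one_of_det_ne_zero {n K : Type*} [Fintype n] [DecidableEq n] [Field K]
    {M : Matrix n n K} (h : M.det ≠ 0) : ∃ N, M * N = 1 :=
  ⟨M⁻¹, Matrix.mul_nonsing_inv M (isUnit_iff_ne_zero.2 h)⟩

theorem exists_det_ne_zero_of_ne_zero {K : Type*} [Field K] {P : Fin 3 → K} (hP : P ≠ 0) :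
    ∃ M : Matrix (Fin 3) (Fin 3) K, M.det ≠ 0 ∧ ∀ i, M i 0 = P i := by
  by_cases h0 : P 0 = 0
  · by_cases h1 : P 1 = 0
    · have h2 : P 2 ≠ 0 := fun h => hP (by funext i; fin_cases i <;> simp [*])
      exact ⟨!![P 0, 0, 1; P 1, 1, 0; P 2, 0, 0], by simpa [Matrix.det_fin_three] using h2,
        fun i => by fin_cases i <;> rfl⟩
    · exact ⟨!![P 0, 1, 0; P 1, 0, 0; P 2, 0, 1], by simpa [Matrix.det_fin_three] using h1,
        fun i => by fin_cases i <;> rfl⟩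
  · exact ⟨!![P 0, 0, 0; P 1, 1, 0; P 2, 0, 1], by simpa [Matrix.det_fin_three] using h0,
        fun i => by fin_cases i <;> rfl⟩

theorem eq_C_mul_X_pow_of_isHomogeneous {K : Type*} [CommRing K] {p : MvPolynomial (Fin 1) K} {n : ℕ}
    (hp : p.IsHomogeneous n) : ∃ a, p = C a * X 0 ^ n := by
  refine ⟨coeff (Finsupp.single 0 n) p, ?_⟩
  ext m
  rw [coeff_C_mul, coeff_X_pow]
  by_cases h : Finsupp.single 0 n = m
  · simp [h]
  · rw [if_neg h, mul_zero]
    refine hp.coeff_eq_zero fun hm => h ?_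
    refine Finsupp.ext fun i => ?_
    obtain rfl : i = 0 := Subsingleton.elim _ _
    rw [← hm, Finsupp.degree_eq_sum]
    simp

theorem exists_coeffs_of_isHomogeneous {K : Type*} [CommRing K] {p : MvPolynomial (Fin 2) K} {n : ℕ}
    (hp : p.IsHomogeneous n) :
    ∃ c : ℕ → K, p = ∑ i ∈ Finset.range (n + 1), C (c i) * X 1 ^ (n - i) * X 0 ^ i := by
  have h : ∀ i, ∃ a, i ∈ Finset.range (n + 1) →
      (finSuccEquiv K 1 p).coeff i = C a * X 0 ^ (n - i) := fun i => by
    by_cases hi : i ∈ Finset.range (n + 1)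
    · have hi' := Finset.mem_range.1 hi
      obtain ⟨a, ha⟩ := eq_C_mul_X_pow_of_isHomogeneous
        (hp.finSuccEquiv_coeff_isHomogeneous i (n - i) (by omega))
      exact ⟨a, fun _ => ha⟩
    · exact ⟨0, fun h => absurd h hi⟩
  choose c hc using h
  refine ⟨c, ?_⟩
  conv_lhs => rw [eq_sum_rename_succ hp]
  refine Finset.sum_congr rfl fun i hi => ?_
  rw [hc i hi]
  simp

theorem exists_coeffs_linear {K : Type*} [CommRing K] {p : MvPolynomial (Fin 2) K}
    (hp : p.IsHomogeneous 1) : ∃ a b, p = C a * X 0 + C b * X 1 := by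
  obtain ⟨c, hc⟩ := exists_coeffs_of_isHomogeneous hp
  exact ⟨c 1, c 0, by rw [hc]; simp [Finset.sum_range_succ]; ring⟩

theorem exists_coeffs_quadratic {K : Type*} [CommRing K] {p : MvPolynomial (Fin 2) K}
    (hp : p.IsHomogeneous 2) : ∃ a b c, p = C a * X 0 ^ 2 + C b * (X 0 * X 1) + C c * X 1 ^ 2 := by
  obtain ⟨c, hc⟩ := exists_coeffs_of_isHomogeneous hp
  exact ⟨c 2, c 1, c 0, by rw [hc]; simp [Finset.sum_range_succ]; ring⟩

theorem exists_coeffs_cubic {K : Type*} [CommRing K] {p : MvPolynomial (Fin 2) K}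
    (hp : p.IsHomogeneous 3) : ∃ a b c d, p = C a * X 0 ^ 3 + C b * (X 0 ^ 2 * X 1) +
      C c * (X 0 * X 1 ^ 2) + C d * X 1 ^ 3 := by
  obtain ⟨c, hc⟩ := exists_coeffs_of_isHomogeneous hp
  exact ⟨c 3, c 2, c 1, c 0, by rw [hc]; simp [Finset.sum_range_succ]; ring⟩

theorem exists_coeffs_quartic {K : Type*} [CommRing K] {p : MvPolynomial (Fin 2) K}
    (hp : p.IsHomogeneous 4) : ∃ a b c d e, p = C a * X 0 ^ 4 + C b * (X 0 ^ 3 * X 1) +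
      C c * (X 0 ^ 2 * X 1 ^ 2) + C d * (X 0 * X 1 ^ 3) + C e * X 1 ^ 4 := by
  obtain ⟨c, hc⟩ := exists_coeffs_of_isHomogeneous hp
  exact ⟨c 4, c 3, c 2, c 1, c 0, by rw [hc]; simp [Finset.sum_range_succ]; ring⟩

section

variable {k : Type u} [Field k] {f g : MvPolynomial (Fin 3) k}

theorem HasCurve.of_det_ne_zero {M : Matrix (Fin 3) (Fin 3) k} (hM : M.det ≠ 0)
    (hs : SmoothPair f g)
    (h : SmoothPair (linSubst M f) (linSubst M g) → HasCurve (linSubst M f) (linSubst M g)) :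
    HasCurve f g :=
  hasCurve_of_linSubst (exists_mul_eq_one_of_det_ne_zero hM).choose_spec hs h

theorem SmoothPair.shift (h : SmoothPair f g) (Q : MvPolynomial (Fin 3) k) :
    SmoothPair (f + 2 * Q) (g - Q ^ 2 - f * Q) := by
  intro Ω _ _ P w hP h0 h1 h2
  simp only [map_add, map_sub, map_mul, map_pow, map_ofNat] at h0 h1
  refine h Ω P (w + aeval P Q) hP ?_ ?_ ?_
  · linear_combination h0
  · linear_combination h1
  · intro i
    have := h2 i
    have h2' : pderiv i (2 : MvPolynomial (Fin 3) k) = 0 := by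
      rw [show (2 : MvPolynomial (Fin 3) k) = C 2 from rfl, pderiv_C]
    simp only [map_add, map_sub, Derivation.leibniz, Derivation.leibniz_pow, smul_eq_mul, map_mul,
      map_pow, map_ofNat, map_nsmul, h2', map_zero] at this
    simp only [nsmul_eq_mul, Nat.cast_ofNat, Nat.add_one_sub_one, pow_one] at this
    linear_combination this - aeval P (pderiv i Q) * h0

theorem HasCurve.of_shift (Q : MvPolynomial (Fin 3) k)
    (h : HasCurve (f + 2 * Q) (g - Q ^ 2 - f * Q)) : HasCurve f g := by
  obtain ⟨v, w, h1, h2, h3⟩ := h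
  simp only [map_add, map_sub, map_mul, map_pow, map_ofNat] at h1 h2
  exact ⟨v, w + aeval v Q, by linear_combination h1, fun h => h2 (by linear_combination h), h3⟩

theorem SmoothPair.false_of_grad (h : SmoothPair 0 g) {Ω : Type u} [Field Ω] [Algebra k Ω]
    {P : Fin 3 → Ω} (hP : P ≠ 0) (h0 : aeval P g = 0) (h1 : ∀ i, aeval P (pderiv i g) = 0) : False :=
  h Ω P 0 hP (by rw [map_zero]; simp) (by rw [h0]; simp) fun i => by rw [h1 i]; simp

theorem HasCurve.of_eval {x y z w : Polynomial k} (h2 : (2 : k) ≠ 0)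
    (h : w ^ 2 = aeval ![x, y, z] g) (hw : w ≠ 0)
    (h3 : ∃ i j, ![x, y, z] i * Polynomial.derivative (![x, y, z] j) ≠
      ![x, y, z] j * Polynomial.derivative (![x, y, z] i)) : HasCurve 0 g := by
  refine ⟨![x, y, z], w, by simp [h], ?_, h3⟩
  have : (2 : Polynomial k) = Polynomial.C 2 := (map_ofNat Polynomial.C 2).symm
  rw [map_zero, add_zero, this]
  exact mul_ne_zero (Polynomial.C_ne_zero.2 h2) hw

end

section

variable {k : Type u} [Field k] {g : MvPolynomial (Fin 3) k}

theorem linSubst_rename_succ_of_shear {m₁ m₂ : k} (p : MvPolynomial (Fin 2) k) :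
    linSubst !![1, m₁, m₂; 0, 1, 0; 0, 0, 1] (rename Fin.succ p) = rename Fin.succ p := by
  rw [linSubst, aeval_rename_succ]
  conv_rhs => rw [← aeval_X_left_apply (rename Fin.succ p), aeval_rename_succ]
  congr 2
  funext i
  fin_cases i <;> simp [Fin.sum_univ_three]

theorem HasCurve.of_even_form (h2 : (2 : k) ≠ 0) (hs : SmoothPair 0 g) (hg : g.IsHomogeneous 4)
    {P : Fin 3 → k} {a : k} (ha : a ≠ 0) (hP : aeval P g = a ^ 2)
    (H : ∀ q r : MvPolynomial (Fin 2) k, q.IsHomogeneous 2 → r.IsHomogeneous 4 →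
      SmoothPair 0 (C (a ^ 2) * X 0 ^ 4 + rename Fin.succ q * X 0 ^ 2 + rename Fin.succ r) →
      HasCurve 0 (C (a ^ 2) * X 0 ^ 4 + rename Fin.succ q * X 0 ^ 2 + rename Fin.succ r)) :
    HasCurve 0 g := by
  have hP0 : P ≠ 0 := by
    rintro rfl
    rw [aeval_zero_of_isHomogeneous hg four_ne_zero] at hP
    exact pow_ne_zero 2 ha hP.symm
  obtain ⟨M, hM, hMP⟩ := exists_det_ne_zero_of_ne_zero hP0
  refine HasCurve.of_det_ne_zero hM hs fun hs => ?_
  rw [map_zero] at hs ⊢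
  have hg' : (linSubst M g).IsHomogeneous 4 := linSubst_isHomogeneous hg
  have hP' : aeval ![1, 0, 0] (linSubst M g) = a ^ 2 := by
    rw [aeval_linSubst, ← hP]
    congr 2
    funext i
    simp [Fin.sum_univ_three, hMP]
  by_contra hno
  have hδ : 2 * a + aeval ![1, 0, 0] (0 : MvPolynomial (Fin 3) k) ≠ 0 := by
    rw [map_zero, add_zero]; exact mul_ne_zero h2 ha
  obtain ⟨l, q, A, B, hl, hq, hA, hB, hG⟩ :=
    exists_osculating (isHomogeneous_zero _ _ 2) hg' (a := a) (by simp [hP']) hδ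
  have hA0 : A = 0 := by
    by_contra hA0
    exact hno (HasCurve.of_osculating hs (isHomogeneous_zero _ _ 2) hδ hl hq hA hB hG hA0)
  rw [hA0, map_zero] at hG
  obtain ⟨l₁, l₂, rfl⟩ := exists_coeffs_linear hl
  have hS : (!![1, -l₁ / (2 * a), -l₂ / (2 * a); 0, 1, 0; 0, 0, 1] :
      Matrix (Fin 3) (Fin 3) k).det ≠ 0 := by simp [Matrix.det_fin_three]
  refine hno (HasCurve.of_det_ne_zero hS hs fun hs => ?_)
  rw [map_zero] at hs ⊢
  set S := (!![1, -l₁ / (2 * a), -l₂ / (2 * a); 0, 1, 0; 0, 0, 1] : Matrix (Fin 3) (Fin 3) k)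
  set l : MvPolynomial (Fin 2) k := C l₁ * X 0 + C l₂ * X 1 with hl'
  have hX : linSubst S (X 0) = X 0 - C (1 / (2 * a)) * rename Fin.succ l := by
    simp [linSubst, Fin.sum_univ_three, S, hl', rename_X, div_eq_mul_inv]
    ring
  have ha' : C a * C (1 / (2 * a)) = (C (1 / 2) : MvPolynomial (Fin 3) k) := by
    rw [← C_mul]; congr 1; field_simp
  have h2' : (2 : MvPolynomial (Fin 3) k) * C (1 / 2) = 1 := by
    rw [show (2 : MvPolynomial (Fin 3) k) = C 2 from rfl, ← C_mul, ← C_1]; congr 1; field_simp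
  set q' : MvPolynomial (Fin 2) k := q - C (1 / (4 * a)) * l ^ 2 with hq'
  have h4 : (C (1 / (2 * a)) : MvPolynomial (Fin 3) k) * C (1 / 2) = C (1 / (4 * a)) := by
    rw [← C_mul]; rw [show (4 : k) = 2 * 2 by norm_num]; congr 1; field_simp
  have key : linSubst S (linSubst M g) = C (a ^ 2) * X 0 ^ 4 + rename Fin.succ (C (2 * a) * q') * X 0 ^ 2 +
      rename Fin.succ (q' ^ 2 - B) := by
    have := congrArg (linSubst S) hG
    simp only [map_add, map_sub, map_mul, map_pow, hX, S, linSubst_rename_succ_of_shear] at this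
    simp only [map_zero, zero_mul, add_zero, zero_add] at this
    rw [show linSubst S (C a) = C a from aeval_C _ _] at this
    have e : C a * (X 0 - C (1 / (2 * a)) * rename Fin.succ l) ^ 2 + rename Fin.succ l *
        (X 0 - C (1 / (2 * a)) * rename Fin.succ l) + rename Fin.succ q =
        C a * X 0 ^ 2 + rename Fin.succ q' := by
      simp only [hq', map_sub, map_mul, map_pow, rename_C, ← h4]
      linear_combination (C (1 / (2 * a)) * rename Fin.succ l ^ 2 - 2 * X 0 * rename Fin.succ l) * ha' +
        (- X 0 * rename Fin.succ l) * h2' + C (1 / (2 * a)) * rename Fin.succ l ^ 2 * h2'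
    rw [e] at this
    simp only [map_mul, map_pow, map_sub, rename_C, map_ofNat]
    linear_combination -this
  rw [key] at hs ⊢
  have hq'h : q'.IsHomogeneous 2 := by
    refine hq.sub ?_
    simpa using (isHomogeneous_C _ (1 / (4 * a))).mul (hl.pow 2)
  refine H _ _ (by simpa using (isHomogeneous_C _ (2 * a)).mul hq'h) ?_ hs
  exact (by simpa using hq'h.pow 2 : (q' ^ 2).IsHomogeneous 4).sub hB

end

section

variable {k : Type u} [Field k] {g : MvPolynomial (Fin 3) k}

theorem HasCurve.of_even_form_root (h2 : (2 : k) ≠ 0) {a : k} (ha : a ≠ 0)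
    {q r : MvPolynomial (Fin 2) k} (hq : q.IsHomogeneous 2) (hr : r.IsHomogeneous 4)
    {P : Fin 2 → k} (hP : P ≠ 0) (h : aeval P r = 0) :
    HasCurve 0 (C (a ^ 2) * X 0 ^ 4 + rename Fin.succ q * X 0 ^ 2 + rename Fin.succ r) := by
  let s : Polynomial k := Polynomial.X
  let c : k → Polynomial k := fun b => Polynomial.C b
  have hP' : ∀ p : MvPolynomial (Fin 2) k, aeval (fun i => c (P i)) p = c (aeval P p) := fun p => by
    have : (fun i => c (P i)) = algebraMap k (Polynomial k) ∘ P := rfl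
    rw [this, aeval_algebraMap_apply]; rfl
  have hv : ∀ {n} {p : MvPolynomial (Fin 2) k}, p.IsHomogeneous n →
      aeval ![2 * c a * s * c (P 0), 2 * c a * s * c (P 1)] p =
        (2 * c a * s) ^ n * c (aeval P p) := fun hp => by
    rw [← hP', ← aeval_mul_of_isHomogeneous hp]
    congr 2
    funext i
    fin_cases i <;> rfl
  have hsq : ∀ b e : k, e ≠ 0 → c b + c e * s ^ 2 ≠ 0 := fun b e he h0 => by
    have := congrArg (fun p => Polynomial.coeff p 2) h0
    simp [c, s, Polynomial.coeff_X_pow] at this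
    exact he this
  set b := aeval P q
  have hc1 : c 1 = 1 := Polynomial.C_1
  have hA : c b - s ^ 2 ≠ 0 := by simpa [c, sub_eq_add_neg] using hsq b (-1) (by simp)
  have hB : c b + s ^ 2 ≠ 0 := by simpa [c] using hsq b 1 (by simp)
  refine HasCurve.of_eval h2 (x := c b - s ^ 2) (y := 2 * c a * s * c (P 0))
    (z := 2 * c a * s * c (P 1)) (w := (c b - s ^ 2) * (c a * (c b + s ^ 2))) ?_ ?_ ?_
  · have e : (fun i : Fin 2 => (![c b - s ^ 2, 2 * c a * s * c (P 0), 2 * c a * s * c (P 1)] :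
        Fin 3 → Polynomial k) i.succ) = ![2 * c a * s * c (P 0), 2 * c a * s * c (P 1)] := by
      funext i; fin_cases i <;> rfl
    simp only [map_add, map_mul, map_pow, aeval_rename_succ, aeval_X, aeval_C, e, hv hq, hv hr, h]
    simp only [Matrix.cons_val_zero, Polynomial.algebraMap_eq]
    change _ = c a ^ 2 * _ + _ * _ + _ * Polynomial.C 0
    rw [Polynomial.C_0]
    ring
  · exact mul_ne_zero hA (mul_ne_zero (Polynomial.C_ne_zero.2 ha) hB)
  · obtain ⟨i, hi⟩ : ∃ i, P i ≠ 0 := by by_contra hcon; push Not at hcon; exact hP (funext hcon)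
    have h2' : (2 : Polynomial k) ≠ 0 := by
      rw [← map_ofNat Polynomial.C 2]; exact Polynomial.C_ne_zero.2 h2
    have key : ∀ j, P j ≠ 0 → (c b - s ^ 2) * Polynomial.derivative (2 * c a * s * c (P j)) ≠
        2 * c a * s * c (P j) * Polynomial.derivative (c b - s ^ 2) := fun j hj h0 => by
      have hd : Polynomial.derivative (2 : Polynomial k) = 0 := Polynomial.derivative_ofNat 2
      simp only [Polynomial.derivative_mul, Polynomial.derivative_sub, Polynomial.derivative_pow, c, s,
        Polynomial.derivative_C, Polynomial.derivative_X, hd] at h0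
      apply mul_ne_zero (mul_ne_zero h2' (Polynomial.C_ne_zero.2 ha))
        (mul_ne_zero (Polynomial.C_ne_zero.2 hj) hB)
      simp only [c, s]
      norm_num at h0
      rw [map_ofNat] at h0
      linear_combination h0
    fin_cases i
    · exact ⟨0, 1, key 0 hi⟩
    · exact ⟨0, 2, key 1 hi⟩

theorem linSubst_rename_succ_of_block {a b c d : k} (p : MvPolynomial (Fin 2) k) :
    linSubst !![1, 0, 0; 0, a, b; 0, c, d] (rename Fin.succ p) =
      rename Fin.succ (linSubst !![a, b; c, d] p) := by
  rw [linSubst, aeval_rename_succ, linSubst, ← AlgHom.comp_apply, comp_aeval]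
  congr 2
  funext i
  fin_cases i <;> simp [Fin.sum_univ_three]

/-- Ternary quartic forms in the squares of the variables. -/
noncomputable def biquad (α β γ a b c : k) : MvPolynomial (Fin 3) k :=
  C α * X 0 ^ 4 + C β * X 1 ^ 4 + C γ * X 2 ^ 4 + C a * (X 0 ^ 2 * X 1 ^ 2) +
    C b * (X 0 ^ 2 * X 2 ^ 2) + C c * (X 1 ^ 2 * X 2 ^ 2)

theorem HasCurve.of_mixed (h2 : (2 : k) ≠ 0) {α β γ a b c d e : k} (hβ : β ≠ 0)
    (hs : SmoothPair 0 (biquad α (β ^ 2) γ a b c + C d * (X 0 ^ 2 * X 1 * X 2) +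
      C e * (X 1 * X 2 ^ 3))) (h : d ≠ 0 ∨ e ≠ 0) :
    HasCurve 0 (biquad α (β ^ 2) γ a b c + C d * (X 0 ^ 2 * X 1 * X 2) +
      C e * (X 1 * X 2 ^ 3)) := by
  have hM : (!![0, 1, 0; 1, 0, 0; 0, 0, 1] : Matrix (Fin 3) (Fin 3) k).det ≠ 0 := by
    simp [Matrix.det_fin_three]
  refine HasCurve.of_det_ne_zero hM hs fun hs => ?_
  rw [map_zero] at hs ⊢
  have hδ : 2 * β + aeval ![1, 0, 0] (0 : MvPolynomial (Fin 3) k) ≠ 0 := by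
    rw [map_zero, add_zero]; exact mul_ne_zero h2 hβ
  have hX : ∀ i : Fin 2, (X i : MvPolynomial (Fin 2) k).IsHomogeneous 1 := isHomogeneous_X k
  have hC : ∀ (x : k) {n} {p : MvPolynomial (Fin 2) k}, p.IsHomogeneous n →
      (C x * p).IsHomogeneous n := fun x n p hp => by
    simpa using (isHomogeneous_C (Fin 2) x).mul hp
  set q : MvPolynomial (Fin 2) k := C (a / (2 * β)) * X 0 ^ 2 + C (c / (2 * β)) * X 1 ^ 2 with hq'
  have hq : q.IsHomogeneous 2 := (hC _ ((hX 0).pow 2)).add (hC _ ((hX 1).pow 2))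
  refine HasCurve.of_osculating hs (isHomogeneous_zero _ _ 2) (a := β) hδ (l := 0) (q := q)
    (A := -(C d * (X 0 ^ 2 * X 1) + C e * X 1 ^ 3))
    (B := q ^ 2 - (C α * X 0 ^ 4 + C γ * X 1 ^ 4 + C b * (X 0 ^ 2 * X 1 ^ 2)))
    (isHomogeneous_zero _ _ 1) hq ?_ ?_ ?_ ?_
  · exact ((hC _ (((hX 0).pow 2).mul (hX 1))).add (hC _ ((hX 1).pow 3))).neg
  · exact (by simpa using hq.pow 2 : (q ^ 2).IsHomogeneous 4).sub (((hC _ ((hX 0).pow 4)).add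
      (hC _ ((hX 1).pow 4))).add (hC _ (((hX 0).pow 2).mul ((hX 1).pow 2))))
  · have ea : C a = 2 * C β * (C (a / (2 * β)) : MvPolynomial (Fin 3) k) := by
      rw [show (2 : MvPolynomial (Fin 3) k) = C 2 from rfl, ← C_mul, ← C_mul]; congr 1; field_simp
    have ec : C c = 2 * C β * (C (c / (2 * β)) : MvPolynomial (Fin 3) k) := by
      rw [show (2 : MvPolynomial (Fin 3) k) = C 2 from rfl, ← C_mul, ← C_mul]; congr 1; field_simp
    simp only [biquad, hq', map_add, map_sub, map_neg, map_mul, map_pow, rename_C, rename_X, map_zero,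
      linSubst, aeval_C, aeval_X, algebraMap_eq, ea, ec, map_ofNat]
    simp [Fin.sum_univ_three]
    ring
  · intro h0
    rw [neg_eq_zero] at h0
    have e1 := congrArg (aeval ![(1 : k), 1]) h0
    have e2 := congrArg (aeval ![(0 : k), 1]) h0
    simp at e1 e2
    rw [e2, add_zero] at e1
    tauto

end

section

variable {k : Type u} [Field k]

theorem biquad_swap₀₁ (α β γ a b c : k) :
    linSubst !![0, 1, 0; 1, 0, 0; 0, 0, 1] (biquad α β γ a b c) = biquad β α γ a c b := by
  simp [biquad, linSubst, Fin.sum_univ_three]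
  ring

theorem biquad_swap₁₂ (α β γ a b c : k) :
    linSubst !![1, 0, 0; 0, 0, 1; 0, 1, 0] (biquad α β γ a b c) = biquad α γ β b a c := by
  simp [biquad, linSubst, Fin.sum_univ_three]
  ring

theorem SmoothPair.biquad_swap₀₁ {α β γ a b c : k} (h : SmoothPair 0 (biquad α β γ a b c)) :
    SmoothPair 0 (biquad β α γ a c b) := by
  have := h.linSubst (M := !![0, 1, 0; 1, 0, 0; 0, 0, 1]) (N := !![0, 1, 0; 1, 0, 0; 0, 0, 1])
    (by ext i j; fin_cases i <;> fin_cases j <;> simp [Matrix.mul_apply, Fin.sum_univ_three])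
  rwa [map_zero, _root_.biquad_swap₀₁] at this

theorem SmoothPair.biquad_swap₁₂ {α β γ a b c : k} (h : SmoothPair 0 (biquad α β γ a b c)) :
    SmoothPair 0 (biquad α γ β b a c) := by
  have := h.linSubst (M := !![1, 0, 0; 0, 0, 1; 0, 1, 0]) (N := !![1, 0, 0; 0, 0, 1; 0, 1, 0])
    (by ext i j; fin_cases i <;> fin_cases j <;> simp [Matrix.mul_apply, Fin.sum_univ_three])
  rwa [map_zero, _root_.biquad_swap₁₂] at this

theorem HasCurve.biquad_swap₀₁ {α β γ a b c : k} (h : HasCurve 0 (biquad α β γ a b c)) :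
    HasCurve 0 (biquad β α γ a c b) := by
  refine HasCurve.of_linSubst (M := !![0, 1, 0; 1, 0, 0; 0, 0, 1])
    (N := !![0, 1, 0; 1, 0, 0; 0, 0, 1])
    (by ext i j; fin_cases i <;> fin_cases j <;> simp [Matrix.mul_apply, Fin.sum_univ_three]) ?_
  rwa [map_zero, _root_.biquad_swap₀₁]

theorem HasCurve.biquad_swap₁₂ {α β γ a b c : k} (h : HasCurve 0 (biquad α β γ a b c)) :
    HasCurve 0 (biquad α γ β b a c) := by
  refine HasCurve.of_linSubst (M := !![1, 0, 0; 0, 0, 1; 0, 1, 0])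
    (N := !![1, 0, 0; 0, 0, 1; 0, 1, 0])
    (by ext i j; fin_cases i <;> fin_cases j <;> simp [Matrix.mul_apply, Fin.sum_univ_three]) ?_
  rwa [map_zero, _root_.biquad_swap₁₂]

theorem pderiv_biquad (α β γ a b c : k) (i : Fin 3) : pderiv i (biquad α β γ a b c) =
    ![2 * X 0 * (2 * C α * X 0 ^ 2 + C a * X 1 ^ 2 + C b * X 2 ^ 2),
      2 * X 1 * (2 * C β * X 1 ^ 2 + C a * X 0 ^ 2 + C c * X 2 ^ 2),
      2 * X 2 * (2 * C γ * X 2 ^ 2 + C b * X 0 ^ 2 + C c * X 1 ^ 2)] i := by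
  fin_cases i <;> simp [biquad, pderiv_X, Derivation.leibniz, Derivation.leibniz_pow, smul_eq_mul,
    nsmul_eq_mul] <;> ring

theorem SmoothPair.biquad_coeff_ne_zero {α β γ a b c : k} (h : SmoothPair 0 (biquad α β γ a b c)) :
    α ≠ 0 := by
  rintro rfl
  refine h.false_of_grad (Ω := k) (P := ![1, 0, 0]) (fun h => by simpa using congrFun h 0) ?_ ?_
  · simp [biquad]
  · intro i
    rw [pderiv_biquad]
    fin_cases i <;> simp

theorem SmoothPair.biquad_disc_ne_zero (h2 : (2 : k) ≠ 0) {α β γ a b c : k}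
    (h : SmoothPair 0 (biquad α β γ a b c)) : a ^ 2 ≠ 4 * α * β := by
  intro h0
  have hα := h.biquad_coeff_ne_zero
  let φ := algebraMap k (AlgebraicClosure k)
  obtain ⟨z, hz⟩ := IsAlgClosed.exists_pow_nat_eq (-φ a) two_pos
  obtain ⟨y, hy⟩ := IsAlgClosed.exists_pow_nat_eq (φ (2 * α)) two_pos
  have hy0 : y ≠ 0 := by
    rintro rfl
    rw [zero_pow two_ne_zero] at hy
    exact mul_ne_zero h2 hα ((map_eq_zero φ).1 hy.symm)
  have h0' : φ a ^ 2 = 4 * φ α * φ β := by rw [← map_pow, h0, map_mul, map_mul, map_ofNat]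
  rw [map_mul, map_ofNat] at hy
  refine h.false_of_grad (Ω := AlgebraicClosure k) (P := ![z, y, 0])
    (fun h => hy0 (by simpa using congrFun h 1)) ?_ ?_
  · simp only [biquad, map_add, map_mul, map_pow, aeval_X, aeval_C, Matrix.cons_val]
    change φ α * _ + φ β * _ + φ γ * _ + φ a * _ + φ b * _ + φ c * _ = 0
    linear_combination (φ α * z ^ 2 - φ α * φ a + φ a * y ^ 2) * hz + 
      (φ β * y ^ 2 + φ β * 2 * φ α - φ a ^ 2) * hy - φ α * h0'
  · intro i
    rw [pderiv_biquad]
    fin_cases i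
    · simp
      right
      change 2 * φ α * _ + φ a * _ = 0
      linear_combination 2 * φ α * hz + φ a * hy
    · simp
      right
      change 2 * φ β * _ + φ a * _ = 0
      linear_combination φ a * hz + 2 * φ β * hy - h0'
    · simp

theorem HasCurve.biquad_of_monomial (h2 : (2 : k) ≠ 0) {α β γ a κ : k} (hβ : β ≠ 0)
    (h : γ = (2 * α * β - a) * κ ^ 2) : HasCurve 0 (biquad (α ^ 2) (β ^ 2) γ a 0 0) := by
  let s : Polynomial k := Polynomial.X
  let C' : k → Polynomial k := fun b => Polynomial.C b
  refine HasCurve.of_eval h2 (x := C' κ * s ^ 2) (y := 1) (z := s)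
    (w := C' (α * κ ^ 2) * s ^ 4 + C' β) ?_ ?_ ⟨1, 2, ?_⟩
  · simp only [biquad, map_add, map_mul, map_pow, aeval_X, aeval_C, Matrix.cons_val, h, map_sub, map_ofNat,
      map_zero]
    simp [C']
    ring
  · intro h0
    have := congrArg (Polynomial.eval 0) h0
    simp [s, C'] at this
    exact hβ this
  · simp [s]

theorem HasCurve.biquad_of_point (h2 : (2 : k) ≠ 0) {α β γ a x₀ θ : k} (hα : α ≠ 0) (hx : x₀ ≠ 0)
    (hθ : θ ≠ 0) (hP : γ * x₀ ^ 4 + α = θ ^ 2) (hne : γ * x₀ ^ 4 ≠ α) (hγ : γ ≠ 0)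
    (hs : SmoothPair 0 (biquad α β γ a 0 0)) : HasCurve 0 (biquad α β γ a 0 0) := by
  have hM : (!![1, 0, 0; 0, 1, 0; x₀, 0, 1] : Matrix (Fin 3) (Fin 3) k).det ≠ 0 := by
    simp [Matrix.det_fin_three]
  refine HasCurve.of_det_ne_zero hM hs fun hs => ?_
  rw [map_zero] at hs ⊢
  have hδ : 2 * θ + aeval ![1, 0, 0] (0 : MvPolynomial (Fin 3) k) ≠ 0 := by
    rw [map_zero, add_zero]; exact mul_ne_zero h2 hθ
  have hX : ∀ i : Fin 2, (X i : MvPolynomial (Fin 2) k).IsHomogeneous 1 := isHomogeneous_X k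
  have hC : ∀ (x : k) {n} {p : MvPolynomial (Fin 2) k}, p.IsHomogeneous n →
      (C x * p).IsHomogeneous n := fun x n p hp => by
    simpa using (isHomogeneous_C (Fin 2) x).mul hp
  set l₁ := 2 * γ * x₀ ^ 3 / θ with hl₁
  set q₁ := a / (2 * θ) with hq₁
  set q₂ := (6 * γ * x₀ ^ 2 - l₁ ^ 2) / (2 * θ) with hq₂
  have e1 : l₁ * θ = 2 * γ * x₀ ^ 3 := by rw [hl₁]; field_simp
  have e2 : q₁ * (2 * θ) = a := by rw [hq₁]; field_simp
  have e3 : q₂ * (2 * θ) = 6 * γ * x₀ ^ 2 - l₁ ^ 2 := by rw [hq₂]; field_simp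
  set q : MvPolynomial (Fin 2) k := C q₁ * X 0 ^ 2 + C q₂ * X 1 ^ 2 with hq'
  have hq : q.IsHomogeneous 2 := (hC _ ((hX 0).pow 2)).add (hC _ ((hX 1).pow 2))
  refine HasCurve.of_osculating hs (isHomogeneous_zero _ _ 2) (a := θ) hδ (l := C l₁ * X 1) (q := q)
    (A := C (2 * l₁ * q₁) * (X 0 ^ 2 * X 1) + C (2 * l₁ * q₂ - 4 * γ * x₀) * X 1 ^ 3)
    (B := q ^ 2 - (C β * X 0 ^ 4 + C γ * X 1 ^ 4))
    (hC _ (hX 1)) hq ?_ ?_ ?_ ?_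
  · exact ((hC _ (((hX 0).pow 2).mul (hX 1))).add (hC _ ((hX 1).pow 3)))
  · exact (by simpa using hq.pow 2 : (q ^ 2).IsHomogeneous 4).sub ((hC _ ((hX 0).pow 4)).add
      (hC _ ((hX 1).pow 4)))
  · have E0 := congrArg (C : k → MvPolynomial (Fin 3) k) hP
    have E1 := congrArg (C : k → MvPolynomial (Fin 3) k) e1
    have E2 := congrArg (C : k → MvPolynomial (Fin 3) k) e2
    have E3 := congrArg (C : k → MvPolynomial (Fin 3) k) e3
    simp only [map_add, map_sub, map_mul, map_pow, map_ofNat] at E0 E1 E2 E3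
    simp only [biquad, hq', map_add, map_sub, map_mul, map_pow, rename_C, rename_X, map_zero,
      linSubst, aeval_C, aeval_X, algebraMap_eq, map_ofNat]
    simp [Fin.sum_univ_three]
    linear_combination (-X 0 ^ 4) * E0 + 2 * X 0 ^ 3 * X 2 * E1 + X 0 ^ 2 * X 1 ^ 2 * E2 +
      X 0 ^ 2 * X 2 ^ 2 * E3
  · intro h0
    have e := congrArg (aeval ![(0 : k), 1]) h0
    simp at e
    apply hne
    have e4 : 2 * γ * x₀ * (6 * γ * x₀ ^ 4 * θ ^ 2 - 4 * γ ^ 2 * x₀ ^ 8 - 2 * θ ^ 4) = 0 := by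
      linear_combination θ ^ 4 * e - 2 * q₂ * θ ^ 3 * e1 - 2 * γ * x₀ ^ 3 * θ ^ 2 * e3 +
        2 * γ * x₀ ^ 3 * (l₁ * θ + 2 * γ * x₀ ^ 3) * e1
    have e5 := (mul_eq_zero.1 e4).resolve_left (mul_ne_zero (mul_ne_zero h2 hγ) hx)
    have e6 : 2 * α * (γ * x₀ ^ 4 - α) = 0 := by
      rw [show θ ^ 4 = (θ ^ 2) ^ 2 by ring, ← hP] at e5
      linear_combination e5
    exact sub_eq_zero.1 ((mul_eq_zero.1 e6).resolve_left (mul_ne_zero h2 hα))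

theorem exists_conic_param [Finite k] (h2 : (2 : k) ≠ 0) {A B D : k} (hA : A ≠ 0) (hB : B ≠ 0)
    (hD : D ≠ 0) : ∃ ζ x y : Polynomial k,
      .C A * ζ ^ 2 = .C B * x ^ 2 + .C D * y ^ 2 ∧ IsCoprime x y ∧ ¬IsUnit x ∧
      x * Polynomial.derivative y - y * Polynomial.derivative x ≠ 0 := by
  obtain ⟨x₀, y₀, h0⟩ : ∃ x₀ y₀ : k, B * x₀ ^ 2 + D * y₀ ^ 2 = A := by
    have := Fintype.ofFinite k
    obtain ⟨x, y, hxy⟩ := FiniteField.exists_root_sum_quadratic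
      (f := Polynomial.C B * Polynomial.X ^ 2)
      (g := Polynomial.C D * Polynomial.X ^ 2 - Polynomial.C A)
      (by rw [Polynomial.degree_C_mul_X_pow 2 hB]; rfl)
      (by rw [Polynomial.degree_sub_C] <;> rw [Polynomial.degree_C_mul_X_pow 2 hD]; rfl; decide)
      (FiniteField.odd_card_of_char_ne_two fun h => h2 (by
        have := ringChar.spec k 2; rw [h] at this; exact_mod_cast this.2 dvd_rfl))
    refine ⟨x, y, ?_⟩
    simp at hxy
    linear_combination hxy
  have hxy0 : x₀ ≠ 0 ∨ y₀ ≠ 0 := by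
    by_contra hcon
    push Not at hcon
    exact hA (by rw [← h0, hcon.1, hcon.2]; ring)
  have H0 := congrArg (Polynomial.C : k → Polynomial k) h0
  simp only [map_add, map_mul, map_pow] at H0
  obtain ⟨i, hi⟩ : ∃ i : k, i * (A * D) = 1 := ⟨_, inv_mul_cancel₀ (mul_ne_zero hA hD)⟩
  obtain ⟨j, hj⟩ : ∃ j : k, 2 * j = 1 := ⟨_, mul_inv_cancel₀ h2⟩
  have Hi := congrArg (Polynomial.C : k → Polynomial k) hi
  have Hj := congrArg (Polynomial.C : k → Polynomial k) hj
  simp only [map_mul, map_ofNat, map_one] at Hi Hj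
  refine ⟨.C B * .X ^ 2 + .C D, -.C (B * x₀) * .X ^ 2 - .C (2 * D * y₀) * .X + .C (D * x₀),
    .C (B * y₀) * .X ^ 2 - .C (2 * B * x₀) * .X - .C (D * y₀), ?_, ?_, ?_, ?_⟩
  · simp only [map_mul, map_ofNat]
    linear_combination (-(Polynomial.C B * Polynomial.X ^ 2 + Polynomial.C D) ^ 2) * H0
  · refine ⟨.C i * (.C (B * x₀) - .C (B * j * y₀) * .X), .C i * (-.C (D * y₀) - .C (B * j * x₀) * .X), ?_⟩
    simp only [map_mul, map_ofNat]
    linear_combination Polynomial.C i * (Polynomial.C D - Polynomial.C B * Polynomial.X ^ 2 +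
      2 * Polynomial.C j * Polynomial.C B * Polynomial.X ^ 2) * H0 + Hi +
      Polynomial.C i * Polynomial.C A * Polynomial.C B * Polynomial.X ^ 2 * Hj
  · intro hu
    have hd := Polynomial.natDegree_eq_zero_of_isUnit hu
    set x : Polynomial k := -.C (B * x₀) * .X ^ 2 - .C (2 * D * y₀) * .X + .C (D * x₀) with hx
    have e1 : x.coeff 1 = 0 := Polynomial.coeff_eq_zero_of_natDegree_lt (by omega)
    have e2 : x.coeff 2 = 0 := Polynomial.coeff_eq_zero_of_natDegree_lt (by omega)
    rw [hx] at e1 e2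
    simp only [neg_mul, ← map_neg, Polynomial.coeff_add, Polynomial.coeff_sub,
      Polynomial.coeff_C_mul, Polynomial.coeff_X_pow, Polynomial.coeff_X, Polynomial.coeff_C] at e1 e2
    simp [h2, hB, hD] at e1 e2
    tauto
  · intro h
    have e2 := congrArg (fun p => Polynomial.coeff p 0) h
    simp [Polynomial.coeff_X, Polynomial.mul_coeff_zero] at e2
    apply mul_ne_zero (mul_ne_zero h2 hD) hA
    linear_combination -e2 + (-2 * D) * h0

theorem HasCurve.biquad_of_conic [Finite k] (h2 : (2 : k) ≠ 0) {α β γ a b c : k} (hα : α ≠ 0)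
    (hs : SmoothPair 0 (biquad (α ^ 2) (β ^ 2) γ a b c)) (h : b * β ≠ α * c) :
    HasCurve 0 (biquad (α ^ 2) (β ^ 2) γ a b c) := by
  have hβ : β ≠ 0 := fun h => hs.biquad_swap₀₁.biquad_coeff_ne_zero (by rw [h]; ring)
  have hA : a - 2 * α * β ≠ 0 := fun h0 => hs.biquad_disc_ne_zero h2 (by
    linear_combination (a + 2 * α * β) * h0)
  obtain ⟨b', rfl⟩ : ∃ b', b = 2 * α * b' := ⟨b / (2 * α), by field_simp⟩
  have hB : b' ^ 2 - γ ≠ 0 := fun h0 => hs.biquad_swap₁₂.biquad_disc_ne_zero h2 (by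
    linear_combination 4 * α ^ 2 * h0)
  have hD : 2 * b' * β - c ≠ 0 := fun h0 => h (by linear_combination α * h0)
  obtain ⟨ζ, x, y, hcon, hcop, hu, hmin⟩ := exists_conic_param h2 hA hB hD
  have hy : y ≠ 0 := by rintro rfl; simp at hmin
  simp only [map_sub, map_mul, map_ofNat, map_pow] at hcon
  refine HasCurve.of_eval h2 (x := ζ * x) (y := y ^ 2) (z := x * y)
    (w := .C α * (ζ * x) ^ 2 + .C b' * (x * y) ^ 2 + .C β * (y ^ 2) ^ 2) ?_ ?_ ⟨2, 1, ?_⟩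
  · simp only [biquad, map_add, map_mul, map_pow, aeval_X, aeval_C, Matrix.cons_val,
      Polynomial.algebraMap_eq, map_ofNat]
    linear_combination (-x ^ 2 * y ^ 4) * hcon
  · intro h0
    have hdvd : x ∣ y ^ 4 := by
      rw [← (Polynomial.isUnit_C.2 (isUnit_iff_ne_zero.2 hβ)).dvd_mul_left]
      exact ⟨-(.C α * ζ ^ 2 * x + .C b' * x * y ^ 2), by linear_combination h0⟩
    exact hu ((hcop.pow_right (n := 4)).isUnit_of_dvd' dvd_rfl hdvd)
  · intro h0
    simp only [Matrix.cons_val, Polynomial.derivative_mul, Polynomial.derivative_pow] at h0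
    apply mul_ne_zero (pow_ne_zero 2 hy) hmin
    norm_num at h0
    rw [map_ofNat] at h0
    linear_combination h0

end

namespace FiniteField

open Polynomial

variable {k : Type*} [Field k] [Fintype k]

theorem X_pow_card_sub_X_dvd_of_eval_eq_zero {p : k[X]} (h : ∀ a, p.eval a = 0) :
    Polynomial.X ^ Fintype.card k - Polynomial.X ∣ p := by
  have hm : (Polynomial.X ^ Fintype.card k - Polynomial.X : k[X]).Monic :=
    monic_X_pow_sub (by rw [degree_X]; exact_mod_cast Fintype.one_lt_card)
  rw [← modByMonic_eq_zero_iff_dvd hm]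
  refine eq_zero_of_natDegree_lt_card_of_eval_eq_zero _ (f := id) Function.injective_id (fun a => ?_) ?_
  · rw [id, modByMonic_eq_sub_mul_div, Polynomial.eval_sub, Polynomial.eval_mul, h]
    simp [FiniteField.pow_card]
  · have := natDegree_modByMonic_lt p hm (fun h1 => by
      have := congrArg natDegree h1
      rw [FiniteField.X_pow_card_sub_X_natDegree_eq k Fintype.one_lt_card, natDegree_one] at this
      exact Fintype.card_ne_zero this)
    rwa [FiniteField.X_pow_card_sub_X_natDegree_eq k Fintype.one_lt_card] at this

theorem derivative_X_pow_card_sub_X : derivative (Polynomial.X ^ Fintype.card k - Polynomial.X : k[X]) = -1 := by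
  simp [derivative_X_pow]

theorem pow_half_card_eq_neg_one (h2 : (2 : k) ≠ 0) {a : k} (h : ¬IsSquare a) :
    a ^ (Fintype.card k / 2) = -1 := by
  have ha : a ≠ 0 := by rintro rfl; exact h (IsSquare.zero)
  have hc : ringChar k ≠ 2 := fun h => h2 (by
        have := ringChar.spec k 2; rw [h] at this; exact_mod_cast this.2 dvd_rfl)
  exact (FiniteField.pow_dichotomy hc ha).resolve_left fun h1 =>
    h ((FiniteField.isSquare_iff hc ha).2 h1)

theorem two_mul_half_card_add_one (h2 : (2 : k) ≠ 0) :
    2 * (Fintype.card k / 2) + 1 = Fintype.card k := by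
  have hc : ringChar k ≠ 2 := fun h => h2 (by
        have := ringChar.spec k 2; rw [h] at this; exact_mod_cast this.2 dvd_rfl)
  have := FiniteField.odd_card_of_char_ne_two hc
  omega

theorem two_mul_mul_derivative_pow_half_card (h2 : (2 : k) ≠ 0) (p : k[X]) :
    2 * p * derivative (p ^ (Fintype.card k / 2)) = -p ^ (Fintype.card k / 2) * derivative p := by
  have hq := two_mul_half_card_add_one h2
  obtain ⟨n, hn⟩ : ∃ n, Fintype.card k / 2 = n + 1 := ⟨Fintype.card k / 2 - 1, by
    have := Fintype.one_lt_card (α := k); omega⟩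
  rw [hn] at hq ⊢
  have hc := congrArg (Nat.cast : ℕ → k[X]) hq
  rw [show ((Fintype.card k : ℕ) : k[X]) = 0 by
    rw [← map_natCast Polynomial.C, FiniteField.cast_card_eq_zero, map_zero]] at hc
  rw [derivative_pow_succ, map_add, map_natCast, map_one]
  push_cast at hc
  linear_combination p ^ (n + 1) * derivative p * hc

/-- A cubic polynomial over a finite field with at least eleven elements takes a nonzero
square value. -/
theorem exists_isSquare_eval_of_natDegree_eq_three (h2 : (2 : k) ≠ 0) (hq : 11 ≤ Fintype.card k)
    {p : k[X]} (hp : p.natDegree = 3) : ∃ a, p.eval a ≠ 0 ∧ IsSquare (p.eval a) := by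
  by_contra hcon
  push Not at hcon
  have hn := two_mul_half_card_add_one h2
  have hG := two_mul_mul_derivative_pow_half_card h2 p
  set n := Fintype.card k / 2
  set T : k[X] := Polynomial.X ^ Fintype.card k - Polynomial.X with hT
  have hTd : derivative T = -1 := derivative_X_pow_card_sub_X
  have hTn : T.natDegree = Fintype.card k :=
    FiniteField.X_pow_card_sub_X_natDegree_eq k Fintype.one_lt_card
  obtain ⟨R, hR⟩ : T ∣ p * (p ^ n + 1) := X_pow_card_sub_X_dvd_of_eval_eq_zero fun a => by
    by_cases ha : p.eval a = 0
    · simp [ha]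
    · simp [pow_half_card_eq_neg_one h2 (hcon a ha), n]
  have hp0 : p ≠ 0 := by rintro rfl; simp at hp
  have hnp : (p ^ n + 1).natDegree = 3 * n := by
    rw [← Polynomial.C_1, natDegree_add_C, natDegree_pow, hp, mul_comm]
  have hR0 : T ≠ 0 ∧ R ≠ 0 := by
    have : p * (p ^ n + 1) ≠ 0 := mul_ne_zero hp0 fun h => by
      rw [h, natDegree_zero] at hnp; omega
    rw [hR] at this
    exact mul_ne_zero_iff.1 this
  have hRn : R.natDegree = n + 2 := by
    have := congrArg natDegree hR
    rw [natDegree_mul hp0 (fun h => by rw [h, natDegree_zero] at hnp; omega),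
      natDegree_mul hR0.1 hR0.2, hp, hnp, hTn] at this
    omega
  have key : p * (2 * R + derivative p) = T * (2 * p * derivative R - derivative p * R) := by
    have hd := congrArg derivative hR
    rw [derivative_mul, derivative_mul, derivative_add, derivative_one, hTd] at hd
    linear_combination 2 * p * hd - derivative p * hR - p * hG
  have hd3 := natDegree_derivative_le p
  have hle : (2 * R + derivative p).natDegree ≤ n + 2 := by
    refine (natDegree_add_le _ _).trans (max_le ?_ (by omega))
    rw [← map_ofNat Polynomial.C 2]
    exact (natDegree_C_mul_le _ _).trans hRn.le
  have hzero : 2 * R + derivative p = 0 := by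
    by_contra h0
    have h1 := mul_ne_zero hp0 h0
    have := congrArg natDegree key
    rw [key] at h1
    rw [natDegree_mul hp0 h0, natDegree_mul hR0.1 (right_ne_zero_of_mul h1)] at this
    omega
  have : (2 * R).natDegree ≤ 2 := by
    rw [eq_neg_of_add_eq_zero_left hzero, natDegree_neg]; omega
  rw [← map_ofNat Polynomial.C 2, natDegree_C_mul h2] at this
  omega

/-- A quartic polynomial over a finite field with at least seven elements all of whose values
are nonsquares has only multiple roots. -/
theorem dvd_derivative_sq_of_natDegree_eq_four (h2 : (2 : k) ≠ 0) (hq : 7 ≤ Fintype.card k)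
    {p : k[X]} (hp : p.natDegree = 4) (h : ∀ a, ¬IsSquare (p.eval a)) : p ∣ derivative p ^ 2 := by
  have hn := two_mul_half_card_add_one h2
  have hG := two_mul_mul_derivative_pow_half_card h2 p
  set n := Fintype.card k / 2
  set T : k[X] := Polynomial.X ^ Fintype.card k - Polynomial.X with hT
  have hTd : derivative T = -1 := derivative_X_pow_card_sub_X
  have hTn : T.natDegree = Fintype.card k :=
    FiniteField.X_pow_card_sub_X_natDegree_eq k Fintype.one_lt_card
  obtain ⟨R, hR⟩ : T ∣ p ^ n + 1 := X_pow_card_sub_X_dvd_of_eval_eq_zero fun a => by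
    simp [pow_half_card_eq_neg_one h2 (h a), n]
  have hnp : (p ^ n + 1).natDegree = 4 * n := by
    rw [← Polynomial.C_1, natDegree_add_C, natDegree_pow, hp, mul_comm]
  have hR0 : T ≠ 0 ∧ R ≠ 0 := by
    have : p ^ n + 1 ≠ 0 := fun h => by
      rw [h, natDegree_zero] at hnp; omega
    rw [hR] at this
    exact mul_ne_zero_iff.1 this
  have hRn : R.natDegree + 2 = Fintype.card k := by
    have := congrArg natDegree hR
    rw [natDegree_mul hR0.1 hR0.2, hnp, hTn] at this
    omega
  set S := 2 * p * derivative R + derivative p * R with hS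
  have hd := congrArg derivative hR
  rw [derivative_mul, derivative_add, derivative_one, hTd] at hd
  have key : 2 * p * R + derivative p = T * S := by
    linear_combination 2 * p * hd + derivative p * hR - hG
  have hd' := congrArg derivative key
  have h2' : derivative (2 : k[X]) = 0 := derivative_ofNat 2
  rw [derivative_mul, derivative_add, derivative_mul, derivative_mul, h2', hTd] at hd'
  have key2 : T * (2 * p * derivative S - derivative p * S) =
      4 * p * S + 2 * p * derivative (derivative p) - derivative p ^ 2 := by
    linear_combination (-2 * p) * hd' + derivative p * key + 2 * p * hS
  have hp1 : (derivative p).natDegree ≤ 3 := (natDegree_derivative_le p).trans (by omega)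
  have hp2 : (derivative (derivative p)).natDegree ≤ 2 :=
    (natDegree_derivative_le _).trans (by omega)
  have hSn : S.natDegree ≤ 2 := by
    by_cases h0 : S = 0
    · rw [h0]; simp
    have h1 := congrArg natDegree key
    rw [natDegree_mul hR0.1 h0, hTn] at h1
    have h3 : (2 * p * R + derivative p).natDegree ≤ 4 + R.natDegree := by
      refine (natDegree_add_le _ _).trans (max_le ?_ (by omega))
      rw [← map_ofNat Polynomial.C 2, mul_assoc]
      exact (natDegree_C_mul_le _ _).trans (natDegree_mul_le.trans (by omega))
    omega
  have h6 : (4 * p * S + 2 * p * derivative (derivative p) - derivative p ^ 2).natDegree ≤ 6 := by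
    refine (natDegree_sub_le _ _).trans (max_le ((natDegree_add_le _ _).trans (max_le ?_ ?_)) ?_)
    · rw [← map_ofNat Polynomial.C 4, mul_assoc]
      exact (natDegree_C_mul_le _ _).trans (natDegree_mul_le.trans (by omega))
    · rw [← map_ofNat Polynomial.C 2, mul_assoc]
      exact (natDegree_C_mul_le _ _).trans (natDegree_mul_le.trans (by omega))
    · exact natDegree_pow_le.trans (by omega)
  have h7 : 2 * p * derivative S - derivative p * S = 0 := by
    by_contra h0
    rw [← key2, natDegree_mul hR0.1 h0, hTn] at h6
    omega
  rw [h7, mul_zero] at key2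
  exact ⟨4 * S + 2 * derivative (derivative p), by linear_combination key2⟩

end FiniteField

section

theorem isSquare_mul_of_not_isSquare {k : Type*} [Field k] [Finite k] (h2 : (2 : k) ≠ 0) {a b : k}
    (ha : ¬IsSquare a) (hb : ¬IsSquare b) : IsSquare (a * b) := by
  have := Fintype.ofFinite k
  have ha0 : a ≠ 0 := by rintro rfl; exact ha IsSquare.zero
  have hb0 : b ≠ 0 := by rintro rfl; exact hb IsSquare.zero
  have hc : ringChar k ≠ 2 := fun h => h2 (by
        have := ringChar.spec k 2; rw [h] at this; exact_mod_cast this.2 dvd_rfl)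
  rw [FiniteField.isSquare_iff hc (mul_ne_zero ha0 hb0), mul_pow,
    FiniteField.pow_half_card_eq_neg_one h2 ha, FiniteField.pow_half_card_eq_neg_one h2 hb]
  norm_num

theorem isSquare_of_mul_sq {k : Type*} [Field k] {a b : k} (hb : b ≠ 0) (h : IsSquare (a * b ^ 2)) :
    IsSquare a := by
  obtain ⟨r, hr⟩ := h
  exact ⟨r / b, by field_simp; linear_combination hr⟩

theorem isSquare_of_isSquare_mul {k : Type*} [Field k] {a b : k} (hb : b ≠ 0) (h : IsSquare (a * b))
    (hb' : IsSquare b) : IsSquare a := by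
  obtain ⟨r, rfl⟩ := hb'
  exact isSquare_of_mul_sq (b := r) (by rintro rfl; simp at hb) (by rwa [sq])

theorem exists_mul_pow_four_add_one_eq_sq {k : Type*} [Field k] [Fintype k] (h2 : (2 : k) ≠ 0)
    (hq : 11 ≤ Fintype.card k) (Γ : k) : ∃ x θ : k, x ≠ 0 ∧ Γ * x ^ 4 + 1 = θ ^ 2 ∧
      (θ = 0 → ∃ y, y ≠ 0 ∧ y ^ 2 = -4 * Γ ∧ IsSquare (2 * y)) := by
  set p : Polynomial k := Polynomial.X ^ 3 - Polynomial.C (4 * Γ) * Polynomial.X with hp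
  have hpn : p.natDegree = 3 := by rw [hp]; compute_degree!
  obtain ⟨t, ht0, y, hy⟩ := FiniteField.exists_isSquare_eval_of_natDegree_eq_three h2 hq hpn
  have e : p.eval t = t * (t ^ 2 - 4 * Γ) := by simp [hp]; ring
  rw [e] at ht0 hy
  have ht := left_ne_zero_of_mul ht0
  have hy0 : y ≠ 0 := by rintro rfl; rw [hy, zero_mul] at ht0; exact ht0 rfl
  refine ⟨2 * t / y, t * (t ^ 2 + 4 * Γ) / y ^ 2, div_ne_zero (mul_ne_zero h2 ht) hy0, ?_, ?_⟩
  · field_simp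
    linear_combination (-(y ^ 2 + t * (t ^ 2 - 4 * Γ))) * hy
  · intro h0
    have h1 : t ^ 2 + 4 * Γ = 0 := by
      simpa [ht, hy0] using h0
    refine ⟨t, ht, by linear_combination h1, isSquare_of_mul_sq (b := t) ht ⟨y, ?_⟩⟩
    linear_combination t * h1 + hy

theorem exists_mul_pow_four_add_one_eq_sq_of_not_isSquare {k : Type*} [Field k] [Fintype k]
    (h2 : (2 : k) ≠ 0) (h3 : Fintype.card k ≠ 3) (h5 : Fintype.card k ≠ 5) {Γ : k}
    (hΓ : ¬IsSquare Γ) : ∃ x θ : k, x ≠ 0 ∧ θ ≠ 0 ∧ Γ * x ^ 4 + 1 = θ ^ 2 := by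
  classical
  have hΓ0 : Γ ≠ 0 := by rintro rfl; exact hΓ IsSquare.zero
  have hodd := FiniteField.two_mul_half_card_add_one h2
  by_cases h1 : IsSquare (-1 : k)
  · by_cases hq : 11 ≤ Fintype.card k
    · obtain ⟨x, θ, hx, h, h'⟩ := exists_mul_pow_four_add_one_eq_sq h2 hq Γ
      refine ⟨x, θ, hx, fun h0 => ?_, h⟩
      obtain ⟨y, -, hy, -⟩ := h' h0
      refine hΓ (isSquare_of_mul_sq h2 (isSquare_of_isSquare_mul (b := -1) (by simp) ⟨y, ?_⟩ h1))
      linear_combination -hy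
    · have h9 : Fintype.card k = 9 := by
        have := FiniteField.isSquare_neg_one_iff.1 h1
        have := Fintype.one_lt_card (α := k)
        omega
      have h3' : (3 : k) = 0 := by
        have : ((Fintype.card k : ℕ) : k) = 0 := FiniteField.cast_card_eq_zero k
        rw [h9] at this
        have e : (3 : k) ^ 2 = 0 := by push_cast at this; linear_combination this
        exact pow_eq_zero_iff two_ne_zero |>.1 e
      have hΓ4 := FiniteField.pow_half_card_eq_neg_one h2 hΓ
      rw [h9] at hΓ4
      norm_num at hΓ4
      have hor : IsSquare (Γ + 1) ∨ IsSquare (Γ * Γ ^ 4 + 1) := by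
        by_contra hcon
        push Not at hcon
        have e1 := FiniteField.pow_half_card_eq_neg_one h2 hcon.1
        have e2 := FiniteField.pow_half_card_eq_neg_one h2 hcon.2
        rw [h9] at e1 e2
        norm_num at e1 e2
        rw [hΓ4] at e2
        apply h2
        have e3 : (1 - Γ ^ 2) ^ 4 = 1 := by linear_combination (-Γ + 1) ^ 4 * e1 - e2
        linear_combination -e3 + (Γ ^ 4 - 4 * Γ ^ 2 + 5) * hΓ4 - h3'
      have hne : ∀ y : k, y = Γ ∨ y = -Γ → y + 1 ≠ 0 := by
        rintro y hy h0
        have : Γ ^ 4 = 1 := by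
          rcases hy with rfl | rfl
          · rw [eq_neg_of_add_eq_zero_left h0]; norm_num
          · rw [show Γ = 1 by linear_combination -h0]; norm_num
        rw [this] at hΓ4
        exact h2 (by linear_combination hΓ4)
      rcases hor with ⟨θ, hθ⟩ | ⟨θ, hθ⟩
      · exact ⟨1, θ, one_ne_zero, fun h => hne Γ (.inl rfl) (by rw [hθ, h, zero_mul]),
          by linear_combination hθ⟩
      · exact ⟨Γ, θ, hΓ0, fun h => hne (-Γ) (.inr rfl) (by
          rw [h, zero_mul, hΓ4] at hθ; linear_combination hθ), by linear_combination hθ⟩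
  · obtain ⟨δ, hδ⟩ := isSquare_mul_of_not_isSquare h2 hΓ h1
    have hδ0 : δ ≠ 0 := by
      rintro rfl; exact hΓ0 (by linear_combination -hδ)
    obtain ⟨m, hm⟩ : ∃ m : k, m ∉ ({0, 1, -1} : Finset k) := by
      by_contra hcon
      push Not at hcon
      have h4 := Finset.card_le_card (fun a _ => hcon a : (Finset.univ : Finset k) ⊆ {0, 1, -1})
      have h5 := Finset.card_le_three (a := (0 : k)) (b := 1) (c := -1)
      have := Fintype.one_lt_card (α := k)
      rw [Finset.card_univ] at h4
      omega
    simp only [Finset.mem_insert, Finset.mem_singleton, not_or] at hm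
    obtain ⟨hm0, hm1, hm2⟩ := hm
    have hm3 : 1 + m ^ 2 ≠ 0 := fun h => h1 ⟨m, by linear_combination -h⟩
    have hm4 : 1 - m ^ 2 ≠ 0 := fun h => by
      rcases mul_eq_zero.1 (show (1 - m) * (1 + m) = 0 by linear_combination h) with h | h
      · exact hm1 (by linear_combination -h)
      · exact hm2 (by linear_combination h)
    obtain ⟨u, hu, x, hx⟩ : ∃ u, u ^ 2 = (2 * m / (1 + m ^ 2)) ^ 2 ∧ IsSquare (u / δ) := by
      by_cases hs : IsSquare ((2 * m / (1 + m ^ 2)) / δ)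
      · exact ⟨_, rfl, hs⟩
      · refine ⟨-(2 * m / (1 + m ^ 2)), by ring, ?_⟩
        have := isSquare_mul_of_not_isSquare h2 hs h1
        rwa [show (2 * m / (1 + m ^ 2)) / δ * -1 = -(2 * m / (1 + m ^ 2)) / δ by ring] at this
    have hu0 : u ≠ 0 := by
      rintro rfl
      rw [zero_pow two_ne_zero] at hu
      exact pow_ne_zero 2 (div_ne_zero (mul_ne_zero h2 hm0) hm3) hu.symm
    have hxu : x * x * δ = u := by rw [← hx]; field_simp
    refine ⟨x, (1 - m ^ 2) / (1 + m ^ 2), ?_, div_ne_zero hm4 hm3, ?_⟩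
    · rintro rfl; apply hu0; rw [← hxu]; ring
    · have e1 : Γ * x ^ 4 = -u ^ 2 := by rw [← hxu]; linear_combination (-x ^ 4) * hδ
      rw [e1, hu]
      field_simp
      ring

end

theorem zmod_three_biquad : ∀ α β γ a : ZMod 3, α ≠ 0 → β ≠ 0 → γ = -1 →
    a ^ 2 ≠ 4 * α ^ 2 * β ^ 2 → ∃ κ, γ = (2 * α * β - a) * κ ^ 2 ∨ γ = (2 * α * -β - a) * κ ^ 2 := by decide

theorem zmod_five_biquad : ∀ α β γ a : ZMod 5, α ≠ 0 → β ≠ 0 → γ ^ 2 = -1 →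
    a ^ 2 ≠ 4 * α ^ 2 * β ^ 2 → ∃ κ, γ = (2 * α * β - a) * κ ^ 2 ∨ γ = (2 * α * -β - a) * κ ^ 2 ∨
    κ ≠ 0 ∧ γ + α ^ 2 = κ ^ 2 ∨ κ ≠ 0 ∧ γ + β ^ 2 = κ ^ 2 := by decide

theorem zmod_five_fermat : ∀ α β : ZMod 5, α ≠ 0 → β ≠ 0 → (∀ x, x * x ≠ 2 * α * β) →
    β ^ 2 = α ^ 2 := by decide

section

variable {k : Type u} [Field k]

theorem HasCurve.fermat (h5 : (5 : k) = 0) {α : k} (hα : α ≠ 0) :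
    HasCurve 0 (biquad (α ^ 2) (α ^ 2) (α ^ 2) 0 0 0) := by
  have h2 : (2 : k) ≠ 0 := fun h => one_ne_zero (by linear_combination h5 - 2 * h : (1 : k) = 0)
  let s : Polynomial k := Polynomial.X
  have H5 : (5 : Polynomial k) = 0 := by
    rw [← map_ofNat Polynomial.C 5, h5, map_zero]
  refine HasCurve.of_eval h2 (x := s ^ 4 - 1) (y := s ^ 3 + s) (z := s ^ 3 - s)
    (w := .C α * (s ^ 8 - s ^ 4 + 1)) ?_ ?_ ⟨0, 1, ?_⟩
  · simp only [biquad, map_add, map_mul, map_pow, aeval_X, aeval_C, Matrix.cons_val,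
      Polynomial.algebraMap_eq, map_zero]
    linear_combination (Polynomial.C α ^ 2) * (-3 * s ^ 8) * H5
  · refine mul_ne_zero (Polynomial.C_ne_zero.2 hα) fun h0 => ?_
    simpa [s] using congrArg (Polynomial.eval 0) h0
  · intro h0
    have := congrArg (Polynomial.eval 0) h0
    simp [s] at this

theorem HasCurve.biquad_of_smooth [Finite k] (h2 : (2 : k) ≠ 0) {α β γ a b c : k} (hα : α ≠ 0)
    (hβ : β ≠ 0) (hs : SmoothPair 0 (biquad (α ^ 2) (β ^ 2) γ a b c)) :
    HasCurve 0 (biquad (α ^ 2) (β ^ 2) γ a b c) := by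
  have := Fintype.ofFinite k
  have hodd := FiniteField.two_mul_half_card_add_one h2
  have hcard := Fintype.one_lt_card (α := k)
  by_contra hno
  have e1 : b * β = α * c := by
    by_contra h
    exact hno (HasCurve.biquad_of_conic h2 hα hs h)
  have e2 : b * -β = α * c := by
    by_contra h
    rw [← neg_sq β] at hs hno
    exact hno (HasCurve.biquad_of_conic h2 hα hs h)
  obtain rfl : b = 0 := by
    have : 2 * β * b = 0 := by linear_combination e1 - e2
    simpa [h2, hβ] using this
  obtain rfl : c = 0 := by
    rw [zero_mul, eq_comm] at e1
    simpa [hα] using e1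
  have hm1 : ∀ κ, γ ≠ (2 * α * β - a) * κ ^ 2 := fun κ h =>
    hno (HasCurve.biquad_of_monomial h2 hβ h)
  have hm2 : ∀ κ, γ ≠ (2 * α * -β - a) * κ ^ 2 := fun κ h => by
    rw [← neg_sq β] at hno
    exact hno (HasCurve.biquad_of_monomial h2 (neg_ne_zero.2 hβ) h)
  have hγ : γ ≠ 0 := hs.biquad_swap₁₂.biquad_swap₀₁.biquad_coeff_ne_zero
  have hpt : ∀ x θ : k, x ≠ 0 → θ ≠ 0 → γ * x ^ 4 + α ^ 2 = θ ^ 2 → γ * x ^ 4 = α ^ 2 :=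
    fun x θ hx hθ h => by
      by_contra hne
      exact hno (HasCurve.biquad_of_point h2 (pow_ne_zero 2 hα) hx hθ h hne hγ hs)
  have hpt' : ∀ x θ : k, x ≠ 0 → θ ≠ 0 → γ * x ^ 4 + β ^ 2 = θ ^ 2 → γ * x ^ 4 = β ^ 2 :=
    fun x θ hx hθ h => by
      by_contra hne
      exact hno (HasCurve.biquad_of_point h2 (pow_ne_zero 2 hβ) hx hθ h hne hγ
        hs.biquad_swap₀₁).biquad_swap₀₁
  by_cases hsq : IsSquare γ
  · obtain ⟨δ, rfl⟩ := hsq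
    have hδ : δ ≠ 0 := left_ne_zero_of_mul hγ
    rw [← sq] at hs hno hm1 hm2 hpt
    obtain rfl : a = 0 := by
      by_contra h
      exact hno (HasCurve.biquad_of_conic h2 hα hs.biquad_swap₁₂ (by simp [h, hδ])).biquad_swap₁₂
    have n1 : ¬IsSquare (2 * α * β) := fun ⟨r, hr⟩ => by
      have hr0 : r ≠ 0 := by rintro rfl; simp [h2, hα, hβ] at hr
      exact hm1 (δ / r) (by rw [sub_zero, hr]; field_simp)
    have n2 : ¬IsSquare (2 * α * -β) := fun ⟨r, hr⟩ => by
      have hr0 : r ≠ 0 := by rintro rfl; simp [h2, hα, hβ] at hr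
      exact hm2 (δ / r) (by rw [sub_zero, hr]; field_simp)
    have n3 : ¬IsSquare (2 * α * δ) := fun ⟨r, hr⟩ => by
      have hr0 : r ≠ 0 := by rintro rfl; simp [h2, hα, hδ] at hr
      exact hno (HasCurve.biquad_of_monomial (κ := β / r) h2 hδ
        (by rw [sub_zero, hr]; field_simp)).biquad_swap₁₂
    have n4 : ¬IsSquare (2 * β * δ) := fun ⟨r, hr⟩ => by
      have hr0 : r ≠ 0 := by rintro rfl; simp [h2, hβ, hδ] at hr
      exact hno (HasCurve.biquad_of_monomial (κ := α / r) h2 hδ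
        (by rw [sub_zero, hr]; field_simp)).biquad_swap₁₂.biquad_swap₀₁
    have hneg : IsSquare (-1 : k) := by
      refine isSquare_of_mul_sq (b := 2 * α * β) (by simp [*]) ?_
      obtain ⟨r, hr⟩ := isSquare_mul_of_not_isSquare h2 n1 n2
      exact ⟨r, by linear_combination hr⟩
    have htwo : ¬IsSquare (2 : k) := fun h => by
      refine n1 (isSquare_of_mul_sq (b := 2 * δ) (by simp [*]) ?_)
      obtain ⟨r, hr⟩ := (isSquare_mul_of_not_isSquare h2 n3 n4).mul h
      exact ⟨r, by linear_combination hr⟩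
    have hαδ : IsSquare (α * δ) := by
      refine isSquare_of_mul_sq (b := 2) h2 ?_
      obtain ⟨r, hr⟩ := isSquare_mul_of_not_isSquare h2 n3 htwo
      exact ⟨r, by linear_combination hr⟩
    by_cases hq : 11 ≤ Fintype.card k
    · obtain ⟨x, θ, hx, h, h'⟩ := exists_mul_pow_four_add_one_eq_sq h2 hq
        ((δ / α) ^ 2)
      have hθ : θ ≠ 0 := fun h0 => by
        obtain ⟨y, hy0, hy, hys⟩ := h' h0
        set m := α * y / (2 * δ) with hm
        have hmy : y = 2 * δ * m / α := by rw [hm]; field_simp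
        have hm1 : m ^ 2 = -1 := by rw [hm, div_pow, mul_pow, hy]; field_simp; ring
        have hm0 : m ≠ 0 := by rintro h0; rw [h0] at hm1; simp at hm1
        have h3 : IsSquare m := by
          refine isSquare_of_isSquare_mul (b := α * δ) (by simp [*]) ?_ hαδ
          refine isSquare_of_mul_sq (b := 2 / α) (by simp [*]) ?_
          convert hys using 1
          rw [hmy]; field_simp
        refine htwo (isSquare_of_isSquare_mul hm0 ⟨1 + m, ?_⟩ h3)
        linear_combination -hm1
      have h6 := hpt x (θ * α) hx (mul_ne_zero hθ hα) (by
        rw [mul_pow, ← h]; field_simp)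
      refine htwo ⟨θ, ?_⟩
      rw [← sq, ← h, div_pow, div_mul_eq_mul_div, h6]
      field_simp
      norm_num
    · have h4 := FiniteField.isSquare_neg_one_iff.1 hneg
      by_cases h5 : Fintype.card k = 5
      · have e : k ≃+* ZMod 5 := (ZMod.ringEquivOfPrime k (by norm_num) h5).symm
        have key : ∀ x y : k, x ≠ 0 → y ≠ 0 → ¬IsSquare (2 * x * y) → y ^ 2 = x ^ 2 := by
          intro x y hx hy h
          have := zmod_five_fermat (e x) (e y) (by simpa using hx) (by simpa using hy) fun r hr =>
            h ⟨e.symm r, e.injective (by simp [hr, map_ofNat e 2])⟩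
          exact e.injective (by simpa using this)
        rw [key α β hα hβ n1, key α δ hα hδ n3] at hno
        refine hno (HasCurve.fermat ?_ hα)
        have := FiniteField.cast_card_eq_zero k
        rw [h5] at this
        exact_mod_cast this
      · have h9 : Fintype.card k = 9 := by omega
        have h3' : (3 : k) = 0 := by
          have : ((Fintype.card k : ℕ) : k) = 0 := FiniteField.cast_card_eq_zero k
          rw [h9] at this
          have e : (3 : k) ^ 2 = 0 := by push_cast at this; linear_combination this
          exact pow_eq_zero_iff two_ne_zero |>.1 e
        rw [show (2 : k) = -1 by linear_combination h3'] at htwo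
        exact htwo hneg
  · by_cases h3 : Fintype.card k = 3
    · have e : k ≃+* ZMod 3 := (ZMod.ringEquivOfPrime k (by norm_num) h3).symm
      have h4 := FiniteField.pow_half_card_eq_neg_one h2 hsq
      rw [h3] at h4
      norm_num at h4
      rcases zmod_three_biquad (e α) (e β) (e γ) (e a) (by simpa using hα) (by simpa using hβ)
        (by rw [h4]; simp) (fun h => hs.biquad_disc_ne_zero h2 (e.injective (by
          simp [h, map_ofNat e 4]))) with ⟨κ, h | h⟩
      · exact hm1 (e.symm κ) (e.injective (by simp [h, map_ofNat e 2]))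
      · exact hm2 (e.symm κ) (e.injective (by simp [h, map_ofNat e 2]))
    by_cases h5 : Fintype.card k = 5
    · have e : k ≃+* ZMod 5 := (ZMod.ringEquivOfPrime k (by norm_num) h5).symm
      have h4 := FiniteField.pow_half_card_eq_neg_one h2 hsq
      rw [h5] at h4
      norm_num at h4
      rcases zmod_five_biquad (e α) (e β) (e γ) (e a) (by simpa using hα) (by simpa using hβ)
        (by rw [← map_pow, h4]; simp) (fun h => hs.biquad_disc_ne_zero h2 (e.injective (by
          simp [h, map_ofNat e 4]))) with ⟨κ, h | h | ⟨hκ, h⟩ | ⟨hκ, h⟩⟩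
      · exact hm1 (e.symm κ) (e.injective (by simp [h, map_ofNat e 2]))
      · exact hm2 (e.symm κ) (e.injective (by simp [h, map_ofNat e 2]))
      · refine hsq ⟨α, ?_⟩
        rw [← sq, ← hpt 1 (e.symm κ) one_ne_zero (by simpa using hκ) (e.injective (by simp [h]))]
        ring
      · refine hsq ⟨β, ?_⟩
        rw [← sq, ← hpt' 1 (e.symm κ) one_ne_zero (by simpa using hκ) (e.injective (by simp [h]))]
        ring
    obtain ⟨x, θ, hx, hθ, h⟩ := exists_mul_pow_four_add_one_eq_sq_of_not_isSquare h2 h3 h5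
      (Γ := γ / α ^ 2) fun h => hsq (by
        have := h.mul (IsSquare.sq α)
        rwa [div_mul_cancel₀ _ (pow_ne_zero 2 hα)] at this)
    have h6 := hpt x (θ * α) hx (mul_ne_zero hθ hα) (by
        rw [mul_pow, ← h]; field_simp)
    exact hsq (isSquare_of_mul_sq (b := x ^ 2) (pow_ne_zero 2 hx) ⟨α, by linear_combination h6⟩)

end

theorem zmod_three_quartic : ∀ a b c d e : ZMod 3, a = -1 → (∀ t, a * t ^ 4 + b * t ^ 3 + c * t ^ 2 +
    d * t + e = -1) → ∃ u v, b = 2 * a * u ∧ c = a * (u ^ 2 + 2 * v) ∧ d = 2 * a * u * v ∧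
      e = a * v ^ 2 := by decide

theorem zmod_five_quartic : ∀ a, a ^ 2 = -1 → ∀ e, e ^ 2 = -1 → ∀ b c d : ZMod 5,
    (∀ t, (a * t ^ 4 + b * t ^ 3 + c * t ^ 2 + d * t + e) ^ 2 = -1) → ∃ u v, b = 2 * a * u ∧
      c = a * (u ^ 2 + 2 * v) ∧ d = 2 * a * u * v ∧ e = a * v ^ 2 := by
  decide +kernel

section

variable {k : Type u} [Field k]

theorem SmoothPair.false_of_binary_double_root {A : k} {q : MvPolynomial (Fin 2) k} {a b c d e : k}
    (hs : SmoothPair 0 (C A * X 0 ^ 4 + rename Fin.succ q * X 0 ^ 2 + rename Fin.succ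
      (C a * X 0 ^ 4 + C b * (X 0 ^ 3 * X 1) + C c * (X 0 ^ 2 * X 1 ^ 2) + C d * (X 0 * X 1 ^ 3) +
        C e * X 1 ^ 4))) {Ω : Type u} [Field Ω] [Algebra k Ω] {t : Ω}
    (h0 : algebraMap k Ω a * t ^ 4 + algebraMap k Ω b * t ^ 3 + algebraMap k Ω c * t ^ 2 +
      algebraMap k Ω d * t + algebraMap k Ω e = 0)
    (h1 : 4 * algebraMap k Ω a * t ^ 3 + 3 * algebraMap k Ω b * t ^ 2 + 2 * algebraMap k Ω c * t +
      algebraMap k Ω d = 0) : False := by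
  refine hs.false_of_grad (Ω := Ω) (P := ![0, t, 1]) (fun h => by simpa using congrFun h 2) ?_ ?_
  · simp [rename_X]
    linear_combination h0
  · intro i
    fin_cases i
    · simp [pderiv_X, Derivation.leibniz, Derivation.leibniz_pow, rename_X]
    · simp [pderiv_X, Derivation.leibniz, Derivation.leibniz_pow, rename_X]
      linear_combination h1
    · simp [pderiv_X, Derivation.leibniz, Derivation.leibniz_pow, rename_X]
      linear_combination 4 * h0 - t * h1

theorem exists_sq_value_of_even_form [Finite k] (h2 : (2 : k) ≠ 0) {A : k}
    {q r : MvPolynomial (Fin 2) k} (hr : r.IsHomogeneous 4)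
    (hs : SmoothPair 0 (C A * X 0 ^ 4 + rename Fin.succ q * X 0 ^ 2 + rename Fin.succ r))
    (hroot : ∀ P : Fin 2 → k, P ≠ 0 → aeval P r ≠ 0) :
    ∃ (P : Fin 2 → k) (β : k), β ≠ 0 ∧ aeval P r = β ^ 2 := by
  have := Fintype.ofFinite k
  have hodd := FiniteField.two_mul_half_card_add_one h2
  have hcard := Fintype.one_lt_card (α := k)
  by_contra hcon
  push Not at hcon
  have hns : ∀ P : Fin 2 → k, P ≠ 0 → ¬IsSquare (aeval P r) := fun P hP ⟨β, hβ⟩ => by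
    refine hcon P β (fun h => hroot P hP (by rw [hβ, h, zero_mul])) (by rw [hβ, sq])
  obtain ⟨a, b, c, d, e, rfl⟩ := exists_coeffs_quartic hr
  have ha : ¬IsSquare a := by
    have := hns ![1, 0] (fun h => by simpa using congrFun h 0)
    simpa using this
  have ht : ∀ t, ¬IsSquare (a * t ^ 4 + b * t ^ 3 + c * t ^ 2 + d * t + e) := fun t => by
    have := hns ![t, 1] (fun h => by simpa using congrFun h 1)
    simpa [mul_assoc] using this
  have he : ¬IsSquare e := by simpa using ht 0
  have ha0 : a ≠ 0 := by rintro rfl; exact ha IsSquare.zero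
  by_cases hq : 7 ≤ Fintype.card k
  · set p : Polynomial k := .C a * .X ^ 4 + .C b * .X ^ 3 + .C c * .X ^ 2 + .C d * .X + .C e with hp
    have hpn : p.natDegree = 4 := by rw [hp]; compute_degree!
    have hdvd := FiniteField.dvd_derivative_sq_of_natDegree_eq_four h2 hq hpn fun t => by
      simpa [hp] using ht t
    obtain ⟨t, ht⟩ := IsAlgClosed.exists_aeval_eq_zero (AlgebraicClosure k) p (by
      rw [Polynomial.degree_eq_natDegree (by rintro h; rw [h] at hpn; simp at hpn), hpn]; decide)
    have ht' : Polynomial.aeval t (Polynomial.derivative p) = 0 := by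
      obtain ⟨s, hs⟩ := hdvd
      have := congrArg (Polynomial.aeval t) hs
      rw [map_mul, ht, zero_mul, map_pow] at this
      exact pow_eq_zero_iff two_ne_zero |>.1 this
    refine hs.false_of_binary_double_root (Ω := AlgebraicClosure k) (t := t) ?_ ?_
    · simpa [hp] using ht
    · simp [hp, Polynomial.derivative_pow] at ht'
      simp only [map_ofNat] at ht'
      linear_combination ht'
  · have huv : ∃ u v, b = 2 * a * u ∧ c = a * (u ^ 2 + 2 * v) ∧ d = 2 * a * u * v ∧
        e = a * v ^ 2 := by
      have hpow : ∀ x : k, ¬IsSquare x → x ^ (Fintype.card k / 2) = -1 := fun x hx =>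
        FiniteField.pow_half_card_eq_neg_one h2 hx
      by_cases h3 : Fintype.card k = 3
      · have E : k ≃+* ZMod 3 := (ZMod.ringEquivOfPrime k (by norm_num) h3).symm
        rw [h3] at hpow
        norm_num at hpow
        obtain ⟨u, v, h1, h2, h3, h4⟩ := zmod_three_quartic (E a) (E b) (E c) (E d) (E e)
          (by rw [hpow a ha]; simp) fun t => by
            have := congrArg E (hpow _ (ht (E.symm t)))
            simpa using this
        refine ⟨E.symm u, E.symm v, ?_, ?_, ?_, ?_⟩ <;> apply E.injective <;>
          simp [map_ofNat E 2, *]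
      · have h5 : Fintype.card k = 5 := by omega
        have E : k ≃+* ZMod 5 := (ZMod.ringEquivOfPrime k (by norm_num) h5).symm
        rw [h5] at hpow
        norm_num at hpow
        obtain ⟨u, v, h1, h2, h3, h4⟩ := zmod_five_quartic (E a) (by rw [← map_pow, hpow a ha]; simp)
          (E e) (by rw [← map_pow, hpow e he]; simp) (E b) (E c) (E d) fun t => by
            have := congrArg E (hpow _ (ht (E.symm t)))
            simpa using this
        refine ⟨E.symm u, E.symm v, ?_, ?_, ?_, ?_⟩ <;> apply E.injective <;>
          simp [map_ofNat E 2, *]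
    obtain ⟨u, v, rfl, rfl, rfl, rfl⟩ := huv
    obtain ⟨t, ht⟩ := IsAlgClosed.exists_aeval_eq_zero (AlgebraicClosure k)
      (.X ^ 2 + .C u * .X + .C v : Polynomial k) (by
        rw [show (.X ^ 2 + .C u * .X + .C v : Polynomial k).degree = 2 by compute_degree!]; decide)
    simp at ht
    refine hs.false_of_binary_double_root (Ω := AlgebraicClosure k) (t := t) ?_ ?_
    · simp only [map_mul, map_add, map_pow, map_ofNat]
      linear_combination algebraMap k (AlgebraicClosure k) a * (t ^ 2 + algebraMap k (AlgebraicClosure k) u * t + algebraMap k (AlgebraicClosure k) v) * ht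
    · simp only [map_mul, map_add, map_pow, map_ofNat]
      linear_combination 2 * algebraMap k (AlgebraicClosure k) a * (2 * t + algebraMap k (AlgebraicClosure k) u) * ht

theorem linSubst_even_form {A c d e f : k} (q r : MvPolynomial (Fin 2) k) :
    linSubst !![1, 0, 0; 0, c, d; 0, e, f]
      (C A * X 0 ^ 4 + rename Fin.succ q * X 0 ^ 2 + rename Fin.succ r) =
    C A * X 0 ^ 4 + rename Fin.succ (linSubst !![c, d; e, f] q) * X 0 ^ 2 +
      rename Fin.succ (linSubst !![c, d; e, f] r) := by
  have hX : linSubst !![1, 0, 0; 0, c, d; 0, e, f] (X 0) = X 0 := by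
    simp [linSubst, Fin.sum_univ_three]
  have hC : linSubst !![1, 0, 0; 0, c, d; 0, e, f] (C A) = C A := aeval_C _ _
  simp only [map_add, map_mul, map_pow, linSubst_rename_succ_of_block, hX, hC]

theorem HasCurve.of_isSquare_value [Finite k] (h2 : (2 : k) ≠ 0) {g : MvPolynomial (Fin 3) k}
    (hs : SmoothPair 0 g) (hg : g.IsHomogeneous 4) {P : Fin 3 → k} {a : k} (ha : a ≠ 0)
    (hP : aeval P g = a ^ 2) : HasCurve 0 g := by
  refine HasCurve.of_even_form h2 hs hg ha hP fun q r hq hr hs => ?_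
  by_cases hroot : ∃ P : Fin 2 → k, P ≠ 0 ∧ aeval P r = 0
  · obtain ⟨P, hP0, hP⟩ := hroot
    exact HasCurve.of_even_form_root h2 ha hq hr hP0 hP
  push Not at hroot
  obtain ⟨P, β, hβ, hP⟩ := exists_sq_value_of_even_form h2 hr hs hroot
  obtain ⟨x, y, hxy⟩ : ∃ x y, P 0 * y - x * P 1 ≠ 0 := by
    by_contra hcon
    push Not at hcon
    have h0 := hcon 0 1
    have h1 := hcon 1 0
    simp at h0 h1
    have : P = 0 := by funext i; fin_cases i <;> simp [h0, h1]
    rw [this, aeval_zero_of_isHomogeneous hr four_ne_zero] at hP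
    exact pow_ne_zero 2 hβ hP.symm
  refine HasCurve.of_det_ne_zero (M := !![1, 0, 0; 0, P 0, x; 0, P 1, y])
    (by simpa [Matrix.det_fin_three] using hxy) hs fun hs => ?_
  rw [map_zero, linSubst_even_form] at hs ⊢
  set r' := linSubst !![P 0, x; P 1, y] r with hr'
  have hβ' : aeval ![1, 0] r' = β ^ 2 := by
    rw [hr', aeval_linSubst, ← hP]
    congr 2
    funext i
    fin_cases i <;> simp
  have hr4 : r'.IsHomogeneous 4 := linSubst_isHomogeneous hr
  obtain ⟨b₀, b₁, b₂, b₃, b₄, hb⟩ := exists_coeffs_quartic hr4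
  rw [hb] at hs ⊢ hβ'
  simp at hβ'
  subst hβ'
  set z := -b₁ / (4 * β ^ 2) with hz
  have h4 : (4 : k) ≠ 0 := by rw [show (4 : k) = 2 * 2 by norm_num]; exact mul_ne_zero h2 h2
  have hz' : b₁ + 4 * β ^ 2 * z = 0 := by rw [hz]; field_simp; ring
  refine HasCurve.of_det_ne_zero (M := !![1, 0, 0; 0, 1, z; 0, 0, 1])
    (by simp [Matrix.det_fin_three]) hs fun hs => ?_
  rw [map_zero, linSubst_even_form] at hs ⊢
  obtain ⟨c₀, c₁, c₂, hc⟩ := exists_coeffs_quadratic (linSubst_isHomogeneous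
    (linSubst_isHomogeneous hq) : (linSubst !![1, z; 0, 1]
      (linSubst !![P 0, x; P 1, y] q)).IsHomogeneous 2)
  have key : C (a ^ 2) * X 0 ^ 4 + rename Fin.succ (linSubst !![1, z; 0, 1]
      (linSubst !![P 0, x; P 1, y] q)) * X 0 ^ 2 + rename Fin.succ (linSubst !![1, z; 0, 1]
      (C (β ^ 2) * X 0 ^ 4 + C b₁ * (X 0 ^ 3 * X 1) + C b₂ * (X 0 ^ 2 * X 1 ^ 2) +
        C b₃ * (X 0 * X 1 ^ 3) + C b₄ * X 1 ^ 4)) =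
      biquad (a ^ 2) (β ^ 2) (β ^ 2 * z ^ 4 + b₁ * z ^ 3 + b₂ * z ^ 2 + b₃ * z + b₄) c₀ c₂
        (6 * β ^ 2 * z ^ 2 + 3 * b₁ * z + b₂) + C c₁ * (X 0 ^ 2 * X 1 * X 2) +
        C (4 * β ^ 2 * z ^ 3 + 3 * b₁ * z ^ 2 + 2 * b₂ * z + b₃) * (X 1 * X 2 ^ 3) := by
    have Hz := congrArg (C : k → MvPolynomial (Fin 3) k) hz'
    simp only [map_add, map_mul, map_pow, map_ofNat, map_zero] at Hz
    rw [hc]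
    simp only [biquad, linSubst, map_add, map_mul, map_pow, aeval_X, aeval_C, algebraMap_eq, rename_X,
      rename_C, map_ofNat]
    simp [rename_X]
    linear_combination (X 1 ^ 3 * X 2) * Hz
  rw [key] at hs ⊢
  by_cases h : c₁ ≠ 0 ∨ 4 * β ^ 2 * z ^ 3 + 3 * b₁ * z ^ 2 + 2 * b₂ * z + b₃ ≠ 0
  · exact HasCurve.of_mixed h2 hβ hs h
  · push Not at h
    rw [h.1, h.2, C_0, zero_mul, zero_mul, add_zero, add_zero] at hs ⊢
    exact HasCurve.biquad_of_smooth h2 ha hβ hs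

end

section

variable {k : Type u} [Field k]

/-- Ternary quartic forms through the point `(1 : 0 : 0)` with tangent line `X 1 = 0` there. -/
noncomputable def tangentQuartic (a₀ a₁ a₂ d₀ d₁ d₂ d₃ e₀ e₁ e₂ e₃ e₄ : k) : MvPolynomial (Fin 3) k :=
  X 0 ^ 3 * X 1 + X 0 ^ 2 * (C a₀ * X 1 ^ 2 + C a₁ * (X 1 * X 2) + C a₂ * X 2 ^ 2) +
    X 0 * (C d₀ * X 1 ^ 3 + C d₁ * (X 1 ^ 2 * X 2) + C d₂ * (X 1 * X 2 ^ 2) + C d₃ * X 2 ^ 3) +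
    (C e₀ * X 1 ^ 4 + C e₁ * (X 1 ^ 3 * X 2) + C e₂ * (X 1 ^ 2 * X 2 ^ 2) + C e₃ * (X 1 * X 2 ^ 3) +
      C e₄ * X 2 ^ 4)

variable {a₀ a₁ a₂ d₀ d₁ d₂ d₃ e₀ e₁ e₂ e₃ e₄ : k}

theorem aeval_tangentQuartic {A : Type*} [CommRing A] [Algebra k A] (x z y : A) :
    aeval ![x, z, y] (tangentQuartic a₀ a₁ a₂ d₀ d₁ d₂ d₃ e₀ e₁ e₂ e₃ e₄) =
      x ^ 3 * z + x ^ 2 * (algebraMap k A a₀ * z ^ 2 + algebraMap k A a₁ * (z * y) +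
        algebraMap k A a₂ * y ^ 2) + x * (algebraMap k A d₀ * z ^ 3 + algebraMap k A d₁ * (z ^ 2 * y) +
        algebraMap k A d₂ * (z * y ^ 2) + algebraMap k A d₃ * y ^ 3) +
        (algebraMap k A e₀ * z ^ 4 + algebraMap k A e₁ * (z ^ 3 * y) +
        algebraMap k A e₂ * (z ^ 2 * y ^ 2) + algebraMap k A e₃ * (z * y ^ 3) +
        algebraMap k A e₄ * y ^ 4) := by
  simp [tangentQuartic]

theorem eval_tangentQuartic (x z y : k) :
    aeval ![x, z, y] (tangentQuartic a₀ a₁ a₂ d₀ d₁ d₂ d₃ e₀ e₁ e₂ e₃ e₄) =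
      x ^ 3 * z + x ^ 2 * (a₀ * z ^ 2 + a₁ * (z * y) +
        a₂ * y ^ 2) + x * (d₀ * z ^ 3 + d₁ * (z ^ 2 * y) +
        d₂ * (z * y ^ 2) + d₃ * y ^ 3) +
        (e₀ * z ^ 4 + e₁ * (z ^ 3 * y) +
        e₂ * (z ^ 2 * y ^ 2) + e₃ * (z * y ^ 3) +
        e₄ * y ^ 4) := aeval_tangentQuartic x z y

theorem tangentQuartic_isHomogeneous :
    (tangentQuartic a₀ a₁ a₂ d₀ d₁ d₂ d₃ e₀ e₁ e₂ e₃ e₄).IsHomogeneous 4 := by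
  have hX : ∀ i : Fin 3, (X i : MvPolynomial (Fin 3) k).IsHomogeneous 1 := isHomogeneous_X k
  have hC : ∀ (x : k) {n} {p : MvPolynomial (Fin 3) k}, p.IsHomogeneous n →
      (C x * p).IsHomogeneous n := fun x n p hp => by
    simpa using (isHomogeneous_C (Fin 3) x).mul hp
  refine (((((hX 0).pow 3).mul (hX 1)).add (((hX 0).pow 2).mul (((hC _ ((hX 1).pow 2)).add
    (hC _ ((hX 1).mul (hX 2)))).add (hC _ ((hX 2).pow 2))))).add ((hX 0).mul
    ((((hC _ ((hX 1).pow 3)).add (hC _ (((hX 1).pow 2).mul (hX 2)))).add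
    (hC _ ((hX 1).mul ((hX 2).pow 2)))).add (hC _ ((hX 2).pow 3))))).add ?_
  exact ((((hC _ ((hX 1).pow 4)).add (hC _ (((hX 1).pow 3).mul (hX 2)))).add
    (hC _ (((hX 1).pow 2).mul ((hX 2).pow 2)))).add (hC _ ((hX 1).mul ((hX 2).pow 3)))).add
    (hC _ ((hX 2).pow 4))

/-- A smooth quartic does not contain its tangent line. -/
theorem SmoothPair.tangentQuartic_ne
    (hs : SmoothPair 0 (tangentQuartic a₀ a₁ 0 d₀ d₁ d₂ 0 e₀ e₁ e₂ e₃ 0)) : False := by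
  set p : Polynomial k := .X ^ 3 + .C a₁ * .X ^ 2 + .C d₂ * .X + .C e₃ with hp
  have hpn : p.natDegree = 3 := by rw [hp]; compute_degree!
  obtain ⟨t, ht⟩ := IsAlgClosed.exists_aeval_eq_zero (AlgebraicClosure k) p (by
    rw [Polynomial.degree_eq_natDegree (by rintro h; rw [h] at hpn; simp at hpn), hpn]; decide)
  simp [hp] at ht
  refine hs.false_of_grad (Ω := AlgebraicClosure k) (P := ![t, 0, 1])
    (fun h => by simpa using congrFun h 2) ?_ ?_
  · simp [tangentQuartic]
  · intro i
    fin_cases i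
    · simp [tangentQuartic, pderiv_X, Derivation.leibniz, Derivation.leibniz_pow]
    · simp [tangentQuartic, pderiv_X, Derivation.leibniz, Derivation.leibniz_pow]
      linear_combination ht
    · simp [tangentQuartic, pderiv_X, Derivation.leibniz, Derivation.leibniz_pow]

theorem exists_zero_of_not_isSquare_value [Finite k] (h2 : (2 : k) ≠ 0) {g : MvPolynomial (Fin 3) k}
    (hg : g.IsHomogeneous 4) (hR : ∀ P : Fin 3 → k, IsSquare (aeval P g) → aeval P g = 0) :
    ∃ P : Fin 3 → k, P ≠ 0 ∧ aeval P g = 0 := by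
  classical
  have := Fintype.ofFinite k
  have hcard := Fintype.one_lt_card (α := k)
  have hodd := FiniteField.two_mul_half_card_add_one h2
  by_contra hcon
  push Not at hcon
  have hsum := MvPolynomial.sum_eval_eq_zero (g ^ (Fintype.card k / 2)) (by
    refine (totalDegree_pow _ _).trans_lt ((Nat.mul_le_mul_left _ hg.totalDegree_le).trans_lt ?_)
    rw [Fintype.card_fin]
    omega)
  have hval : ∀ P : Fin 3 → k, eval P (g ^ (Fintype.card k / 2)) = if P = 0 then 0 else -1 := by
    intro P
    rw [map_pow]
    change aeval P g ^ _ = _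
    split_ifs with h
    · rw [h, aeval_zero_of_isHomogeneous hg four_ne_zero, zero_pow (by omega)]
    · exact FiniteField.pow_half_card_eq_neg_one h2 fun hsq => hcon P h (hR P hsq)
  have h3 : ∑ P : Fin 3 → k, (if P = 0 then (0 : k) else -1) =
      ∑ P : Fin 3 → k, ((if P = 0 then (1 : k) else 0) - 1) :=
    Finset.sum_congr rfl fun P _ => by split_ifs <;> simp
  simp only [hval, h3, Finset.sum_sub_distrib, Finset.sum_ite_eq', Finset.mem_univ, if_true] at hsum
  simp at hsum

theorem linSubst_tangentQuartic (t : k) : linSubst !![1, 0, t; 0, 1, 0; 0, 0, 1]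
    (tangentQuartic a₀ a₁ a₂ d₀ d₁ d₂ d₃ e₀ e₁ e₂ e₃ e₄) =
    tangentQuartic a₀ (a₁ + 3 * t) a₂ d₀ (d₁ + 2 * t * a₀) (d₂ + 3 * t ^ 2 + 2 * t * a₁)
      (d₃ + 2 * t * a₂) e₀ (e₁ + t * d₀) (e₂ + t ^ 2 * a₀ + t * d₁)
      (e₃ + t ^ 3 + t ^ 2 * a₁ + t * d₂) (e₄ + t ^ 2 * a₂ + t * d₃) := by
  simp only [tangentQuartic, linSubst, map_add, map_mul, map_pow, aeval_X, aeval_C, algebraMap_eq,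
    Fin.sum_univ_three, map_ofNat]
  simp
  ring

theorem HasCurve.of_tangentQuartic [Finite k] (h2 : (2 : k) ≠ 0) {g : MvPolynomial (Fin 3) k}
    (hs : SmoothPair 0 g) (hg : g.IsHomogeneous 4)
    (H : ∀ a₀ a₁ a₂ d₀ d₁ d₂ d₃ e₀ e₁ e₂ e₃ e₄ : k, (a₂ = 0 ∨ d₃ = 0) →
      SmoothPair 0 (tangentQuartic a₀ a₁ a₂ d₀ d₁ d₂ d₃ e₀ e₁ e₂ e₃ e₄) →
      (∀ P : Fin 3 → k, IsSquare (aeval P (tangentQuartic a₀ a₁ a₂ d₀ d₁ d₂ d₃ e₀ e₁ e₂ e₃ e₄)) →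
        aeval P (tangentQuartic a₀ a₁ a₂ d₀ d₁ d₂ d₃ e₀ e₁ e₂ e₃ e₄) = 0) →
      HasCurve 0 (tangentQuartic a₀ a₁ a₂ d₀ d₁ d₂ d₃ e₀ e₁ e₂ e₃ e₄)) : HasCurve 0 g := by
  have H' : ∀ a₀ a₁ a₂ d₀ d₁ d₂ d₃ e₀ e₁ e₂ e₃ e₄ : k,
      SmoothPair 0 (tangentQuartic a₀ a₁ a₂ d₀ d₁ d₂ d₃ e₀ e₁ e₂ e₃ e₄) →
      HasCurve 0 (tangentQuartic a₀ a₁ a₂ d₀ d₁ d₂ d₃ e₀ e₁ e₂ e₃ e₄) := by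
    intro a₀ a₁ a₂ d₀ d₁ d₂ d₃ e₀ e₁ e₂ e₃ e₄ hs
    obtain ⟨t, ht⟩ : ∃ t, a₂ = 0 ∨ d₃ + 2 * t * a₂ = 0 := by
      by_cases h : a₂ = 0
      · exact ⟨0, .inl h⟩
      · exact ⟨-d₃ / (2 * a₂), .inr (by field_simp; ring)⟩
    refine HasCurve.of_det_ne_zero (M := !![1, 0, t; 0, 1, 0; 0, 0, 1])
      (by simp [Matrix.det_fin_three]) hs fun hs => ?_
    rw [map_zero, linSubst_tangentQuartic] at hs ⊢
    by_contra hno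
    refine hno (H _ _ _ _ _ _ _ _ _ _ _ _ ht hs fun P ⟨b, hb⟩ => ?_)
    by_contra hne
    exact hno (HasCurve.of_isSquare_value h2 hs tangentQuartic_isHomogeneous (a := b)
      (by rintro rfl; exact hne (by rw [hb, zero_mul])) (by rw [hb, sq]))
  by_contra hno
  obtain ⟨P, hP0, hP⟩ := exists_zero_of_not_isSquare_value h2 hg fun P ⟨b, hb⟩ => by
    by_contra hne
    exact hno (HasCurve.of_isSquare_value h2 hs hg (a := b)
      (by rintro rfl; exact hne (by rw [hb, zero_mul])) (by rw [hb, sq]))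
  obtain ⟨M, hM, hMP⟩ := exists_det_ne_zero_of_ne_zero hP0
  refine hno (HasCurve.of_det_ne_zero hM hs fun hs => ?_)
  rw [map_zero] at hs ⊢
  have hg' : (linSubst M g).IsHomogeneous 4 := linSubst_isHomogeneous hg
  have hP' : aeval ![(1 : k), 0, 0] (linSubst M g) = 0 := by
    rw [aeval_linSubst]
    refine (congrArg (fun v => aeval v g) (funext fun i => ?_)).trans hP
    simp [Fin.sum_univ_three, hMP]
  obtain ⟨g₁, g₂, g₃, g₄, h₁, h₂, h₃, h₄, e⟩ := exists_quartic_expansion hg'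
  rw [hP', C_0, zero_mul, zero_add] at e
  rw [e] at hs ⊢
  obtain ⟨l₁, l₂, rfl⟩ := exists_coeffs_linear h₁
  obtain ⟨n₁, n₂, hn⟩ : ∃ n₁ n₂, l₁ * n₁ + l₂ * n₂ = 1 := by
    by_cases hl₁ : l₁ = 0
    · by_cases hl₂ : l₂ = 0
      · exfalso
        obtain ⟨_, _, _, rfl⟩ := exists_coeffs_quadratic h₂
        obtain ⟨_, _, _, _, rfl⟩ := exists_coeffs_cubic h₃
        obtain ⟨_, _, _, _, _, rfl⟩ := exists_coeffs_quartic h₄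
        refine hs.false_of_grad (Ω := k) (P := ![1, 0, 0]) (fun h => by simpa using congrFun h 0) ?_ ?_
        · simp [hl₁, hl₂, rename_X]
        · intro i
          fin_cases i <;>
            simp [hl₁, hl₂, rename_X, pderiv_X, Derivation.leibniz, Derivation.leibniz_pow]
      · exact ⟨0, l₂⁻¹, by field_simp; ring⟩
    · exact ⟨l₁⁻¹, 0, by field_simp; ring⟩
  refine HasCurve.of_det_ne_zero (M := !![1, 0, 0; 0, n₁, -l₂; 0, n₂, l₁])
    (by rw [Matrix.det_fin_three]; simp; rw [mul_comm, hn]; simp) hs fun hs => ?_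
  have hX : linSubst !![1, 0, 0; 0, n₁, -l₂; 0, n₂, l₁] (X 0) = X 0 := by
    simp [linSubst, Fin.sum_univ_three]
  have hlin : linSubst !![n₁, -l₂; n₂, l₁] (C l₁ * X 0 + C l₂ * X 1) = X 0 := by
    have := congrArg (C : k → MvPolynomial (Fin 2) k) hn
    simp only [map_add, map_mul, map_one] at this
    simp [linSubst]
    linear_combination X 0 * this
  obtain ⟨a₂, a₁, a₀, ha⟩ := exists_coeffs_quadratic
    (linSubst_isHomogeneous h₂ : (linSubst !![n₁, -l₂; n₂, l₁] g₂).IsHomogeneous 2)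
  obtain ⟨d₃, d₂, d₁, d₀, hd⟩ := exists_coeffs_cubic
    (linSubst_isHomogeneous h₃ : (linSubst !![n₁, -l₂; n₂, l₁] g₃).IsHomogeneous 3)
  obtain ⟨c₄, c₃, c₂, c₁, c₀, hc⟩ := exists_coeffs_quartic
    (linSubst_isHomogeneous h₄ : (linSubst !![n₁, -l₂; n₂, l₁] g₄).IsHomogeneous 4)
  have key : linSubst !![1, 0, 0; 0, n₁, -l₂; 0, n₂, l₁]
      (rename Fin.succ (C l₁ * X 0 + C l₂ * X 1) * X 0 ^ 3 + rename Fin.succ g₂ * X 0 ^ 2 +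
        rename Fin.succ g₃ * X 0 + rename Fin.succ g₄) =
      tangentQuartic a₂ a₁ a₀ d₃ d₂ d₁ d₀ c₄ c₃ c₂ c₁ c₀ := by
    rw [map_add, map_add, map_add, map_mul, map_mul, map_mul, map_pow, map_pow, hX]
    simp only [linSubst_rename_succ_of_block, hlin, ha, hd, hc]
    simp only [tangentQuartic, map_add, map_mul, map_pow, rename_X, rename_C, Fin.succ_zero_eq_one,
      Fin.succ_one_eq_two]
    ring
  rw [map_zero, key] at hs ⊢
  exact H' _ _ _ _ _ _ _ _ _ _ _ _ hs

end

theorem coeff_eq_zero_of_forall_sum_eq_zero {k : Type*} [Field k] [Fintype k] {n : ℕ}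
    (hn : n ≤ Fintype.card k) {c : Fin n → k} (h : ∀ x : k, ∑ i, c i * x ^ (i : ℕ) = 0) (i : Fin n) :
    c i = 0 := by
  obtain ⟨f⟩ : Nonempty (Fin n ↪ k) := Function.Embedding.nonempty_of_card_le (by simpa using hn)
  have := Matrix.eq_zero_of_forall_index_sum_pow_mul_eq_zero f.injective (v := c) fun j => by
    rw [← h (f j)]
    exact Finset.sum_congr rfl fun i _ => mul_comm _ _
  exact congrFun this i

theorem zmod_seven_cubic : ∀ a b c : ZMod 7, (∀ x, x ^ 3 + a * x ^ 2 + b * x + c = 0 ∨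
    (x ^ 3 + a * x ^ 2 + b * x + c) ^ 3 = -1) → a ^ 2 = 3 * b ∧ c = -1 - a ^ 3 := by
  decide +kernel

theorem zmod_five_cubic : ∀ a b c : ZMod 5, (∀ x, x ^ 3 + a * x ^ 2 + b * x + c = 0 ∨
    (x ^ 3 + a * x ^ 2 + b * x + c) ^ 2 = -1) →
      c - 2 * b * a + a ^ 3 = 0 ∧ (b - 2 * a ^ 2 = 1 ∨ b - 2 * a ^ 2 = 2) := by
  decide +kernel

theorem zmod_five_tangent : ∀ a e : ZMod 5, a ≠ 0 → (∀ x y, y ^ 2 * (a * x ^ 2 + e * y ^ 2) = 0 ∨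
    (y ^ 2 * (a * x ^ 2 + e * y ^ 2)) ^ 2 = -1) → e = 0 ∧ a ^ 2 = -1 := by
  decide +kernel

theorem zmod_five_quartic_value : ∀ c a b d : ZMod 5, c ^ 2 = -1 →
    ¬∀ m, 2 * m ^ 4 + c * a * m ^ 3 + 2 * a ^ 2 * m ^ 2 + b * m + d = 1 ∨
      2 * m ^ 4 + c * a * m ^ 3 + 2 * a ^ 2 * m ^ 2 + b * m + d = 2 := by
  decide +kernel

section

variable {k : Type u} [Field k] {a₀ a₁ a₂ d₀ d₁ d₂ d₃ e₀ e₁ e₂ e₃ e₄ : k}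

theorem SmoothPair.tangentQuartic_false_of_eleven_le [Fintype k] (h2 : (2 : k) ≠ 0)
    (hq : 11 ≤ Fintype.card k)
    (hR : ∀ P : Fin 3 → k, IsSquare (aeval P (tangentQuartic a₀ a₁ a₂ d₀ d₁ d₂ d₃ e₀ e₁ e₂ e₃ e₄)) →
      aeval P (tangentQuartic a₀ a₁ a₂ d₀ d₁ d₂ d₃ e₀ e₁ e₂ e₃ e₄) = 0) : False := by
  set p : Polynomial k := .X ^ 3 + .C a₀ * .X ^ 2 + .C d₀ * .X + .C e₀ with hp
  have hpn : p.natDegree = 3 := by rw [hp]; compute_degree!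
  obtain ⟨x, hx, hx'⟩ := FiniteField.exists_isSquare_eval_of_natDegree_eq_three h2 hq hpn
  have e : p.eval x = aeval ![x, 1, 0] (tangentQuartic a₀ a₁ a₂ d₀ d₁ d₂ d₃ e₀ e₁ e₂ e₃ e₄) := by
    rw [eval_tangentQuartic, hp]; simp; ring
  rw [e] at hx hx'
  exact hx (hR _ hx')

theorem pow_half_card_of_isSquare_imp [Fintype k] (h2 : (2 : k) ≠ 0) {v : k} (h : IsSquare v → v = 0) :
    v = 0 ∨ v ^ (Fintype.card k / 2) = -1 := by
  by_cases hv : IsSquare v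
  · exact .inl (h hv)
  · exact .inr (FiniteField.pow_half_card_eq_neg_one h2 hv)

theorem SmoothPair.tangentQuartic_false_of_card_seven [Fintype k] (h2 : (2 : k) ≠ 0)
    (hq : Fintype.card k = 7) (hs : SmoothPair 0 (tangentQuartic a₀ a₁ a₂ d₀ d₁ d₂ d₃ e₀ e₁ e₂ e₃ e₄))
    (hR : ∀ P : Fin 3 → k, IsSquare (aeval P (tangentQuartic a₀ a₁ a₂ d₀ d₁ d₂ d₃ e₀ e₁ e₂ e₃ e₄)) →
      aeval P (tangentQuartic a₀ a₁ a₂ d₀ d₁ d₂ d₃ e₀ e₁ e₂ e₃ e₄) = 0) : False := by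
  have E : k ≃+* ZMod 7 := (ZMod.ringEquivOfPrime k (by norm_num) hq).symm
  have key : ∀ m : k, (a₂ * m ^ 2 + a₁ * m + a₀) ^ 2 = 3 * (d₃ * m ^ 3 + d₂ * m ^ 2 + d₁ * m + d₀) ∧
      e₄ * m ^ 4 + e₃ * m ^ 3 + e₂ * m ^ 2 + e₁ * m + e₀ = -1 - (a₂ * m ^ 2 + a₁ * m + a₀) ^ 3 := by
    intro m
    have := zmod_seven_cubic (E (a₂ * m ^ 2 + a₁ * m + a₀)) (E (d₃ * m ^ 3 + d₂ * m ^ 2 + d₁ * m + d₀))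
      (E (e₄ * m ^ 4 + e₃ * m ^ 3 + e₂ * m ^ 2 + e₁ * m + e₀)) fun x => by
        have h := pow_half_card_of_isSquare_imp h2 (hR ![E.symm x, 1, m])
        rw [hq, eval_tangentQuartic] at h
        refine h.imp (fun h => ?_) (fun h => ?_)
        · apply E.symm.injective
          simp only [map_add, map_mul, map_pow, RingEquiv.symm_apply_apply, map_zero]
          linear_combination h
        · apply E.symm.injective
          simp only [map_add, map_mul, map_pow, RingEquiv.symm_apply_apply, map_neg, map_one]
          refine Eq.trans (congrArg (· ^ 3) ?_) h
          ring
    exact ⟨E.injective (by simpa [map_ofNat E 3] using this.1), E.injective (by simpa using this.2)⟩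
  have c1 := fun i => coeff_eq_zero_of_forall_sum_eq_zero (n := 5) (by omega)
    (c := ![a₀ ^ 2 - 3 * d₀, 2 * a₀ * a₁ - 3 * d₁, a₁ ^ 2 + 2 * a₀ * a₂ - 3 * d₂,
      2 * a₁ * a₂ - 3 * d₃, a₂ ^ 2]) (fun m => by
      simp [Fin.sum_univ_succ]
      linear_combination (key m).1) i
  obtain rfl : a₂ = 0 := by simpa using c1 4
  have h3 : (3 : k) ≠ 0 := fun h => by
    have := congrArg E h
    rw [map_ofNat, map_zero] at this
    exact absurd this (by decide)
  obtain rfl : d₃ = 0 := by simpa [h3] using c1 3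
  have c2 := fun i => coeff_eq_zero_of_forall_sum_eq_zero (n := 5) (by omega)
    (c := ![e₀ + 1 + a₀ ^ 3, e₁ + 3 * a₀ ^ 2 * a₁, e₂ + 3 * a₀ * a₁ ^ 2, e₃ + a₁ ^ 3, e₄])
    (fun m => by
      simp [Fin.sum_univ_succ]
      linear_combination (key m).2) i
  obtain rfl : e₄ = 0 := by simpa using c2 4
  exact hs.tangentQuartic_ne

theorem tangentQuartic_coeff_eq_zero
    (hR : ∀ P : Fin 3 → k, IsSquare (aeval P (tangentQuartic a₀ a₁ 0 d₀ d₁ d₂ d₃ e₀ e₁ e₂ e₃ e₄)) →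
      aeval P (tangentQuartic a₀ a₁ 0 d₀ d₁ d₂ d₃ e₀ e₁ e₂ e₃ e₄) = 0) : d₃ = 0 := by
  by_contra h
  have e : aeval ![(1 - e₄) / d₃, 0, 1] (tangentQuartic a₀ a₁ 0 d₀ d₁ d₂ d₃ e₀ e₁ e₂ e₃ e₄) = 1 := by
    rw [eval_tangentQuartic]
    field_simp
    ring
  have := hR ![(1 - e₄) / d₃, 0, 1]
  rw [e] at this
  exact one_ne_zero (this ⟨1, by norm_num⟩)

theorem SmoothPair.tangentQuartic_false_of_card_five [Fintype k] (h2 : (2 : k) ≠ 0)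
    (hq : Fintype.card k = 5) (hs : SmoothPair 0 (tangentQuartic a₀ a₁ a₂ d₀ d₁ d₂ d₃ e₀ e₁ e₂ e₃ e₄))
    (had : a₂ = 0 ∨ d₃ = 0)
    (hR : ∀ P : Fin 3 → k, IsSquare (aeval P (tangentQuartic a₀ a₁ a₂ d₀ d₁ d₂ d₃ e₀ e₁ e₂ e₃ e₄)) →
      aeval P (tangentQuartic a₀ a₁ a₂ d₀ d₁ d₂ d₃ e₀ e₁ e₂ e₃ e₄) = 0) : False := by
  have E : k ≃+* ZMod 5 := (ZMod.ringEquivOfPrime k (by norm_num) hq).symm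
  have hd : d₃ = 0 := by
    rcases had with rfl | h
    · exact tangentQuartic_coeff_eq_zero hR
    · exact h
  subst hd
  have h5 : (5 : k) = 0 := by
    have := FiniteField.cast_card_eq_zero k
    rw [hq] at this; exact_mod_cast this
  have key : ∀ m : k, (e₄ * m ^ 4 + e₃ * m ^ 3 + e₂ * m ^ 2 + e₁ * m + e₀) -
      2 * (d₂ * m ^ 2 + d₁ * m + d₀) * (a₂ * m ^ 2 + a₁ * m + a₀) + (a₂ * m ^ 2 + a₁ * m + a₀) ^ 3 = 0 ∧
      ((d₂ * m ^ 2 + d₁ * m + d₀) - 2 * (a₂ * m ^ 2 + a₁ * m + a₀) ^ 2 = 1 ∨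
        (d₂ * m ^ 2 + d₁ * m + d₀) - 2 * (a₂ * m ^ 2 + a₁ * m + a₀) ^ 2 = 2) := by
    intro m
    have := zmod_five_cubic (E (a₂ * m ^ 2 + a₁ * m + a₀)) (E (d₂ * m ^ 2 + d₁ * m + d₀))
      (E (e₄ * m ^ 4 + e₃ * m ^ 3 + e₂ * m ^ 2 + e₁ * m + e₀)) fun x => by
        have h := pow_half_card_of_isSquare_imp h2 (hR ![E.symm x, 1, m])
        rw [hq, eval_tangentQuartic] at h
        refine h.imp (fun h => ?_) (fun h => ?_)
        · apply E.symm.injective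
          simp only [map_add, map_mul, map_pow, RingEquiv.symm_apply_apply, map_zero]
          linear_combination h
        · apply E.symm.injective
          simp only [map_add, map_mul, map_pow, RingEquiv.symm_apply_apply, map_neg, map_one]
          refine Eq.trans (congrArg (· ^ 2) ?_) h
          ring
    refine ⟨E.injective (by simpa [map_ofNat E 2] using this.1), ?_⟩
    refine this.2.imp (fun h => E.injective ?_) (fun h => E.injective ?_)
    · simpa [map_ofNat E 2] using h
    · simpa [map_ofNat E 2] using h
  have h5' : ∀ m : k, m ^ 5 = m := fun m => by rw [← hq]; exact FiniteField.pow_card m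
  have c1 := fun i => coeff_eq_zero_of_forall_sum_eq_zero (n := 5) (by omega)
    (c := ![e₀ - 2 * d₀ * a₀ + a₀ ^ 3,
      e₁ - 2 * d₁ * a₀ - 2 * d₀ * a₁ + 3 * a₀ ^ 2 * a₁ + 3 * a₂ ^ 2 * a₁,
      e₂ - 2 * d₂ * a₀ - 2 * d₁ * a₁ - 2 * d₀ * a₂ + 3 * a₀ ^ 2 * a₂ + 3 * a₀ * a₁ ^ 2 + a₂ ^ 3,
      e₃ - 2 * d₂ * a₁ - 2 * d₁ * a₂ + a₁ ^ 3 + 6 * a₀ * a₁ * a₂,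
      e₄ - 2 * d₂ * a₂ + 3 * a₁ ^ 2 * a₂ + 3 * a₀ * a₂ ^ 2]) (fun m => by
      simp [Fin.sum_univ_succ]
      linear_combination (key m).1 - (3 * a₂ ^ 2 * a₁ + a₂ ^ 3 * m) * h5' m) i
  have c14 := c1 4
  simp at c14
  by_cases ha : a₂ = 0
  · subst ha
    obtain rfl : e₄ = 0 := by simpa using c14
    exact hs.tangentQuartic_ne
  · have := zmod_five_tangent (E a₂) (E e₄) (by simpa using ha) fun x y => by
      have h := pow_half_card_of_isSquare_imp h2 (hR ![E.symm x, 0, E.symm y])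
      rw [hq, eval_tangentQuartic] at h
      refine h.imp (fun h => ?_) (fun h => ?_)
      · apply E.symm.injective
        simp only [map_add, map_mul, map_pow, RingEquiv.symm_apply_apply, map_zero]
        linear_combination h
      · apply E.symm.injective
        simp only [map_add, map_mul, map_pow, RingEquiv.symm_apply_apply, map_neg, map_one]
        refine Eq.trans (congrArg (· ^ 2) ?_) h
        ring
    obtain rfl : e₄ = 0 := by simpa using this.1
    have ha2 : a₂ ^ 2 = -1 := E.injective (by simpa using this.2)
    have hd2 : d₂ = 4 * (a₁ ^ 2 + a₀ * a₂) := by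
      have : a₂ * (d₂ - 4 * (a₁ ^ 2 + a₀ * a₂)) = 0 := by
        linear_combination 2 * c14 + a₂ * (d₂ - 2 * a₁ ^ 2 - 2 * a₀ * a₂) * h5
      linear_combination (mul_eq_zero.1 this).resolve_left ha
    refine zmod_five_quartic_value (E a₂) (E a₁) (E (d₁ - 4 * a₁ * a₀)) (E (d₀ - 2 * a₀ ^ 2))
      (by rw [← map_pow, ha2]; simp) fun m => ?_
    have e : (d₂ * E.symm m ^ 2 + d₁ * E.symm m + d₀) -
        2 * (a₂ * E.symm m ^ 2 + a₁ * E.symm m + a₀) ^ 2 = 2 * E.symm m ^ 4 + a₂ * a₁ * E.symm m ^ 3 +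
        2 * a₁ ^ 2 * E.symm m ^ 2 + (d₁ - 4 * a₁ * a₀) * E.symm m + (d₀ - 2 * a₀ ^ 2) := by
      rw [hd2]
      linear_combination (-2 * E.symm m ^ 4) * ha2 - (a₂ * a₁ * E.symm m ^ 3) * h5
    have h6 := (key (E.symm m)).2
    rw [e] at h6
    refine h6.imp (fun h => ?_) (fun h => ?_)
    · have := congrArg E h
      simpa [map_ofNat E 2, map_ofNat E 4] using this
    · have := congrArg E h
      simpa [map_ofNat E 2, map_ofNat E 4] using this

end

section

variable {k : Type u} [Field k] {a₀ a₁ a₂ d₀ d₁ d₂ d₃ e₀ e₁ e₂ e₃ e₄ : k}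

theorem hermitian_curve_pos {R : Type*} [CommRing R] (h3 : (3 : R) = 0) {A s : R}
    (hA : A ^ 2 + A - 1 = 0) :
    s * (-A * s ^ 5 + A * s - s ^ 5 - s ^ 4 + s + 1) ^ 2 =
      (-A * s ^ 3 - A - s ^ 3 - s ^ 2 + s + 1) ^ 3 *
        (-A * s ^ 2 + A + s ^ 3 + s ^ 2 - s + 1) -
      A ^ 2 * (-A * s ^ 3 - A - s ^ 3 - s ^ 2 + s + 1) *
        (-A * s ^ 2 + A + s ^ 3 + s ^ 2 - s + 1) ^ 3 +
      A * (-A * s ^ 2 + A + s ^ 3 - s ^ 2 - s + 1) ^ 4 := by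
  linear_combination (A ^ 4 * s ^ 9 - 3 * A ^ 4 * s ^ 7 + A ^ 4 * s ^ 6 + 3 * A ^ 4 * s ^ 5 -
    3 * A ^ 4 * s ^ 4 - A ^ 4 * s ^ 3 + 3 * A ^ 4 * s ^ 2 - A ^ 4 - 3 * A ^ 3 * s ^ 10 - 3 * A ^
    3 * s ^ 9 + 9 * A ^ 3 * s ^ 8 - A ^ 3 * s ^ 7 - 13 * A ^ 3 * s ^ 6 + 15 * A ^ 3 * s ^ 5 + 9
    * A ^ 3 * s ^ 4 - 15 * A ^ 3 * s ^ 3 + 4 * A ^ 3 * s - 2 * A ^ 3 + 2 * A ^ 2 * s ^ 11 + 6 *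
    A ^ 2 * s ^ 10 - 3 * A ^ 2 * s ^ 9 - 10 * A ^ 2 * s ^ 8 + 18 * A ^ 2 * s ^ 7 + 9 * A ^ 2 * s
    ^ 6 - 21 * A ^ 2 * s ^ 5 - 6 * A ^ 2 * s ^ 4 - 2 * A ^ 2 * s ^ 3 + 3 * A ^ 2 * s ^ 2 + 6 * A
    ^ 2 * s - 2 * A ^ 2 - 4 * A * s ^ 11 - 10 * A * s ^ 10 + 20 * A * s ^ 9 + 10 * A * s ^ 8 -
    73 * A * s ^ 7 + 5 * A * s ^ 6 + 90 * A * s ^ 5 - 12 * A * s ^ 4 - 39 * A * s ^ 3 + 13 * A *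
    s ^ 2 + 6 * A * s - 6 * A + 2 * s ^ 12 + 10 * s ^ 11 - 7 * s ^ 10 - 15 * s ^ 9 + 53 * s ^ 8
    + 45 * s ^ 7 - 68 * s ^ 6 - 27 * s ^ 5 + 26 * s ^ 4 - 29 * s ^ 3 - 7 * s ^ 2 + 16 * s + 1) *
    hA + (-2 * A * s ^ 10 + 3 * A * s ^ 9 - 4 * A * s ^ 8 - 32 * A * s ^ 7 + 3 * A * s ^ 6 + 33
    * A * s ^ 5 - 2 * A * s ^ 3 + 5 * A * s ^ 2 - 2 * A * s - 2 * A + s ^ 12 + 5 * s ^ 11 - s ^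
    10 - 8 * s ^ 9 + 14 * s ^ 8 + 17 * s ^ 7 - 20 * s ^ 6 - 11 * s ^ 5 + 7 * s ^ 4 - 8 * s ^ 3 -
    s ^ 2 + 5 * s) * h3

theorem hermitian_curve_neg {R : Type*} [CommRing R] (h3 : (3 : R) = 0) {A s : R}
    (hA : A ^ 2 - A - 1 = 0) :
    s * (-A * s ^ 5 + A * s + s ^ 5 - s ^ 4 - s + 1) ^ 2 =
      (A * s ^ 2 + A * s + A + s ^ 3 - 1) ^ 3 *
        (A * s ^ 3 + A * s ^ 2 - A * s - s ^ 2 + 1) -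
      A ^ 2 * (A * s ^ 2 + A * s + A + s ^ 3 - 1) *
        (A * s ^ 3 + A * s ^ 2 - A * s - s ^ 2 + 1) ^ 3 +
      A * (-A * s ^ 2 + A + s ^ 3 + s ^ 2 - s - 1) ^ 4 := by
  linear_combination (A ^ 4 * s ^ 11 + 4 * A ^ 4 * s ^ 10 + 4 * A ^ 4 * s ^ 9 - 2 * A ^ 4 * s
    ^ 8 - 5 * A ^ 4 * s ^ 7 - 2 * A ^ 4 * s ^ 6 + 2 * A ^ 4 * s ^ 5 + 2 * A ^ 4 * s ^ 4 - A ^ 4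
    * s ^ 3 + A ^ 3 * s ^ 12 + 4 * A ^ 3 * s ^ 11 + A ^ 3 * s ^ 10 - 11 * A ^ 3 * s ^ 9 - 9 * A
    ^ 3 * s ^ 8 + 10 * A ^ 3 * s ^ 7 + 18 * A ^ 3 * s ^ 6 + 2 * A ^ 3 * s ^ 5 - 16 * A ^ 3 * s ^
    4 - 3 * A ^ 3 * s ^ 3 + 7 * A ^ 3 * s ^ 2 - A ^ 3 + A ^ 2 * s ^ 12 + 2 * A ^ 2 * s ^ 11 - A
    ^ 2 * s ^ 10 + 5 * A ^ 2 * s ^ 9 + 10 * A ^ 2 * s ^ 8 - 22 * A ^ 2 * s ^ 7 - 34 * A ^ 2 * s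
    ^ 6 + 6 * A ^ 2 * s ^ 5 + 20 * A ^ 2 * s ^ 4 - 3 * A ^ 2 * s ^ 3 - 10 * A ^ 2 * s ^ 2 + 2 *
    A ^ 2 * s + 3 * A ^ 2 + 2 * A * s ^ 12 + 6 * A * s ^ 11 - 6 * A * s ^ 10 - 24 * A * s ^ 9 -
    2 * A * s ^ 8 + 23 * A * s ^ 7 - 6 * A * s ^ 6 - 30 * A * s ^ 5 + 7 * A * s ^ 4 + 26 * A * s
    ^ 3 + 2 * A * s ^ 2 - 12 * A * s - 4 * A + 3 * s ^ 12 + 10 * s ^ 11 - s ^ 10 - 24 * s ^ 9 -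
    24 * s ^ 8 - s ^ 7 + 20 * s ^ 6 + 14 * s ^ 5 - 24 * s ^ 4 - 25 * s ^ 3 - 3 * s ^ 2 + 11 * s
    + 5) * hA + (A * s ^ 12 + 3 * A * s ^ 11 - A * s ^ 10 - 10 * A * s ^ 9 - 2 * A * s ^ 8 + 2 *
    A * s ^ 7 - 10 * A * s ^ 6 - 9 * A * s ^ 5 + 4 * A * s ^ 4 + 7 * A * s ^ 3 - 3 * A * s - A +
    s ^ 12 + 4 * s ^ 11 - s ^ 10 - 8 * s ^ 9 - 9 * s ^ 8 - s ^ 7 + 9 * s ^ 6 + 5 * s ^ 5 - 8 * s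
    ^ 4 - 9 * s ^ 3 - 2 * s ^ 2 + 4 * s + 2) * h3

theorem HasCurve.tangentQuartic_hermitian (h3 : (3 : k) = 0) {α : k} (hα : α ^ 4 = -1) :
    HasCurve 0 (tangentQuartic 0 0 0 (-α ^ 2) 0 0 0 0 0 0 0 α) := by
  have h2 : (2 : k) ≠ 0 := fun h => one_ne_zero (by linear_combination h3 - h : (1 : k) = 0)
  have H3 : (3 : Polynomial k) = 0 := by rw [← map_ofNat Polynomial.C 3, h3, map_zero]
  let A : Polynomial k := Polynomial.C α
  let t : Polynomial k := Polynomial.X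
  have hα' : (α ^ 2 + α - 1) * (α ^ 2 - α - 1) = 0 := by linear_combination hα - α ^ 2 * h3
  rcases mul_eq_zero.1 hα' with h | h
  · have hA : A ^ 2 + A - 1 = 0 := by
      have := congrArg (Polynomial.C : k → Polynomial k) h
      simpa using this
    refine HasCurve.of_eval h2
      (x := -A * t ^ 6 - A - t ^ 6 - t ^ 4 + t ^ 2 + 1)
      (y := -A * t ^ 4 + A + t ^ 6 + t ^ 4 - t ^ 2 + 1)
      (z := -A * t ^ 4 + A + t ^ 6 - t ^ 4 - t ^ 2 + 1)
      (w := -A * t ^ 11 + A * t ^ 3 - t ^ 11 - t ^ 9 + t ^ 3 + t) ?_ ?_ ⟨0, 1, ?_⟩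
    · rw [aeval_tangentQuartic]
      simp only [Polynomial.algebraMap_eq, map_zero, map_neg, map_pow]
      change _ = _ + _ * (_ + _ + _) + _ * (-A ^ 2 * _ + _ + _ + _) + (_ + _ + _ + _ + A * _)
      linear_combination hermitian_curve_pos H3 (s := t ^ 2) hA
    · intro h0
      have := congrArg (fun p => Polynomial.coeff p 1) h0
      simp [A, t, Polynomial.coeff_X, Polynomial.coeff_one] at this
    · intro h0
      have := congrArg (fun p => Polynomial.coeff p 1) h0
      simp [A, t, Polynomial.coeff_X, Polynomial.coeff_one, Polynomial.mul_coeff_one] at this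
      exact one_ne_zero (by linear_combination -this - h3 : (1 : k) = 0)
  · have hA : A ^ 2 - A - 1 = 0 := by
      have := congrArg (Polynomial.C : k → Polynomial k) h
      simpa using this
    refine HasCurve.of_eval h2
      (x := A * t ^ 4 + A * t ^ 2 + A + t ^ 6 - 1)
      (y := A * t ^ 6 + A * t ^ 4 - A * t ^ 2 - t ^ 4 + 1)
      (z := -A * t ^ 4 + A + t ^ 6 + t ^ 4 - t ^ 2 - 1)
      (w := -A * t ^ 11 + A * t ^ 3 + t ^ 11 - t ^ 9 - t ^ 3 + t) ?_ ?_ ⟨0, 1, ?_⟩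
    · rw [aeval_tangentQuartic]
      simp only [Polynomial.algebraMap_eq, map_zero, map_neg, map_pow]
      change _ = _ + _ * (_ + _ + _) + _ * (-A ^ 2 * _ + _ + _ + _) + (_ + _ + _ + _ + A * _)
      linear_combination hermitian_curve_neg H3 (s := t ^ 2) hA
    · intro h0
      have := congrArg (fun p => Polynomial.coeff p 1) h0
      simp [A, t, Polynomial.coeff_X, Polynomial.coeff_one] at this
    · intro h0
      have := congrArg (fun p => Polynomial.coeff p 1) h0
      simp [A, t, Polynomial.coeff_X, Polynomial.coeff_one, Polynomial.mul_coeff_one] at this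
      exact one_ne_zero (by linear_combination hα + 2 * α ^ 2 * this + α ^ 4 * h3 : (1 : k) = 0)

theorem cubic_coeffs_of_card_nine [Fintype k] (hq : Fintype.card k = 9) (h3 : (3 : k) = 0) {a b c : k}
    (h : ∀ x : k, x ^ 3 + a * x ^ 2 + b * x + c = 0 ∨ (x ^ 3 + a * x ^ 2 + b * x + c) ^ 4 = -1) :
    a = 0 ∧ b ^ 2 = -1 ∧ c ^ 3 = -b * c := by
  have h9 : ∀ x : k, x ^ 9 = x := fun x => by rw [← hq]; exact FiniteField.pow_card x
  have h5 : ∀ x : k, (x ^ 3 + a * x ^ 2 + b * x + c) ^ 5 + (x ^ 3 + a * x ^ 2 + b * x + c) = 0 :=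
    fun x => by
      rcases h x with h | h
      · rw [h]; ring
      · rw [pow_succ, h]; ring
  have hcube : ∀ p q r s : k, (p + q + r + s) ^ 3 = p ^ 3 + q ^ 3 + r ^ 3 + s ^ 3 := fun p q r s => by
    linear_combination (p ^ 2 * q + p ^ 2 * r + p ^ 2 * s + q ^ 2 * p + q ^ 2 * r + q ^ 2 * s +
      r ^ 2 * p + r ^ 2 * q + r ^ 2 * s + s ^ 2 * p + s ^ 2 * q + s ^ 2 * r +
      2 * (p * q * r + p * q * s + p * r * s + q * r * s)) * h3
  have ha : a = 0 := by
    by_contra ha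
    set t := b / a with ht
    set d := t ^ 3 + a * t ^ 2 + b * t + c with hd
    have hb : b = a * t := by rw [ht]; field_simp
    have hF : ∀ x : k, (x ^ 3 + a * x ^ 2 + 0 * x + d) ^ 5 + (x ^ 3 + a * x ^ 2 + d) = 0 := fun x => by
      have := h5 (x + t)
      rw [show (x + t) ^ 3 + a * (x + t) ^ 2 + b * (x + t) + c = x ^ 3 + a * x ^ 2 + 0 * x + d by
        rw [hd, hb]; linear_combination (x ^ 2 * t + x * t ^ 2 + a * x * t) * h3] at this
      linear_combination this
    have := coeff_eq_zero_of_forall_sum_eq_zero (n := 9) hq.ge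
      (c := ![d ^ 5 + d, d ^ 2 + 2 * a ^ 3 * d, 2 * a * d ^ 4 + a ^ 5 + a, 2 * a * d + 2 * a ^ 4 + 2 * d ^ 4 + 1,
        2 * d + a ^ 3 + a ^ 2 * d ^ 3, a ^ 2 + 2 * a * d ^ 3, 2 * a + a ^ 3 * d ^ 2 + d ^ 3, 1,
        2 * a ^ 4 * d]) (fun x => by
      have e := hF x
      rw [show (x ^ 3 + a * x ^ 2 + 0 * x + d) ^ 5 = (x ^ 3 + a * x ^ 2 + d) ^ 2 *
        (x ^ 3 + a * x ^ 2 + 0 * x + d) ^ 3 by ring, hcube] at e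
      simp [Fin.sum_univ_succ]
      linear_combination e - ((x ^ 3 + a * x ^ 2 + d) ^ 2 + a ^ 3 * (x ^ 3 + 2 * a * x ^ 2 + a ^ 2 * x + 2 * d)) * h9 x) 7
    simp at this
  subst ha
  have hc := coeff_eq_zero_of_forall_sum_eq_zero (n := 9) hq.ge
    (c := ![c ^ 5 + c, c ^ 2 + b ^ 3 + 2 * b * c ^ 4 + b, b ^ 2 * c ^ 3 + 2 * b * c,
      b ^ 2 + b ^ 3 * c ^ 2 + 2 * c ^ 4 + 1, 2 * c + 2 * b ^ 4 * c + 2 * b * c ^ 3,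
      2 * b + b ^ 5, 2 * b ^ 3 * c + c ^ 3, 1 + 2 * b ^ 4, 0]) (fun x => by
      have e := h5 x
      rw [show (x ^ 3 + 0 * x ^ 2 + b * x + c) ^ 5 = (x ^ 3 + b * x + c) ^ 2 *
        (x ^ 3 + 0 * x ^ 2 + b * x + c) ^ 3 by ring, hcube] at e
      simp [Fin.sum_univ_succ]
      linear_combination e - ((x ^ 3 + b * x + c) ^ 2 + b ^ 3) * h9 x)
  have h6 : 2 * b ^ 3 * c + c ^ 3 = 0 := by simpa using hc 6
  have h3' : b ^ 2 + b ^ 3 * c ^ 2 + 2 * c ^ 4 + 1 = 0 := by simpa using hc 3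
  have hb : b ^ 2 = -1 := by linear_combination h3' - 2 * c * h6 + b ^ 3 * c ^ 2 * h3
  exact ⟨rfl, hb, by linear_combination h6 - 2 * b * c * hb + b * c * h3⟩

theorem HasCurve.tangentQuartic_of_card_nine [Fintype k] (h2 : (2 : k) ≠ 0)
    (hq : Fintype.card k = 9) (hs : SmoothPair 0 (tangentQuartic a₀ a₁ a₂ d₀ d₁ d₂ d₃ e₀ e₁ e₂ e₃ e₄))
    (hR : ∀ P : Fin 3 → k, IsSquare (aeval P (tangentQuartic a₀ a₁ a₂ d₀ d₁ d₂ d₃ e₀ e₁ e₂ e₃ e₄)) →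
      aeval P (tangentQuartic a₀ a₁ a₂ d₀ d₁ d₂ d₃ e₀ e₁ e₂ e₃ e₄) = 0) :
    HasCurve 0 (tangentQuartic a₀ a₁ a₂ d₀ d₁ d₂ d₃ e₀ e₁ e₂ e₃ e₄) := by
  have h3 : (3 : k) = 0 := by
    have : ((Fintype.card k : ℕ) : k) = 0 := FiniteField.cast_card_eq_zero k
    rw [hq] at this
    have e : (3 : k) ^ 2 = 0 := by push_cast at this; linear_combination this
    exact pow_eq_zero_iff two_ne_zero |>.1 e
  have h9 : ∀ x : k, x ^ 9 = x := fun x => by rw [← hq]; exact FiniteField.pow_card x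
  have key : ∀ m : k, _ := fun m => cubic_coeffs_of_card_nine hq h3
    (a := a₂ * m ^ 2 + a₁ * m + a₀) (b := d₃ * m ^ 3 + d₂ * m ^ 2 + d₁ * m + d₀)
    (c := e₄ * m ^ 4 + e₃ * m ^ 3 + e₂ * m ^ 2 + e₁ * m + e₀) fun x => by
      have h := pow_half_card_of_isSquare_imp h2 (hR ![x, 1, m])
      rw [hq, eval_tangentQuartic] at h
      refine h.imp (fun h => ?_) (fun h => ?_)
      · linear_combination h
      · refine Eq.trans (congrArg (· ^ 4) ?_) h
        ring
  have c1 := fun i => coeff_eq_zero_of_forall_sum_eq_zero (n := 3) (by omega) (c := ![a₀, a₁, a₂])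
    (fun m => by simp [Fin.sum_univ_succ]; linear_combination (key m).1) i
  obtain rfl : a₀ = 0 := c1 0
  obtain rfl : a₁ = 0 := c1 1
  obtain rfl : a₂ = 0 := c1 2
  have c2 := fun i => coeff_eq_zero_of_forall_sum_eq_zero (n := 7) (by omega)
    (c := ![d₀ ^ 2 + 1, 2 * d₀ * d₁, d₁ ^ 2 + 2 * d₀ * d₂, 2 * d₀ * d₃ + 2 * d₁ * d₂,
      d₂ ^ 2 + 2 * d₁ * d₃, 2 * d₂ * d₃, d₃ ^ 2])
    (fun m => by simp [Fin.sum_univ_succ]; linear_combination (key m).2.1) i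
  obtain rfl : d₃ = 0 := by simpa using c2 6
  obtain rfl : d₂ = 0 := by simpa using c2 4
  obtain rfl : d₁ = 0 := by simpa using c2 2
  have hd : d₀ ^ 2 + 1 = 0 := c2 0
  have hcube : ∀ p q r s t : k, (p + q + r + s + t) ^ 3 = p ^ 3 + q ^ 3 + r ^ 3 + s ^ 3 + t ^ 3 := by
    have h : ∀ p q : k, (p + q) ^ 3 = p ^ 3 + q ^ 3 := fun p q => by
      linear_combination (p ^ 2 * q + p * q ^ 2) * h3
    intro p q r s t
    rw [h, h, h, h]
  have c3 := fun i => coeff_eq_zero_of_forall_sum_eq_zero (n := 7) (by omega)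
    (c := ![e₀ ^ 3 + d₀ * e₀, e₃ ^ 3 + d₀ * e₁, d₀ * e₂, e₁ ^ 3 + d₀ * e₃, e₄ ^ 3 + d₀ * e₄, 0,
      e₂ ^ 3])
    (fun m => by
      have e := (key m).2.2
      rw [hcube] at e
      simp [Fin.sum_univ_succ]
      linear_combination e - (e₃ ^ 3 + e₄ ^ 3 * m ^ 3) * h9 m) i
  obtain rfl : e₂ = 0 := by simpa using c3 6
  have he4 : e₄ ≠ 0 := by
    rintro rfl
    exact hs.tangentQuartic_ne
  have hd0 : d₀ = -e₄ ^ 2 := by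
    have : e₄ * (e₄ ^ 2 + d₀) = 0 := by
      have : e₄ ^ 3 + d₀ * e₄ = 0 := c3 4
      linear_combination this
    linear_combination (mul_eq_zero.1 this).resolve_left he4
  subst hd0
  have hα : e₄ ^ 4 = -1 := by linear_combination hd
  set t := e₃ / e₄ with ht
  have het : e₃ = e₄ * t := by rw [ht]; field_simp
  have he1 : e₁ = e₄ * t ^ 3 := by
    have : e₃ ^ 3 + -e₄ ^ 2 * e₁ = 0 := c3 1
    rw [het] at this
    have h : e₄ ^ 2 * (e₄ * t ^ 3 - e₁) = 0 := by linear_combination this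
    linear_combination -(mul_eq_zero.1 h).resolve_left (pow_ne_zero 2 he4)
  obtain ⟨v, hv⟩ : ∃ v, v ^ 3 - e₄ ^ 2 * v = e₀ - e₄ * t ^ 4 := by
    have h0 : e₀ ^ 3 + -e₄ ^ 2 * e₀ = 0 := c3 0
    have h1 : (e₀ - e₄ * t ^ 4) * ((e₀ - e₄ * t ^ 4 - e₄) * (e₀ - e₄ * t ^ 4 + e₄)) = 0 := by
      linear_combination h0 - e₄ ^ 3 * t ^ 3 * h9 t +
        (-e₀ ^ 2 * e₄ * t ^ 4 + e₀ * e₄ ^ 2 * t ^ 8) * h3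
    rcases mul_eq_zero.1 h1 with h | h
    · exact ⟨0, by rw [h]; ring⟩
    rcases mul_eq_zero.1 h with h | h
    · exact ⟨-e₄ ^ 3, by linear_combination (-e₄ ^ 5 + 2 * e₄) * hα - h - e₄ * h3⟩
    · exact ⟨e₄ ^ 3, by linear_combination (e₄ ^ 5 - 2 * e₄) * hα - h + e₄ * h3⟩
  rw [het, he1]
  have hM : (!![1, -v, 0; 0, 1, 0; 0, -t, 1] : Matrix (Fin 3) (Fin 3) k).det ≠ 0 := by
    simp [Matrix.det_fin_three]
  refine HasCurve.of_linSubst (exists_mul_eq_one_of_det_ne_zero hM).choose_spec ?_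
  rw [map_zero]
  have e : linSubst !![1, -v, 0; 0, 1, 0; 0, -t, 1]
      (tangentQuartic 0 0 0 (-e₄ ^ 2) 0 0 0 e₀ (e₄ * t ^ 3) 0 (e₄ * t) e₄) =
      tangentQuartic 0 0 0 (-e₄ ^ 2) 0 0 0 0 0 0 0 e₄ := by
    have Hv := congrArg (C : k → MvPolynomial (Fin 3) k) hv
    have H3 := congrArg (C : k → MvPolynomial (Fin 3) k) h3
    simp only [map_sub, map_mul, map_pow, map_ofNat, map_zero] at Hv H3
    simp only [tangentQuartic, linSubst, map_add, map_mul, map_pow, aeval_X, aeval_C, algebraMap_eq,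
      Fin.sum_univ_three, map_zero, map_neg]
    simp
    linear_combination (-X 1 ^ 4) * Hv + (-X 0 ^ 2 * C v * X 1 ^ 2 + X 0 * C v ^ 2 * X 1 ^ 3 +
      C e₄ * (-C t * X 2 ^ 3 * X 1 + C t ^ 2 * X 2 ^ 2 * X 1 ^ 2)) * H3
  rw [e]
  exact HasCurve.tangentQuartic_hermitian h3 hα

end

section

variable {k : Type u} [Field k] {a₀ a₁ a₂ d₀ d₁ d₂ d₃ e₀ e₁ e₂ e₃ e₄ : k}

theorem two_ne_zero_of_three_eq_zero (h3 : (3 : k) = 0) : (2 : k) ≠ 0 := fun h =>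
  one_ne_zero (by linear_combination h3 - h : (1 : k) = 0)

theorem HasCurve.tangentQuartic_quartic_sq (h3 : (3 : k) = 0) :
    HasCurve 0 (tangentQuartic 0 0 0 (-1) 0 0 0 0 0 0 0 (-1) : MvPolynomial (Fin 3) k) := by
  have H3 : (3 : Polynomial k) = 0 := by rw [← map_ofNat Polynomial.C 3, h3, map_zero]
  let t : Polynomial k := Polynomial.X
  refine HasCurve.of_eval (two_ne_zero_of_three_eq_zero h3)
    (x := t ^ 8 + 1)
    (y := -t ^ 4)
    (z := t ^ 7 + t ^ 5 - t ^ 3 - t)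
    (w := t ^ 14 + t ^ 12 - t ^ 4 - t ^ 2) ?_ ?_ ⟨0, 2, ?_⟩
  · rw [aeval_tangentQuartic]
    simp only [map_zero, map_neg, map_one]
    linear_combination (t ^ 28 + 2 * t ^ 26 + t ^ 24 - 4 * t ^ 22 - 5 * t ^ 20 + 2 * t ^ 18 + 8 * t ^ 16 + 2 * t
      ^ 14 - 5 * t ^ 12 - 4 * t ^ 10 + t ^ 8 + 2 * t ^ 6 + t ^ 4) * H3
  · intro h0
    have := congrArg (fun p => Polynomial.coeff p 2) h0
    simp [t, Polynomial.coeff_X, Polynomial.coeff_one, Polynomial.coeff_X_pow] at this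
  · intro h0
    have := congrArg (fun p => Polynomial.coeff p 0) h0
    simp [t, Polynomial.coeff_X, Polynomial.coeff_one] at this

theorem HasCurve.tangentQuartic_conic_sq (h3 : (3 : k) = 0) :
    HasCurve 0 (tangentQuartic (-1) 0 0 (-1) 0 1 0 0 0 0 0 (-1) : MvPolynomial (Fin 3) k) := by
  have H3 : (3 : Polynomial k) = 0 := by rw [← map_ofNat Polynomial.C 3, h3, map_zero]
  let t : Polynomial k := Polynomial.X
  refine HasCurve.of_eval (two_ne_zero_of_three_eq_zero h3)
    (x := 1)
    (y := t ^ 4 + t ^ 2)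
    (z := t ^ 3 + t ^ 2 - t)
    (w := t ^ 6 + t ^ 5 - t ^ 4 - t) ?_ ?_ ⟨0, 2, ?_⟩
  · rw [aeval_tangentQuartic]
    simp only [map_zero, map_neg, map_one]
    linear_combination (t ^ 12 + 2 * t ^ 11 + t ^ 10 - 4 * t ^ 9 + 2 * t ^ 7 + t ^ 6) * H3
  · intro h0
    have := congrArg (fun p => Polynomial.coeff p 1) h0
    simp [t, Polynomial.coeff_X, Polynomial.coeff_one, Polynomial.coeff_X_pow] at this
  · intro h0
    have := congrArg (fun p => Polynomial.coeff p 0) h0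
    simp [t, Polynomial.coeff_X, Polynomial.coeff_one] at this

theorem HasCurve.tangentQuartic_split_sq (h3 : (3 : k) = 0) :
    HasCurve 0 (tangentQuartic 0 0 0 (-1) 0 0 0 0 0 (-1) 1 (-1) : MvPolynomial (Fin 3) k) := by
  have H3 : (3 : Polynomial k) = 0 := by rw [← map_ofNat Polynomial.C 3, h3, map_zero]
  let t : Polynomial k := Polynomial.X
  refine HasCurve.of_eval (two_ne_zero_of_three_eq_zero h3)
    (x := 1)
    (y := -t ^ 4 - t ^ 3 - t ^ 2 - 1)
    (z := t)
    (w := t ^ 6 + t ^ 4 + t ^ 3 + t ^ 2 - t) ?_ ?_ ⟨0, 2, ?_⟩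
  · rw [aeval_tangentQuartic]
    simp only [map_zero, map_neg, map_one]
    linear_combination (-t ^ 11 - t ^ 10 - t ^ 9 - t ^ 8 - 2 * t ^ 7 - t ^ 6 - t ^ 5 - t ^ 4 - t ^ 3) * H3
  · intro h0
    have := congrArg (fun p => Polynomial.coeff p 1) h0
    simp [t, Polynomial.coeff_X, Polynomial.coeff_one, Polynomial.coeff_X_pow] at this
  · intro h0
    have := congrArg (fun p => Polynomial.coeff p 0) h0
    simp [t, Polynomial.coeff_X, Polynomial.coeff_one] at this

theorem HasCurve.tangentQuartic_sum_sq (h3 : (3 : k) = 0) :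
    HasCurve 0 (tangentQuartic 0 0 0 (-1) 0 0 0 (-1) 0 1 0 (-1) : MvPolynomial (Fin 3) k) := by
  have H3 : (3 : Polynomial k) = 0 := by rw [← map_ofNat Polynomial.C 3, h3, map_zero]
  let t : Polynomial k := Polynomial.X
  refine HasCurve.of_eval (two_ne_zero_of_three_eq_zero h3)
    (x := t ^ 8 - t ^ 2 + 1)
    (y := t ^ 6 + t ^ 4 + t ^ 2)
    (z := t ^ 4 - t ^ 2)
    (w := t ^ 15 - t ^ 13 + t ^ 11 - t ^ 9 + t ^ 7 - t ^ 5 + t ^ 3 - t) ?_ ?_ ⟨0, 1, ?_⟩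
  · rw [aeval_tangentQuartic]
    simp only [map_zero, map_neg, map_one]
    linear_combination (-t ^ 28 + t ^ 26 + t ^ 24 + 5 * t ^ 22 + 3 * t ^ 20 + 7 * t ^ 18 + 5 * t ^ 16 + 7 * t ^
      14 + 5 * t ^ 12 + t ^ 10 + t ^ 6) * H3
  · intro h0
    have := congrArg (fun p => Polynomial.coeff p 1) h0
    simp [t, Polynomial.coeff_X, Polynomial.coeff_one, Polynomial.coeff_X_pow] at this
  · intro h0
    have := congrArg (fun p => Polynomial.coeff p 1) h0
    simp [t, Polynomial.coeff_X, Polynomial.coeff_one, Polynomial.mul_coeff_one] at this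
    exact two_ne_zero_of_three_eq_zero h3 (by linear_combination this)

theorem HasCurve.linSubst_of_det {f g : MvPolynomial (Fin 3) k} (h : HasCurve f g)
    {M : Matrix (Fin 3) (Fin 3) k} (hM : M.det ≠ 0) : HasCurve (linSubst M f) (linSubst M g) := by
  obtain ⟨N, hN⟩ := exists_mul_eq_one_of_det_ne_zero hM
  refine HasCurve.of_linSubst (mul_eq_one_comm.1 hN) ?_
  rwa [linSubst_linSubst hN, linSubst_linSubst hN]

theorem HasCurve.tangentQuartic_neg
    (h : HasCurve 0 (tangentQuartic a₀ (-a₁) a₂ d₀ (-d₁) d₂ (-d₃) e₀ (-e₁) e₂ (-e₃) e₄)) :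
    HasCurve 0 (tangentQuartic a₀ a₁ a₂ d₀ d₁ d₂ d₃ e₀ e₁ e₂ e₃ e₄) := by
  have := h.linSubst_of_det (M := !![1, 0, 0; 0, 1, 0; 0, 0, -1]) (by simp [Matrix.det_fin_three])
  rw [map_zero] at this
  convert this using 1
  simp [tangentQuartic, linSubst, Fin.sum_univ_three]
  ring

theorem HasCurve.tangentQuartic_mixed_split (h3 : (3 : k) = 0) :
    HasCurve 0 (tangentQuartic 0 0 0 (-1) 0 0 0 0 1 (-1) 0 (-1) : MvPolynomial (Fin 3) k) := by
  have h := (HasCurve.tangentQuartic_split_sq h3).linSubst_of_det (M := !![1, 0, -1; 0, 1, 0; 0, 0, 1])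
    (by simp only [Matrix.det_fin_three, Matrix.of_apply, Matrix.cons_val]
        exact fun h => one_ne_zero (by linear_combination (1) * h - 0 * h3 : (1 : k) = 0))
  have H3 : (3 : MvPolynomial (Fin 3) k) = 0 := by rw [← map_ofNat C 3, h3, map_zero]
  rw [map_zero] at h
  convert h using 1
  simp [tangentQuartic, linSubst, Fin.sum_univ_three]
  linear_combination -(-X 0 ^ 2 * X 1 * X 2 + X 0 * X 1 * X 2 ^ 2) * H3

theorem HasCurve.tangentQuartic_mixed_quartic (h3 : (3 : k) = 0) :
    HasCurve 0 (tangentQuartic 0 0 0 (-1) 0 0 0 (-1) 1 0 0 (-1) : MvPolynomial (Fin 3) k) := by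
  have h := (HasCurve.tangentQuartic_quartic_sq h3).linSubst_of_det (M := !![0, 1, 0; -1, 0, -1; 0, 1, 1])
    (by simp only [Matrix.det_fin_three, Matrix.of_apply, Matrix.cons_val]
        exact fun h => one_ne_zero (by linear_combination (1) * h - 0 * h3 : (1 : k) = 0))
  have H3 : (3 : MvPolynomial (Fin 3) k) = 0 := by rw [← map_ofNat C 3, h3, map_zero]
  rw [map_zero] at h
  convert h using 1
  simp [tangentQuartic, linSubst, Fin.sum_univ_three]
  linear_combination -(X 0 ^ 2 * X 1 * X 2 + X 0 * X 1 * X 2 ^ 2 - 2 * X 1 ^ 3 * X 2 - 2 * X 1 ^ 2 * X 2 ^ 2 - X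
    1 * X 2 ^ 3) * H3

theorem HasCurve.tangentQuartic_diff_sq (h3 : (3 : k) = 0) :
    HasCurve 0 (tangentQuartic 0 0 0 (-1) 0 0 0 (-1) 0 (-1) 0 (-1) : MvPolynomial (Fin 3) k) := by
  have h := (HasCurve.tangentQuartic_split_sq h3).linSubst_of_det (M := !![1, 0, 0; 0, 1, 0; 0, 1, 1])
    (by simp only [Matrix.det_fin_three, Matrix.of_apply, Matrix.cons_val]
        exact fun h => one_ne_zero (by linear_combination (1) * h - 0 * h3 : (1 : k) = 0))
  have H3 : (3 : MvPolynomial (Fin 3) k) = 0 := by rw [← map_ofNat C 3, h3, map_zero]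
  rw [map_zero] at h
  convert h using 1
  simp [tangentQuartic, linSubst, Fin.sum_univ_three]
  linear_combination -(-X 1 ^ 3 * X 2 - X 1 ^ 2 * X 2 ^ 2 - X 1 * X 2 ^ 3) * H3

theorem HasCurve.tangentQuartic_conic_pos (h3 : (3 : k) = 0) :
    HasCurve 0 (tangentQuartic (-1) 0 0 0 0 1 0 (-1) 0 1 0 (-1) : MvPolynomial (Fin 3) k) := by
  have h := (HasCurve.tangentQuartic_conic_sq h3).linSubst_of_det (M := !![1, 1, 0; 0, 1, 0; 0, 0, 1])
    (by simp only [Matrix.det_fin_three, Matrix.of_apply, Matrix.cons_val]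
        exact fun h => one_ne_zero (by linear_combination (1) * h - 0 * h3 : (1 : k) = 0))
  have H3 : (3 : MvPolynomial (Fin 3) k) = 0 := by rw [← map_ofNat C 3, h3, map_zero]
  rw [map_zero] at h
  convert h using 1
  simp [tangentQuartic, linSubst, Fin.sum_univ_three]
  linear_combination -(X 0 ^ 2 * X 1 ^ 2) * H3

theorem HasCurve.tangentQuartic_conic_neg (h3 : (3 : k) = 0) :
    HasCurve 0 (tangentQuartic (-1) 0 0 0 0 (-1) 0 (-1) 0 (-1) 0 (-1) : MvPolynomial (Fin 3) k) := by
  have h := (HasCurve.tangentQuartic_conic_sq h3).linSubst_of_det (M := !![0, 1, 0; -1, -1, 0; 0, 0, 1])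
    (by simp only [Matrix.det_fin_three, Matrix.of_apply, Matrix.cons_val]
        exact fun h => one_ne_zero (by linear_combination (1) * h - 0 * h3 : (1 : k) = 0))
  have H3 : (3 : MvPolynomial (Fin 3) k) = 0 := by rw [← map_ofNat C 3, h3, map_zero]
  rw [map_zero] at h
  convert h using 1
  simp [tangentQuartic, linSubst, Fin.sum_univ_three]
  linear_combination -(X 0 ^ 2 * X 1 ^ 2) * H3

theorem HasCurve.tangentQuartic_conic_pos_shift (h3 : (3 : k) = 0) :
    HasCurve 0 (tangentQuartic (-1) 0 0 0 0 1 0 (-1) (-1) 1 1 (-1) : MvPolynomial (Fin 3) k) := by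
  have h := (HasCurve.tangentQuartic_conic_sq h3).linSubst_of_det (M := !![1, 0, 1; 0, 1, 0; 0, 1, 1])
    (by simp only [Matrix.det_fin_three, Matrix.of_apply, Matrix.cons_val]
        exact fun h => one_ne_zero (by linear_combination (1) * h - 0 * h3 : (1 : k) = 0))
  have H3 : (3 : MvPolynomial (Fin 3) k) = 0 := by rw [← map_ofNat C 3, h3, map_zero]
  rw [map_zero] at h
  convert h using 1
  simp [tangentQuartic, linSubst, Fin.sum_univ_three]
  linear_combination -(X 0 ^ 2 * X 1 * X 2 + X 0 * X 1 * X 2 ^ 2 - X 1 ^ 3 * X 2 - 2 * X 1 ^ 2 * X 2 ^ 2 - X 1 *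
    X 2 ^ 3) * H3

theorem HasCurve.tangentQuartic_conic_neg_shift (h3 : (3 : k) = 0) :
    HasCurve 0 (tangentQuartic (-1) 0 0 0 0 (-1) 0 (-1) (-1) (-1) 1 (-1) : MvPolynomial (Fin 3) k) := by
  have h := (HasCurve.tangentQuartic_conic_sq h3).linSubst_of_det (M := !![0, 1, 0; -1, 1, -1; 0, 1, -1])
    (by simp only [Matrix.det_fin_three, Matrix.of_apply, Matrix.cons_val]
        exact fun h => one_ne_zero (by linear_combination (-1) * h - 0 * h3 : (1 : k) = 0))
  have H3 : (3 : MvPolynomial (Fin 3) k) = 0 := by rw [← map_ofNat C 3, h3, map_zero]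
  rw [map_zero] at h
  convert h using 1
  simp [tangentQuartic, linSubst, Fin.sum_univ_three]
  linear_combination -(-X 0 ^ 2 * X 1 ^ 2 + X 0 ^ 2 * X 1 * X 2 + X 0 * X 1 ^ 3 - 2 * X 0 * X 1 ^ 2 * X 2 + X 0 *
    X 1 * X 2 ^ 2 + 2 * X 1 ^ 3 * X 2 - 2 * X 1 ^ 2 * X 2 ^ 2 + X 1 * X 2 ^ 3) * H3

theorem HasCurve.tangentQuartic_bitangent_split (h3 : (3 : k) = 0) :
    HasCurve 0 (tangentQuartic 0 0 (-1) (-1) 0 0 0 0 1 0 (-1) 0 : MvPolynomial (Fin 3) k) := by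
  have h := (HasCurve.tangentQuartic_split_sq h3).linSubst_of_det (M := !![0, 1, 0; -1, 0, 1; 0, 0, -1])
    (by simp only [Matrix.det_fin_three, Matrix.of_apply, Matrix.cons_val]
        exact fun h => one_ne_zero (by linear_combination (-1) * h - 0 * h3 : (1 : k) = 0))
  have H3 : (3 : MvPolynomial (Fin 3) k) = 0 := by rw [← map_ofNat C 3, h3, map_zero]
  rw [map_zero] at h
  convert h using 1
  simp [tangentQuartic, linSubst, Fin.sum_univ_three]
  linear_combination -(-X 0 ^ 2 * X 1 * X 2 + X 0 * X 1 * X 2 ^ 2 + X 0 * X 2 ^ 3 - X 2 ^ 4) * H3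

theorem HasCurve.tangentQuartic_bitangent_conic (h3 : (3 : k) = 0) :
    HasCurve 0 (tangentQuartic 0 0 (-1) (-1) 1 0 0 (-1) 1 0 (-1) 0 : MvPolynomial (Fin 3) k) := by
  have h := (HasCurve.tangentQuartic_conic_sq h3).linSubst_of_det (M := !![1, -1, -1; -1, -1, 1; 1, 0, 1])
    (by simp only [Matrix.det_fin_three, Matrix.of_apply, Matrix.cons_val]
        exact fun h => one_ne_zero (by linear_combination (-4) * h - 5 * h3 : (1 : k) = 0))
  have H3 : (3 : MvPolynomial (Fin 3) k) = 0 := by rw [← map_ofNat C 3, h3, map_zero]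
  rw [map_zero] at h
  convert h using 1
  simp [tangentQuartic, linSubst, Fin.sum_univ_three]
  linear_combination -(-X 0 ^ 4 + X 0 ^ 3 * X 1 + X 0 ^ 2 * X 1 ^ 2 - 4 * X 0 ^ 2 * X 1 * X 2 - 3 * X 0 ^ 2 * X 2
    ^ 2 - X 0 * X 1 ^ 3 - X 0 * X 1 ^ 2 * X 2 + 4 * X 0 * X 1 * X 2 ^ 2 + X 1 ^ 3 * X 2 + X 1
    ^ 2 * X 2 ^ 2 - X 1 * X 2 ^ 3 - X 2 ^ 4) * H3

theorem HasCurve.of_tangent_line (h2 : (2 : k) ≠ 0) {g : MvPolynomial (Fin 3) k} {u v : Fin 3 → k}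
    {c₃ c₄ : k} (huv : ∃ i j, u i * v j ≠ u j * v i)
    (h : ∀ X Y : Polynomial k, aeval (fun i => X * .C (u i) + Y * .C (v i)) g =
      Y ^ 2 * (X ^ 2 + .C c₃ * (X * Y) + .C c₄ * Y ^ 2)) : HasCurve 0 g := by
  have h2' : (2 : Polynomial k) ≠ 0 := by
    rw [← map_ofNat Polynomial.C 2]; exact Polynomial.C_ne_zero.2 h2
  let s : Polynomial k := Polynomial.X
  set X : Polynomial k := .C c₄ - s ^ 2 with hX
  set Y : Polynomial k := 2 * s - .C c₃ with hY
  have hmin : s ^ 2 - .C c₃ * s + .C c₄ ≠ 0 := fun h0 => by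
    have := congrArg (fun p => Polynomial.coeff p 2) h0
    simp [s, Polynomial.coeff_X, Polynomial.coeff_C] at this
  have hXY : X * Polynomial.derivative Y - Y * Polynomial.derivative X =
      2 * (s ^ 2 - .C c₃ * s + .C c₄) := by
    have hd : Polynomial.derivative (2 : Polynomial k) = 0 := Polynomial.derivative_ofNat 2
    simp only [hX, hY, s, Polynomial.derivative_sub, Polynomial.derivative_mul, hd,
      Polynomial.derivative_C, Polynomial.derivative_X_pow, Polynomial.derivative_X]
    norm_num
    rw [map_ofNat]
    ring
  refine ⟨fun i => X * .C (u i) + Y * .C (v i), Y * (.C c₄ + s ^ 2 - .C c₃ * s), ?_, ?_, ?_⟩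
  · rw [h, map_zero, hX, hY]; ring
  · rw [map_zero, add_zero]
    refine mul_ne_zero h2' (mul_ne_zero (fun h0 => ?_) fun h0 => hmin (by linear_combination h0))
    have := congrArg (fun p => Polynomial.coeff p 1) h0
    simp [hY, s, Polynomial.coeff_C, h2] at this
  · obtain ⟨i, j, hij⟩ := huv
    refine ⟨i, j, fun h0 => ?_⟩
    simp only [Polynomial.derivative_add, Polynomial.derivative_mul, Polynomial.derivative_C] at h0
    have e : Polynomial.C (u i * v j - u j * v i) * (2 * (s ^ 2 - .C c₃ * s + .C c₄)) = 0 := by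
      rw [← hXY, map_sub, map_mul, map_mul]
      linear_combination h0
    rcases mul_eq_zero.1 e with e | e
    · exact hij (sub_eq_zero.1 (Polynomial.C_eq_zero.1 e))
    · exact mul_ne_zero h2' hmin e

end

section

variable {k : Type u} [Field k] {a₀ a₁ a₂ d₀ d₁ d₂ d₃ e₀ e₁ e₂ e₃ e₄ : k}

/-- The directional derivative of `tangentQuartic` at `(x, z, y)` along `(x', z', y')`. -/
def tangentQuarticGrad {R : Type*} [CommRing R] (a₀ a₁ a₂ d₀ d₁ d₂ d₃ e₀ e₁ e₂ e₃ e₄ x z y x' z' y' : R) : R :=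
  3 * x ^ 2 * x' * z + x ^ 3 * z' + 2 * x * x' * (a₀ * z ^ 2 + a₁ * (z * y) + a₂ * y ^ 2) +
    x ^ 2 * (2 * a₀ * z * z' + a₁ * (z * y' + z' * y) + 2 * a₂ * y * y') +
    x' * (d₀ * z ^ 3 + d₁ * (z ^ 2 * y) + d₂ * (z * y ^ 2) + d₃ * y ^ 3) +
    x * (3 * d₀ * z ^ 2 * z' + d₁ * (2 * z * z' * y + z ^ 2 * y') + d₂ * (z' * y ^ 2 + 2 * z * y * y') +
      3 * d₃ * y ^ 2 * y') +
    (4 * e₀ * z ^ 3 * z' + e₁ * (3 * z ^ 2 * z' * y + z ^ 3 * y') +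
      e₂ * (2 * z * z' * y ^ 2 + 2 * z ^ 2 * y * y') + e₃ * (z' * y ^ 3 + 3 * z * y ^ 2 * y') +
      4 * e₄ * y ^ 3 * y')

/-- The second order Taylor term of `tangentQuartic` at `(x, z, y)` along `(x', z', y')`. -/
def tangentQuarticHess {R : Type*} [CommRing R] (a₀ a₁ a₂ d₀ d₁ d₂ d₃ e₀ e₁ e₂ e₃ e₄ x z y x' z' y' : R) : R :=
  3 * x * x' ^ 2 * z + 3 * x ^ 2 * x' * z' + x' ^ 2 * (a₀ * z ^ 2 + a₁ * (z * y) + a₂ * y ^ 2) +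
    2 * x * x' * (2 * a₀ * z * z' + a₁ * (z * y' + z' * y) + 2 * a₂ * y * y') +
    x ^ 2 * (a₀ * z' ^ 2 + a₁ * (z' * y') + a₂ * y' ^ 2) +
    x' * (3 * d₀ * z ^ 2 * z' + d₁ * (2 * z * z' * y + z ^ 2 * y') + d₂ * (z' * y ^ 2 + 2 * z * y * y') +
      3 * d₃ * y ^ 2 * y') +
    x * (3 * d₀ * z * z' ^ 2 + d₁ * (z' ^ 2 * y + 2 * z * z' * y') + d₂ * (2 * z' * y * y' + z * y' ^ 2) +
      3 * d₃ * y * y' ^ 2) +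
    (6 * e₀ * z ^ 2 * z' ^ 2 + e₁ * (3 * z * z' ^ 2 * y + 3 * z ^ 2 * z' * y') +
      e₂ * (z' ^ 2 * y ^ 2 + 4 * z * z' * y * y' + z ^ 2 * y' ^ 2) +
      e₃ * (3 * z' * y ^ 2 * y' + 3 * z * y * y' ^ 2) + 6 * e₄ * y ^ 2 * y' ^ 2)

theorem SmoothPair.tangentQuartic_grad_ne
    (hs : SmoothPair 0 (tangentQuartic a₀ a₁ a₂ d₀ d₁ d₂ d₃ e₀ e₁ e₂ e₃ e₄)) {x z y : k}
    (hP : ¬(x = 0 ∧ z = 0 ∧ y = 0))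
    (h : x ^ 3 * z + x ^ 2 * (a₀ * z ^ 2 + a₁ * (z * y) + a₂ * y ^ 2) +
      x * (d₀ * z ^ 3 + d₁ * (z ^ 2 * y) + d₂ * (z * y ^ 2) + d₃ * y ^ 3) +
      (e₀ * z ^ 4 + e₁ * (z ^ 3 * y) + e₂ * (z ^ 2 * y ^ 2) + e₃ * (z * y ^ 3) + e₄ * y ^ 4) = 0)
    (h₀ : tangentQuarticGrad a₀ a₁ a₂ d₀ d₁ d₂ d₃ e₀ e₁ e₂ e₃ e₄ x z y 1 0 0 = 0)
    (h₁ : tangentQuarticGrad a₀ a₁ a₂ d₀ d₁ d₂ d₃ e₀ e₁ e₂ e₃ e₄ x z y 0 1 0 = 0)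
    (h₂ : tangentQuarticGrad a₀ a₁ a₂ d₀ d₁ d₂ d₃ e₀ e₁ e₂ e₃ e₄ x z y 0 0 1 = 0) : False := by
  refine hs.false_of_grad (Ω := k) (P := ![x, z, y])
    (fun h => hP ⟨by simpa using congrFun h 0, by simpa using congrFun h 1,
      by simpa using congrFun h 2⟩) (by rw [eval_tangentQuartic, h]) ?_
  simp only [tangentQuarticGrad] at h₀ h₁ h₂
  intro i
  fin_cases i
  · simp [tangentQuartic, pderiv_X, Derivation.leibniz, Derivation.leibniz_pow]
    linear_combination h₀
  · simp [tangentQuartic, pderiv_X, Derivation.leibniz, Derivation.leibniz_pow]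
    linear_combination h₁
  · simp [tangentQuartic, pderiv_X, Derivation.leibniz, Derivation.leibniz_pow]
    linear_combination h₂

theorem HasCurve.tangentQuartic_of_tangent_line (h2 : (2 : k) ≠ 0) {x z y x' z' y' : k}
    (hP : ¬(x * z' = z * x' ∧ x * y' = y * x' ∧ z * y' = y * z'))
    (h : x ^ 3 * z + x ^ 2 * (a₀ * z ^ 2 + a₁ * (z * y) + a₂ * y ^ 2) +
      x * (d₀ * z ^ 3 + d₁ * (z ^ 2 * y) + d₂ * (z * y ^ 2) + d₃ * y ^ 3) +
      (e₀ * z ^ 4 + e₁ * (z ^ 3 * y) + e₂ * (z ^ 2 * y ^ 2) + e₃ * (z * y ^ 3) + e₄ * y ^ 4) = 0)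
    (h₁ : tangentQuarticGrad a₀ a₁ a₂ d₀ d₁ d₂ d₃ e₀ e₁ e₂ e₃ e₄ x z y x' z' y' = 0)
    (h₂ : tangentQuarticHess a₀ a₁ a₂ d₀ d₁ d₂ d₃ e₀ e₁ e₂ e₃ e₄ x z y x' z' y' = 1) :
    HasCurve 0 (tangentQuartic a₀ a₁ a₂ d₀ d₁ d₂ d₃ e₀ e₁ e₂ e₃ e₄) := by
  refine HasCurve.of_tangent_line h2 (u := ![x, z, y]) (v := ![x', z', y'])
    (c₃ := tangentQuarticGrad a₀ a₁ a₂ d₀ d₁ d₂ d₃ e₀ e₁ e₂ e₃ e₄ x' z' y' x z y)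
    (c₄ := x' ^ 3 * z' + x' ^ 2 * (a₀ * z' ^ 2 + a₁ * (z' * y') + a₂ * y' ^ 2) +
      x' * (d₀ * z' ^ 3 + d₁ * (z' ^ 2 * y') + d₂ * (z' * y' ^ 2) + d₃ * y' ^ 3) +
      (e₀ * z' ^ 4 + e₁ * (z' ^ 3 * y') + e₂ * (z' ^ 2 * y' ^ 2) + e₃ * (z' * y' ^ 3) +
        e₄ * y' ^ 4)) ?_ fun S T => ?_
  · by_contra! hc
    exact hP ⟨hc 0 1, hc 0 2, hc 1 2⟩
  · have e : (fun i => S * Polynomial.C (![x, z, y] i) + T * Polynomial.C (![x', z', y'] i)) =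
        ![S * .C x + T * .C x', S * .C z + T * .C z', S * .C y + T * .C y'] := by
      ext1 i; fin_cases i <;> rfl
    have H := congrArg (Polynomial.C (R := k)) h
    have H₁ := congrArg (Polynomial.C (R := k)) h₁
    have H₂ := congrArg (Polynomial.C (R := k)) h₂
    rw [e, aeval_tangentQuartic]
    simp only [tangentQuarticGrad, tangentQuarticHess, map_add, map_mul, map_pow, map_zero, map_one,
      map_ofNat, Polynomial.algebraMap_eq] at H H₁ H₂ ⊢
    linear_combination S ^ 4 * H + S ^ 3 * T * H₁ + S ^ 2 * T ^ 2 * H₂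

theorem linSubst_tangentQuartic_shear₀₁ (t : k) : linSubst !![1, t, 0; 0, 1, 0; 0, 0, 1]
    (tangentQuartic a₀ a₁ a₂ d₀ d₁ d₂ d₃ e₀ e₁ e₂ e₃ e₄) =
    tangentQuartic (a₀ + 3 * t) a₁ a₂ (d₀ + 3 * t ^ 2 + 2 * t * a₀) (d₁ + 2 * t * a₁)
      (d₂ + 2 * t * a₂) d₃ (e₀ + t ^ 3 + t ^ 2 * a₀ + t * d₀) (e₁ + t ^ 2 * a₁ + t * d₁)
      (e₂ + t ^ 2 * a₂ + t * d₂) (e₃ + t * d₃) e₄ := by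
  simp only [tangentQuartic, linSubst, map_add, map_mul, map_pow, aeval_X, aeval_C, algebraMap_eq,
    Fin.sum_univ_three, map_ofNat]
  simp
  ring

theorem linSubst_tangentQuartic_shear₂₁ (t : k) : linSubst !![1, 0, 0; 0, 1, 0; 0, t, 1]
    (tangentQuartic a₀ a₁ a₂ d₀ d₁ d₂ d₃ e₀ e₁ e₂ e₃ e₄) =
    tangentQuartic (a₀ + t * a₁ + t ^ 2 * a₂) (a₁ + 2 * t * a₂) a₂
      (d₀ + t * d₁ + t ^ 2 * d₂ + t ^ 3 * d₃) (d₁ + 2 * t * d₂ + 3 * t ^ 2 * d₃) (d₂ + 3 * t * d₃) d₃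
      (e₀ + t * e₁ + t ^ 2 * e₂ + t ^ 3 * e₃ + t ^ 4 * e₄)
      (e₁ + 2 * t * e₂ + 3 * t ^ 2 * e₃ + 4 * t ^ 3 * e₄) (e₂ + 3 * t * e₃ + 6 * t ^ 2 * e₄)
      (e₃ + 4 * t * e₄) e₄ := by
  simp only [tangentQuartic, linSubst, map_add, map_mul, map_pow, aeval_X, aeval_C, algebraMap_eq,
    Fin.sum_univ_three, map_ofNat]
  simp
  ring

end

section

variable {a₀ a₁ a₂ d₀ d₁ d₂ d₃ e₀ e₁ e₂ e₃ e₄ : ZMod 3}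

/-- The quartic has a singular point or a tangent line with a square leading coefficient. -/
def TangentQuarticGood (a₀ a₁ a₂ d₀ d₁ d₂ d₃ e₀ e₁ e₂ e₃ e₄ : ZMod 3) : Prop :=
  ∃ x z y : ZMod 3, x ^ 3 * z + x ^ 2 * (a₀ * z ^ 2 + a₁ * (z * y) + a₂ * y ^ 2) +
      x * (d₀ * z ^ 3 + d₁ * (z ^ 2 * y) + d₂ * (z * y ^ 2) + d₃ * y ^ 3) +
      (e₀ * z ^ 4 + e₁ * (z ^ 3 * y) + e₂ * (z ^ 2 * y ^ 2) + e₃ * (z * y ^ 3) + e₄ * y ^ 4) = 0 ∧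
    ((¬(x = 0 ∧ z = 0 ∧ y = 0) ∧
      tangentQuarticGrad a₀ a₁ a₂ d₀ d₁ d₂ d₃ e₀ e₁ e₂ e₃ e₄ x z y 1 0 0 = 0 ∧
      tangentQuarticGrad a₀ a₁ a₂ d₀ d₁ d₂ d₃ e₀ e₁ e₂ e₃ e₄ x z y 0 1 0 = 0 ∧
      tangentQuarticGrad a₀ a₁ a₂ d₀ d₁ d₂ d₃ e₀ e₁ e₂ e₃ e₄ x z y 0 0 1 = 0) ∨
    ∃ x' z' y' : ZMod 3,
      tangentQuarticHess a₀ a₁ a₂ d₀ d₁ d₂ d₃ e₀ e₁ e₂ e₃ e₄ x z y x' z' y' = 1 ∧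
      tangentQuarticGrad a₀ a₁ a₂ d₀ d₁ d₂ d₃ e₀ e₁ e₂ e₃ e₄ x z y x' z' y' = 0 ∧
      ¬(x * z' = z * x' ∧ x * y' = y * x' ∧ z * y' = y * z'))

instance : Decidable (TangentQuarticGood a₀ a₁ a₂ d₀ d₁ d₂ d₃ e₀ e₁ e₂ e₃ e₄) := by
  unfold TangentQuarticGood; infer_instance

theorem HasCurve.tangentQuartic_of_good (hs : SmoothPair 0 (tangentQuartic a₀ a₁ a₂ d₀ d₁ d₂ d₃ e₀ e₁ e₂ e₃ e₄))
    (h : TangentQuarticGood a₀ a₁ a₂ d₀ d₁ d₂ d₃ e₀ e₁ e₂ e₃ e₄) :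
    HasCurve 0 (tangentQuartic a₀ a₁ a₂ d₀ d₁ d₂ d₃ e₀ e₁ e₂ e₃ e₄) := by
  obtain ⟨x, z, y, h, ⟨hP, h₀, h₁, h₂⟩ | ⟨x', z', y', h₂, h₁, hP⟩⟩ := h
  · exact (hs.tangentQuartic_grad_ne hP h h₀ h₁ h₂).elim
  · exact HasCurve.tangentQuartic_of_tangent_line (by decide) hP h h₁ h₂

/-- The quartic takes no nonzero square value off the tangent line. -/
def TangentQuarticNonsquare (a₀ a₁ a₂ d₀ d₁ d₂ e₀ e₁ e₂ e₃ e₄ : ZMod 3) : Prop :=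
  ∀ y x : ZMod 3, x ^ 3 + x ^ 2 * (a₀ + a₁ * y + a₂ * y ^ 2) +
      x * (d₀ + d₁ * y + d₂ * y ^ 2) + (e₀ + e₁ * y + e₂ * y ^ 2 + e₃ * y ^ 3 + e₄ * y ^ 4) ≠ 1

instance : Decidable (TangentQuarticNonsquare a₀ a₁ a₂ d₀ d₁ d₂ e₀ e₁ e₂ e₃ e₄) := by
  unfold TangentQuarticNonsquare; infer_instance

theorem zmod_three_hyperflex_bilinear : ∀ d₀ e₀ : ZMod 3, (∀ x, x ^ 3 + x * d₀ + e₀ ≠ 1) →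
    ∀ a₁ e₁ e₂ e₃ : ZMod 3, a₁ ≠ 0 → TangentQuarticNonsquare 0 a₁ 0 d₀ 0 0 e₀ e₁ e₂ e₃ (-1) →
    TangentQuarticGood 0 a₁ 0 d₀ 0 0 0 e₀ e₁ e₂ e₃ (-1) := by
  decide +kernel

theorem zmod_three_hyperflex_flat : ∀ d₀ e₀ : ZMod 3, (∀ x, x ^ 3 + x * d₀ + e₀ ≠ 1) →
    ∀ d₁ d₂ e₁ e₂ e₃ : ZMod 3, TangentQuarticNonsquare 0 0 0 d₀ d₁ d₂ e₀ e₁ e₂ e₃ (-1) →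
    d₀ = -1 ∧ d₁ = 0 ∧ d₂ = 0 := by
  decide +kernel

theorem zmod_three_hyperflex_flat_cases : ∀ e₀ e₁ e₂ : ZMod 3,
    TangentQuarticNonsquare 0 0 0 (-1) 0 0 e₀ e₁ e₂ 0 (-1) →
    (e₀, e₁, e₂) = (0, 0, 0) ∨ (e₀, e₁, e₂) = (0, 1, -1) ∨ (e₀, e₁, e₂) = (0, -1, -1) ∨
    (e₀, e₁, e₂) = (-1, 1, 0) ∨ (e₀, e₁, e₂) = (-1, -1, 0) ∨ (e₀, e₁, e₂) = (-1, 0, 1) ∨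
    (e₀, e₁, e₂) = (-1, 0, -1) ∨ TangentQuarticGood 0 0 0 (-1) 0 0 0 e₀ e₁ e₂ 0 (-1) := by
  decide +kernel

theorem zmod_three_hyperflex_conic : ∀ a₀ e₀ : ZMod 3, a₀ ≠ 0 → (∀ x, x ^ 3 + x ^ 2 * a₀ + e₀ ≠ 1) →
    ∀ d₂ e₁ e₂ e₃ : ZMod 3, TangentQuarticNonsquare a₀ 0 0 0 0 d₂ e₀ e₁ e₂ e₃ (-1) →
    (a₀ = -1 ∧ d₂ = 1 ∧ e₀ = -1 ∧ e₁ = -e₃ ∧ e₂ = 1) ∨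
    (a₀ = -1 ∧ d₂ = -1 ∧ e₀ = -1 ∧ e₁ = -e₃ ∧ e₂ = -1) ∨
    TangentQuarticGood a₀ 0 0 0 0 d₂ 0 e₀ e₁ e₂ e₃ (-1) := by
  decide +kernel

set_option synthInstance.maxSize 1000 in
set_option synthInstance.maxHeartbeats 200000 in
theorem zmod_three_bitangent : ∀ a₀ d₀ e₀ : ZMod 3, (∀ x, x ^ 3 + x ^ 2 * a₀ + x * d₀ + e₀ ≠ 1) →
    ∀ d₁ e₁ e₂ e₃ : ZMod 3, TangentQuarticNonsquare a₀ 0 (-1) d₀ d₁ 0 e₀ e₁ e₂ e₃ 0 →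
    (a₀ = 0 ∧ d₀ = -1 ∧ e₀ = -d₁ ^ 2 ∧ e₁ = -e₃ ∧ e₂ = 0 ∧ e₃ ≠ 0) ∨
    TangentQuarticGood a₀ 0 (-1) d₀ d₁ 0 0 e₀ e₁ e₂ e₃ 0 := by
  decide +kernel

theorem forall_tangentQuartic_linSubst_ne_one {g : MvPolynomial (Fin 3) (ZMod 3)}
    (h : ∀ P : Fin 3 → ZMod 3, aeval P g ≠ 1) (M : Matrix (Fin 3) (Fin 3) (ZMod 3)) (P : Fin 3 → ZMod 3) :
    aeval P (linSubst M g) ≠ 1 := by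
  rw [aeval_linSubst]
  exact h _

theorem tangentQuarticNonsquare_of_forall_ne_one
    (h : ∀ P : Fin 3 → ZMod 3, aeval P (tangentQuartic a₀ a₁ a₂ d₀ d₁ d₂ d₃ e₀ e₁ e₂ e₃ e₄) ≠ 1)
    (hd : d₃ = 0) : TangentQuarticNonsquare a₀ a₁ a₂ d₀ d₁ d₂ e₀ e₁ e₂ e₃ e₄ := by
  intro y x h'
  refine h ![x, 1, y] ?_
  rw [eval_tangentQuartic, hd]
  linear_combination h'

theorem TangentQuarticNonsquare.line_zero
    (h : TangentQuarticNonsquare a₀ a₁ a₂ d₀ d₁ d₂ e₀ e₁ e₂ e₃ e₄) (x : ZMod 3) :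
    x ^ 3 + x ^ 2 * a₀ + x * d₀ + e₀ ≠ 1 := fun h' => h 0 x (by linear_combination h')

theorem HasCurve.tangentQuartic_of_hyperflex
    (hs : SmoothPair 0 (tangentQuartic a₀ a₁ 0 d₀ d₁ d₂ 0 e₀ e₁ e₂ e₃ (-1)))
    (hR : ∀ P : Fin 3 → ZMod 3, aeval P (tangentQuartic a₀ a₁ 0 d₀ d₁ d₂ 0 e₀ e₁ e₂ e₃ (-1)) ≠ 1) :
    HasCurve 0 (tangentQuartic a₀ a₁ 0 d₀ d₁ d₂ 0 e₀ e₁ e₂ e₃ (-1)) := by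
  have h3 : (3 : ZMod 3) = 0 := by decide
  have hsq : ∀ a : ZMod 3, a ≠ 0 → a * a = 1 := by decide
  have hcube : ∀ a : ZMod 3, a ^ 3 - a = 0 := by decide
  have hel : ∀ a : ZMod 3, a = 0 ∨ a = 1 ∨ a = -1 := by decide
  by_cases ha₁ : a₁ = 0
  · subst ha₁
    by_cases ha₀ : a₀ = 0
    · subst ha₀
      have hN := tangentQuarticNonsquare_of_forall_ne_one hR rfl
      obtain ⟨rfl, rfl, rfl⟩ := zmod_three_hyperflex_flat d₀ e₀
        (fun x h => hN.line_zero x (by linear_combination h)) _ _ _ _ _ hN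
      refine HasCurve.of_det_ne_zero (M := !![1, 0, -e₃; 0, 1, 0; 0, 0, 1])
        (by simp [Matrix.det_fin_three]) hs fun hs => ?_
      replace hR := forall_tangentQuartic_linSubst_ne_one hR !![1, 0, -e₃; 0, 1, 0; 0, 0, 1]
      rw [map_zero, linSubst_tangentQuartic] at hs ⊢
      rw [linSubst_tangentQuartic] at hR
      have hc : e₃ + (-e₃) ^ 3 + (-e₃) ^ 2 * 0 + -e₃ * 0 = 0 := by linear_combination -hcube e₃
      rw [hc] at hs hR ⊢
      simp only [h3, zero_mul, mul_zero, add_zero] at hs hR ⊢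
      generalize e₁ + -e₃ * -1 = e₁ at hs hR ⊢
      rcases zmod_three_hyperflex_flat_cases e₀ e₁ e₂
        (tangentQuarticNonsquare_of_forall_ne_one hR rfl) with h | h | h | h | h | h | h | h
      all_goals first
        | exact HasCurve.tangentQuartic_of_good hs h
        | (simp only [Prod.mk.injEq] at h; obtain ⟨rfl, rfl, rfl⟩ := h)
      · exact HasCurve.tangentQuartic_quartic_sq h3
      · exact HasCurve.tangentQuartic_mixed_split h3
      · apply HasCurve.tangentQuartic_neg
        simpa using HasCurve.tangentQuartic_mixed_split h3
      · exact HasCurve.tangentQuartic_mixed_quartic h3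
      · apply HasCurve.tangentQuartic_neg
        simpa using HasCurve.tangentQuartic_mixed_quartic h3
      · exact HasCurve.tangentQuartic_sum_sq h3
      · exact HasCurve.tangentQuartic_diff_sq h3
    · have hc : ∀ d : ZMod 3, d + 2 * (a₀ * d) * a₀ = 0 := fun d => by
        linear_combination 2 * d * hsq a₀ ha₀ + d * h3
      refine HasCurve.of_det_ne_zero (M := !![1, a₀ * d₀, 0; 0, 1, 0; 0, 0, 1])
        (by simp [Matrix.det_fin_three]) hs fun hs => ?_
      replace hR := forall_tangentQuartic_linSubst_ne_one hR !![1, a₀ * d₀, 0; 0, 1, 0; 0, 0, 1]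
      rw [map_zero, linSubst_tangentQuartic_shear₀₁] at hs ⊢
      rw [linSubst_tangentQuartic_shear₀₁] at hR
      simp only [h3, zero_mul, mul_zero, add_zero, hc] at hs hR ⊢
      generalize e₀ + (a₀ * d₀) ^ 3 + (a₀ * d₀) ^ 2 * a₀ + a₀ * d₀ * d₀ = e₀ at hs hR ⊢
      generalize e₁ + a₀ * d₀ * d₁ = e₁ at hs hR ⊢
      generalize e₂ + a₀ * d₀ * d₂ = e₂ at hs hR ⊢
      refine HasCurve.of_det_ne_zero (M := !![1, 0, a₀ * d₁; 0, 1, 0; 0, 0, 1])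
        (by simp [Matrix.det_fin_three]) hs fun hs => ?_
      replace hR := forall_tangentQuartic_linSubst_ne_one hR !![1, 0, a₀ * d₁; 0, 1, 0; 0, 0, 1]
      rw [map_zero, linSubst_tangentQuartic] at hs ⊢
      rw [linSubst_tangentQuartic] at hR
      simp only [h3, zero_mul, mul_zero, add_zero, hc] at hs hR ⊢
      generalize e₂ + (a₀ * d₁) ^ 2 * a₀ + a₀ * d₁ * d₁ = e₂ at hs hR ⊢
      generalize e₃ + (a₀ * d₁) ^ 3 + a₀ * d₁ * d₂ = e₃ at hs hR ⊢
      have hN := tangentQuarticNonsquare_of_forall_ne_one hR rfl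
      rcases zmod_three_hyperflex_conic a₀ e₀ ha₀ (fun x h => hN.line_zero x (by linear_combination h))
        _ _ _ _ hN with ⟨rfl, rfl, rfl, rfl, rfl⟩ | ⟨rfl, rfl, rfl, rfl, rfl⟩ | h
      · obtain rfl | rfl | rfl : e₃ = 0 ∨ e₃ = 1 ∨ e₃ = -1 := hel e₃
        · simpa using HasCurve.tangentQuartic_conic_pos h3
        · exact HasCurve.tangentQuartic_conic_pos_shift h3
        · apply HasCurve.tangentQuartic_neg
          simpa using HasCurve.tangentQuartic_conic_pos_shift h3
      · obtain rfl | rfl | rfl : e₃ = 0 ∨ e₃ = 1 ∨ e₃ = -1 := hel e₃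
        · simpa using HasCurve.tangentQuartic_conic_neg h3
        · exact HasCurve.tangentQuartic_conic_neg_shift h3
        · apply HasCurve.tangentQuartic_neg
          simpa using HasCurve.tangentQuartic_conic_neg_shift h3
      · exact HasCurve.tangentQuartic_of_good hs h
  · have hc : ∀ d : ZMod 3, d + 2 * (a₁ * d) * a₁ = 0 := fun d => by
      linear_combination 2 * d * hsq a₁ ha₁ + d * h3
    have hc' : a₀ + -(a₁ * a₀) * a₁ = 0 := by linear_combination - a₀ * hsq a₁ ha₁
    refine HasCurve.of_det_ne_zero (M := !![1, 0, 0; 0, 1, 0; 0, -(a₁ * a₀), 1])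
      (by simp [Matrix.det_fin_three]) hs fun hs => ?_
    replace hR := forall_tangentQuartic_linSubst_ne_one hR !![1, 0, 0; 0, 1, 0; 0, -(a₁ * a₀), 1]
    rw [map_zero, linSubst_tangentQuartic_shear₂₁] at hs ⊢
    rw [linSubst_tangentQuartic_shear₂₁] at hR
    simp only [mul_zero, add_zero, hc'] at hs hR ⊢
    generalize d₀ + _ + _ = d₀ at hs hR ⊢
    generalize d₁ + _ = d₁ at hs hR ⊢
    generalize e₀ + _ + _ + _ + _ = e₀ at hs hR ⊢
    generalize e₁ + _ + _ + _ = e₁ at hs hR ⊢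
    generalize e₂ + _ + _ = e₂ at hs hR ⊢
    generalize e₃ + _ = e₃ at hs hR ⊢
    refine HasCurve.of_det_ne_zero (M := !![1, a₁ * d₁, 0; 0, 1, 0; 0, 0, 1])
      (by simp [Matrix.det_fin_three]) hs fun hs => ?_
    replace hR := forall_tangentQuartic_linSubst_ne_one hR !![1, a₁ * d₁, 0; 0, 1, 0; 0, 0, 1]
    rw [map_zero, linSubst_tangentQuartic_shear₀₁] at hs ⊢
    rw [linSubst_tangentQuartic_shear₀₁] at hR
    simp only [h3, zero_mul, mul_zero, add_zero, hc] at hs hR ⊢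
    generalize e₀ + _ + _ = e₀ at hs hR ⊢
    generalize e₁ + _ + _ = e₁ at hs hR ⊢
    generalize e₂ + _ = e₂ at hs hR ⊢
    refine HasCurve.of_det_ne_zero (M := !![1, 0, a₁ * d₂; 0, 1, 0; 0, 0, 1])
      (by simp [Matrix.det_fin_three]) hs fun hs => ?_
    replace hR := forall_tangentQuartic_linSubst_ne_one hR !![1, 0, a₁ * d₂; 0, 1, 0; 0, 0, 1]
    rw [map_zero, linSubst_tangentQuartic] at hs ⊢
    rw [linSubst_tangentQuartic] at hR
    simp only [h3, zero_mul, mul_zero, add_zero, hc] at hs hR ⊢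
    have hN := tangentQuarticNonsquare_of_forall_ne_one hR rfl
    exact HasCurve.tangentQuartic_of_good hs (zmod_three_hyperflex_bilinear d₀ e₀
      (fun x h => hN.line_zero x (by linear_combination h)) _ _ _ _ ha₁ hN)

theorem SmoothPair.tangentQuartic_bitangent_false (h : d₀ = -1 ∧ d₁ ^ 2 = 1 ∧ e₀ = -1 ∧ e₁ = -d₁ ∧ e₃ = d₁)
    (hs : SmoothPair 0 (tangentQuartic 0 0 (-1) d₀ d₁ 0 0 e₀ e₁ 0 e₃ 0)) : False := by
  obtain ⟨rfl, hd, rfl, rfl, rfl⟩ := h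
  obtain ⟨ζ, hζ⟩ := IsAlgClosed.exists_aeval_eq_zero (AlgebraicClosure (ZMod 3))
    (Polynomial.X ^ 2 + Polynomial.X - 1 : Polynomial (ZMod 3)) (by
      have : (Polynomial.X ^ 2 + Polynomial.X - 1 : Polynomial (ZMod 3)).degree = 2 := by
        compute_degree!
      rw [this]; decide)
  simp at hζ
  have hd' : (algebraMap (ZMod 3) (AlgebraicClosure (ZMod 3)) e₃) ^ 2 = 1 := by
    rw [← map_pow, hd, map_one]
  set δ := algebraMap (ZMod 3) (AlgebraicClosure (ZMod 3)) e₃ with hδ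
  refine hs.false_of_grad (Ω := AlgebraicClosure (ZMod 3)) (P := ![1, ζ, δ])
    (fun h => by simpa using congrFun h 0) ?_ ?_
  · rw [aeval_tangentQuartic]
    simp [← hδ]
    linear_combination -(ζ ^ 2 + ζ - 1) * hζ + (-1 + ζ ^ 2 - ζ ^ 3 + ζ * (δ ^ 2 + 1)) * hd'
  · intro i
    fin_cases i
    · simp [tangentQuartic, pderiv_X, Derivation.leibniz, Derivation.leibniz_pow, ← hδ]
      linear_combination (2 - ζ) * hζ + (-2 + ζ ^ 2) * hd'
    · simp [tangentQuartic, pderiv_X, Derivation.leibniz, Derivation.leibniz_pow, ← hδ]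
      linear_combination (-4 * ζ - 2) * hζ + (2 * ζ - 3 * ζ ^ 2 + δ ^ 2 + 1) * hd'
    · simp [tangentQuartic, pderiv_X, Derivation.leibniz, Derivation.leibniz_pow, ← hδ]
      linear_combination δ * (2 - ζ) * hζ + 3 * δ * ζ * hd'

theorem HasCurve.tangentQuartic_of_bitangent
    (hs : SmoothPair 0 (tangentQuartic a₀ a₁ (-1) d₀ d₁ d₂ 0 e₀ e₁ e₂ e₃ 0))
    (hR : ∀ P : Fin 3 → ZMod 3, aeval P (tangentQuartic a₀ a₁ (-1) d₀ d₁ d₂ 0 e₀ e₁ e₂ e₃ 0) ≠ 1) :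
    HasCurve 0 (tangentQuartic a₀ a₁ (-1) d₀ d₁ d₂ 0 e₀ e₁ e₂ e₃ 0) := by
  have h3 : (3 : ZMod 3) = 0 := by decide
  have hel : ∀ a : ZMod 3, a = 0 ∨ a = 1 ∨ a = -1 := by decide
  have hc : ∀ d : ZMod 3, d + 2 * -d * -1 = 0 := fun d => by linear_combination d * h3
  refine HasCurve.of_det_ne_zero (M := !![1, 0, 0; 0, 1, 0; 0, -a₁, 1])
    (by simp [Matrix.det_fin_three]) hs fun hs => ?_
  replace hR := forall_tangentQuartic_linSubst_ne_one hR !![1, 0, 0; 0, 1, 0; 0, -a₁, 1]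
  rw [map_zero, linSubst_tangentQuartic_shear₂₁] at hs ⊢
  rw [linSubst_tangentQuartic_shear₂₁] at hR
  simp only [mul_zero, add_zero, hc] at hs hR ⊢
  generalize a₀ + _ + _ = a₀ at hs hR ⊢
  generalize d₀ + _ + _ = d₀ at hs hR ⊢
  generalize d₁ + _ = d₁ at hs hR ⊢
  generalize e₀ + _ + _ + _ = e₀ at hs hR ⊢
  generalize e₁ + _ + _ = e₁ at hs hR ⊢
  generalize e₂ + _ = e₂ at hs hR ⊢
  refine HasCurve.of_det_ne_zero (M := !![1, -d₂, 0; 0, 1, 0; 0, 0, 1])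
    (by simp [Matrix.det_fin_three]) hs fun hs => ?_
  replace hR := forall_tangentQuartic_linSubst_ne_one hR !![1, -d₂, 0; 0, 1, 0; 0, 0, 1]
  rw [map_zero, linSubst_tangentQuartic_shear₀₁] at hs ⊢
  rw [linSubst_tangentQuartic_shear₀₁] at hR
  simp only [h3, zero_mul, mul_zero, add_zero, hc] at hs hR ⊢
  generalize d₀ + _ = d₀ at hs hR ⊢
  generalize e₀ + _ + _ + _ = e₀ at hs hR ⊢
  generalize e₁ + _ = e₁ at hs hR ⊢
  generalize e₂ + _ + _ = e₂ at hs hR ⊢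
  have hN := tangentQuarticNonsquare_of_forall_ne_one hR rfl
  rcases zmod_three_bitangent a₀ d₀ e₀ hN.line_zero _ _ _ _ hN with
    ⟨rfl, rfl, rfl, rfl, rfl, he⟩ | h
  · obtain rfl | rfl | rfl : e₃ = 0 ∨ e₃ = 1 ∨ e₃ = -1 := hel e₃
    · exact absurd rfl he
    · obtain rfl | rfl | rfl : d₁ = 0 ∨ d₁ = 1 ∨ d₁ = -1 := hel d₁
      · apply HasCurve.tangentQuartic_neg
        simpa using HasCurve.tangentQuartic_bitangent_split h3
      · exact (SmoothPair.tangentQuartic_bitangent_false (by decide) hs).elim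
      · apply HasCurve.tangentQuartic_neg
        simpa using HasCurve.tangentQuartic_bitangent_conic h3
    · obtain rfl | rfl | rfl : d₁ = 0 ∨ d₁ = 1 ∨ d₁ = -1 := hel d₁
      · simpa using HasCurve.tangentQuartic_bitangent_split h3
      · simpa using HasCurve.tangentQuartic_bitangent_conic h3
      · exact (SmoothPair.tangentQuartic_bitangent_false (by decide) hs).elim
  · exact HasCurve.tangentQuartic_of_good hs h

theorem HasCurve.of_zmod_three {g : MvPolynomial (Fin 3) (ZMod 3)} (hs : SmoothPair 0 g)
    (hg : g.IsHomogeneous 4) : HasCurve 0 g := by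
  refine HasCurve.of_tangentQuartic (by decide) hs hg fun a₀ a₁ a₂ d₀ d₁ d₂ d₃ e₀ e₁ e₂ e₃ e₄ had hs hR => ?_
  have hd : d₃ = 0 := by
    rcases had with rfl | h
    · exact tangentQuartic_coeff_eq_zero hR
    · exact h
  subst hd
  have hR' : ∀ P : Fin 3 → ZMod 3, aeval P (tangentQuartic a₀ a₁ a₂ d₀ d₁ d₂ 0 e₀ e₁ e₂ e₃ e₄) ≠ 1 :=
    fun P h => one_ne_zero (h.symm.trans (hR P (h ▸ IsSquare.one)))
  have hT : ∀ a e : ZMod 3, (∀ x y, x ^ 2 * (a * y ^ 2) + e * y ^ 4 ≠ 1) →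
      (a = 0 ∧ e = 0) ∨ (a = 1 ∧ e = -1) ∨ (a = 0 ∧ e = -1) ∨ (a = -1 ∧ e = 0) := by decide
  rcases hT a₂ e₄ (fun x y h => hR' ![x, 0, y] (by
    rw [eval_tangentQuartic]; linear_combination h)) with
    ⟨rfl, rfl⟩ | ⟨rfl, rfl⟩ | ⟨rfl, rfl⟩ | ⟨rfl, rfl⟩
  · exact hs.tangentQuartic_ne.elim
  · refine HasCurve.tangentQuartic_of_tangent_line (by decide) (x := 1) (z := 0) (y := 0)
      (x' := 0) (z' := 0) (y' := 1) (by decide) ?_ ?_ ?_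
    · ring
    · simp [tangentQuarticGrad]
    · simp [tangentQuarticHess]
  · exact HasCurve.tangentQuartic_of_hyperflex hs hR'
  · exact HasCurve.tangentQuartic_of_bitangent hs hR'

end

section

variable {k : Type u} [Field k] {f g : MvPolynomial (Fin 3) k} {K : Type*} [Field K]

theorem map_aeval_of_ringEquiv {A B : Type*} [CommRing A] [CommRing B] [Algebra k A] [Algebra K B]
    (E : k ≃+* K) (φ : A →+* B) (hφ : ∀ x, φ (algebraMap k A x) = algebraMap K B (E x)) {σ : Type*}
    (P : σ → A) (p : MvPolynomial σ k) :
    φ (aeval P p) = aeval (fun i => φ (P i)) (map (E : k →+* K) p) := by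
  rw [aeval_def, aeval_def, eval₂_map, eval₂_comp_left]
  congr 1
  ext x
  exact hφ x

theorem HasCurve.of_ringEquiv (E : k ≃+* K)
    (h : HasCurve (map (E : k →+* K) f) (map (E : k →+* K) g)) : HasCurve f g := by
  obtain ⟨v, w, h1, h2, i, j, h3⟩ := h
  let φ : Polynomial K ≃+* Polynomial k := Polynomial.mapEquiv E.symm
  have hφ : ∀ p : MvPolynomial (Fin 3) k, φ (aeval v (map (E : k →+* K) p)) = aeval (fun i => φ (v i)) p := by
    intro p
    have := map_aeval_of_ringEquiv E.symm (φ : Polynomial K →+* Polynomial k)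
      (fun x => by simp [φ]) v (map (E : k →+* K) p)
    rw [map_map] at this
    have e : ((E.symm : K →+* k).comp (E : k →+* K)) = RingHom.id k := by ext; simp
    rw [e, map_id] at this
    exact this
  have hd : ∀ p, φ (Polynomial.derivative p) = Polynomial.derivative (φ p) := fun p => by
    simp [φ, Polynomial.derivative_map]
  refine ⟨fun i => φ (v i), φ w, ?_, fun h0 => h2 (φ.injective ?_), i, j, fun h0 => h3 (φ.injective ?_)⟩
  · rw [← hφ, ← hφ, ← h1]; simp
  · rw [← hφ] at h0
    simpa [map_ofNat φ 2] using h0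
  · simpa [hd] using h0

end

section

variable {k : Type u} [Field k] {f g : MvPolynomial (Fin 3) k} {K : Type} [Field K]

theorem SmoothPair.map_ringEquiv (E : k ≃+* K) (h : SmoothPair f g) :
    SmoothPair (MvPolynomial.map (E : k →+* K) f) (MvPolynomial.map (E : k →+* K) g) := by
  intro Ω _ _ P w hP h0 h1 h2
  let φ : Ω ≃+* ULift.{u} Ω := ULift.ringEquiv.symm
  let _ : Algebra k (ULift.{u} Ω) :=
    ((φ : Ω →+* ULift.{u} Ω).comp ((algebraMap K Ω).comp (E : k →+* K))).toAlgebra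
  have hφ : ∀ p : MvPolynomial (Fin 3) k, φ.symm (aeval (fun i => φ (P i)) p) =
      aeval P (MvPolynomial.map (E : k →+* K) p) := fun p => by
    have := map_aeval_of_ringEquiv E (φ.symm : ULift.{u} Ω →+* Ω) (fun x => rfl) (fun i => φ (P i)) p
    exact this
  simp only [pderiv_map, ← hφ] at h0 h1 h2
  refine h (ULift.{u} Ω) (fun i => φ (P i)) (φ w) (fun e => hP (funext fun i => ?_)) ?_ ?_ fun i => ?_
  · exact φ.injective (by simpa using congrFun e i)
  · exact φ.symm.injective (by simpa [map_ofNat φ.symm 2] using h0)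
  · exact φ.symm.injective (by simpa using h1)
  · exact φ.symm.injective (by simpa using h2 i)

theorem HasCurve.of_two_ne_zero [Fintype k] (h2 : (2 : k) ≠ 0) (hs : SmoothPair f g)
    (hf : f.IsHomogeneous 2) (hg : g.IsHomogeneous 4) : HasCurve f g := by
  have key : ∀ g : MvPolynomial (Fin 3) k, SmoothPair 0 g → g.IsHomogeneous 4 → HasCurve 0 g := by
    intro g hs hg
    have h1 := FiniteField.two_mul_half_card_add_one h2
    have h3 := Fintype.one_lt_card (α := k)
    obtain hq | hq | hq | hq | hq : Fintype.card k = 3 ∨ Fintype.card k = 5 ∨ Fintype.card k = 7 ∨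
      Fintype.card k = 9 ∨ 11 ≤ Fintype.card k := by omega
    · have E : k ≃+* ZMod 3 := (ZMod.ringEquivOfPrime k (by norm_num) hq).symm
      refine HasCurve.of_ringEquiv E ?_
      have hs' := hs.map_ringEquiv E
      rw [map_zero] at hs' ⊢
      exact HasCurve.of_zmod_three hs' (hg.map _)
    · exact HasCurve.of_tangentQuartic h2 hs hg fun _ _ _ _ _ _ _ _ _ _ _ _ had hs hR =>
        (SmoothPair.tangentQuartic_false_of_card_five h2 hq hs had hR).elim
    · exact HasCurve.of_tangentQuartic h2 hs hg fun _ _ _ _ _ _ _ _ _ _ _ _ _ hs hR =>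
        (SmoothPair.tangentQuartic_false_of_card_seven h2 hq hs hR).elim
    · exact HasCurve.of_tangentQuartic h2 hs hg fun _ _ _ _ _ _ _ _ _ _ _ _ _ hs hR =>
        HasCurve.tangentQuartic_of_card_nine h2 hq hs hR
    · exact HasCurve.of_tangentQuartic h2 hs hg fun _ _ _ _ _ _ _ _ _ _ _ _ _ _ hR =>
        (SmoothPair.tangentQuartic_false_of_eleven_le h2 hq hR).elim
  have hQ : (-(C (2⁻¹ : k)) * f).IsHomogeneous 2 := by
    simpa using ((isHomogeneous_C (Fin 3) (-2⁻¹ : k)).mul hf)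
  have hc : f + 2 * (-(C (2⁻¹ : k)) * f) = 0 := by
    have : (2 : MvPolynomial (Fin 3) k) * C (2⁻¹ : k) = 1 := by
      rw [← map_ofNat C 2, ← map_mul, mul_inv_cancel₀ h2, map_one]
    linear_combination - f * this
  refine HasCurve.of_shift (-(C (2⁻¹ : k)) * f) ?_
  have hs' := hs.shift (-(C (2⁻¹ : k)) * f)
  rw [hc] at hs' ⊢
  exact key _ hs' ((hg.sub (hQ.pow 2)).sub (hf.mul hQ))

end

section

variable {k : Type u} [Field k] {f g : MvPolynomial (Fin 3) k}

theorem exists_sq_eq_of_two_eq_zero [Finite k] (h2 : (2 : k) = 0) (a : k) : ∃ b, b ^ 2 = a := by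
  have : CharP k 2 := CharTwo.of_one_ne_zero_of_two_eq_zero one_ne_zero h2
  obtain ⟨b, hb⟩ := FiniteField.isSquare_of_char_two (ringChar.eq k 2) a
  exact ⟨b, by rw [hb, sq]⟩

theorem HasCurve.of_split_form [Finite k] (h2 : (2 : k) = 0) {δ l₁ l₂ c₁ c₂ c₃ : k} (hδ : δ ≠ 0)
    {B : MvPolynomial (Fin 2) k} (hB : B.IsHomogeneous 4) :
    HasCurve (C δ * X 0 ^ 2 + (C l₁ * X 1 + C l₂ * X 2) * X 0 +
      (C c₁ * X 1 ^ 2 + C c₂ * (X 1 * X 2) + C c₃ * X 2 ^ 2)) (rename Fin.succ B) := by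
  obtain ⟨x, y, hxy, hl⟩ : ∃ x y, (x ≠ 0 ∨ y ≠ 0) ∧ l₁ * x + l₂ * y = 0 := by
    by_cases h : l₂ = 0
    · exact ⟨0, 1, .inr one_ne_zero, by rw [h]; ring⟩
    · exact ⟨-l₂, l₁, .inl (neg_ne_zero.2 h), by ring⟩
  obtain ⟨d, hd⟩ := exists_sq_eq_of_two_eq_zero h2 δ
  have hd0 : d ≠ 0 := by rintro rfl; exact hδ (by rw [← hd]; ring)
  obtain ⟨b, hb⟩ := exists_sq_eq_of_two_eq_zero h2 (aeval ![x, y] B)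
  obtain ⟨c, hc⟩ := exists_sq_eq_of_two_eq_zero h2 (c₁ * x ^ 2 + c₂ * (x * y) + c₃ * y ^ 2)
  let τ : Polynomial k := Polynomial.X
  set p : Polynomial k := .C b + τ ^ 2 + .C c * τ with hp
  set v : Fin 3 → Polynomial k := ![.C d⁻¹ * p, .C x * τ, .C y * τ] with hv
  have H2 : (2 : Polynomial k) = 0 := by rw [← map_ofNat Polynomial.C 2, h2, map_zero]
  have Hd : Polynomial.C δ * Polynomial.C d⁻¹ ^ 2 = 1 := by
    rw [← map_pow, ← map_mul, ← hd, ← mul_pow, mul_inv_cancel₀ hd0, one_pow, map_one]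
  have Hl : Polynomial.C l₁ * Polynomial.C x + Polynomial.C l₂ * Polynomial.C y = 0 := by
    rw [← map_mul, ← map_mul, ← map_add, hl, map_zero]
  have Hc : Polynomial.C c ^ 2 = Polynomial.C c₁ * Polynomial.C x ^ 2 +
      Polynomial.C c₂ * (Polynomial.C x * Polynomial.C y) + Polynomial.C c₃ * Polynomial.C y ^ 2 := by
    rw [← map_pow, hc]; simp
  have Hf : aeval v (C δ * X 0 ^ 2 + (C l₁ * X 1 + C l₂ * X 2) * X 0 +
      (C c₁ * X 1 ^ 2 + C c₂ * (X 1 * X 2) + C c₃ * X 2 ^ 2) : MvPolynomial (Fin 3) k) =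
      (.C b + τ ^ 2) ^ 2 := by
    simp [hv]
    linear_combination p ^ 2 * Hd + τ * Polynomial.C d⁻¹ * p * Hl - τ ^ 2 * Hc +
      (τ ^ 2 * .C c ^ 2 + τ * .C c * (.C b + τ ^ 2)) * H2
  have Hg : aeval v (rename Fin.succ B) = .C b ^ 2 * τ ^ 4 := by
    rw [aeval_rename_succ]
    have e : (fun i : Fin 2 => v i.succ) = fun i => τ * algebraMap k (Polynomial k) (![x, y] i) := by
      funext i; fin_cases i <;> simp [hv, mul_comm]
    have e' : aeval (fun i => algebraMap k (Polynomial k) (![x, y] i)) B =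
        algebraMap k (Polynomial k) (aeval ![x, y] B) := by
      exact aeval_algebraMap_apply _ _ _
    rw [e, aeval_mul_of_isHomogeneous hB, e', ← hb, map_pow, Polynomial.algebraMap_eq, mul_comm]
  have hne : Polynomial.C b + τ ^ 2 ≠ 0 := fun h => by
    have := congrArg (fun p => Polynomial.coeff p 2) h
    simp [τ] at this
  have hp' : p * Polynomial.derivative τ - τ * Polynomial.derivative p = .C b + τ ^ 2 := by
    simp [hp, τ]
    linear_combination -(Polynomial.X ^ 2) * H2
  refine ⟨v, τ ^ 4, ?_, ?_, ?_⟩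
  · rw [Hf, Hg]
    linear_combination (τ ^ 8 + Polynomial.C b * τ ^ 6) * H2
  · rw [Hf, H2, zero_mul, zero_add]
    exact pow_ne_zero 2 hne
  · have key : ∀ z : k, z ≠ 0 → Polynomial.C d⁻¹ * p * Polynomial.derivative (Polynomial.C z * τ) ≠
        Polynomial.C z * τ * Polynomial.derivative (Polynomial.C d⁻¹ * p) := fun z hz h => by
      rw [Polynomial.derivative_C_mul, Polynomial.derivative_C_mul] at h
      have : Polynomial.C (d⁻¹ * z) * (.C b + τ ^ 2) = 0 := by
        rw [← hp', map_mul]; linear_combination h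
      rcases mul_eq_zero.1 this with h | h
      · exact mul_ne_zero (inv_ne_zero hd0) hz (Polynomial.C_eq_zero.1 h)
      · exact hne h
    rcases hxy with h | h
    · exact ⟨0, 1, key x h⟩
    · exact ⟨0, 2, key y h⟩

theorem HasCurve.of_value [Finite k] (h2 : (2 : k) = 0) (hs : SmoothPair f g)
    (hf : f.IsHomogeneous 2) (hg : g.IsHomogeneous 4) {P : Fin 3 → k} {w : k}
    (hfP : aeval P f ≠ 0) (hw : w ^ 2 + aeval P f * w = aeval P g) : HasCurve f g := by
  have hP0 : P ≠ 0 := by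
    rintro rfl
    exact hfP (aeval_zero_of_isHomogeneous hf two_ne_zero)
  obtain ⟨M, hM, hMP⟩ := exists_det_ne_zero_of_ne_zero hP0
  refine HasCurve.of_det_ne_zero hM hs fun hs => ?_
  have he : ∀ p : MvPolynomial (Fin 3) k, aeval ![(1 : k), 0, 0] (linSubst M p) = aeval P p := fun p => by
    rw [aeval_linSubst]
    congr 2
    funext i
    simp [Fin.sum_univ_three, hMP]
  have hf' : (linSubst M f).IsHomogeneous 2 := linSubst_isHomogeneous hf
  have hg' : (linSubst M g).IsHomogeneous 4 := linSubst_isHomogeneous hg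
  by_contra hno
  have hδ : 2 * w + aeval ![(1 : k), 0, 0] (linSubst M f) ≠ 0 := by
    rwa [h2, zero_mul, zero_add, he]
  obtain ⟨l, q, A, B, hl, hq, hA, hB, hG⟩ := exists_osculating hf' hg' (a := w) (by rw [he, he, hw]) hδ
  have hA0 : A = 0 := by
    by_contra hA0
    exact hno (HasCurve.of_osculating hs hf' hδ hl hq hA hB hG hA0)
  rw [hA0, map_zero, zero_mul, zero_add] at hG
  obtain ⟨f₁, f₂, hf₁, hf₂, ef⟩ := exists_quadratic_expansion hf'
  obtain ⟨l₁, l₂, rfl⟩ := exists_coeffs_linear hf₁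
  obtain ⟨c₁, c₂, c₃, rfl⟩ := exists_coeffs_quadratic hf₂
  refine hno (HasCurve.of_shift (C w * X 0 ^ 2 + rename Fin.succ l * X 0 + rename Fin.succ q) ?_)
  have H2 : (2 : MvPolynomial (Fin 3) k) = 0 := by rw [← map_ofNat C 2, h2, map_zero]
  have := HasCurve.of_split_form h2 (δ := aeval ![1, 0, 0] (linSubst M f)) (l₁ := l₁) (l₂ := l₂)
    (c₁ := c₁) (c₂ := c₂) (c₃ := c₃) (by rwa [he]) hB.neg
  convert this using 1
  · rw [H2, zero_mul, add_zero, ef]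
    simp [rename_X, he]
  · rw [map_neg, ← hG]; ring

end

namespace FiniteField

open Polynomial

variable {k : Type*} [Field k]

/-- The homogenized Artin–Schreier trace polynomial `f ^ (2 ^ n) * (1 + ∑ i < n, (g / f²) ^ (2 ^ i))`. -/
def artinSchreier {R : Type*} [CommRing R] (f g : R) : ℕ → R
  | 0 => f
  | n + 1 => g * f ^ (2 ^ (n + 1) - 2) + artinSchreier f g n ^ 2

theorem artinSchreier_map {R S : Type*} [CommRing R] [CommRing S] (φ : R →+* S) (f g : R) (n : ℕ) :
    φ (artinSchreier f g n) = artinSchreier (φ f) (φ g) n := by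
  induction n with
  | zero => rfl
  | succ n ih => simp [artinSchreier, ih]

theorem artinSchreier_mul {R : Type*} [CommRing R] (a c : R) (n : ℕ) :
    artinSchreier a (a ^ 2 * c) n = a ^ 2 ^ n * artinSchreier 1 c n := by
  induction n with
  | zero => simp [artinSchreier]
  | succ n ih =>
    have h : 2 ^ (n + 1) = 2 + (2 ^ (n + 1) - 2) := by
      have := Nat.one_le_two_pow (n := n); rw [pow_succ]; omega
    simp only [artinSchreier, ih, one_pow, mul_one]
    have e : a ^ 2 ^ (n + 1) = a ^ 2 * a ^ (2 ^ (n + 1) - 2) := by rw [← pow_add, ← h]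
    have e' : (a ^ 2 ^ n) ^ 2 = a ^ 2 ^ (n + 1) := by rw [← pow_mul, ← pow_succ]
    rw [mul_pow, e', e]
    ring

theorem artinSchreier_add (h2 : (2 : k) = 0) (c d : k) (n : ℕ) :
    artinSchreier 1 (c + d) n = artinSchreier 1 c n + artinSchreier 1 d n + 1 := by
  induction n with
  | zero => simp only [artinSchreier]; linear_combination - h2
  | succ n ih =>
    simp only [artinSchreier, ih, one_pow, mul_one]
    linear_combination (artinSchreier 1 c n * artinSchreier 1 d n + artinSchreier 1 c n +
      artinSchreier 1 d n) * h2

theorem artinSchreier_sq_add (h2 : (2 : k) = 0) (c : k) (n : ℕ) :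
    artinSchreier 1 c n ^ 2 + artinSchreier 1 c n = c ^ 2 ^ n + c := by
  induction n with
  | zero => simp only [artinSchreier]; linear_combination (1 - c) * h2
  | succ n ih =>
    simp only [artinSchreier, one_pow, mul_one]
    have e : c ^ 2 ^ (n + 1) = (c ^ 2 ^ n) ^ 2 := by rw [← pow_mul, ← pow_succ]
    have := congrArg (· ^ 2) ih
    rw [e]
    linear_combination this + (c * artinSchreier 1 c n ^ 2 - artinSchreier 1 c n ^ 3 -
      c * c ^ 2 ^ n + 2 * c * c ^ 2 ^ n + c ^ 2) * h2

theorem natDegree_artinSchreier_X (n : ℕ) :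
    (artinSchreier 1 Polynomial.X (n + 1) : k[X]).natDegree = 2 ^ n := by
  induction n with
  | zero =>
    simp only [artinSchreier, one_pow, mul_one, pow_zero]
    exact natDegree_X_add_C 1
  | succ n ih =>
    rw [artinSchreier, one_pow, mul_one, natDegree_add_eq_right_of_natDegree_lt]
    · rw [natDegree_pow, ih, pow_succ, mul_comm]
    · rw [natDegree_pow, ih, natDegree_X]
      have := Nat.one_le_two_pow (n := n); omega

theorem artinSchreier_eq_zero_of_forall_ne [Fintype k] (h2 : (2 : k) = 0) {n : ℕ}
    (hn : Fintype.card k = 2 ^ n) {c : k} (h : ∀ w, w ^ 2 + w ≠ c) : artinSchreier 1 c n = 0 := by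
  classical
  have hn0 : n ≠ 0 := by
    rintro rfl
    exact absurd hn (by have := Fintype.one_lt_card (α := k); omega)
  obtain ⟨n, rfl⟩ := Nat.exists_eq_succ_of_ne_zero hn0
  have hv : ∀ c : k, artinSchreier 1 c (n + 1) = 0 ∨ artinSchreier 1 c (n + 1) = 1 := fun c => by
    have h1 := artinSchreier_sq_add h2 c (n + 1)
    rw [← hn, FiniteField.pow_card] at h1
    have : artinSchreier 1 c (n + 1) * (artinSchreier 1 c (n + 1) - 1) = 0 := by
      linear_combination h1 + (c - artinSchreier 1 c (n + 1)) * h2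
    rcases mul_eq_zero.1 this with h | h
    · exact .inl h
    · exact .inr (sub_eq_zero.1 h)
  by_contra hc
  have hc1 := (hv c).resolve_left hc
  have hsq : ∀ w : k, artinSchreier 1 (w ^ 2) (n + 1) = artinSchreier 1 w (n + 1) ^ 2 := fun w => by
    have : ∀ m, artinSchreier 1 (w ^ 2) m = artinSchreier 1 w m ^ 2 := fun m => by
      induction m with
      | zero => simp [artinSchreier]
      | succ m ih =>
        simp only [artinSchreier, one_pow, mul_one, ih]
        linear_combination (-w * artinSchreier 1 w m ^ 2) * h2
    exact this _
  have himg : ∀ w : k, artinSchreier 1 (w ^ 2 + w) (n + 1) = 1 := fun w => by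
    rw [artinSchreier_add h2, hsq]
    rcases hv w with h | h <;> rw [h]
    · ring
    · linear_combination h2
  let p : k[X] := artinSchreier 1 Polynomial.X (n + 1) - 1
  have hp : p.natDegree = 2 ^ n := by
    have := natDegree_artinSchreier_X (k := k) n
    rw [show p = artinSchreier 1 Polynomial.X (n + 1) - Polynomial.C 1 by rw [map_one], natDegree_sub_C, this]
  have hp0 : p ≠ 0 := by
    intro h0
    rw [h0, natDegree_zero] at hp
    exact absurd hp (by have := Nat.one_le_two_pow (n := n); omega)
  have hroot : ∀ d : k, artinSchreier 1 d (n + 1) = 1 → d ∈ p.roots.toFinset := fun d hd => by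
    rw [Multiset.mem_toFinset, mem_roots hp0, IsRoot.def]
    have := artinSchreier_map (evalRingHom d) 1 Polynomial.X (n + 1)
    simp only [coe_evalRingHom, Polynomial.eval_one, Polynomial.eval_X] at this
    rw [show p = artinSchreier 1 Polynomial.X (n + 1) - 1 from rfl, Polynomial.eval_sub, this, hd, Polynomial.eval_one, sub_self]
  let I : Finset k := Finset.univ.image fun w : k => w ^ 2 + w
  have hI : Fintype.card k ≤ 2 * I.card := by
    rw [← Finset.card_univ]
    refine Finset.card_le_mul_card_image _ 2 fun b _ => ?_
    by_cases hb : ∃ w : k, w ^ 2 + w = b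
    · obtain ⟨w, rfl⟩ := hb
      refine (Finset.card_le_card (t := {w, w + 1}) fun v hv => ?_).trans Finset.card_le_two
      have hv := (Finset.mem_filter.1 hv).2
      have : (v - w) * (v - (w + 1)) = 0 := by
        linear_combination hv + (w ^ 2 + w - v * w - v) * h2
      rcases mul_eq_zero.1 this with h | h
      · simp [sub_eq_zero.1 h]
      · simp [sub_eq_zero.1 h]
    · rw [Finset.card_eq_zero.2]
      · omega
      · exact Finset.filter_eq_empty_iff.2 fun w _ hw => hb ⟨w, hw⟩
  have hcI : c ∉ I := fun hc => by
    obtain ⟨w, _, hw⟩ := Finset.mem_image.1 hc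
    exact h w hw
  have hsub : insert c I ⊆ p.roots.toFinset := fun d hd => by
    rcases Finset.mem_insert.1 hd with rfl | hd
    · exact hroot _ hc1
    · obtain ⟨w, _, rfl⟩ := Finset.mem_image.1 hd
      exact hroot _ (himg w)
  have h1 := Finset.card_le_card hsub
  rw [Finset.card_insert_of_notMem hcI] at h1
  have h3 := (Multiset.toFinset_card_le p.roots).trans (card_roots' p)
  rw [hp] at h3
  rw [hn, pow_succ] at hI
  omega

theorem exists_artinSchreier_point [Fintype k] (h2 : (2 : k) = 0) (hq : 8 ≤ Fintype.card k)
    {a b c₀ c₁ c₂ c₃ : k} (hab : a ≠ 0 ∨ b ≠ 0) (hc : c₃ ≠ 0) :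
    ∃ t w : k, a * t + b ≠ 0 ∧
      w ^ 2 + (a * t + b) * w = c₃ * t ^ 3 + c₂ * t ^ 2 + c₁ * t + c₀ := by
  by_contra! hno
  have : CharP k 2 := CharTwo.of_one_ne_zero_of_two_eq_zero one_ne_zero h2
  obtain ⟨n, -, hn⟩ := FiniteField.card k 2
  obtain ⟨m, hm⟩ : ∃ m, (n : ℕ) = m + 1 := ⟨n - 1, (Nat.succ_pred_eq_of_pos n.2).symm⟩
  rw [hm] at hn
  set f : k[X] := Polynomial.C a * Polynomial.X + Polynomial.C b with hf
  set g : k[X] := Polynomial.C c₃ * Polynomial.X ^ 3 + Polynomial.C c₂ * Polynomial.X ^ 2 + Polynomial.C c₁ * Polynomial.X + Polynomial.C c₀ with hg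
  have hf0 : f ≠ 0 := by
    intro h0
    have e0 := congrArg (Polynomial.coeff · 0) h0
    have e1 := congrArg (Polynomial.coeff · 1) h0
    simp [hf] at e0 e1
    tauto
  have hfd : f.natDegree ≤ 1 := by rw [hf]; compute_degree
  have hgd : g.natDegree = 3 := by rw [hg]; compute_degree!
  have hg'd : (derivative g).natDegree ≤ 2 := (natDegree_derivative_le g).trans (by rw [hgd])
  have H2 : (2 : k[X]) = 0 := by rw [← map_ofNat Polynomial.C 2, h2, map_zero]
  set H : k[X] := artinSchreier f g (m + 1) with hH
  have hHd : ∀ j, (artinSchreier f g (j + 1)).natDegree = 3 * 2 ^ j := fun j => by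
    induction j with
    | zero =>
      simp only [artinSchreier, zero_add, pow_one, Nat.sub_self, pow_zero, mul_one]
      rw [natDegree_add_eq_left_of_natDegree_lt, hgd]
      have := natDegree_pow_le (p := f) (n := 2)
      omega
    | succ j ih =>
      rw [artinSchreier, natDegree_add_eq_right_of_natDegree_lt]
      · rw [natDegree_pow, ih, pow_succ]; ring
      · rw [natDegree_pow, ih]
        have h1 := natDegree_mul_le (p := g) (q := f ^ (2 ^ (j + 1 + 1) - 2))
        have h3 := natDegree_pow_le (p := f) (n := 2 ^ (j + 1 + 1) - 2)
        have h4 : (2 ^ (j + 1 + 1) - 2) * f.natDegree ≤ 2 ^ (j + 1 + 1) - 2 := by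
          simpa using Nat.mul_le_mul_left (2 ^ (j + 1 + 1) - 2) hfd
        have := Nat.one_le_two_pow (n := j)
        rw [pow_succ, pow_succ] at *
        omega
  have hev : ∀ t, (f * H).eval t = 0 := fun t => by
    rw [Polynomial.eval_mul]
    by_cases h0 : f.eval t = 0
    · rw [h0, zero_mul]
    · have e := artinSchreier_map (evalRingHom t) f g (m + 1)
      simp only [coe_evalRingHom] at e
      have hft : f.eval t = a * t + b := by simp [hf]
      have hgt : g.eval t = c₃ * t ^ 3 + c₂ * t ^ 2 + c₁ * t + c₀ := by simp [hg]
      have hc : g.eval t = f.eval t ^ 2 * (g.eval t / f.eval t ^ 2) := by field_simp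
      rw [hH, e, hc, artinSchreier_mul, artinSchreier_eq_zero_of_forall_ne h2 hn, mul_zero, mul_zero]
      intro w hw
      refine hno t (f.eval t * w) (hft ▸ h0) ?_
      rw [← hft, ← hgt, hc, ← hw]
      ring
  obtain ⟨R, hR⟩ := X_pow_card_sub_X_dvd_of_eval_eq_zero hev
  have hH' : derivative H * f ^ 2 = derivative g * f ^ Fintype.card k := by
    have hm1 : m ≠ 0 := by rintro rfl; norm_num at hn; omega
    have e : 2 ^ (m + 1) - 2 = 2 * (2 ^ m - 1) := by rw [pow_succ]; omega
    have e' : Fintype.card k = 2 * (2 ^ m - 1) + 2 := by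
      rw [hn, pow_succ]; have := Nat.one_le_two_pow (n := m); omega
    rw [hH, artinSchreier, e, pow_mul', e', pow_add, pow_mul' f 2]
    simp only [derivative_add, derivative_mul, sq]
    linear_combination (g * (f ^ (2 ^ m - 1) * derivative (f ^ (2 ^ m - 1))) +
      artinSchreier f g m * derivative (artinSchreier f g m)) * f ^ 2 * H2
  have hfq : f ^ Fintype.card k = f + Polynomial.C a * (Polynomial.X ^ Fintype.card k - Polynomial.X) := by
    rw [← FiniteField.expand_card, hf]; simp; ring
  have hdvd : Polynomial.X ^ Fintype.card k - Polynomial.X ∣ f * (f * (R + derivative g)) := by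
    have hd := congrArg derivative hR
    rw [derivative_mul, derivative_mul, derivative_X_pow_card_sub_X] at hd
    refine ⟨f * (f * derivative R) - f * derivative f * R - derivative g * f * Polynomial.C a, ?_⟩
    linear_combination f ^ 2 * hd - f * derivative f * hR - f * hH' - f * derivative g * hfq
  have hq2 : Fintype.card k = 2 * 2 ^ m := by rw [hn, pow_succ, mul_comm]
  have hR0 : R ≠ 0 := by
    rintro rfl
    rw [mul_zero] at hR
    rcases mul_eq_zero.1 hR with h | h
    · exact hf0 h
    · have := hHd m
      rw [← hH, h, natDegree_zero] at this
      have := Nat.one_le_two_pow (n := m)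
      omega
  have hDd := FiniteField.X_pow_card_sub_X_natDegree_eq k (p := Fintype.card k) Fintype.one_lt_card
  have hRd : R.natDegree = f.natDegree + 2 ^ m := by
    have hD0 : (Polynomial.X ^ Fintype.card k - Polynomial.X : k[X]) ≠ 0 := fun h => by
      rw [h, natDegree_zero] at hDd; omega
    have hH0 : H ≠ 0 := by
      rintro h
      rw [h, mul_zero] at hR
      exact mul_ne_zero hD0 hR0 hR.symm
    have := congrArg natDegree hR
    rw [natDegree_mul hf0 hH0, natDegree_mul hD0 hR0, hDd, hH, hHd] at this
    omega
  have hz : f * (f * (R + derivative g)) = 0 := by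
    by_contra h0
    have h1 := natDegree_le_of_dvd hdvd h0
    rw [hDd] at h1
    have h3 := natDegree_mul_le (p := f) (q := f * (R + derivative g))
    have h4 := natDegree_mul_le (p := f) (q := R + derivative g)
    have h5 := natDegree_add_le R (derivative g)
    have h6 : max R.natDegree (derivative g).natDegree ≤ 2 ^ m + 1 :=
      max_le (by omega) (by omega)
    omega
  have hRg : R = -derivative g := by
    linear_combination ((mul_eq_zero.1 ((mul_eq_zero.1 hz).resolve_left hf0)).resolve_left hf0)
  rw [hRg, natDegree_neg] at hRd
  omega

end FiniteField

section

variable {k : Type u} [Field k] {f g : MvPolynomial (Fin 3) k}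

theorem exists_ne_zero_of_line {l₁ l₂ n₁ n₂ α β γ δ ε : k} (hn : l₁ * n₁ + l₂ * n₂ = 1)
    (hf : ¬(α = 0 ∧ β = 0 ∧ γ = 0 ∧ δ = 0 ∧ ε = 0)) {t : k} (ht0 : t ≠ 0) (ht1 : t ≠ 1) :
    ∃ x y, l₁ * x + l₂ * y ≠ 0 ∧
      (α * x + β * y ≠ 0 ∨ γ * x ^ 2 + δ * (x * y) + ε * y ^ 2 ≠ 0) := by
  by_contra! hno
  have key : ∀ m, α * (n₁ - m * l₂) + β * (n₂ + m * l₁) = 0 ∧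
      γ * (n₁ - m * l₂) ^ 2 + δ * ((n₁ - m * l₂) * (n₂ + m * l₁)) + ε * (n₂ + m * l₁) ^ 2 = 0 :=
    fun m => hno _ _ (by
      rw [show l₁ * (n₁ - m * l₂) + l₂ * (n₂ + m * l₁) = 1 by linear_combination hn]
      exact one_ne_zero)
  obtain ⟨a0, b0⟩ := key 0
  obtain ⟨a1, b1⟩ := key 1
  obtain ⟨-, bt⟩ := key t
  have hu : γ * l₂ ^ 2 - δ * (l₂ * l₁) + ε * l₁ ^ 2 = 0 := by
    have : t * (t - 1) * (γ * l₂ ^ 2 - δ * (l₂ * l₁) + ε * l₁ ^ 2) = 0 := by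
      linear_combination bt - t * b1 - (1 - t) * b0
    exact (mul_eq_zero.1 this).resolve_left (mul_ne_zero ht0 (sub_ne_zero.2 ht1))
  have hB : -2 * γ * n₁ * l₂ + δ * (n₁ * l₁ - l₂ * n₂) + 2 * ε * n₂ * l₁ = 0 := by
    linear_combination b1 - b0 - hu
  have hn0 : γ * n₁ ^ 2 + δ * (n₁ * n₂) + ε * n₂ ^ 2 = 0 := by linear_combination b0
  have hn2 : (l₁ * n₁ + l₂ * n₂) ^ 2 = 1 := by rw [hn, one_pow]
  refine hf ⟨?_, ?_, ?_, ?_, ?_⟩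
  · linear_combination -α * hn + l₁ * a0 - n₂ * (a1 - a0)
  · linear_combination -β * hn + l₂ * a0 + n₁ * (a1 - a0)
  · linear_combination -γ * hn2 + l₁ ^ 2 * hn0 - l₁ * n₂ * hB + n₂ ^ 2 * hu
  · linear_combination -δ * hn2 + 2 * l₁ * l₂ * hn0 + (l₁ * n₁ - l₂ * n₂) * hB - 2 * n₁ * n₂ * hu
  · linear_combination -ε * hn2 + l₂ ^ 2 * hn0 + l₂ * n₁ * hB + n₁ ^ 2 * hu

theorem HasCurve.of_zero_of_eight_le [Fintype k] (h2 : (2 : k) = 0) (hq : 8 ≤ Fintype.card k)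
    (hs : SmoothPair f g) (hf0 : f ≠ 0) (hf : f.IsHomogeneous 2) (hg : g.IsHomogeneous 4)
    {P : Fin 3 → k} (hP0 : P ≠ 0) (hP : aeval P f = 0) : HasCurve f g := by
  obtain ⟨M, hM, hMP⟩ := exists_det_ne_zero_of_ne_zero hP0
  refine HasCurve.of_det_ne_zero hM hs fun hs => ?_
  have hf0' : linSubst M f ≠ 0 := fun h => hf0 (by
    obtain ⟨N, hN⟩ := exists_mul_eq_one_of_det_ne_zero hM
    rw [← linSubst_linSubst hN f, h, map_zero])
  have hP' : aeval ![(1 : k), 0, 0] (linSubst M f) = 0 := by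
    rw [aeval_linSubst]
    refine (congrArg (fun v => aeval v f) (funext fun i => ?_)).trans hP
    simp [Fin.sum_univ_three, hMP]
  have hf' : (linSubst M f).IsHomogeneous 2 := linSubst_isHomogeneous hf
  have hg' : (linSubst M g).IsHomogeneous 4 := linSubst_isHomogeneous hg
  generalize linSubst M f = f at *
  generalize linSubst M g = g at *
  have H2 : (2 : MvPolynomial (Fin 3) k) = 0 := by rw [← map_ofNat C 2, h2, map_zero]
  obtain ⟨b, hb⟩ := exists_sq_eq_of_two_eq_zero h2 (aeval ![(1 : k), 0, 0] g)
  have hQ : (C b * X 0 ^ 2 : MvPolynomial (Fin 3) k).IsHomogeneous 2 := by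
    simpa using (isHomogeneous_C (Fin 3) b).mul ((isHomogeneous_X k 0).pow 2)
  refine HasCurve.of_shift (C b * X 0 ^ 2) ?_
  replace hs := hs.shift (C b * X 0 ^ 2)
  rw [H2, zero_mul, add_zero] at hs ⊢
  have hg0 : aeval ![(1 : k), 0, 0] (g - (C b * X 0 ^ 2) ^ 2 - f * (C b * X 0 ^ 2)) = 0 := by
    rw [map_sub, map_sub, map_mul _ f, hP', ← hb]
    simp
  replace hg := (hg'.sub (hQ.pow 2)).sub (hf'.mul hQ)
  generalize g - (C b * X 0 ^ 2) ^ 2 - f * (C b * X 0 ^ 2) = g at *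
  obtain ⟨f₁, f₂, hf₁, hf₂, ef⟩ := exists_quadratic_expansion hf'
  obtain ⟨g₁, g₂, g₃, g₄, hg₁, hg₂, hg₃, hg₄, eg⟩ := exists_quartic_expansion hg
  obtain ⟨α, β, rfl⟩ := exists_coeffs_linear hf₁
  obtain ⟨γ, δ, ε, rfl⟩ := exists_coeffs_quadratic hf₂
  obtain ⟨l₁, l₂, rfl⟩ := exists_coeffs_linear hg₁
  obtain ⟨c₁, c₂, c₃, rfl⟩ := exists_coeffs_quadratic hg₂
  obtain ⟨d₁, d₂, d₃, d₄, rfl⟩ := exists_coeffs_cubic hg₃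
  obtain ⟨e₁, e₂, e₃, e₄, e₅, rfl⟩ := exists_coeffs_quartic hg₄
  rw [hP', C_0, zero_mul, zero_add] at ef
  rw [hg0, C_0, zero_mul, zero_add] at eg
  simp only [map_add, map_mul, map_pow, rename_X, rename_C, Fin.succ_zero_eq_one,
    Fin.succ_one_eq_two] at ef eg
  have hl : ¬(l₁ = 0 ∧ l₂ = 0) := by
    rintro ⟨rfl, rfl⟩
    refine hs k ![1, 0, 0] 0 (fun h => by simpa using congrFun h 0) (by rw [hP']; ring)
      (by rw [hg0]; ring) fun i => ?_
    rw [mul_zero, eg]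
    fin_cases i <;> simp [pderiv_X, Derivation.leibniz, Derivation.leibniz_pow]
  obtain ⟨n₁, n₂, hn⟩ : ∃ n₁ n₂, l₁ * n₁ + l₂ * n₂ = 1 := by
    by_cases hl₁ : l₁ = 0
    · exact ⟨0, l₂⁻¹, by rw [mul_inv_cancel₀ fun h => hl ⟨hl₁, h⟩]; ring⟩
    · exact ⟨l₁⁻¹, 0, by rw [mul_inv_cancel₀ hl₁]; ring⟩
  obtain ⟨t, ht0, ht1⟩ : ∃ t : k, t ≠ 0 ∧ t ≠ 1 := by
    classical
    obtain ⟨t, ht⟩ : ∃ t, t ∉ ({0, 1} : Finset k) := by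
      by_contra! h
      have := Finset.card_le_card (fun x _ => h x : (Finset.univ : Finset k) ⊆ {0, 1})
      have := Finset.card_le_two (a := (0 : k)) (b := 1)
      rw [Finset.card_univ] at *
      omega
    simp at ht
    exact ⟨t, ht.1, ht.2⟩
  obtain ⟨x, y, hxy, hxy'⟩ := exists_ne_zero_of_line (α := α) (β := β) (γ := γ) (δ := δ) (ε := ε) hn
    (by rintro ⟨rfl, rfl, rfl, rfl, rfl⟩; exact hf0' (by rw [ef]; simp)) ht0 ht1
  obtain ⟨s, w, hs0, hw⟩ := FiniteField.exists_artinSchreier_point h2 hq hxy' hxy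
    (c₂ := c₁ * x ^ 2 + c₂ * (x * y) + c₃ * y ^ 2)
    (c₁ := d₁ * x ^ 3 + d₂ * (x ^ 2 * y) + d₃ * (x * y ^ 2) + d₄ * y ^ 3)
    (c₀ := e₁ * x ^ 4 + e₂ * (x ^ 3 * y) + e₃ * (x ^ 2 * y ^ 2) + e₄ * (x * y ^ 3) + e₅ * y ^ 4)
  have hfe : aeval ![s, x, y] f = (α * x + β * y) * s + (γ * x ^ 2 + δ * (x * y) + ε * y ^ 2) := by
    rw [ef]; simp
  refine HasCurve.of_value h2 hs hf' hg (P := ![s, x, y]) (w := w) (by rwa [hfe]) ?_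
  rw [hfe, hw, eg]
  simp

/-- The ternary quadratic form with the given coefficients. -/
noncomputable def quadForm (a b c d e h : k) : MvPolynomial (Fin 3) k :=
  C a * X 0 ^ 2 + C b * X 1 ^ 2 + C c * X 2 ^ 2 + C d * (X 0 * X 1) + C e * (X 0 * X 2) +
    C h * (X 1 * X 2)

theorem exists_eq_quadForm (hf : f.IsHomogeneous 2) : ∃ a b c d e h, f = quadForm a b c d e h := by
  obtain ⟨f₁, f₂, hf₁, hf₂, ef⟩ := exists_quadratic_expansion hf
  obtain ⟨α, β, rfl⟩ := exists_coeffs_linear hf₁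
  obtain ⟨γ, δ, ε, rfl⟩ := exists_coeffs_quadratic hf₂
  refine ⟨aeval ![1, 0, 0] f, γ, ε, α, β, δ, ef.trans ?_⟩
  simp only [map_add, map_mul, map_pow, rename_X, rename_C, Fin.succ_zero_eq_one,
    Fin.succ_one_eq_two, quadForm]
  ring

theorem HasCurve.of_eq_linSubst {f₀ : MvPolynomial (Fin 3) k} {N : Matrix (Fin 3) (Fin 3) k}
    (hN : N.det ≠ 0) (hf : f = linSubst N f₀) (hs : SmoothPair f g) (hg : g.IsHomogeneous 4)
    (H : ∀ g', SmoothPair f₀ g' → g'.IsHomogeneous 4 → HasCurve f₀ g') : HasCurve f g := by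
  obtain ⟨M, hM⟩ := exists_mul_eq_one_of_det_ne_zero hN
  refine HasCurve.of_det_ne_zero (M := M)
    (fun h => by simpa [h] using congrArg Matrix.det hM) hs fun hs => ?_
  rw [hf, linSubst_linSubst hM] at hs ⊢
  exact H _ hs (linSubst_isHomogeneous hg)

/-- Over a finite field of characteristic two it is enough to treat four quadratic forms. -/
theorem HasCurve.of_quadForm_cases [Finite k] (h2 : (2 : k) = 0) (hf0 : f ≠ 0) (hs : SmoothPair f g)
    (hf : f.IsHomogeneous 2) (hg : g.IsHomogeneous 4)
    (H₁ : ∀ g', SmoothPair (X 0 ^ 2 + X 1 * X 2) g' → g'.IsHomogeneous 4 →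
      HasCurve (X 0 ^ 2 + X 1 * X 2 : MvPolynomial (Fin 3) k) g')
    (H₂ : ∀ g', SmoothPair (X 1 * X 2) g' → g'.IsHomogeneous 4 →
      HasCurve (X 1 * X 2 : MvPolynomial (Fin 3) k) g')
    (H₃ : ∀ (ν : k) g', (∀ t, t ^ 2 + t + ν ≠ 0) →
      SmoothPair (X 1 ^ 2 + X 1 * X 2 + C ν * X 2 ^ 2) g' → g'.IsHomogeneous 4 →
      HasCurve (X 1 ^ 2 + X 1 * X 2 + C ν * X 2 ^ 2) g')
    (H₄ : ∀ g', SmoothPair (X 0 ^ 2) g' → g'.IsHomogeneous 4 →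
      HasCurve (X 0 ^ 2 : MvPolynomial (Fin 3) k) g') : HasCurve f g := by
  have H2 : (2 : MvPolynomial (Fin 3) k) = 0 := by rw [← map_ofNat C 2, h2, map_zero]
  have hsquare : ∀ {a b c : k} {g}, quadForm a b c 0 0 0 ≠ 0 → SmoothPair (quadForm a b c 0 0 0) g →
      g.IsHomogeneous 4 → HasCurve (quadForm a b c 0 0 0) g := by
    intro a b c g h0 hs hg
    obtain ⟨α, rfl⟩ := exists_sq_eq_of_two_eq_zero h2 a
    obtain ⟨β, rfl⟩ := exists_sq_eq_of_two_eq_zero h2 b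
    obtain ⟨γ, rfl⟩ := exists_sq_eq_of_two_eq_zero h2 c
    have hne : (![α, β, γ] : Fin 3 → k) ≠ 0 := fun h => h0 (by
      have e0 := congrFun h 0
      have e1 := congrFun h 1
      have e2 := congrFun h 2
      simp at e0 e1 e2
      simp [quadForm, e0, e1, e2])
    obtain ⟨M, hM, hMP⟩ := exists_det_ne_zero_of_ne_zero hne
    refine HasCurve.of_eq_linSubst (N := M.transpose) (by rwa [Matrix.det_transpose]) ?_ hs hg H₄
    have m0 := hMP 0
    have m1 := hMP 1
    have m2 := hMP 2
    simp at m0 m1 m2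
    simp [quadForm, linSubst, Fin.sum_univ_three, m0, m1, m2]
    linear_combination -(C α * C β * X 0 * X 1 + C α * C γ * X 0 * X 2 + C β * C γ * X 1 * X 2) * H2
  obtain ⟨a, b, c, d, e, h, rfl⟩ := exists_eq_quadForm hf
  by_cases hr : (![h, e, d] : Fin 3 → k) = 0
  · have e0 := congrFun hr 0
    have e1 := congrFun hr 1
    have e2 := congrFun hr 2
    simp at e0 e1 e2
    subst e0 e1 e2
    exact hsquare hf0 hs hg
  obtain ⟨M, hM, hMP⟩ := exists_det_ne_zero_of_ne_zero hr
  have m0 := hMP 0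
  have m1 := hMP 1
  have m2 := hMP 2
  simp at m0 m1 m2
  have hf0' : linSubst M (quadForm a b c d e h) ≠ 0 := fun h => hf0 (by
    obtain ⟨N, hN⟩ := exists_mul_eq_one_of_det_ne_zero hM
    rw [← linSubst_linSubst hN (quadForm _ _ _ _ _ _), h, map_zero])
  refine HasCurve.of_det_ne_zero hM hs fun hs => ?_
  have hg' : (linSubst M g).IsHomogeneous 4 := linSubst_isHomogeneous hg
  obtain ⟨a', b', c', h', e'⟩ : ∃ a' b' c' h' : k,
      linSubst M (quadForm a b c d e h) = quadForm a' b' c' 0 0 h' := by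
    let Q : Fin 3 → k := fun i => a * M 0 i ^ 2 + b * M 1 i ^ 2 + c * M 2 i ^ 2 +
      d * (M 0 i * M 1 i) + e * (M 0 i * M 2 i) + h * (M 1 i * M 2 i)
    refine ⟨Q 0, Q 1, Q 2, d * (M 0 1 * M 1 2 + M 0 2 * M 1 1) + e * (M 0 1 * M 2 2 + M 0 2 * M 2 1) +
      h * (M 1 1 * M 2 2 + M 1 2 * M 2 1), ?_⟩
    simp [quadForm, linSubst, Fin.sum_univ_three, m0, m1, m2, Q]
    linear_combination (X 0 * X 1 * (C a * C h * C (M 0 1) + C b * C e * C (M 1 1) + C c * C d * C (M 2 1) +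
        C d * C h * C (M 1 1) + C d * C e * C (M 0 1) + C e * C h * C (M 2 1)) +
      X 0 * X 2 * (C a * C h * C (M 0 2) + C b * C e * C (M 1 2) + C c * C d * C (M 2 2) +
        C d * C h * C (M 1 2) + C d * C e * C (M 0 2) + C e * C h * C (M 2 2)) +
      X 1 * X 2 * (C a * C (M 0 1) * C (M 0 2) + C b * C (M 1 1) * C (M 1 2) +
        C c * C (M 2 1) * C (M 2 2))) * H2
  rw [e'] at hs hf0' ⊢
  by_cases hh : h' = 0
  · subst hh
    exact hsquare hf0' hs hg'
  obtain ⟨α, rfl⟩ := exists_sq_eq_of_two_eq_zero h2 a'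
  obtain ⟨β, rfl⟩ := exists_sq_eq_of_two_eq_zero h2 b'
  obtain ⟨γ, hγ⟩ := exists_sq_eq_of_two_eq_zero h2 c'
  by_cases hα : α = 0
  · subst hα
    by_cases hβ : β = 0
    · subst hβ
      refine HasCurve.of_eq_linSubst (N := !![1, 0, 0; 0, h', c'; 0, 0, 1])
        (by simpa [Matrix.det_fin_three] using hh) ?_ hs hg' H₂
      simp [quadForm, linSubst, Fin.sum_univ_three]
      ring
    by_cases hroot : ∃ t, β ^ 2 * t ^ 2 + h' * t + c' = 0
    · obtain ⟨t, ht⟩ := hroot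
      refine HasCurve.of_eq_linSubst (N := !![1, 0, 0; 0, 1, t; 0, β ^ 2, β ^ 2 * t + h'])
        (by rw [Matrix.det_fin_three]; simp; rw [mul_comm t]; simpa using hh) ?_ hs hg' H₂
      have Ht := congrArg (C : k → MvPolynomial (Fin 3) k) ht
      simp only [map_add, map_mul, map_pow, map_zero] at Ht
      simp [quadForm, linSubst, Fin.sum_univ_three]
      linear_combination X 2 ^ 2 * Ht - (X 1 * X 2 * C β ^ 2 * C t +
        X 2 ^ 2 * (C β ^ 2 * C t ^ 2 + C h' * C t)) * H2
    · push Not at hroot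
      refine HasCurve.of_eq_linSubst (f₀ := X 1 ^ 2 + X 1 * X 2 + C (c' * β ^ 2 / h' ^ 2) * X 2 ^ 2)
        (N := !![1, 0, 0; 0, β, 0; 0, 0, h' / β])
        (by simp [Matrix.det_fin_three]; exact ⟨hβ, hh, hβ⟩) ?_ hs hg'
        (fun g' hs hg => H₃ _ g' (fun t ht => hroot (h' * t / β ^ 2) ?_) hs hg)
      · have e1 : C c' = (C (c' * β ^ 2 / h' ^ 2) * C (h' / β) ^ 2 : MvPolynomial (Fin 3) k) := by
          rw [← C_pow, ← C_mul]; congr 1; field_simp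
        have e3 : C h' = (C β * C (h' / β) : MvPolynomial (Fin 3) k) := by
          rw [← C_mul]; congr 1; field_simp
        simp only [quadForm, linSubst, Fin.sum_univ_three, map_add, map_mul, map_pow, aeval_X,
          aeval_C, algebraMap_eq]
        simp [-map_div₀]
        rw [e1, e3]
        ring
      · field_simp
        field_simp at ht
        linear_combination ht
  · refine HasCurve.of_eq_linSubst (N := !![α, β, γ; 0, h', 0; 0, 0, 1])
      (by simpa [Matrix.det_fin_three] using ⟨hα, hh⟩) ?_ hs hg' H₁
    rw [← hγ]
    simp [quadForm, linSubst, Fin.sum_univ_three]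
    linear_combination -(C α * C β * X 0 * X 1 + C α * C γ * X 0 * X 2 + C β * C γ * X 1 * X 2) * H2

end

section

variable {k : Type u} [Field k] {f g : MvPolynomial (Fin 3) k}

/-- The ternary quartic form with the given coefficients. -/
noncomputable def quarticForm (a₁ a₂ a₃ b₁ b₂ b₃ c₁ c₂ c₃ c₄ c₅ c₆ d₁ d₂ d₃ : k) :
    MvPolynomial (Fin 3) k :=
  C a₁ * X 0 ^ 4 + C a₂ * X 1 ^ 4 + C a₃ * X 2 ^ 4 +
    C b₁ * (X 0 ^ 2 * X 1 ^ 2) + C b₂ * (X 0 ^ 2 * X 2 ^ 2) + C b₃ * (X 1 ^ 2 * X 2 ^ 2) +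
    C c₁ * (X 0 ^ 3 * X 1) + C c₂ * (X 0 ^ 3 * X 2) + C c₃ * (X 0 * X 1 ^ 3) +
    C c₄ * (X 0 * X 2 ^ 3) + C c₅ * (X 1 ^ 3 * X 2) + C c₆ * (X 1 * X 2 ^ 3) +
    C d₁ * (X 0 ^ 2 * X 1 * X 2) + C d₂ * (X 0 * X 1 ^ 2 * X 2) + C d₃ * (X 0 * X 1 * X 2 ^ 2)

theorem exists_eq_quarticForm (hg : g.IsHomogeneous 4) :
    ∃ a₁ a₂ a₃ b₁ b₂ b₃ c₁ c₂ c₃ c₄ c₅ c₆ d₁ d₂ d₃,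
      g = quarticForm a₁ a₂ a₃ b₁ b₂ b₃ c₁ c₂ c₃ c₄ c₅ c₆ d₁ d₂ d₃ := by
  obtain ⟨g₁, g₂, g₃, g₄, hg₁, hg₂, hg₃, hg₄, eg⟩ := exists_quartic_expansion hg
  obtain ⟨l₁, l₂, rfl⟩ := exists_coeffs_linear hg₁
  obtain ⟨m₁, m₂, m₃, rfl⟩ := exists_coeffs_quadratic hg₂
  obtain ⟨n₁, n₂, n₃, n₄, rfl⟩ := exists_coeffs_cubic hg₃
  obtain ⟨e₁, e₂, e₃, e₄, e₅, rfl⟩ := exists_coeffs_quartic hg₄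
  refine ⟨aeval ![1, 0, 0] g, e₁, e₅, m₁, m₃, e₃, l₁, l₂, n₁, n₄, e₂, e₄, m₂, n₂, n₃, eg.trans ?_⟩
  simp only [map_add, map_mul, map_pow, rename_X, rename_C, Fin.succ_zero_eq_one,
    Fin.succ_one_eq_two, quarticForm]
  ring

variable {a₁ a₂ a₃ b₁ b₂ b₃ c₁ c₂ c₃ c₄ c₅ c₆ d₁ d₂ d₃ : k}

theorem quarticForm_isHomogeneous :
    (quarticForm a₁ a₂ a₃ b₁ b₂ b₃ c₁ c₂ c₃ c₄ c₅ c₆ d₁ d₂ d₃).IsHomogeneous 4 := by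
  have h : ∀ (a : k) {i j l : ℕ}, i + j + l = 4 →
      (C a * (X 0 ^ i * X 1 ^ j * X 2 ^ l) : MvPolynomial (Fin 3) k).IsHomogeneous 4 := fun a i j l h => by
    have := (isHomogeneous_C (Fin 3) a).mul
      ((((isHomogeneous_X k (0 : Fin 3)).pow i).mul ((isHomogeneous_X k (1 : Fin 3)).pow j)).mul
        ((isHomogeneous_X k (2 : Fin 3)).pow l))
    rwa [one_mul, one_mul, one_mul, zero_add, h] at this
  have e : quarticForm a₁ a₂ a₃ b₁ b₂ b₃ c₁ c₂ c₃ c₄ c₅ c₆ d₁ d₂ d₃ =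
      C a₁ * (X 0 ^ 4 * X 1 ^ 0 * X 2 ^ 0) + C a₂ * (X 0 ^ 0 * X 1 ^ 4 * X 2 ^ 0) +
      C a₃ * (X 0 ^ 0 * X 1 ^ 0 * X 2 ^ 4) + C b₁ * (X 0 ^ 2 * X 1 ^ 2 * X 2 ^ 0) +
      C b₂ * (X 0 ^ 2 * X 1 ^ 0 * X 2 ^ 2) + C b₃ * (X 0 ^ 0 * X 1 ^ 2 * X 2 ^ 2) +
      C c₁ * (X 0 ^ 3 * X 1 ^ 1 * X 2 ^ 0) + C c₂ * (X 0 ^ 3 * X 1 ^ 0 * X 2 ^ 1) +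
      C c₃ * (X 0 ^ 1 * X 1 ^ 3 * X 2 ^ 0) + C c₄ * (X 0 ^ 1 * X 1 ^ 0 * X 2 ^ 3) +
      C c₅ * (X 0 ^ 0 * X 1 ^ 3 * X 2 ^ 1) + C c₆ * (X 0 ^ 0 * X 1 ^ 1 * X 2 ^ 3) +
      C d₁ * (X 0 ^ 2 * X 1 ^ 1 * X 2 ^ 1) + C d₂ * (X 0 ^ 1 * X 1 ^ 2 * X 2 ^ 1) +
      C d₃ * (X 0 ^ 1 * X 1 ^ 1 * X 2 ^ 2) := by
    simp only [quarticForm]; ring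
  rw [e]
  repeat' apply IsHomogeneous.add
  all_goals exact h _ rfl

theorem aeval_quarticForm {A : Type*} [CommRing A] [Algebra k A] (x y z : A) :
    aeval ![x, y, z] (quarticForm a₁ a₂ a₃ b₁ b₂ b₃ c₁ c₂ c₃ c₄ c₅ c₆ d₁ d₂ d₃) =
      algebraMap k A a₁ * x ^ 4 + algebraMap k A a₂ * y ^ 4 + algebraMap k A a₃ * z ^ 4 +
      algebraMap k A b₁ * (x ^ 2 * y ^ 2) + algebraMap k A b₂ * (x ^ 2 * z ^ 2) +
      algebraMap k A b₃ * (y ^ 2 * z ^ 2) + algebraMap k A c₁ * (x ^ 3 * y) +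
      algebraMap k A c₂ * (x ^ 3 * z) + algebraMap k A c₃ * (x * y ^ 3) +
      algebraMap k A c₄ * (x * z ^ 3) + algebraMap k A c₅ * (y ^ 3 * z) +
      algebraMap k A c₆ * (y * z ^ 3) + algebraMap k A d₁ * (x ^ 2 * y * z) +
      algebraMap k A d₂ * (x * y ^ 2 * z) + algebraMap k A d₃ * (x * y * z ^ 2) := by
  simp [quarticForm]

theorem eval_quarticForm (x y z : k) :
    aeval ![x, y, z] (quarticForm a₁ a₂ a₃ b₁ b₂ b₃ c₁ c₂ c₃ c₄ c₅ c₆ d₁ d₂ d₃) =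
      a₁ * x ^ 4 + a₂ * y ^ 4 + a₃ * z ^ 4 + b₁ * (x ^ 2 * y ^ 2) + b₂ * (x ^ 2 * z ^ 2) +
      b₃ * (y ^ 2 * z ^ 2) + c₁ * (x ^ 3 * y) + c₂ * (x ^ 3 * z) + c₃ * (x * y ^ 3) +
      c₄ * (x * z ^ 3) + c₅ * (y ^ 3 * z) + c₆ * (y * z ^ 3) + d₁ * (x ^ 2 * y * z) +
      d₂ * (x * y ^ 2 * z) + d₃ * (x * y * z ^ 2) := by
  rw [aeval_quarticForm]; rfl

theorem HasCurve.of_shift_of_two_eq_zero (h2 : (2 : k) = 0) {Q G : MvPolynomial (Fin 3) k}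
    (hG : g = G + Q ^ 2 + f * Q) (hs : SmoothPair f g) (h : SmoothPair f G → HasCurve f G) :
    HasCurve f g := by
  have H2 : (2 : MvPolynomial (Fin 3) k) = 0 := by rw [← map_ofNat C 2, h2, map_zero]
  have e : g - Q ^ 2 - f * Q = G := by rw [hG]; ring
  have e' : f + 2 * Q = f := by rw [H2, zero_mul, add_zero]
  have := hs.shift Q
  rw [e, e'] at this
  refine HasCurve.of_shift Q ?_
  rw [e, e']
  exact h this

/-- In characteristic two, a form without the monomials `y³z` and `yz³` has a double point on the
line `x = 0` when `f = x²`. -/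
theorem SmoothPair.false_of_sq (h2 : (2 : k) = 0)
    (hs : SmoothPair (X 0 ^ 2) (quarticForm a₁ a₂ a₃ b₁ b₂ b₃ c₁ c₂ c₃ c₄ 0 0 d₁ d₂ d₃)) : False := by
  let Ω := AlgebraicClosure k
  let φ := algebraMap k Ω
  have H2 : (2 : Ω) = 0 := by rw [← map_ofNat φ 2, h2, map_zero]
  have hX : ∀ i, (X i : MvPolynomial (Fin 2) Ω).IsHomogeneous 1 := fun i => isHomogeneous_X Ω i
  have hE : (C (φ c₃) * X 0 ^ 3 + C (φ c₄) * X 1 ^ 3 + C (φ d₂) * (X 0 ^ 2 * X 1) +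
      C (φ d₃) * (X 0 * X 1 ^ 2) : MvPolynomial (Fin 2) Ω).IsHomogeneous 3 := by
    repeat' apply IsHomogeneous.add
    · simpa using (isHomogeneous_C _ _).mul ((hX 0).pow 3)
    · simpa using (isHomogeneous_C _ _).mul ((hX 1).pow 3)
    · simpa using (isHomogeneous_C _ _).mul (((hX 0).pow 2).mul (hX 1))
    · simpa using (isHomogeneous_C _ _).mul ((hX 0).mul ((hX 1).pow 2))
  obtain ⟨P, hP, h0⟩ := exists_root_of_isHomogeneous hE three_ne_zero
  simp at h0
  obtain ⟨w, hw⟩ := IsAlgClosed.exists_pow_nat_eq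
    (φ a₂ * P 0 ^ 4 + φ a₃ * P 1 ^ 4 + φ b₃ * (P 0 ^ 2 * P 1 ^ 2)) two_pos
  refine hs Ω ![0, P 0, P 1] w (fun h => hP ?_) ?_ ?_ fun i => ?_
  · ext i; fin_cases i
    · simpa using congrFun h 1
    · simpa using congrFun h 2
  · simp [H2]
  · rw [aeval_quarticForm]; simp; linear_combination hw
  · fin_cases i
    · simp [quarticForm, pderiv_X, Derivation.leibniz, Derivation.leibniz_pow]
      linear_combination -h0
    · simp [quarticForm, pderiv_X, Derivation.leibniz, Derivation.leibniz_pow]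
      linear_combination -(2 * φ a₂ * P 0 ^ 3 + φ b₃ * P 0 * P 1 ^ 2) * H2
    · simp [quarticForm, pderiv_X, Derivation.leibniz, Derivation.leibniz_pow]
      linear_combination -(2 * φ a₃ * P 1 ^ 3 + φ b₃ * P 1 * P 0 ^ 2) * H2

theorem HasCurve.of_sq_quarticForm [Finite k] (h2 : (2 : k) = 0)
    (hs : SmoothPair (X 0 ^ 2) (quarticForm a₁ a₂ a₃ b₁ b₂ b₃ c₁ c₂ c₃ c₄ c₅ c₆ d₁ d₂ d₃))
    (H : ∀ a c₁ c₂ d₁, SmoothPair (X 0 ^ 2) (quarticForm a 0 0 0 0 0 c₁ c₂ c₃ c₄ c₅ c₆ d₁ d₂ d₃) →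
      HasCurve (X 0 ^ 2) (quarticForm a 0 0 0 0 0 c₁ c₂ c₃ c₄ c₅ c₆ d₁ d₂ d₃)) :
    HasCurve (X 0 ^ 2) (quarticForm a₁ a₂ a₃ b₁ b₂ b₃ c₁ c₂ c₃ c₄ c₅ c₆ d₁ d₂ d₃) := by
  have : CharP k 2 := CharTwo.of_one_ne_zero_of_two_eq_zero one_ne_zero h2
  obtain ⟨q, rfl⟩ := exists_sq_eq_of_two_eq_zero h2 a₂
  obtain ⟨r, rfl⟩ := exists_sq_eq_of_two_eq_zero h2 a₃
  obtain ⟨u, rfl⟩ := exists_sq_eq_of_two_eq_zero h2 b₃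
  obtain ⟨s, hs'⟩ := exists_sq_eq_of_two_eq_zero h2 (b₁ - q)
  obtain ⟨t, ht⟩ := exists_sq_eq_of_two_eq_zero h2 (b₂ - r)
  obtain rfl : b₁ = s ^ 2 + q := by linear_combination -hs'
  obtain rfl : b₂ = t ^ 2 + r := by linear_combination -ht
  refine HasCurve.of_shift_of_two_eq_zero h2 (Q := quadForm 0 q r s t u) ?_ hs
    (H a₁ (c₁ - s) (c₂ - t) (d₁ - u))
  simp only [quarticForm, quadForm, map_zero, map_add, map_sub, map_pow]
  grind

theorem HasCurve.of_sq_normalForm [Finite k] (h2 : (2 : k) = 0) (hs : SmoothPair (X 0 ^ 2) g)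
    (hg : g.IsHomogeneous 4)
    (H : ∀ a c₁ c₂ c₃ c₄ c₅ c₆ d₁ d₂ d₃,
      SmoothPair (X 0 ^ 2) (quarticForm a 0 0 0 0 0 c₁ c₂ c₃ c₄ c₅ c₆ d₁ d₂ d₃) →
      HasCurve (X 0 ^ 2 : MvPolynomial (Fin 3) k)
        (quarticForm a 0 0 0 0 0 c₁ c₂ c₃ c₄ c₅ c₆ d₁ d₂ d₃)) : HasCurve (X 0 ^ 2) g := by
  obtain ⟨a₁, a₂, a₃, b₁, b₂, b₃, c₁, c₂, c₃, c₄, c₅, c₆, d₁, d₂, d₃, rfl⟩ := exists_eq_quarticForm hg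
  exact HasCurve.of_sq_quarticForm h2 hs fun a c₁ c₂ d₁ => H a c₁ c₂ c₃ c₄ c₅ c₆ d₁ d₂ d₃

theorem FiniteField.sq_add_self_add_one_of_forall_ne [Fintype k] (hq : Fintype.card k = 4) (h2 : (2 : k) = 0)
    {a b : k} (ha : a ≠ 0) (h : ∀ w, w ^ 2 + a * w ≠ b) : (b * a) ^ 2 + b * a + 1 = 0 := by
  have h3 : a ^ 3 = 1 := by
    have := FiniteField.pow_card_sub_one_eq_one a ha
    rwa [hq] at this
  have := FiniteField.artinSchreier_eq_zero_of_forall_ne h2 (n := 2) (c := b * a) (by rw [hq]; rfl)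
    fun w hw => h (w * a) (by linear_combination a ^ 2 * hw + b * h3)
  simp only [FiniteField.artinSchreier] at this
  linear_combination this - b * a * h2

theorem FiniteField.coeff_eq_zero_of_card_eq_four [Fintype k] (hq : Fintype.card k = 4) {a b c d : k}
    (h : ∀ x : k, a + b * x + c * x ^ 2 + d * x ^ 3 = 0) : a = 0 ∧ b = 0 ∧ c = 0 ∧ d = 0 := by
  have := coeff_eq_zero_of_forall_sum_eq_zero (n := 4) hq.ge (c := ![a, b, c, d])
    (fun x => by simp [Fin.sum_univ_succ]; linear_combination h x)
  exact ⟨by simpa using this 0, by simpa using this 1, by simpa using this 2, by simpa using this 3⟩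

theorem FiniteField.cubic_coeff_of_card_eq_four [Fintype k] (hq : Fintype.card k = 4) (h2 : (2 : k) = 0)
    {a b c d : k} (h : ∀ x : k, (a + b * x + c * x ^ 2 + d * x ^ 3) ^ 2 +
      (a + b * x + c * x ^ 2 + d * x ^ 3) + 1 = 0) :
    a ^ 2 + a + 1 = 0 ∧ b + c ^ 2 = 0 ∧ d ^ 2 + d = 0 := by
  have hx : ∀ x : k, x ^ 4 = x := fun x => by rw [← hq]; exact FiniteField.pow_card x
  obtain ⟨h0, h1, -, h3⟩ := FiniteField.coeff_eq_zero_of_card_eq_four hq (a := a ^ 2 + a + 1)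
    (b := b + c ^ 2) (c := c + b ^ 2) (d := d ^ 2 + d) fun x => by
      linear_combination h x - (c ^ 2 + d ^ 2 * x ^ 2) * hx x -
        (a * b * x + a * c * x ^ 2 + a * d * x ^ 3 + b * c * x ^ 3 + b * d * x ^ 4 + c * d * x ^ 5) * h2
  exact ⟨h0, h1, h3⟩

theorem sq_add_self_add_one_of_not_hasCurve [Fintype k] (hq : Fintype.card k = 4) (h2 : (2 : k) = 0)
    (hno : ¬HasCurve f (quarticForm a₁ a₂ a₃ b₁ b₂ b₃ c₁ c₂ c₃ c₄ c₅ c₆ d₁ d₂ d₃))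
    (hs : SmoothPair f (quarticForm a₁ a₂ a₃ b₁ b₂ b₃ c₁ c₂ c₃ c₄ c₅ c₆ d₁ d₂ d₃))
    (hf : f.IsHomogeneous 2) (x y z : k) {δ : k} (e : aeval ![x, y, z] f = δ) (hδ : δ ≠ 0) :
    ((a₁ * x ^ 4 + a₂ * y ^ 4 + a₃ * z ^ 4 + b₁ * (x ^ 2 * y ^ 2) + b₂ * (x ^ 2 * z ^ 2) +
      b₃ * (y ^ 2 * z ^ 2) + c₁ * (x ^ 3 * y) + c₂ * (x ^ 3 * z) + c₃ * (x * y ^ 3) +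
      c₄ * (x * z ^ 3) + c₅ * (y ^ 3 * z) + c₆ * (y * z ^ 3) + d₁ * (x ^ 2 * y * z) +
      d₂ * (x * y ^ 2 * z) + d₃ * (x * y * z ^ 2)) * δ) ^ 2 +
    (a₁ * x ^ 4 + a₂ * y ^ 4 + a₃ * z ^ 4 + b₁ * (x ^ 2 * y ^ 2) + b₂ * (x ^ 2 * z ^ 2) +
      b₃ * (y ^ 2 * z ^ 2) + c₁ * (x ^ 3 * y) + c₂ * (x ^ 3 * z) + c₃ * (x * y ^ 3) +
      c₄ * (x * z ^ 3) + c₅ * (y ^ 3 * z) + c₆ * (y * z ^ 3) + d₁ * (x ^ 2 * y * z) +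
      d₂ * (x * y ^ 2 * z) + d₃ * (x * y * z ^ 2)) * δ + 1 = 0 := by
  rw [← eval_quarticForm]
  exact FiniteField.sq_add_self_add_one_of_forall_ne hq h2 hδ fun w hw =>
    hno (HasCurve.of_value h2 hs hf quarticForm_isHomogeneous (P := ![x, y, z]) (e ▸ hδ) (by rwa [e]))

theorem HasCurve.of_sq_of_card_eq_four [Fintype k] (hq : Fintype.card k = 4) (h2 : (2 : k) = 0)
    (hs : SmoothPair (X 0 ^ 2) g) (hg : g.IsHomogeneous 4) : HasCurve (X 0 ^ 2) g := by
  refine HasCurve.of_sq_normalForm h2 hs hg fun a c₁ c₂ c₃ c₄ c₅ c₆ d₁ d₂ d₃ hs => ?_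
  by_contra hno
  have key := fun y z : k => sq_add_self_add_one_of_not_hasCurve hq h2 hno hs
    (by simpa using (isHomogeneous_X k (0 : Fin 3)).pow 2) 1 y z (δ := 1) (by simp) one_ne_zero
  obtain rfl : c₅ = 0 := by
    have h := fun z => (FiniteField.cubic_coeff_of_card_eq_four hq h2 (a := a + c₂ * z + c₄ * z ^ 3)
      (b := c₁ + d₁ * z + d₃ * z ^ 2 + c₆ * z ^ 3) (c := d₂ * z) (d := c₃ + c₅ * z)
      fun y => by linear_combination key y z).2.2
    have := (FiniteField.coeff_eq_zero_of_card_eq_four hq (a := c₃ ^ 2 + c₃) (b := c₅) (c := c₅ ^ 2)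
      (d := 0) fun z => by linear_combination h z - c₃ * c₅ * z * h2).2.1
    exact this
  obtain rfl : c₆ = 0 := by
    have h := fun y => (FiniteField.cubic_coeff_of_card_eq_four hq h2 (a := a + c₁ * y + c₃ * y ^ 3)
      (b := c₂ + d₁ * y + d₂ * y ^ 2) (c := d₃ * y) (d := c₄ + c₆ * y)
      fun z => by linear_combination key y z).2.2
    have := (FiniteField.coeff_eq_zero_of_card_eq_four hq (a := c₄ ^ 2 + c₄) (b := c₆) (c := c₆ ^ 2)
      (d := 0) fun z => by linear_combination h z - c₄ * c₆ * z * h2).2.1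
    exact this
  exact hs.false_of_sq h2

theorem SmoothPair.false_of_first
    (hf : aeval ![(1 : k), 0, 0] f = 0)
    (hs : SmoothPair f (quarticForm 0 a₂ a₃ b₁ b₂ b₃ 0 0 c₃ c₄ c₅ c₆ d₁ d₂ d₃)) : False := by
  refine hs k ![1, 0, 0] 0 (fun h => by simpa using congrFun h 0) (by rw [hf]; ring)
    (by simp [quarticForm]) fun i => ?_
  fin_cases i <;> simp [quarticForm, pderiv_X, Derivation.leibniz, Derivation.leibniz_pow]

theorem SmoothPair.false_of_second
    (hf : aeval ![(0 : k), 1, 0] f = 0)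
    (hs : SmoothPair f (quarticForm a₁ 0 a₃ b₁ b₂ b₃ c₁ c₂ 0 c₄ 0 c₆ d₁ d₂ d₃)) : False := by
  refine hs k ![0, 1, 0] 0 (fun h => by simpa using congrFun h 1) (by rw [hf]; ring)
    (by simp [quarticForm]) fun i => ?_
  fin_cases i <;> simp [quarticForm, pderiv_X, Derivation.leibniz, Derivation.leibniz_pow]

theorem isHomogeneous_norm {ν : k} :
    (X 1 ^ 2 + X 1 * X 2 + C ν * X 2 ^ 2 : MvPolynomial (Fin 3) k).IsHomogeneous 2 := by
  have hX : ∀ i, (X i : MvPolynomial (Fin 3) k).IsHomogeneous 1 := isHomogeneous_X k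
  exact (((hX 1).pow 2).add ((hX 1).mul (hX 2))).add
    (by simpa using (isHomogeneous_C _ ν).mul ((hX 2).pow 2))

theorem HasCurve.of_norm_normalForm [Finite k] (h2 : (2 : k) = 0) {ν : k}
    (hs : SmoothPair (X 1 ^ 2 + X 1 * X 2 + C ν * X 2 ^ 2) g) (hg : g.IsHomogeneous 4)
    (H : ∀ a₂ a₃ b₁ b₂ b₃ c₁ c₂ c₃ c₄ c₅ c₆ d₁ d₂ d₃,
      SmoothPair (X 1 ^ 2 + X 1 * X 2 + C ν * X 2 ^ 2)
        (quarticForm 0 a₂ a₃ b₁ b₂ b₃ c₁ c₂ c₃ c₄ c₅ c₆ d₁ d₂ d₃) →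
      HasCurve (X 1 ^ 2 + X 1 * X 2 + C ν * X 2 ^ 2 : MvPolynomial (Fin 3) k)
        (quarticForm 0 a₂ a₃ b₁ b₂ b₃ c₁ c₂ c₃ c₄ c₅ c₆ d₁ d₂ d₃)) :
    HasCurve (X 1 ^ 2 + X 1 * X 2 + C ν * X 2 ^ 2) g := by
  obtain ⟨a₁, a₂, a₃, b₁, b₂, b₃, c₁, c₂, c₃, c₄, c₅, c₆, d₁, d₂, d₃, rfl⟩ := exists_eq_quarticForm hg
  obtain ⟨p, rfl⟩ := exists_sq_eq_of_two_eq_zero h2 a₁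
  refine HasCurve.of_shift_of_two_eq_zero h2 (Q := C p * X 0 ^ 2) ?_ hs
    (H a₂ a₃ (b₁ - p) (b₂ - ν * p) b₃ c₁ c₂ c₃ c₄ c₅ c₆ (d₁ - p) d₂ d₃)
  simp only [quarticForm, map_zero, map_mul, map_sub, map_pow]
  ring

theorem HasCurve.of_norm_of_card_eq_four [Fintype k] (hq : Fintype.card k = 4) (h2 : (2 : k) = 0) {ν : k}
    (hν : ∀ t, t ^ 2 + t + ν ≠ 0)
    (hs : SmoothPair (X 1 ^ 2 + X 1 * X 2 + C ν * X 2 ^ 2) g) (hg : g.IsHomogeneous 4) :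
    HasCurve (X 1 ^ 2 + X 1 * X 2 + C ν * X 2 ^ 2) g := by
  have hx : ∀ x : k, x ^ 4 = x := fun x => by rw [← hq]; exact FiniteField.pow_card x
  refine HasCurve.of_norm_normalForm h2 hs hg fun a₂ a₃ b₁ b₂ b₃ c₁ c₂ c₃ c₄ c₅ c₆ d₁ d₂ d₃ hs => ?_
  by_contra hno
  have hN3 : ∀ y : k, (y ^ 2 + y + ν) ^ 3 = 1 := fun y => by
    have := FiniteField.pow_card_sub_one_eq_one _ (hν y)
    rwa [hq] at this
  have key := fun x y : k => sq_add_self_add_one_of_not_hasCurve hq h2 hno hs isHomogeneous_norm x y 1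
    (δ := y ^ 2 + y + ν) (by simp) (hν y)
  have h := fun y => (FiniteField.cubic_coeff_of_card_eq_four hq h2
    (a := (y ^ 2 + y + ν) * (a₂ * y ^ 4 + a₃ + b₃ * y ^ 2 + c₅ * y ^ 3 + c₆ * y))
    (b := (y ^ 2 + y + ν) * (c₃ * y ^ 3 + c₄ + d₂ * y ^ 2 + d₃ * y))
    (c := (y ^ 2 + y + ν) * (b₁ * y ^ 2 + b₂ + d₁ * y)) (d := (y ^ 2 + y + ν) * (c₁ * y + c₂))
    fun x => by linear_combination key x y).2.2
  obtain ⟨h₀, h₁, h₂, h₃⟩ := FiniteField.coeff_eq_zero_of_card_eq_four hq (a := c₂ ^ 2 * ν + c₂)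
    (b := c₁ ^ 2 + c₂ ^ 2 + c₁) (c := c₁ ^ 2 * ν + c₂ ^ 2) (d := c₁ ^ 2) fun y => by
      linear_combination (y ^ 2 + y + ν) ^ 2 * h y - (c₁ ^ 2) * hx y -
        ((y ^ 2 + y + ν) * (c₁ * y + c₂) ^ 2 + (c₁ * y + c₂)) * hN3 y -
          (c₁ * c₂ * y) * (y ^ 2 + y + ν) * h2
  obtain rfl : c₁ = 0 := by simpa using h₃
  obtain rfl : c₂ = 0 := by simpa using h₂
  exact hs.false_of_first (by simp)

end

section

variable {k : Type u} [Field k] {f g : MvPolynomial (Fin 3) k}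
  {a₁ a₂ a₃ b₁ b₂ b₃ c₁ c₂ c₃ c₄ c₅ c₆ d₁ d₂ d₃ : k}

theorem linSubst_swap_quarticForm : linSubst !![1, 0, 0; 0, 0, 1; 0, 1, 0]
    (quarticForm a₁ a₂ a₃ b₁ b₂ b₃ c₁ c₂ c₃ c₄ c₅ c₆ d₁ d₂ d₃) =
      quarticForm a₁ a₃ a₂ b₂ b₁ b₃ c₂ c₁ c₄ c₃ c₆ c₅ d₁ d₃ d₂ := by
  simp [quarticForm, linSubst, Fin.sum_univ_three]
  ring

theorem HasCurve.swap_quarticForm (hf : linSubst !![1, 0, 0; 0, 0, 1; 0, 1, 0] f = f)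
    (hs : SmoothPair f (quarticForm a₁ a₂ a₃ b₁ b₂ b₃ c₁ c₂ c₃ c₄ c₅ c₆ d₁ d₂ d₃))
    (h : SmoothPair f (quarticForm a₁ a₃ a₂ b₂ b₁ b₃ c₂ c₁ c₄ c₃ c₆ c₅ d₁ d₃ d₂) →
      HasCurve f (quarticForm a₁ a₃ a₂ b₂ b₁ b₃ c₂ c₁ c₄ c₃ c₆ c₅ d₁ d₃ d₂)) :
    HasCurve f (quarticForm a₁ a₂ a₃ b₁ b₂ b₃ c₁ c₂ c₃ c₄ c₅ c₆ d₁ d₂ d₃) := by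
  refine HasCurve.of_det_ne_zero (M := !![1, 0, 0; 0, 0, 1; 0, 1, 0])
    (by simp [Matrix.det_fin_three]) hs ?_
  rwa [hf, linSubst_swap_quarticForm]

theorem HasCurve.of_eval_of_two_eq_zero {x y z w F : Polynomial k} (h2 : (2 : k) = 0)
    (hF : aeval (![x, y, z] : Fin 3 → Polynomial k) f = F)
    (h : w ^ 2 + F * w = aeval (![x, y, z] : Fin 3 → Polynomial k) g) (hF0 : F ≠ 0)
    (h3 : ∃ i j : Fin 3, ![x, y, z] i * Polynomial.derivative (![x, y, z] j) ≠
      ![x, y, z] j * Polynomial.derivative (![x, y, z] i)) : HasCurve f g := by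
  have H2 : (2 : Polynomial k) = 0 := by rw [← map_ofNat Polynomial.C 2, h2, map_zero]
  exact ⟨![x, y, z], w, by rw [hF, h], by rwa [hF, H2, zero_mul, zero_add], h3⟩

theorem HasCurve.mul_quarticForm_one (h2 : (2 : k) = 0) {A : k} (hA : A ^ 2 + A + 1 = 0) :
    HasCurve (X 1 * X 2) (quarticForm 0 0 0 0 0 A 1 1 0 0 1 1 0 0 0) := by
  have : CharP k 2 := CharTwo.of_one_ne_zero_of_two_eq_zero one_ne_zero h2
  have hA' := congrArg (Polynomial.C : k → _) hA
  simp only [map_add, map_pow, map_one, map_zero] at hA'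
  refine HasCurve.of_eval_of_two_eq_zero h2
    (x := .C A * .X ^ 4 + .C A * .X ^ 2 + 1) (y := .X ^ 2 + .X) (z := .X ^ 2 + .X + 1)
    (w := .X ^ 6 + .X ^ 3 + 1) (F := .X ^ 4 + .X) ?_ ?_ ?_ ⟨1, 2, ?_⟩
  · simp only [map_mul, aeval_X, Matrix.cons_val]
    grind
  · rw [aeval_quarticForm]
    simp only [map_zero, map_one, Polynomial.algebraMap_eq]
    grind
  · intro h
    simpa [Polynomial.coeff_X] using congrArg (Polynomial.coeff · 1) h
  · intro h
    simp at h
    have : (1 : Polynomial k) = 0 := by grind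
    exact one_ne_zero this

theorem HasCurve.mul_quarticForm_sq (h2 : (2 : k) = 0) {A : k} (hA : A ^ 2 + A + 1 = 0) :
    HasCurve (X 1 * X 2) (quarticForm 0 0 0 0 0 A 1 1 0 0 (A + 1) A 0 0 0) := by
  have : CharP k 2 := CharTwo.of_one_ne_zero_of_two_eq_zero one_ne_zero h2
  have hA' := congrArg (Polynomial.C : k → _) hA
  simp only [map_add, map_pow, map_one, map_zero] at hA'
  have hA0 : A ≠ 0 := by rintro rfl; simp at hA
  have hA1 : A + 1 ≠ 0 := fun h => hA0 (by linear_combination (-1 : k) * hA + (A + 1) * h)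
  refine HasCurve.of_eval_of_two_eq_zero h2
    (x := .C A * .X ^ 2 + .X ^ 3 + .X ^ 2 + .X) (y := .C (A + 1) * .X ^ 2)
    (z := .C (A + 1) * (.X ^ 4 + .X ^ 3 + .X + 1))
    (w := .C A * .X ^ 5 + .C A * .X ^ 4 + .C A * .X ^ 2 + .X ^ 7 + .X ^ 6 + .X ^ 5 + .X ^ 3 + .X ^ 2 + .X)
    (F := .C A * (.X ^ 6 + .X ^ 5 + .X ^ 3 + .X ^ 2)) ?_ ?_ ?_ ⟨1, 0, ?_⟩
  · simp only [map_mul, aeval_X, Matrix.cons_val, map_add, map_one]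
    grind
  · rw [aeval_quarticForm]
    simp only [map_zero, map_one, Polynomial.algebraMap_eq, map_add]
    grind
  · intro h
    simpa [Polynomial.coeff_X, hA0] using congrArg (Polynomial.coeff · 2) h
  · intro h
    have : Polynomial.C (A + 1) * (.X ^ 4 + .X ^ 2) = 0 := by
      simp at h
      simp only [map_add, map_one]
      grind
    simpa [Polynomial.coeff_X, hA1, -map_add] using congrArg (Polynomial.coeff · 2) this

theorem isHomogeneous_mul : (X 1 * X 2 : MvPolynomial (Fin 3) k).IsHomogeneous 2 :=
  (isHomogeneous_X k (1 : Fin 3)).mul (isHomogeneous_X k (2 : Fin 3))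

theorem HasCurve.of_mul_normalForm [Finite k] (h2 : (2 : k) = 0) (hs : SmoothPair (X 1 * X 2) g)
    (hg : g.IsHomogeneous 4)
    (H : ∀ b c₁ c₂ c₃ c₄ c₅ c₆ d₁ d₂ d₃,
      SmoothPair (X 1 * X 2) (quarticForm 0 0 0 0 0 b c₁ c₂ c₃ c₄ c₅ c₆ d₁ d₂ d₃) →
      HasCurve (X 1 * X 2 : MvPolynomial (Fin 3) k)
        (quarticForm 0 0 0 0 0 b c₁ c₂ c₃ c₄ c₅ c₆ d₁ d₂ d₃)) : HasCurve (X 1 * X 2) g := by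
  have : CharP k 2 := CharTwo.of_one_ne_zero_of_two_eq_zero one_ne_zero h2
  obtain ⟨a₁, a₂, a₃, b₁, b₂, b₃, c₁, c₂, c₃, c₄, c₅, c₆, d₁, d₂, d₃, rfl⟩ := exists_eq_quarticForm hg
  obtain ⟨p, rfl⟩ := exists_sq_eq_of_two_eq_zero h2 a₁
  obtain ⟨q, rfl⟩ := exists_sq_eq_of_two_eq_zero h2 a₂
  obtain ⟨r, rfl⟩ := exists_sq_eq_of_two_eq_zero h2 a₃
  obtain ⟨s, rfl⟩ := exists_sq_eq_of_two_eq_zero h2 b₁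
  obtain ⟨t, rfl⟩ := exists_sq_eq_of_two_eq_zero h2 b₂
  refine HasCurve.of_shift_of_two_eq_zero h2 (Q := quadForm p q r s t 0) ?_ hs
    (H b₃ c₁ c₂ c₃ c₄ (c₅ - q) (c₆ - r) (d₁ - p) (d₂ - s) (d₃ - t))
  simp only [quarticForm, quadForm, map_zero, map_sub, map_pow]
  grind

theorem mul_quarticForm_relations [Fintype k] (hq : Fintype.card k = 4) (h2 : (2 : k) = 0)
    (hno : ¬HasCurve (X 1 * X 2) (quarticForm 0 0 0 0 0 b₃ c₁ c₂ c₃ c₄ c₅ c₆ d₁ d₂ d₃))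
    (hs : SmoothPair (X 1 * X 2) (quarticForm 0 0 0 0 0 b₃ c₁ c₂ c₃ c₄ c₅ c₆ d₁ d₂ d₃)) :
    b₃ ^ 2 + b₃ + 1 = 0 ∧ c₁ = c₂ ^ 2 ∧ c₄ = c₃ + d₁ ^ 2 ∧ c₆ = c₅ ^ 2 ∧ d₂ = 0 ∧ d₃ = 0 := by
  have : CharP k 2 := CharTwo.of_one_ne_zero_of_two_eq_zero one_ne_zero h2
  have hx : ∀ x : k, x ^ 4 = x := fun x => by rw [← hq]; exact FiniteField.pow_card x
  have key := fun x y : k => sq_add_self_add_one_of_not_hasCurve hq h2 hno hs isHomogeneous_mul x y 1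
    (δ := y) (by simp)
  have h := fun y hy => FiniteField.cubic_coeff_of_card_eq_four hq h2
    (a := y * (b₃ * y ^ 2 + c₅ * y ^ 3 + c₆ * y)) (b := y * (c₃ * y ^ 3 + c₄ + d₂ * y ^ 2 + d₃ * y))
    (c := y * (d₁ * y)) (d := y * (c₁ * y + c₂)) fun x => by linear_combination key x y hy
  have hc : ∀ {b c d : k}, (∀ y, y ≠ 0 → b * y + c * y ^ 2 + d * y ^ 3 = 0) → b = 0 ∧ c = 0 ∧ d = 0 :=
    fun {b c d} h => (FiniteField.coeff_eq_zero_of_card_eq_four hq (a := 0) fun y => by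
      by_cases hy : y = 0
      · rw [hy]; ring
      · linear_combination h y hy).2
  obtain ⟨h₁, -, h₃⟩ := hc (b := b₃ ^ 2 + b₃ + 1) (c := c₆ ^ 2 + c₅) (d := c₆ + c₅ ^ 2) fun y hy => by
    have := (h y hy).1
    have := hx y
    grind
  obtain ⟨h₄, h₅, h₆⟩ := hc (b := d₂) (c := c₃ + c₄ + d₁ ^ 2) (d := d₃) fun y hy => by
    have := (h y hy).2.1
    have := hx y
    grind
  obtain ⟨h₇, -, -⟩ := hc (b := c₁ + c₂ ^ 2) (c := 0) (d := c₂ + c₁ ^ 2) fun y hy => by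
    have := (h y hy).2.2
    have := hx y
    grind
  exact ⟨h₁, by grind, by grind, by grind, h₄, h₆⟩

theorem HasCurve.of_mul_reduced [Fintype k] (hq : Fintype.card k = 4) (h2 : (2 : k) = 0)
    (hs : SmoothPair (X 1 * X 2) (quarticForm 0 0 0 0 0 b₃ 1 1 0 0 c₅ c₆ 0 0 0)) :
    HasCurve (X 1 * X 2) (quarticForm 0 0 0 0 0 b₃ 1 1 0 0 c₅ c₆ 0 0 0) := by
  by_contra hno
  obtain ⟨hA, -, -, rfl, -, -⟩ := mul_quarticForm_relations hq h2 hno hs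
  have hc0 : c₅ ≠ 0 := by
    rintro rfl
    exact hs.false_of_second (by simp)
  have hc3 : c₅ ^ 3 = 1 := by
    have := FiniteField.pow_card_sub_one_eq_one c₅ hc0
    rwa [hq] at this
  have : (c₅ - 1) * ((c₅ - b₃) * (c₅ - (b₃ + 1))) = 0 := by
    have : CharP k 2 := CharTwo.of_one_ne_zero_of_two_eq_zero one_ne_zero h2
    grind
  rcases mul_eq_zero.1 this with h | h
  · obtain rfl := sub_eq_zero.1 h
    exact hno (by simpa using HasCurve.mul_quarticForm_one h2 hA)
  rcases mul_eq_zero.1 h with h | h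
  · obtain rfl := sub_eq_zero.1 h
    refine hno (HasCurve.swap_quarticForm (by simp [linSubst, Fin.sum_univ_three, mul_comm]) hs fun _ => ?_)
    rw [show c₅ ^ 2 = c₅ + 1 by linear_combination hA - (c₅ + 1) * h2]
    exact HasCurve.mul_quarticForm_sq h2 hA
  · obtain rfl := sub_eq_zero.1 h
    rw [show (b₃ + 1) ^ 2 = b₃ by linear_combination hA] at hno
    exact hno (HasCurve.mul_quarticForm_sq h2 hA)

theorem HasCurve.of_mul_shear [Fintype k] (hq : Fintype.card k = 4) (h2 : (2 : k) = 0) {ω p e m m' : k}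
    (hs : SmoothPair (X 1 * X 2) (quarticForm 0 0 0 0 0 ω 1 1 p (p + e ^ 2) m m' e 0 0)) :
    HasCurve (X 1 * X 2) (quarticForm 0 0 0 0 0 ω 1 1 p (p + e ^ 2) m m' e 0 0) := by
  have : CharP k 2 := CharTwo.of_one_ne_zero_of_two_eq_zero one_ne_zero h2
  have hx : ∀ x : k, (C x : MvPolynomial (Fin 3) k) ^ 4 = C x := fun x => by
    rw [← map_pow, ← hq, FiniteField.pow_card]
  let u := p ^ 2
  let v := u + e
  let q := (u ^ 3 + p * u) ^ 2
  let r := (v ^ 3 + v * (p + e ^ 2)) ^ 2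
  have hu : (C u : MvPolynomial (Fin 3) k) = C p ^ 2 := map_pow _ _ _
  have hv : (C v : MvPolynomial (Fin 3) k) = C u + C e := map_add _ _ _
  have hq' : (C q : MvPolynomial (Fin 3) k) ^ 2 = C u ^ 3 + C p * C u := by
    calc (C q : MvPolynomial (Fin 3) k) ^ 2 = C (u ^ 3 + p * u) ^ 4 := by simp only [q, map_pow]; ring
      _ = _ := by rw [hx]; simp only [map_add, map_mul, map_pow]
  have hr' : (C r : MvPolynomial (Fin 3) k) ^ 2 = C v ^ 3 + C v * (C p + C e ^ 2) := by
    calc (C r : MvPolynomial (Fin 3) k) ^ 2 = C (v ^ 3 + v * (p + e ^ 2)) ^ 4 := by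
          simp only [r, map_pow]; ring
      _ = _ := by rw [hx]; simp only [map_add, map_mul, map_pow]
  refine HasCurve.of_det_ne_zero (M := !![1, u, v; 0, 1, 0; 0, 0, 1])
    (by simp [Matrix.det_fin_three]) hs fun hs => ?_
  have hf : linSubst !![1, u, v; 0, 1, 0; 0, 0, 1] (X 1 * X 2) = (X 1 * X 2 : MvPolynomial (Fin 3) k) := by
    simp [linSubst, Fin.sum_univ_three]
  rw [hf] at hs ⊢
  refine HasCurve.of_shift_of_two_eq_zero h2 (Q := quadForm 0 q r (u ^ 2) (v ^ 2) 0)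
    (G := quarticForm 0 0 0 0 0 (ω + u ^ 2 * v + u * v ^ 2) 1 1 0 0
      (m + u ^ 3 + u ^ 2 * v + e * u ^ 2 + p * v - q)
      (m' + v ^ 3 + u * v ^ 2 + e * v ^ 2 + u * (p + e ^ 2) - r) 0 0 0) ?_ hs
    (HasCurve.of_mul_reduced hq h2)
  have h1 := hx u
  have h2 := hx v
  have h3 := hx p
  simp [quarticForm, quadForm, linSubst, Fin.sum_univ_three]
  clear_value u v q r
  grind

theorem HasCurve.of_mul_of_card_eq_four [Fintype k] (hq : Fintype.card k = 4) (h2 : (2 : k) = 0)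
    (hs : SmoothPair (X 1 * X 2) g) (hg : g.IsHomogeneous 4) : HasCurve (X 1 * X 2) g := by
  refine HasCurve.of_mul_normalForm h2 hs hg fun ω c₁ b p c₄ m c₆ e d₂ d₃ hs => ?_
  by_contra hno
  obtain ⟨-, rfl, rfl, rfl, rfl, rfl⟩ := mul_quarticForm_relations hq h2 hno hs
  have hb0 : b ≠ 0 := by
    rintro rfl
    rw [zero_pow two_ne_zero] at hs
    exact hs.false_of_first (by simp)
  have hb : b ^ 3 = 1 := by
    have := FiniteField.pow_card_sub_one_eq_one b hb0
    rwa [hq] at this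
  have hdet : (!![1, 0, 0; 0, b, 0; 0, 0, b ^ 2] : Matrix (Fin 3) (Fin 3) k).det ≠ 0 := by
    simp [Matrix.det_fin_three, hb0]
  apply hno
  refine HasCurve.of_det_ne_zero hdet hs fun hs => ?_
  have hb' := congrArg (C : k → MvPolynomial (Fin 3) k) hb
  simp only [map_pow, map_one] at hb'
  have hf : linSubst !![1, 0, 0; 0, b, 0; 0, 0, b ^ 2] (X 1 * X 2) =
      (X 1 * X 2 : MvPolynomial (Fin 3) k) := by
    simp [linSubst, Fin.sum_univ_three]
    linear_combination X 1 * X 2 * hb'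
  have hg : linSubst !![1, 0, 0; 0, b, 0; 0, 0, b ^ 2]
      (quarticForm 0 0 0 0 0 ω (b ^ 2) b p (p + e ^ 2) m (m ^ 2) e 0 0) =
      quarticForm 0 0 0 0 0 ω 1 1 p (p + e ^ 2) (m * b ^ 2) (m ^ 2 * b) e 0 0 := by
    simp [quarticForm, linSubst, Fin.sum_univ_three]
    grind
  rw [hf, hg] at hs ⊢
  exact HasCurve.of_mul_shear hq h2 hs

end

section

variable {k : Type u} [Field k] {f g : MvPolynomial (Fin 3) k}
  {a₁ a₂ a₃ b₁ b₂ b₃ c₁ c₂ c₃ c₄ c₅ c₆ d₁ d₂ d₃ : k}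

theorem HasCurve.conic_quarticForm (h2 : (2 : k) = 0) {A : k} (hA : A ^ 2 + A + 1 = 0) :
    HasCurve (X 0 ^ 2 + X 1 * X 2) (quarticForm A 0 0 0 0 A 0 0 1 1 0 0 0 0 0) := by
  have : CharP k 2 := CharTwo.of_one_ne_zero_of_two_eq_zero one_ne_zero h2
  have hA' := congrArg (Polynomial.C : k → _) hA
  simp only [map_add, map_pow, map_one, map_zero] at hA'
  refine HasCurve.of_eval_of_two_eq_zero h2
    (x := .C A + 1) (y := .C A * .X + .X ^ 2 + .X + 1)
    (z := .C A * .X ^ 5 + .C A * .X ^ 4 + .C A + .X ^ 6 + .X ^ 5 + .X ^ 4 + .X ^ 3 + .X)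
    (w := .C A * .X ^ 9 + .C A * .X ^ 8 + .C A * .X ^ 6 + .C A * .X ^ 4 + .C A * .X ^ 2 + .C A * .X +
      .X ^ 5 + .X ^ 2) (F := .X ^ 8 + .X ^ 2) ?_ ?_ ?_ ⟨0, 1, ?_⟩
  · simp only [map_add, map_pow, map_mul, aeval_X, Matrix.cons_val]
    grind
  · rw [aeval_quarticForm]
    simp only [map_zero, map_one, Polynomial.algebraMap_eq]
    grind
  · intro h
    simpa [Polynomial.coeff_X] using congrArg (Polynomial.coeff · 2) h
  · intro h
    simp at h
    have : (1 : Polynomial k) = 0 := by grind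
    exact one_ne_zero this

theorem isHomogeneous_conic : (X 0 ^ 2 + X 1 * X 2 : MvPolynomial (Fin 3) k).IsHomogeneous 2 :=
  ((isHomogeneous_X k (0 : Fin 3)).pow 2).add isHomogeneous_mul

theorem HasCurve.of_conic_normalForm [Finite k] (h2 : (2 : k) = 0) (hs : SmoothPair (X 0 ^ 2 + X 1 * X 2) g)
    (hg : g.IsHomogeneous 4)
    (H : ∀ a b c₁ c₂ c₃ c₄ c₅ c₆ d₂ d₃,
      SmoothPair (X 0 ^ 2 + X 1 * X 2) (quarticForm a 0 0 0 0 b c₁ c₂ c₃ c₄ c₅ c₆ 0 d₂ d₃) →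
      HasCurve (X 0 ^ 2 + X 1 * X 2 : MvPolynomial (Fin 3) k)
        (quarticForm a 0 0 0 0 b c₁ c₂ c₃ c₄ c₅ c₆ 0 d₂ d₃)) : HasCurve (X 0 ^ 2 + X 1 * X 2) g := by
  have : CharP k 2 := CharTwo.of_one_ne_zero_of_two_eq_zero one_ne_zero h2
  obtain ⟨a₁, a₂, a₃, b₁, b₂, b₃, c₁, c₂, c₃, c₄, c₅, c₆, d₁, d₂, d₃, rfl⟩ := exists_eq_quarticForm hg
  obtain ⟨q, rfl⟩ := exists_sq_eq_of_two_eq_zero h2 a₂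
  obtain ⟨r, rfl⟩ := exists_sq_eq_of_two_eq_zero h2 a₃
  obtain ⟨s, hs'⟩ := exists_sq_eq_of_two_eq_zero h2 (b₁ - q)
  obtain ⟨t, ht⟩ := exists_sq_eq_of_two_eq_zero h2 (b₂ - r)
  obtain rfl : b₁ = s ^ 2 + q := by linear_combination -hs'
  obtain rfl : b₂ = t ^ 2 + r := by linear_combination -ht
  refine HasCurve.of_shift_of_two_eq_zero h2
    (Q := quadForm 0 q r s t d₁) ?_ hs
    (H a₁ (b₃ - d₁ ^ 2 - d₁) (c₁ - s) (c₂ - t) c₃ c₄ (c₅ - q) (c₆ - r) (d₂ - s) (d₃ - t))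
  simp only [quarticForm, quadForm, map_zero, map_add, map_sub, map_pow]
  grind

theorem conic_quarticForm_relations [Fintype k] (hq : Fintype.card k = 4) (h2 : (2 : k) = 0)
    (hno : ¬HasCurve (X 0 ^ 2 + X 1 * X 2) (quarticForm a₁ 0 0 0 0 b₃ c₁ c₂ c₃ c₄ c₅ c₆ 0 d₂ d₃))
    (hs : SmoothPair (X 0 ^ 2 + X 1 * X 2) (quarticForm a₁ 0 0 0 0 b₃ c₁ c₂ c₃ c₄ c₅ c₆ 0 d₂ d₃)) :
    a₁ ^ 2 + a₁ + 1 = 0 ∧ b₃ = a₁ + c₃ + c₄ ∧ c₁ = 0 ∧ c₂ = 0 ∧ c₃ ^ 2 = c₃ ∧ c₄ ^ 2 = c₄ ∧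
      c₅ = d₂ ^ 2 ∧ c₆ = d₂ ∧ d₃ = d₂ ^ 2 := by
  have : CharP k 2 := CharTwo.of_one_ne_zero_of_two_eq_zero one_ne_zero h2
  have hx : ∀ x : k, x ^ 4 = x := fun x => by rw [← hq]; exact FiniteField.pow_card x
  have key := fun x c : k => sq_add_self_add_one_of_not_hasCurve hq h2 hno hs isHomogeneous_conic x 1
    (x ^ 2 + c) (δ := c) (by simp; grind)
  have key₀ := fun x : k => sq_add_self_add_one_of_not_hasCurve hq h2 hno hs isHomogeneous_conic x 0 1
    (δ := x ^ 2) (by simp)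
  have h3 : ∀ x : k, x ≠ 0 → x ^ 3 = 1 := fun x h => by
    have := FiniteField.pow_card_sub_one_eq_one x h
    rwa [hq] at this
  have hc : ∀ {b c d : k}, (∀ y, y ≠ 0 → b * y + c * y ^ 2 + d * y ^ 3 = 0) → b = 0 ∧ c = 0 ∧ d = 0 :=
    fun {b c d} h => (FiniteField.coeff_eq_zero_of_card_eq_four hq (a := 0) fun y => by
      by_cases hy : y = 0
      · rw [hy]; ring
      · linear_combination h y hy).2
  have h := fun c hc => FiniteField.cubic_coeff_of_card_eq_four hq h2
    (a := c₅ * c ^ 2 + b₃ + c₆ * c) (b := (a₁ + c₃ + b₃) * c + (d₂ + c₆) * c ^ 2 + d₃)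
    (c := (c₂ + d₃ + c₅) * c + c₄ * c ^ 2 + c₆) (d := (c₁ + d₂ + c₆) * c + c₂ * c ^ 2 + c₄) fun x => by
      rw [← key x c hc]
      have e : (a₁ * x ^ 4 + 0 * 1 ^ 4 + 0 * (x ^ 2 + c) ^ 4 + 0 * (x ^ 2 * 1 ^ 2) +
        0 * (x ^ 2 * (x ^ 2 + c) ^ 2) + b₃ * (1 ^ 2 * (x ^ 2 + c) ^ 2) + c₁ * (x ^ 3 * 1) +
        c₂ * (x ^ 3 * (x ^ 2 + c)) + c₃ * (x * 1 ^ 3) + c₄ * (x * (x ^ 2 + c) ^ 3) +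
        c₅ * (1 ^ 3 * (x ^ 2 + c)) + c₆ * (1 * (x ^ 2 + c) ^ 3) + 0 * (x ^ 2 * 1 * (x ^ 2 + c)) +
        d₂ * (x * 1 ^ 2 * (x ^ 2 + c)) + d₃ * (x * 1 * (x ^ 2 + c) ^ 2)) * c =
          c₅ * c ^ 2 + b₃ + c₆ * c + ((a₁ + c₃ + b₃) * c + (d₂ + c₆) * c ^ 2 + d₃) * x +
          ((c₂ + d₃ + c₅) * c + c₄ * c ^ 2 + c₆) * x ^ 2 + ((c₁ + d₂ + c₆) * c + c₂ * c ^ 2 + c₄) * x ^ 3 := by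
        have := hx x
        have := h3 c hc
        grind
      rw [e]
  obtain ⟨h₁, h₂, -⟩ := hc (b := b₃ ^ 2 + b₃ + 1) (c := c₅ ^ 2 + c₆) (d := c₅ + c₆ ^ 2) fun y hy => by
    have := (h y hy).1
    have := hx y
    grind
  obtain ⟨h₄, h₅, h₆⟩ := hc (b := d₃ + c₆ ^ 2) (c := a₁ + c₃ + b₃ + c₄ ^ 2) (d := d₂ + c₆ + (c₂ + d₃ + c₅) ^ 2)
    fun y hy => by
      have := (h y hy).2.1
      have := hx y
      grind
  obtain ⟨h₇, h₈, -⟩ := hc (b := c₄ + c₄ ^ 2) (c := (c₁ + d₂ + c₆) + c₂ ^ 2) (d := c₂ + (c₁ + d₂ + c₆) ^ 2)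
    fun y hy => by
      have := (h y hy).2.2
      have := hx y
      grind
  obtain ⟨h₉, h₁₀, -⟩ := hc (b := (a₁ + c₄) ^ 2 + (a₁ + c₄) + 1) (c := c₂ ^ 2) (d := c₂)
    fun y hy => by
      have e : (a₁ * y ^ 4 + 0 * 0 ^ 4 + 0 * 1 ^ 4 + 0 * (y ^ 2 * 0 ^ 2) + 0 * (y ^ 2 * 1 ^ 2) +
        b₃ * (0 ^ 2 * 1 ^ 2) + c₁ * (y ^ 3 * 0) + c₂ * (y ^ 3 * 1) + c₃ * (y * 0 ^ 3) +
        c₄ * (y * 1 ^ 3) + c₅ * (0 ^ 3 * 1) + c₆ * (0 * 1 ^ 3) + 0 * (y ^ 2 * 0 * 1) +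
        d₂ * (y * 0 ^ 2 * 1) + d₃ * (y * 0 * 1 ^ 2)) * y ^ 2 = a₁ + c₄ + c₂ * y ^ 2 := by
        have := h3 y hy
        grind
      have h := key₀ y (pow_ne_zero 2 hy)
      rw [e] at h
      have := hx y
      grind
  have hc2 : c₂ = 0 := by simpa using h₁₀
  have := hx c₅
  have := hx c₆
  have := hx d₂
  refine ⟨by grind, by grind, ?_, hc2, by grind, by grind, by grind, by grind, by grind⟩
  grind

theorem HasCurve.conic_shear [Fintype k] (hq : Fintype.card k = 4) (h2 : (2 : k) = 0) {ω p₁ p₄ r : k}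
    (hp : p₄ ^ 2 = p₄) (t : k)
    (hs : SmoothPair (X 0 ^ 2 + X 1 * X 2)
      (quarticForm ω 0 0 0 0 (ω + p₁ + p₄) 0 0 p₁ p₄ (r ^ 2) r 0 r (r ^ 2)))
    (H : ∀ p r', p = p₁ + t * r ^ 2 + t ^ 2 * r + p₄ * t ^ 3 → r' = r + p₄ * t →
      SmoothPair (X 0 ^ 2 + X 1 * X 2)
        (quarticForm ω 0 0 0 0 (ω + p + p₄) 0 0 p p₄ (r' ^ 2) r' 0 r' (r' ^ 2)) →
      HasCurve (X 0 ^ 2 + X 1 * X 2)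
        (quarticForm ω 0 0 0 0 (ω + p + p₄) 0 0 p p₄ (r' ^ 2) r' 0 r' (r' ^ 2))) :
    HasCurve (X 0 ^ 2 + X 1 * X 2)
      (quarticForm ω 0 0 0 0 (ω + p₁ + p₄) 0 0 p₁ p₄ (r ^ 2) r 0 r (r ^ 2)) := by
  have : CharP k 2 := CharTwo.of_one_ne_zero_of_two_eq_zero one_ne_zero h2
  have hx : ∀ x : k, (C x : MvPolynomial (Fin 3) k) ^ 4 = C x := fun x => by
    rw [← map_pow, ← hq, FiniteField.pow_card]
  refine HasCurve.of_det_ne_zero (M := !![1, t, 0; 0, 1, 0; 0, t ^ 2, 1])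
    (by simp [Matrix.det_fin_three]) hs fun hs => ?_
  have hf : linSubst !![1, t, 0; 0, 1, 0; 0, t ^ 2, 1] (X 0 ^ 2 + X 1 * X 2) =
      (X 0 ^ 2 + X 1 * X 2 : MvPolynomial (Fin 3) k) := by
    simp [linSubst, Fin.sum_univ_three]
    grind
  rw [hf] at hs ⊢
  have hg : linSubst !![1, t, 0; 0, 1, 0; 0, t ^ 2, 1]
      (quarticForm ω 0 0 0 0 (ω + p₁ + p₄) 0 0 p₁ p₄ (r ^ 2) r 0 r (r ^ 2)) =
      quarticForm ω 0 0 0 0 (ω + (p₁ + t * r ^ 2 + t ^ 2 * r + p₄ * t ^ 3) + p₄) 0 0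
        (p₁ + t * r ^ 2 + t ^ 2 * r + p₄ * t ^ 3) p₄ ((r + p₄ * t) ^ 2) (r + p₄ * t) 0
        (r + p₄ * t) ((r + p₄ * t) ^ 2) := by
    have ht := hx t
    have hp := congrArg (C : k → MvPolynomial (Fin 3) k) hp
    simp only [map_pow] at hp
    simp [quarticForm, linSubst, Fin.sum_univ_three]
    grind
  rw [hg] at hs ⊢
  exact H _ _ rfl rfl hs

theorem HasCurve.conic_of_right_one [Fintype k] (hq : Fintype.card k = 4) (h2 : (2 : k) = 0) {ω p r : k}
    (hω : ω ^ 2 + ω + 1 = 0) (hp : p ^ 2 = p)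
    (hs : SmoothPair (X 0 ^ 2 + X 1 * X 2)
      (quarticForm ω 0 0 0 0 (ω + p + 1) 0 0 p 1 (r ^ 2) r 0 r (r ^ 2))) :
    HasCurve (X 0 ^ 2 + X 1 * X 2)
      (quarticForm ω 0 0 0 0 (ω + p + 1) 0 0 p 1 (r ^ 2) r 0 r (r ^ 2)) := by
  have : CharP k 2 := CharTwo.of_one_ne_zero_of_two_eq_zero one_ne_zero h2
  have hr : r ^ 4 = r := by rw [← hq]; exact FiniteField.pow_card r
  refine HasCurve.conic_shear hq h2 (one_pow 2) r hs fun p' r' hp' hr' hs => ?_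
  obtain rfl : r' = 0 := by grind
  have : p' * (p' - 1) = 0 := by grind
  rw [zero_pow two_ne_zero] at hs ⊢
  rcases mul_eq_zero.1 this with h | h
  · rw [h] at hs
    exact (hs.false_of_second (by simp)).elim
  · rw [sub_eq_zero.1 h, show ω + 1 + 1 = ω by linear_combination h2]
    exact HasCurve.conic_quarticForm h2 hω

theorem HasCurve.of_conic_of_card_eq_four [Fintype k] (hq : Fintype.card k = 4) (h2 : (2 : k) = 0)
    (hs : SmoothPair (X 0 ^ 2 + X 1 * X 2) g) (hg : g.IsHomogeneous 4) :
    HasCurve (X 0 ^ 2 + X 1 * X 2) g := by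
  have : CharP k 2 := CharTwo.of_one_ne_zero_of_two_eq_zero one_ne_zero h2
  have hx : ∀ x : k, x ^ 4 = x := fun x => by rw [← hq]; exact FiniteField.pow_card x
  refine HasCurve.of_conic_normalForm h2 hs hg fun ω b c₁ c₂ p₁ p₄ c₅ r d₂ d₃ hs => ?_
  by_contra hno
  obtain ⟨hω, rfl, rfl, rfl, hp₁, hp₄, rfl, rfl, rfl⟩ := conic_quarticForm_relations hq h2 hno hs
  have h01 : ∀ {p : k}, p ^ 2 = p → p = 0 ∨ p = 1 := fun {p} h => by
    have : p * (p - 1) = 0 := by linear_combination h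
    exact (mul_eq_zero.1 this).imp_right sub_eq_zero.1
  have left : ∀ r : k, SmoothPair (X 0 ^ 2 + X 1 * X 2)
      (quarticForm ω 0 0 0 0 (ω + 1 + 0) 0 0 1 0 (r ^ 2) r 0 r (r ^ 2)) →
      HasCurve (X 0 ^ 2 + X 1 * X 2)
      (quarticForm ω 0 0 0 0 (ω + 1 + 0) 0 0 1 0 (r ^ 2) r 0 r (r ^ 2)) := fun r hs => by
    refine HasCurve.swap_quarticForm (by simp [linSubst, Fin.sum_univ_three, mul_comm]) hs fun hs => ?_
    have := HasCurve.conic_of_right_one hq h2 (ω := ω) (p := 0) (r := r ^ 2) hω (by ring)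
    rw [show (r ^ 2) ^ 2 = r by rw [← pow_mul, hx], show ω + 0 + 1 = ω + 1 + 0 by ring] at this
    exact this hs
  rcases h01 hp₄ with rfl | rfl
  · rcases h01 hp₁ with rfl | rfl
    · have hr : r ≠ 0 := by
        rintro rfl
        rw [zero_pow two_ne_zero] at hs
        exact hs.false_of_second (by simp)
      refine hno (HasCurve.conic_shear hq h2 (by ring) (ω * r) hs fun p' r' hp' hr' hs => ?_)
      have hr3 : r ^ 3 = 1 := by
        have := FiniteField.pow_card_sub_one_eq_one r hr
        rwa [hq] at this
      obtain rfl : p' = 1 := by grind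
      exact left _ hs
    · exact hno (left r hs)
  · exact hno (HasCurve.conic_of_right_one hq h2 hω hp₁ hs)

end

section

variable {k : Type u} [Field k]

/-- The value of a quadratic form at a point. -/
def quadVal {R : Type*} [CommRing R] (a b c d e h x y z : R) : R :=
  a * x ^ 2 + b * y ^ 2 + c * z ^ 2 + d * (x * y) + e * (x * z) + h * (y * z)

/-- The polar form of a quadratic form in characteristic two. -/
def quadPolar {R : Type*} [CommRing R] (d e h x y z x' y' z' : R) : R :=
  d * (x * y' + x' * y) + e * (x * z' + x' * z) + h * (y * z' + y' * z)

/-- The value of a quartic form at a point. -/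
def quarticVal {R : Type*} [CommRing R] (a₁ a₂ a₃ b₁ b₂ b₃ c₁ c₂ c₃ c₄ c₅ c₆ d₁ d₂ d₃ x y z : R) : R :=
  a₁ * x ^ 4 + a₂ * y ^ 4 + a₃ * z ^ 4 + b₁ * (x ^ 2 * y ^ 2) + b₂ * (x ^ 2 * z ^ 2) +
    b₃ * (y ^ 2 * z ^ 2) + c₁ * (x ^ 3 * y) + c₂ * (x ^ 3 * z) + c₃ * (x * y ^ 3) +
    c₄ * (x * z ^ 3) + c₅ * (y ^ 3 * z) + c₆ * (y * z ^ 3) + d₁ * (x ^ 2 * y * z) +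
    d₂ * (x * y ^ 2 * z) + d₃ * (x * y * z ^ 2)

/-- In characteristic two, the coefficient of `s³t` in the value of a quartic form at
`s • (x, y, z) + t • (x', y', z')`. -/
def quarticPolar {R : Type*} [CommRing R] (c₁ c₂ c₃ c₄ c₅ c₆ d₁ d₂ d₃ x y z x' y' z' : R) : R :=
  (c₁ * x ^ 2 + c₃ * y ^ 2 + d₃ * z ^ 2) * (x * y' + x' * y) +
    (c₂ * x ^ 2 + d₂ * y ^ 2 + c₄ * z ^ 2) * (x * z' + x' * z) +
    (d₁ * x ^ 2 + c₅ * y ^ 2 + c₆ * z ^ 2) * (y * z' + y' * z)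

/-- In characteristic two, the coefficient of `s²t²` in the value of a quartic form at
`s • (x, y, z) + t • (x', y', z')`. -/
def quarticMid {R : Type*} [CommRing R] (b₁ b₂ b₃ c₁ c₂ c₃ c₄ c₅ c₆ d₁ d₂ d₃ x y z x' y' z' : R) : R :=
  b₁ * (x ^ 2 * y' ^ 2 + x' ^ 2 * y ^ 2) + b₂ * (x ^ 2 * z' ^ 2 + x' ^ 2 * z ^ 2) +
    b₃ * (y ^ 2 * z' ^ 2 + y' ^ 2 * z ^ 2) +
    (c₁ * (x * x') + c₃ * (y * y')) * (x * y' + x' * y) +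
    (c₂ * (x * x') + c₄ * (z * z')) * (x * z' + x' * z) +
    (c₅ * (y * y') + c₆ * (z * z')) * (y * z' + y' * z) +
    d₁ * (x ^ 2 * (y' * z') + x' ^ 2 * (y * z)) + d₂ * (y ^ 2 * (x' * z') + y' ^ 2 * (x * z)) +
    d₃ * (z ^ 2 * (x' * y') + z' ^ 2 * (x * y))

variable {a₁ a₂ a₃ b₁ b₂ b₃ c₁ c₂ c₃ c₄ c₅ c₆ d₁ d₂ d₃ e₁ e₂ e₃ e₄ e₅ e₆ : k}

theorem quarticVal_add {R : Type*} [CommRing R] (h2 : (2 : R) = 0)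
    {a₁ a₂ a₃ b₁ b₂ b₃ c₁ c₂ c₃ c₄ c₅ c₆ d₁ d₂ d₃ x y z x' y' z' s t : R} :
    quarticVal a₁ a₂ a₃ b₁ b₂ b₃ c₁ c₂ c₃ c₄ c₅ c₆ d₁ d₂ d₃ (s * x + t * x') (s * y + t * y')
      (s * z + t * z') =
    quarticVal a₁ a₂ a₃ b₁ b₂ b₃ c₁ c₂ c₃ c₄ c₅ c₆ d₁ d₂ d₃ x y z * s ^ 4 +
    quarticPolar c₁ c₂ c₃ c₄ c₅ c₆ d₁ d₂ d₃ x y z x' y' z' * (s ^ 3 * t) +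
    quarticMid b₁ b₂ b₃ c₁ c₂ c₃ c₄ c₅ c₆ d₁ d₂ d₃ x y z x' y' z' * (s ^ 2 * t ^ 2) +
    quarticPolar c₁ c₂ c₃ c₄ c₅ c₆ d₁ d₂ d₃ x' y' z' x y z * (s * t ^ 3) +
    quarticVal a₁ a₂ a₃ b₁ b₂ b₃ c₁ c₂ c₃ c₄ c₅ c₆ d₁ d₂ d₃ x' y' z' * t ^ 4 := by
  have p4 : ∀ a b : R, (a + b) ^ 4 = a ^ 4 + b ^ 4 := fun a b => by
    linear_combination (2 * a ^ 3 * b + 3 * a ^ 2 * b ^ 2 + 2 * a * b ^ 3) * h2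
  have p2 : ∀ a b : R, (a + b) ^ 2 = a ^ 2 + b ^ 2 := fun a b => by
    linear_combination (a * b) * h2
  have p3 : ∀ a b : R, (a + b) ^ 3 = (a ^ 2 + b ^ 2) * (a + b) := fun a b => by
    rw [pow_succ, p2]
  have c (x y x' y' : R) : (s * x + t * x') ^ 3 * (s * y + t * y') = x ^ 3 * y * s ^ 4 +
      x ^ 2 * (x * y' + x' * y) * (s ^ 3 * t) + (x * x') * (x * y' + x' * y) * (s ^ 2 * t ^ 2) +
      x' ^ 2 * (x * y' + x' * y) * (s * t ^ 3) + x' ^ 3 * y' * t ^ 4 := by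
    linear_combination (x ^ 2 * x' * y * s ^ 3 * t + (x * x' * (x * y' + x' * y)) * s ^ 2 * t ^ 2 +
      x * x' ^ 2 * y' * s * t ^ 3) * h2
  simp only [quarticVal, quarticPolar, quarticMid, p4, p2]
  simp only [mul_comm (s * x + t * x') ((s * y + t * y') ^ 3), mul_comm (s * x + t * x') ((s * z + t * z') ^ 3),
    mul_comm (s * y + t * y') ((s * z + t * z') ^ 3), c]
  ring

theorem aeval_quadForm {A : Type*} [CommRing A] [Algebra k A] (x y z : A) :
    aeval ![x, y, z] (quadForm e₁ e₂ e₃ e₄ e₅ e₆) = quadVal (algebraMap k A e₁) (algebraMap k A e₂)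
      (algebraMap k A e₃) (algebraMap k A e₄) (algebraMap k A e₅) (algebraMap k A e₆) x y z := by
  simp [quadForm, quadVal]

theorem HasCurve.quarticForm_of_tangent_line [Finite k] (h2 : (2 : k) = 0) {x y z x' y' z' α a b h₁ : k}
    (hPR : ¬(x * y' = y * x' ∧ x * z' = z * x' ∧ y * z' = z * y'))
    (hf : quadVal e₁ e₂ e₃ e₄ e₅ e₆ x y z = 0) (ha : quadPolar e₄ e₅ e₆ x y z x' y' z' = a)
    (hb : quadVal e₁ e₂ e₃ e₄ e₅ e₆ x' y' z' = b) (hab : a ≠ 0 ∨ b ≠ 0)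
    (hg : quarticVal a₁ a₂ a₃ b₁ b₂ b₃ c₁ c₂ c₃ c₄ c₅ c₆ d₁ d₂ d₃ x y z = α ^ 2)
    (hg₁ : quarticPolar c₁ c₂ c₃ c₄ c₅ c₆ d₁ d₂ d₃ x y z x' y' z' = a * α)
    (hg₃ : quarticPolar c₁ c₂ c₃ c₄ c₅ c₆ d₁ d₂ d₃ x' y' z' x y z = h₁)
    (hD : a ^ 2 * quarticVal a₁ a₂ a₃ b₁ b₂ b₃ c₁ c₂ c₃ c₄ c₅ c₆ d₁ d₂ d₃ x' y' z' + a * b * h₁ +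
      b ^ 2 * (quarticMid b₁ b₂ b₃ c₁ c₂ c₃ c₄ c₅ c₆ d₁ d₂ d₃ x y z x' y' z' + b * α) + h₁ ^ 2 ≠ 0) :
    HasCurve (quadForm e₁ e₂ e₃ e₄ e₅ e₆)
      (quarticForm a₁ a₂ a₃ b₁ b₂ b₃ c₁ c₂ c₃ c₄ c₅ c₆ d₁ d₂ d₃) := by
  have : CharP k 2 := CharTwo.of_one_ne_zero_of_two_eq_zero one_ne_zero h2
  generalize hg₂ : quarticMid b₁ b₂ b₃ c₁ c₂ c₃ c₄ c₅ c₆ d₁ d₂ d₃ x y z x' y' z' = g₂ at hD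
  generalize hg₄ : quarticVal a₁ a₂ a₃ b₁ b₂ b₃ c₁ c₂ c₃ c₄ c₅ c₆ d₁ d₂ d₃ x' y' z' = h₂ at hD
  obtain ⟨p, q, hpq⟩ : ∃ p q : k, a * p + b * q = 1 := by
    rcases hab with h | h
    · exact ⟨a⁻¹, 0, by field_simp; simp⟩
    · exact ⟨0, b⁻¹, by field_simp; simp⟩
  obtain ⟨W, hW⟩ := exists_sq_eq_of_two_eq_zero h2 ((g₂ + b * α) * b ^ 2 + h₁ * (a * b) + h₂ * a ^ 2)
  let β := W + h₁
  have hβ : β ≠ 0 := fun h => hD (by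
    have : β ^ 2 = 0 := by rw [h]; ring
    simp only [β] at this
    grind)
  have hCβ : Polynomial.C β = Polynomial.C W + Polynomial.C h₁ := map_add _ _ _
  generalize hc : (g₂ + b * α) * p ^ 2 + h₁ * (p * q) + h₂ * q ^ 2 = c
  let T : Polynomial k := .X ^ 2 + .X + .C c
  let S : Polynomial k := T * .C b + .C β * .C p
  let R : Polynomial k := T * .C a + .C β * .C q
  let V : Polynomial k := T * .C W + .C β * .X
  have H2 : (2 : Polynomial k) = 0 := by rw [← map_ofNat Polynomial.C 2, h2, map_zero]
  have hT : Polynomial.derivative T = 1 := by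
    simp only [T, Polynomial.derivative_add, Polynomial.derivative_X_pow, Polynomial.derivative_X,
      Polynomial.derivative_C, add_zero]
    rw [Nat.cast_ofNat, h2, map_zero]; ring
  have hS' : Polynomial.derivative S = .C b := by simp [S, hT]
  have hR' : Polynomial.derivative R = .C a := by simp [R, hT]
  have Hpq := congrArg (Polynomial.C (R := k)) hpq
  have HW := congrArg (Polynomial.C (R := k)) hW
  have Hc := congrArg (Polynomial.C (R := k)) hc
  simp only [map_add, map_mul, map_pow, map_one] at Hpq HW Hc
  have hL : .C a * S + .C b * R = .C β := by
    simp only [S, R]; linear_combination .C β * Hpq + .C a * .C b * T * H2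
  have hSR : S * .C a - R * .C b = .C β := by
    simp only [S, R]; linear_combination .C β * Hpq - .C b * .C β * .C q * H2
  have hV : V ^ 2 + .C β * V = (.C g₂ + .C b * .C α) * S ^ 2 + .C h₁ * (S * R) + .C h₂ * R ^ 2 := by
    have hTX : T = .X ^ 2 + .X + .C c := rfl
    simp only [S, R, V]
    clear_value T β
    clear hT hS' hR' hL hSR
    grind
  have hR0 : R ≠ 0 := fun h => by
    rw [h, Polynomial.derivative_zero] at hR'
    have ha0 : a = 0 := Polynomial.C_eq_zero.1 hR'.symm
    rw [h, mul_zero, add_zero, ha0, map_zero, zero_mul] at hL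
    exact hβ (Polynomial.C_eq_zero.1 hL.symm)
  clear_value S R V T
  refine HasCurve.of_eval_of_two_eq_zero h2 (x := S * .C x + R * .C x') (y := S * .C y + R * .C y')
    (z := S * .C z + R * .C z') (F := R * .C β) (w := R * V + .C α * S ^ 2) ?_ ?_
    (mul_ne_zero hR0 (Polynomial.C_ne_zero.2 hβ)) ?_
  · have Hf := congrArg (Polynomial.C (R := k)) hf
    have Ha := congrArg (Polynomial.C (R := k)) ha
    have Hb := congrArg (Polynomial.C (R := k)) hb
    rw [aeval_quadForm, ← hL]
    simp only [quadVal, quadPolar, map_add, map_mul, map_pow, map_zero, Polynomial.algebraMap_eq] at Hf Ha Hb ⊢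
    rw [← Ha, ← Hb]
    linear_combination S ^ 2 * Hf + (.C e₁ * .C x * .C x' + .C e₂ * .C y * .C y' + .C e₃ * .C z * .C z') * S * R * H2
  · have e : aeval ![S * .C x + R * .C x', S * .C y + R * .C y', S * .C z + R * .C z']
        (quarticForm a₁ a₂ a₃ b₁ b₂ b₃ c₁ c₂ c₃ c₄ c₅ c₆ d₁ d₂ d₃) = quarticVal (.C a₁) (.C a₂) (.C a₃)
        (.C b₁) (.C b₂) (.C b₃) (.C c₁) (.C c₂) (.C c₃) (.C c₄) (.C c₅) (.C c₆) (.C d₁) (.C d₂) (.C d₃)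
        (S * .C x + R * .C x') (S * .C y + R * .C y') (S * .C z + R * .C z') := aeval_quarticForm _ _ _
    have H := congrArg (Polynomial.C (R := k)) hg
    have H₁ := congrArg (Polynomial.C (R := k)) hg₁
    have H₂ := congrArg (Polynomial.C (R := k)) hg₂
    have H₃ := congrArg (Polynomial.C (R := k)) hg₃
    have H₄ := congrArg (Polynomial.C (R := k)) hg₄
    rw [e, quarticVal_add H2]
    have m₀ : ∀ x y z, Polynomial.C (quarticVal a₁ a₂ a₃ b₁ b₂ b₃ c₁ c₂ c₃ c₄ c₅ c₆ d₁ d₂ d₃ x y z) =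
        quarticVal (.C a₁) (.C a₂) (.C a₃) (.C b₁) (.C b₂) (.C b₃) (.C c₁) (.C c₂) (.C c₃) (.C c₄) (.C c₅)
          (.C c₆) (.C d₁) (.C d₂) (.C d₃) (.C x) (.C y) (.C z) := fun x y z => by simp [quarticVal]
    have m₁ : ∀ x y z x' y' z', Polynomial.C (quarticPolar c₁ c₂ c₃ c₄ c₅ c₆ d₁ d₂ d₃ x y z x' y' z') =
        quarticPolar (.C c₁) (.C c₂) (.C c₃) (.C c₄) (.C c₅) (.C c₆) (.C d₁) (.C d₂) (.C d₃) (.C x) (.C y)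
          (.C z) (.C x') (.C y') (.C z') := fun x y z x' y' z' => by simp [quarticPolar]
    have m₂ : Polynomial.C (quarticMid b₁ b₂ b₃ c₁ c₂ c₃ c₄ c₅ c₆ d₁ d₂ d₃ x y z x' y' z') =
        quarticMid (.C b₁) (.C b₂) (.C b₃) (.C c₁) (.C c₂) (.C c₃) (.C c₄) (.C c₅) (.C c₆) (.C d₁) (.C d₂)
          (.C d₃) (.C x) (.C y) (.C z) (.C x') (.C y') (.C z') := by simp [quarticMid]
    rw [m₀] at H H₄
    rw [m₁] at H₁ H₃
    rw [m₂] at H₂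
    rw [H, H₁, H₂, H₃, H₄]
    simp only [map_mul, map_pow]
    linear_combination R ^ 2 * hV - R * .C α * S ^ 2 * hL +
      (R * V * .C α * S ^ 2 + .C b * .C α * S ^ 2 * R ^ 2) * H2
  · by_contra! h
    have key : ∀ u u' v v' : k, (S * .C u + R * .C u') * Polynomial.derivative (S * .C v + R * .C v') =
        (S * .C v + R * .C v') * Polynomial.derivative (S * .C u + R * .C u') → u * v' = v * u' := by
      intro u u' v v' h
      simp only [Polynomial.derivative_add, Polynomial.derivative_mul, Polynomial.derivative_C, hS', hR',
        mul_zero, add_zero] at h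
      have : Polynomial.C β * (.C (u * v') - .C (v * u')) = 0 := by
        simp only [map_mul]
        linear_combination h - (.C u * .C v' - .C v * .C u') * hSR
      exact Polynomial.C_injective (sub_eq_zero.1
        ((mul_eq_zero.1 this).resolve_left (Polynomial.C_ne_zero.2 hβ)))
    exact hPR ⟨key _ _ _ _ (h 0 1), key _ _ _ _ (h 0 2), key _ _ _ _ (h 1 2)⟩

end

section

variable {k : Type u} [Field k] {a₁ a₂ a₃ b₁ b₂ b₃ c₁ c₂ c₃ c₄ c₅ c₆ d₁ d₂ d₃ e₁ e₂ e₃ e₄ e₅ e₆ : k}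

/-- The equations in characteristic two for a singular point of `w² + f w = g` above `(x, y, z)`. -/
def IsDoublePoint {R : Type*} [CommRing R]
    (e₁ e₂ e₃ e₄ e₅ e₆ a₁ a₂ a₃ b₁ b₂ b₃ c₁ c₂ c₃ c₄ c₅ c₆ d₁ d₂ d₃ x y z w : R) : Prop :=
  quadVal e₁ e₂ e₃ e₄ e₅ e₆ x y z = 0 ∧
    w ^ 2 = quarticVal a₁ a₂ a₃ b₁ b₂ b₃ c₁ c₂ c₃ c₄ c₅ c₆ d₁ d₂ d₃ x y z ∧
    (e₄ * y + e₅ * z) * w = c₁ * (x ^ 2 * y) + c₂ * (x ^ 2 * z) + c₃ * y ^ 3 + c₄ * z ^ 3 +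
      d₂ * (y ^ 2 * z) + d₃ * (y * z ^ 2) ∧
    (e₄ * x + e₆ * z) * w = c₁ * x ^ 3 + c₃ * (x * y ^ 2) + c₅ * (y ^ 2 * z) + c₆ * z ^ 3 +
      d₁ * (x ^ 2 * z) + d₃ * (x * z ^ 2) ∧
    (e₅ * x + e₆ * y) * w = c₂ * x ^ 3 + c₄ * (x * z ^ 2) + c₅ * y ^ 3 + c₆ * (y * z ^ 2) +
      d₁ * (x ^ 2 * y) + d₂ * (x * y ^ 2)

instance {R : Type*} [CommRing R] [DecidableEq R]
    (e₁ e₂ e₃ e₄ e₅ e₆ a₁ a₂ a₃ b₁ b₂ b₃ c₁ c₂ c₃ c₄ c₅ c₆ d₁ d₂ d₃ x y z w : R) :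
    Decidable (IsDoublePoint e₁ e₂ e₃ e₄ e₅ e₆ a₁ a₂ a₃ b₁ b₂ b₃ c₁ c₂ c₃ c₄ c₅ c₆ d₁ d₂ d₃ x y z w) := by
  unfold IsDoublePoint; infer_instance

theorem SmoothPair.not_isDoublePoint (h2 : (2 : k) = 0)
    (hs : SmoothPair (quadForm e₁ e₂ e₃ e₄ e₅ e₆)
      (quarticForm a₁ a₂ a₃ b₁ b₂ b₃ c₁ c₂ c₃ c₄ c₅ c₆ d₁ d₂ d₃))
    {Ω : Type u} [Field Ω] (φ : k →+* Ω) {x y z w : Ω} (h0 : ¬(x = 0 ∧ y = 0 ∧ z = 0)) :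
    ¬IsDoublePoint (φ e₁) (φ e₂) (φ e₃) (φ e₄) (φ e₅) (φ e₆) (φ a₁) (φ a₂) (φ a₃) (φ b₁) (φ b₂) (φ b₃)
      (φ c₁) (φ c₂) (φ c₃) (φ c₄) (φ c₅) (φ c₆) (φ d₁) (φ d₂) (φ d₃) x y z w := by
  rintro ⟨hf, hg, hx, hy, hz⟩
  let _ := φ.toAlgebra
  have hφ : algebraMap k Ω = φ := rfl
  have H2 : (2 : Ω) = 0 := by rw [← map_ofNat φ 2, h2, map_zero]
  have hf' : aeval ![x, y, z] (quadForm e₁ e₂ e₃ e₄ e₅ e₆) = 0 := by rw [aeval_quadForm, ← hf, hφ]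
  refine hs Ω ![x, y, z] w (fun h => h0 ⟨congrFun h 0, congrFun h 1, congrFun h 2⟩) ?_ ?_ fun i => ?_
  · rw [hf', H2]; ring
  · rw [hf', hg, aeval_quarticForm, hφ, quarticVal]; ring
  · fin_cases i
    · simp [quarticForm, quadForm, pderiv_X, Derivation.leibniz, Derivation.leibniz_pow, hφ]
      linear_combination hx + (φ e₁ * x * w - 2 * φ a₁ * x ^ 3 - φ b₁ * x * y ^ 2 - φ b₂ * x * z ^ 2 -
        φ c₁ * x ^ 2 * y - φ c₂ * x ^ 2 * z - φ d₁ * x * y * z) * H2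
    · simp [quarticForm, quadForm, pderiv_X, Derivation.leibniz, Derivation.leibniz_pow, hφ]
      linear_combination hy + (φ e₂ * y * w - 2 * φ a₂ * y ^ 3 - φ b₁ * y * x ^ 2 - φ b₃ * y * z ^ 2 -
        φ c₃ * y ^ 2 * x - φ c₅ * y ^ 2 * z - φ d₂ * x * y * z) * H2
    · simp [quarticForm, quadForm, pderiv_X, Derivation.leibniz, Derivation.leibniz_pow, hφ]
      linear_combination hz + (φ e₃ * z * w - 2 * φ a₃ * z ^ 3 - φ b₂ * z * x ^ 2 - φ b₃ * z * y ^ 2 -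
        φ c₄ * z ^ 2 * x - φ c₆ * z ^ 2 * y - φ d₃ * x * y * z) * H2

end

section

instance : Fact (∀ r : ZMod 2, r ^ 2 ≠ 1 + 1 * r) := ⟨by decide⟩

/-- A computable model of the field with four elements. -/
abbrev QuadraticExtension : Type := QuadraticAlgebra (ZMod 2) 1 1

variable {a₁ a₂ a₃ b₁ b₂ b₃ c₁ c₂ c₃ c₄ c₅ c₆ d₁ d₂ d₃ e₁ e₂ e₃ e₄ e₅ e₆ : ZMod 2}

/-- There is a singular point of `w² + f w = g` above `(x, y, z)`. -/
def HasDoublePoint (e₁ e₂ e₃ e₄ e₅ e₆ a₁ a₂ a₃ b₁ b₂ b₃ c₁ c₂ c₃ c₄ c₅ c₆ d₁ d₂ d₃ : ZMod 2)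
    (x y z : QuadraticExtension) : Prop :=
  IsDoublePoint (R := QuadraticExtension) ⟨e₁, 0⟩ ⟨e₂, 0⟩ ⟨e₃, 0⟩ ⟨e₄, 0⟩ ⟨e₅, 0⟩ ⟨e₆, 0⟩ ⟨a₁, 0⟩ ⟨a₂, 0⟩ ⟨a₃, 0⟩
    ⟨b₁, 0⟩ ⟨b₂, 0⟩ ⟨b₃, 0⟩ ⟨c₁, 0⟩ ⟨c₂, 0⟩ ⟨c₃, 0⟩ ⟨c₄, 0⟩ ⟨c₅, 0⟩ ⟨c₆, 0⟩ ⟨d₁, 0⟩ ⟨d₂, 0⟩ ⟨d₃, 0⟩ x y z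
    (quarticVal ⟨a₁, 0⟩ ⟨a₂, 0⟩ ⟨a₃, 0⟩ ⟨b₁, 0⟩ ⟨b₂, 0⟩ ⟨b₃, 0⟩ ⟨c₁, 0⟩ ⟨c₂, 0⟩ ⟨c₃, 0⟩ ⟨c₄, 0⟩ ⟨c₅, 0⟩
      ⟨c₆, 0⟩ ⟨d₁, 0⟩ ⟨d₂, 0⟩ ⟨d₃, 0⟩ x y z ^ 2)

instance (x y z : QuadraticExtension) : Decidable (HasDoublePoint e₁ e₂ e₃ e₄ e₅ e₆ a₁ a₂ a₃ b₁ b₂ b₃ c₁ c₂ c₃ c₄ c₅ c₆ d₁ d₂ d₃ x y z) := by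
  unfold HasDoublePoint; infer_instance

theorem SmoothPair.not_hasDoublePoint
    (hs : SmoothPair (quadForm e₁ e₂ e₃ e₄ e₅ e₆)
      (quarticForm a₁ a₂ a₃ b₁ b₂ b₃ c₁ c₂ c₃ c₄ c₅ c₆ d₁ d₂ d₃)) {x y z : QuadraticExtension}
    (h0 : ¬(x = 0 ∧ y = 0 ∧ z = 0)) :
    ¬HasDoublePoint e₁ e₂ e₃ e₄ e₅ e₆ a₁ a₂ a₃ b₁ b₂ b₃ c₁ c₂ c₃ c₄ c₅ c₆ d₁ d₂ d₃ x y z :=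
  hs.not_isDoublePoint (by decide) (algebraMap (ZMod 2) QuadraticExtension) h0

theorem zmod_two_norm : ∀ c₁ c₂ d₁ d₂ : ZMod 2, c₁ ≠ 0 ∨ c₂ ≠ 0 →
    HasDoublePoint 0 1 1 0 0 1 0 1 1 0 0 1 c₁ c₂ c₁ c₂ 0 0 d₁ d₂ (d₁ + d₂) 0 1 ⟨0, 1⟩ ∨
    HasDoublePoint 0 1 1 0 0 1 0 1 1 0 0 1 c₁ c₂ c₁ c₂ 0 0 d₁ d₂ (d₁ + d₂) 1 1 ⟨0, 1⟩ ∨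
    HasDoublePoint 0 1 1 0 0 1 0 1 1 0 0 1 c₁ c₂ c₁ c₂ 0 0 d₁ d₂ (d₁ + d₂) 1 ⟨0, 1⟩ 1 ∨
    HasDoublePoint 0 1 1 0 0 1 0 1 1 0 0 1 c₁ c₂ c₁ c₂ 0 0 d₁ d₂ (d₁ + d₂) 1 ⟨0, 1⟩ ⟨1, 1⟩ := by
  decide +kernel

/-- The surface `w² + f w = g` contains a conic over a line. -/
def HasTangentLine (e₁ e₂ e₃ e₄ e₅ e₆ a₁ a₂ a₃ b₁ b₂ b₃ c₁ c₂ c₃ c₄ c₅ c₆ d₁ d₂ d₃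
    x y z x' y' z' : ZMod 2) : Prop :=
  ¬(x * y' = y * x' ∧ x * z' = z * x' ∧ y * z' = z * y') ∧
  quadVal e₁ e₂ e₃ e₄ e₅ e₆ x y z = 0 ∧
  (quadPolar e₄ e₅ e₆ x y z x' y' z' ≠ 0 ∨ quadVal e₁ e₂ e₃ e₄ e₅ e₆ x' y' z' ≠ 0) ∧
  quarticPolar c₁ c₂ c₃ c₄ c₅ c₆ d₁ d₂ d₃ x y z x' y' z' = quadPolar e₄ e₅ e₆ x y z x' y' z' *
    quarticVal a₁ a₂ a₃ b₁ b₂ b₃ c₁ c₂ c₃ c₄ c₅ c₆ d₁ d₂ d₃ x y z ∧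
  quadPolar e₄ e₅ e₆ x y z x' y' z' ^ 2 *
      quarticVal a₁ a₂ a₃ b₁ b₂ b₃ c₁ c₂ c₃ c₄ c₅ c₆ d₁ d₂ d₃ x' y' z' +
    quadPolar e₄ e₅ e₆ x y z x' y' z' * quadVal e₁ e₂ e₃ e₄ e₅ e₆ x' y' z' *
      quarticPolar c₁ c₂ c₃ c₄ c₅ c₆ d₁ d₂ d₃ x' y' z' x y z +
    quadVal e₁ e₂ e₃ e₄ e₅ e₆ x' y' z' ^ 2 *
      (quarticMid b₁ b₂ b₃ c₁ c₂ c₃ c₄ c₅ c₆ d₁ d₂ d₃ x y z x' y' z' +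
        quadVal e₁ e₂ e₃ e₄ e₅ e₆ x' y' z' *
          quarticVal a₁ a₂ a₃ b₁ b₂ b₃ c₁ c₂ c₃ c₄ c₅ c₆ d₁ d₂ d₃ x y z) +
    quarticPolar c₁ c₂ c₃ c₄ c₅ c₆ d₁ d₂ d₃ x' y' z' x y z ^ 2 ≠ 0

instance (x y z x' y' z' : ZMod 2) : Decidable (HasTangentLine e₁ e₂ e₃ e₄ e₅ e₆ a₁ a₂ a₃ b₁ b₂ b₃ c₁ c₂ c₃ c₄
    c₅ c₆ d₁ d₂ d₃ x y z x' y' z') := by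
  unfold HasTangentLine; infer_instance

theorem HasCurve.of_hasTangentLine {x y z x' y' z' : ZMod 2}
    (h : HasTangentLine e₁ e₂ e₃ e₄ e₅ e₆ a₁ a₂ a₃ b₁ b₂ b₃ c₁ c₂ c₃ c₄ c₅ c₆ d₁ d₂ d₃ x y z x' y' z') :
    HasCurve (quadForm e₁ e₂ e₃ e₄ e₅ e₆)
      (quarticForm a₁ a₂ a₃ b₁ b₂ b₃ c₁ c₂ c₃ c₄ c₅ c₆ d₁ d₂ d₃) := by
  obtain ⟨h₁, h₂, h₃, h₄, h₅⟩ := h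
  have hsq : ∀ x : ZMod 2, x = x ^ 2 := by decide
  exact HasCurve.quarticForm_of_tangent_line (by decide) h₁ h₂ rfl rfl h₃ (hsq _) h₄ rfl h₅

set_option synthInstance.maxSize 1000 in
set_option synthInstance.maxHeartbeats 200000 in
theorem zmod_two_conic : ∀ c₁ c₂ c₅ c₆ d₂ d₃ : ZMod 2,
    (c₁ = 0 ∧ c₂ = 0 ∧ c₅ = 1 ∧ c₆ = 1 ∧ d₂ = 1 ∧ d₃ = 1) ∨
    (∃ x y z x' y' z', HasTangentLine 1 0 0 0 0 1 1 0 0 0 0 (1 + c₅ + c₆) c₁ c₂ c₁ c₂ c₅ c₆ 0 d₂ d₃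
      x y z x' y' z') ∨
    HasDoublePoint 1 0 0 0 0 1 1 0 0 0 0 (1 + c₅ + c₆) c₁ c₂ c₁ c₂ c₅ c₆ 0 d₂ d₃ 0 1 0 ∨
    HasDoublePoint 1 0 0 0 0 1 1 0 0 0 0 (1 + c₅ + c₆) c₁ c₂ c₁ c₂ c₅ c₆ 0 d₂ d₃ 0 0 1 ∨
    HasDoublePoint 1 0 0 0 0 1 1 0 0 0 0 (1 + c₅ + c₆) c₁ c₂ c₁ c₂ c₅ c₆ 0 d₂ d₃ 1 1 1 ∨
    HasDoublePoint 1 0 0 0 0 1 1 0 0 0 0 (1 + c₅ + c₆) c₁ c₂ c₁ c₂ c₅ c₆ 0 d₂ d₃ 1 ⟨0, 1⟩ ⟨1, 1⟩ := by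
  decide +kernel

set_option synthInstance.maxSize 1000 in
set_option synthInstance.maxHeartbeats 200000 in
theorem zmod_two_mul : ∀ c₁ c₂ c₃ c₄ c₅ c₆ d₁ d₂ : ZMod 2,
    (c₁ = 1 ∧ c₂ = 1 ∧ d₂ = 0 ∧ d₁ = c₃ + c₄ ∧ ((c₅ = 1 ∧ c₆ = 1 ∧ (c₃ = 0 ∨ c₄ = 0)) ∨
      (c₅ = 0 ∧ c₆ = 0 ∧ c₃ = 1 ∧ c₄ = 1))) ∨
    (∃ x y z x' y' z', HasTangentLine 0 0 0 0 0 1 0 0 0 0 0 (1 + c₅ + c₆) c₁ c₂ c₃ c₄ c₅ c₆ d₁ d₂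
      (c₁ + c₂ + c₃ + c₄ + d₁ + d₂) x y z x' y' z') ∨
    HasDoublePoint 0 0 0 0 0 1 0 0 0 0 0 (1 + c₅ + c₆) c₁ c₂ c₃ c₄ c₅ c₆ d₁ d₂
      (c₁ + c₂ + c₃ + c₄ + d₁ + d₂) 1 0 0 ∨
    HasDoublePoint 0 0 0 0 0 1 0 0 0 0 0 (1 + c₅ + c₆) c₁ c₂ c₃ c₄ c₅ c₆ d₁ d₂
      (c₁ + c₂ + c₃ + c₄ + d₁ + d₂) 0 1 0 ∨
    HasDoublePoint 0 0 0 0 0 1 0 0 0 0 0 (1 + c₅ + c₆) c₁ c₂ c₃ c₄ c₅ c₆ d₁ d₂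
      (c₁ + c₂ + c₃ + c₄ + d₁ + d₂) 1 0 1 ∨
    HasDoublePoint 0 0 0 0 0 1 0 0 0 0 0 (1 + c₅ + c₆) c₁ c₂ c₃ c₄ c₅ c₆ d₁ d₂
      (c₁ + c₂ + c₃ + c₄ + d₁ + d₂) 1 1 0 := by
  decide +kernel

end

section

variable {k : Type u} [Field k] {a₁ a₂ a₃ b₁ b₂ b₃ c₁ c₂ c₃ c₄ c₅ c₆ d₁ d₂ d₃ : k}

theorem HasCurve.conic_quarticForm_zmod_two (h2 : (2 : k) = 0) :
    HasCurve (X 0 ^ 2 + X 1 * X 2) (quarticForm (1 : k) 0 0 0 0 1 0 0 0 0 1 1 0 1 1) := by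
  have : CharP k 2 := CharTwo.of_one_ne_zero_of_two_eq_zero one_ne_zero h2
  refine HasCurve.of_eval_of_two_eq_zero h2 (x := .X) (y := .X ^ 4) (z := 1)
    (w := .X ^ 6 + .X ^ 5 + .X ^ 3 + .X ^ 2) (F := .X ^ 4 + .X ^ 2) ?_ ?_ ?_ ⟨0, 2, ?_⟩
  · simp only [map_add, map_pow, map_mul, aeval_X, Matrix.cons_val]
    grind
  · rw [aeval_quarticForm]
    simp only [map_zero, map_one]
    grind
  · intro h
    simpa [Polynomial.coeff_X] using congrArg (Polynomial.coeff · 2) h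
  · simp

theorem HasCurve.mul_quarticForm_of_eval (h2 : (2 : k) = 0) (x w : Polynomial k)
    (h : w ^ 2 + (.X ^ 2 + .X) * w = aeval (![x, .X + 1, .X] : Fin 3 → Polynomial k)
      (quarticForm a₁ a₂ a₃ b₁ b₂ b₃ c₁ c₂ c₃ c₄ c₅ c₆ d₁ d₂ d₃)) :
    HasCurve (X 1 * X 2) (quarticForm a₁ a₂ a₃ b₁ b₂ b₃ c₁ c₂ c₃ c₄ c₅ c₆ d₁ d₂ d₃) := by
  refine HasCurve.of_eval_of_two_eq_zero h2 (x := x) (y := .X + 1) (z := .X) (w := w)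
    (F := .X ^ 2 + .X) ?_ ?_ ?_ ⟨1, 2, ?_⟩
  · simp; ring
  · rw [h]
  · intro h
    simpa [Polynomial.coeff_X] using congrArg (Polynomial.coeff · 2) h
  · simp

theorem HasCurve.mul_quarticForm_zmod_two (h2 : (2 : k) = 0) :
    HasCurve (X 1 * X 2) (quarticForm (0 : k) 0 0 0 0 1 1 1 0 0 1 1 0 0 0) := by
  have : CharP k 2 := CharTwo.of_one_ne_zero_of_two_eq_zero one_ne_zero h2
  refine HasCurve.mul_quarticForm_of_eval h2 (.X ^ 4 + .X ^ 2 + 1) (.X ^ 6 + .X ^ 5 + .X ^ 4 + .X ^ 3 + 1) ?_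
  rw [aeval_quarticForm]
  simp only [map_zero, map_one]
  grind

theorem HasCurve.mul_quarticForm_zmod_two_right (h2 : (2 : k) = 0) :
    HasCurve (X 1 * X 2) (quarticForm (0 : k) 0 0 0 0 1 1 1 0 1 1 1 1 0 0) := by
  have : CharP k 2 := CharTwo.of_one_ne_zero_of_two_eq_zero one_ne_zero h2
  refine HasCurve.mul_quarticForm_of_eval h2 (.X ^ 4 + .X ^ 2 + .X + 1) (.X ^ 6 + .X ^ 4 + .X + 1) ?_
  rw [aeval_quarticForm]
  simp only [map_zero, map_one]
  grind

theorem HasCurve.mul_quarticForm_zmod_two_both (h2 : (2 : k) = 0) :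
    HasCurve (X 1 * X 2) (quarticForm (0 : k) 0 0 0 0 1 1 1 1 1 0 0 0 0 0) := by
  have : CharP k 2 := CharTwo.of_one_ne_zero_of_two_eq_zero one_ne_zero h2
  refine HasCurve.mul_quarticForm_of_eval h2 (.X ^ 4 + .X ^ 2) (.X ^ 6 + .X ^ 5 + .X ^ 3 + .X) ?_
  rw [aeval_quarticForm]
  simp only [map_zero, map_one]
  grind

theorem HasCurve.sq_quarticForm_of_eval (h2 : (2 : k) = 0) (y z w : Polynomial k)
    (h : w ^ 2 + (.X ^ 4 + .X ^ 2) * w = aeval (![.X ^ 2 + .X, y, z] : Fin 3 → Polynomial k)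
      (quarticForm a₁ a₂ a₃ b₁ b₂ b₃ c₁ c₂ c₃ c₄ c₅ c₆ d₁ d₂ d₃)) (hz : z ≠ 0)
    (hz' : Polynomial.derivative z = 0) :
    HasCurve (X 0 ^ 2) (quarticForm a₁ a₂ a₃ b₁ b₂ b₃ c₁ c₂ c₃ c₄ c₅ c₆ d₁ d₂ d₃) := by
  have : CharP k 2 := CharTwo.of_one_ne_zero_of_two_eq_zero one_ne_zero h2
  refine HasCurve.of_eval_of_two_eq_zero h2 (x := .X ^ 2 + .X) (y := y) (z := z) (w := w)
    (F := .X ^ 4 + .X ^ 2) ?_ ?_ ?_ ⟨0, 2, ?_⟩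
  · simp; grind
  · rw [h]
  · intro h
    simpa [Polynomial.coeff_X] using congrArg (Polynomial.coeff · 2) h
  · intro h
    simp [hz'] at h
    grind

theorem HasCurve.sq_quarticForm_left (h2 : (2 : k) = 0) :
    HasCurve (X 0 ^ 2) (quarticForm (1 : k) 0 0 0 0 0 0 1 0 1 1 0 0 0 1) := by
  have : CharP k 2 := CharTwo.of_one_ne_zero_of_two_eq_zero one_ne_zero h2
  refine HasCurve.sq_quarticForm_of_eval h2 (.X ^ 4 + .X ^ 2 + 1) 1 (.X ^ 6 + .X ^ 2 + 1) ?_ one_ne_zero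
    Polynomial.derivative_one
  rw [aeval_quarticForm]
  simp only [map_zero, map_one]
  grind

theorem HasCurve.sq_quarticForm_right (h2 : (2 : k) = 0) :
    HasCurve (X 0 ^ 2) (quarticForm (1 : k) 0 0 0 0 0 0 1 0 1 1 0 1 0 0) := by
  have : CharP k 2 := CharTwo.of_one_ne_zero_of_two_eq_zero one_ne_zero h2
  refine HasCurve.sq_quarticForm_of_eval h2 (.X ^ 4 + .X + 1) ((.X ^ 2 + .X) ^ 2)
    (.X ^ 8 + .X ^ 5 + .X ^ 3 + .X) ?_ (fun h => ?_) ?_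
  · rw [aeval_quarticForm]
    simp only [map_zero, map_one]
    grind
  · simpa [Polynomial.coeff_X] using congrArg (Polynomial.coeff · 2) (pow_eq_zero_iff two_ne_zero |>.1 h)
  · rw [Polynomial.derivative_sq, h2, map_zero, zero_mul, zero_mul]

end

section

variable {f g : MvPolynomial (Fin 3) (ZMod 2)} {a₁ a₂ a₃ b₁ b₂ b₃ c₁ c₂ c₃ c₄ c₅ c₆ d₁ d₂ d₃ : ZMod 2}

theorem aeval_eq_one_of_not_hasCurve (hno : ¬HasCurve f g) (hs : SmoothPair f g) (hf : f.IsHomogeneous 2)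
    (hg : g.IsHomogeneous 4) {P : Fin 3 → ZMod 2} (hP : aeval P f = 1) : aeval P g = 1 := by
  by_contra h
  have h01 : ∀ a : ZMod 2, a ≠ 1 → a = 0 := by decide
  exact hno (HasCurve.of_value (by decide) hs hf hg (P := P) (w := 0) (by rw [hP]; exact one_ne_zero)
    (by rw [h01 _ h]; ring))

theorem HasCurve.of_conic_zmod_two (hs : SmoothPair (X 0 ^ 2 + X 1 * X 2) g) (hg : g.IsHomogeneous 4) :
    HasCurve (X 0 ^ 2 + X 1 * X 2) g := by
  refine HasCurve.of_conic_normalForm (by decide) hs hg fun a b c₁ c₂ c₃ c₄ c₅ c₆ d₂ d₃ hs => ?_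
  by_contra hno
  have hR := fun P => aeval_eq_one_of_not_hasCurve hno hs isHomogeneous_conic quarticForm_isHomogeneous (P := P)
  have r₁ := hR ![1, 0, 0] (by simp)
  have r₂ := hR ![1, 1, 0] (by simp)
  have r₃ := hR ![1, 0, 1] (by simp)
  have r₄ := hR ![0, 1, 1] (by simp)
  rw [eval_quarticForm] at r₁ r₂ r₃ r₄
  obtain rfl : a = 1 := by linear_combination r₁
  obtain rfl : c₃ = c₁ := by grind
  obtain rfl : c₄ = c₂ := by grind
  obtain rfl : b = 1 + c₅ + c₆ := by grind
  have e : (X 0 ^ 2 + X 1 * X 2 : MvPolynomial (Fin 3) (ZMod 2)) = quadForm 1 0 0 0 0 1 := by simp [quadForm]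
  rw [e] at hs hno
  rcases zmod_two_conic c₃ c₄ c₅ c₆ d₂ d₃ with ⟨rfl, rfl, rfl, rfl, rfl, rfl⟩ | ⟨_, _, _, _, _, _, h⟩ | h | h | h | h
  · rw [← e] at hno
    exact hno (HasCurve.conic_quarticForm_zmod_two (by decide))
  · exact hno (HasCurve.of_hasTangentLine h)
  all_goals exact hs.not_hasDoublePoint (by decide) h

theorem HasCurve.of_mul_zmod_two (hs : SmoothPair (X 1 * X 2) g) (hg : g.IsHomogeneous 4) :
    HasCurve (X 1 * X 2) g := by
  refine HasCurve.of_mul_normalForm (by decide) hs hg fun b c₁ c₂ c₃ c₄ c₅ c₆ d₁ d₂ d₃ hs => ?_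
  by_contra hno
  have hR := fun P => aeval_eq_one_of_not_hasCurve hno hs isHomogeneous_mul quarticForm_isHomogeneous (P := P)
  have r₁ := hR ![0, 1, 1] (by simp)
  have r₂ := hR ![1, 1, 1] (by simp)
  rw [eval_quarticForm] at r₁ r₂
  obtain rfl : b = 1 + c₅ + c₆ := by grind
  obtain rfl : d₃ = c₁ + c₂ + c₃ + c₄ + d₁ + d₂ := by grind
  have e : (X 1 * X 2 : MvPolynomial (Fin 3) (ZMod 2)) = quadForm 0 0 0 0 0 1 := by simp [quadForm]
  have hs' := hs
  rw [e] at hs'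
  rcases zmod_two_mul c₁ c₂ c₃ c₄ c₅ c₆ d₁ d₂ with ⟨rfl, rfl, rfl, rfl, h⟩ | ⟨_, _, _, _, _, _, h⟩ | h | h | h | h
  · have h01 : ∀ a : ZMod 2, a = 0 ∨ a = 1 := by decide
    rcases h with ⟨rfl, rfl, h⟩ | ⟨rfl, rfl, rfl, rfl⟩
    · rcases h01 c₃ with rfl | rfl
      · rcases h01 c₄ with rfl | rfl
        · exact hno (HasCurve.mul_quarticForm_zmod_two (by decide))
        · exact hno (HasCurve.mul_quarticForm_zmod_two_right (by decide))
      · obtain rfl := h.resolve_left one_ne_zero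
        refine hno (HasCurve.swap_quarticForm (by simp [linSubst, Fin.sum_univ_three, mul_comm]) hs fun _ => ?_)
        exact HasCurve.mul_quarticForm_zmod_two_right (by decide)
    · exact hno (HasCurve.mul_quarticForm_zmod_two_both (by decide))
  · rw [e] at hno
    exact hno (HasCurve.of_hasTangentLine h)
  all_goals exact hs'.not_hasDoublePoint (by decide) h

theorem HasCurve.of_norm_zmod_two {ν : ZMod 2} (hν : ∀ t, t ^ 2 + t + ν ≠ 0)
    (hs : SmoothPair (X 1 ^ 2 + X 1 * X 2 + C ν * X 2 ^ 2) g) (hg : g.IsHomogeneous 4) :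
    HasCurve (X 1 ^ 2 + X 1 * X 2 + C ν * X 2 ^ 2) g := by
  obtain rfl : ν = 1 := by
    have : ∀ ν : ZMod 2, (∀ t, t ^ 2 + t + ν ≠ 0) → ν = 1 := by decide
    exact this ν hν
  refine HasCurve.of_norm_normalForm (by decide) hs hg fun a₂ a₃ b₁ b₂ b₃ c₁ c₂ c₃ c₄ c₅ c₆ d₁ d₂ d₃ hs => ?_
  have hsq : ∀ a : ZMod 2, (C a : MvPolynomial (Fin 3) (ZMod 2)) ^ 2 = C a := fun a => by
    rw [← map_pow]; congr 1; revert a; decide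
  have b₁' := hsq b₁
  have b₂' := hsq b₂
  have c₅' := hsq c₅
  have c₆' := hsq c₆
  refine HasCurve.of_shift_of_two_eq_zero (by decide) (Q := quadForm 0 c₅ c₆ b₁ b₂ 0)
    (G := quarticForm 0 a₂ a₃ 0 0 (b₃ + c₅ + c₆) c₁ c₂ (c₃ + b₁) (c₄ + b₂) 0 0 d₁ (d₂ + b₁ + b₂) (d₃ + b₁ + b₂))
    (by simp only [quarticForm, quadForm, map_zero, map_add, map_one]; grind) hs fun hs => ?_
  generalize b₃ + c₅ + c₆ = b₃ at *
  generalize c₃ + b₁ = c₃ at *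
  generalize c₄ + b₂ = c₄ at *
  generalize d₂ + b₁ + b₂ = d₂ at *
  generalize d₃ + b₁ + b₂ = d₃ at *
  by_contra hno
  have hR := fun P => aeval_eq_one_of_not_hasCurve hno hs isHomogeneous_norm quarticForm_isHomogeneous (P := P)
  have r₁ := hR ![0, 1, 0] (by simp)
  have r₂ := hR ![0, 0, 1] (by simp)
  have r₃ := hR ![0, 1, 1] (by simp; decide)
  have r₄ := hR ![1, 1, 0] (by simp)
  have r₅ := hR ![1, 0, 1] (by simp)
  have r₆ := hR ![1, 1, 1] (by simp; decide)
  rw [eval_quarticForm] at r₁ r₂ r₃ r₄ r₅ r₆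
  obtain rfl : a₂ = 1 := by grind
  obtain rfl : a₃ = 1 := by grind
  obtain rfl : b₃ = 1 := by grind
  obtain rfl : c₃ = c₁ := by grind
  obtain rfl : c₄ = c₂ := by grind
  obtain rfl : d₃ = d₁ + d₂ := by grind
  by_cases hc : c₃ = 0 ∧ c₄ = 0
  · rw [hc.1, hc.2] at hs
    exact hs.false_of_first (by simp)
  have e : (X 1 ^ 2 + X 1 * X 2 + C 1 * X 2 ^ 2 : MvPolynomial (Fin 3) (ZMod 2)) = quadForm 0 1 1 0 0 1 := by
    simp [quadForm]; ring
  rw [e] at hs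
  rcases zmod_two_norm c₃ c₄ d₁ d₂ (by tauto) with h | h | h | h
  all_goals exact hs.not_hasDoublePoint (by decide) h

theorem HasCurve.of_sq_reduced (hs : SmoothPair (X 0 ^ 2) (quarticForm a₁ 0 0 0 0 0 c₁ c₂ 0 c₄ 1 0 d₁ 0 d₃)) :
    HasCurve (X 0 ^ 2) (quarticForm a₁ 0 0 0 0 0 c₁ c₂ 0 c₄ 1 0 d₁ 0 d₃) := by
  by_contra hno
  have hR := fun P => aeval_eq_one_of_not_hasCurve hno hs (by simpa using (isHomogeneous_X _ (0 : Fin 3)).pow 2)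
    quarticForm_isHomogeneous (P := P)
  have r₁ := hR ![1, 0, 0] (by simp)
  have r₂ := hR ![1, 1, 0] (by simp)
  have r₃ := hR ![1, 0, 1] (by simp)
  have r₄ := hR ![1, 1, 1] (by simp)
  rw [eval_quarticForm] at r₁ r₂ r₃ r₄
  have h01 : ∀ a : ZMod 2, a = 0 ∨ a = 1 := by decide
  obtain rfl : a₁ = 1 := by grind
  obtain rfl : c₁ = 0 := by grind
  obtain rfl : c₄ = c₂ := by grind
  obtain rfl : c₄ = 1 := by
    refine (h01 _).resolve_left ?_
    rintro rfl
    refine hno (HasCurve.swap_quarticForm (by simp [linSubst, Fin.sum_univ_three]) hs fun hs => ?_)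
    exact (hs.false_of_second (by simp)).elim
  rcases h01 d₁ with rfl | rfl
  · obtain rfl : d₃ = 1 := by grind
    exact hno (HasCurve.sq_quarticForm_left (by decide))
  · obtain rfl : d₃ = 0 := by grind
    exact hno (HasCurve.sq_quarticForm_right (by decide))

theorem linSubst_shear_quarticForm {k : Type*} [Field k] (h2 : (2 : k) = 0)
    (u v a₁ c₁ c₂ c₃ c₄ d₁ d₂ d₃ : k) : linSubst !![1, 0, 0; u, 1, 0; v, 0, 1]
      (quarticForm a₁ 0 0 0 0 0 c₁ c₂ c₃ c₄ 1 0 d₁ d₂ d₃) =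
    quarticForm (u ^ 3 * v + u ^ 3 * c₃ + u ^ 2 * v * d₂ + u * v ^ 2 * d₃ + u * v * d₁ + u * c₁ +
      v ^ 3 * c₄ + v * c₂ + a₁) 0 0 (u * v + u * c₃ + v * d₂) (u * d₃ + v * c₄) 0
      (u ^ 2 * v + u ^ 2 * c₃ + v ^ 2 * d₃ + v * d₁ + c₁)
      (u ^ 3 + u ^ 2 * d₂ + u * d₁ + v ^ 2 * c₄ + c₂) (v + c₃) c₄ 1 0 (u ^ 2 + d₁) (u + d₂) d₃ := by
  have H2 : (2 : MvPolynomial (Fin 3) k) = 0 := by rw [← map_ofNat C 2, h2, map_zero]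
  simp [quarticForm, linSubst, Fin.sum_univ_three]
  linear_combination (X 0 ^ 3 * X 1 * C u ^ 2 * C v + X 0 ^ 3 * X 1 * C u ^ 2 * C c₃ + X 0 ^ 3 * X 1 * C u * C v * C
    d₂ + X 0 ^ 3 * X 2 * C u * C v * C d₃ + X 0 ^ 3 * X 2 * C v ^ 2 * C c₄ + X 0 ^ 2 * X 1 ^ 2 * C
    u * C v + X 0 ^ 2 * X 1 ^ 2 * C u * C c₃ + X 0 ^ 2 * X 1 * X 2 * C u ^ 2 + X 0 ^ 2 * X 1 * X 2
    * C u * C d₂ + X 0 ^ 2 * X 1 * X 2 * C v * C d₃ + X 0 ^ 2 * X 2 ^ 2 * C v * C c₄ + X 0 * X 1 ^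
    2 * X 2 * C u) * H2

theorem HasCurve.of_sq_shear (hs : SmoothPair (X 0 ^ 2) (quarticForm a₁ 0 0 0 0 0 c₁ c₂ c₃ c₄ 1 0 d₁ d₂ d₃)) :
    HasCurve (X 0 ^ 2) (quarticForm a₁ 0 0 0 0 0 c₁ c₂ c₃ c₄ 1 0 d₁ d₂ d₃) := by
  have h0 : ∀ a : ZMod 2, a + a = 0 := by decide
  refine HasCurve.of_det_ne_zero (M := !![1, 0, 0; d₂, 1, 0; c₃, 0, 1])
    (by simp [Matrix.det_fin_three]) hs fun hs => ?_
  have hf : linSubst !![1, 0, 0; d₂, 1, 0; c₃, 0, 1] (X 0 ^ 2) = (X 0 ^ 2 : MvPolynomial (Fin 3) (ZMod 2)) := by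
    simp [linSubst, Fin.sum_univ_three]
  rw [hf, linSubst_shear_quarticForm (by decide), h0 c₃, h0 d₂] at hs ⊢
  exact HasCurve.of_sq_quarticForm (by decide) hs fun _ _ _ _ => HasCurve.of_sq_reduced

theorem HasCurve.of_sq_zmod_two (hs : SmoothPair (X 0 ^ 2) g) (hg : g.IsHomogeneous 4) :
    HasCurve (X 0 ^ 2) g := by
  refine HasCurve.of_sq_normalForm (by decide) hs hg fun a c₁ c₂ c₃ c₄ c₅ c₆ d₁ d₂ d₃ hs => ?_
  have h01 : ∀ a : ZMod 2, a = 0 ∨ a = 1 := by decide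
  rcases h01 c₅ with rfl | rfl <;> rcases h01 c₆ with rfl | rfl
  · exact (hs.false_of_sq (by decide)).elim
  · refine HasCurve.swap_quarticForm (by simp [linSubst, Fin.sum_univ_three]) hs HasCurve.of_sq_shear
  · exact HasCurve.of_sq_shear hs
  · refine HasCurve.of_det_ne_zero (M := !![1, 0, 0; 0, 1, 1; 0, 0, 1])
      (by simp [Matrix.det_fin_three]) hs fun hs => ?_
    have hf : linSubst !![1, 0, 0; 0, 1, 1; 0, 0, 1] (X 0 ^ 2) = (X 0 ^ 2 : MvPolynomial (Fin 3) (ZMod 2)) := by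
      simp [linSubst, Fin.sum_univ_three]
    have e : linSubst !![1, 0, 0; 0, 1, 1; 0, 0, 1] (quarticForm a 0 0 0 0 0 c₁ c₂ c₃ c₄ 1 1 d₁ d₂ d₃) =
        quarticForm a 0 0 0 d₁ 1 c₁ (c₁ + c₂) c₃ (c₃ + c₄ + d₂ + d₃) 1 0 d₁ (c₃ + d₂) (c₃ + d₃) := by
      simp [quarticForm, linSubst, Fin.sum_univ_three]
      grind
    rw [hf, e] at hs ⊢
    exact HasCurve.of_sq_quarticForm (by decide) hs fun _ _ _ _ => HasCurve.of_sq_shear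

end

theorem HasCurve.of_two_eq_zero {k : Type u} [Field k] [Fintype k] (h2 : (2 : k) = 0)
    {f g : MvPolynomial (Fin 3) k} (hf0 : f ≠ 0) (hs : SmoothPair f g)
    (hf : f.IsHomogeneous 2) (hg : g.IsHomogeneous 4) : HasCurve f g := by
  have : CharP k 2 := CharTwo.of_one_ne_zero_of_two_eq_zero one_ne_zero h2
  obtain ⟨n, -, hn⟩ := FiniteField.card k 2
  obtain hq | hq | hq : Fintype.card k = 2 ∨ Fintype.card k = 4 ∨ 8 ≤ Fintype.card k := by
    obtain hn' | hn' | hn' : (n : ℕ) = 1 ∨ (n : ℕ) = 2 ∨ 3 ≤ (n : ℕ) := by have := n.pos; omega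
    · exact .inl (by rw [hn, hn']; rfl)
    · exact .inr (.inl (by rw [hn, hn']; rfl))
    · exact .inr (.inr (by rw [hn]; exact Nat.pow_le_pow_right two_pos hn'))
  · have E : k ≃+* ZMod 2 := (ZMod.ringEquivOfPrime k Nat.prime_two hq).symm
    refine HasCurve.of_ringEquiv E (HasCurve.of_quadForm_cases (by decide) (fun h => hf0 ?_)
      (hs.map_ringEquiv E) (hf.map _) (hg.map _) (fun _ => HasCurve.of_conic_zmod_two)
      (fun _ => HasCurve.of_mul_zmod_two) (fun _ _ => HasCurve.of_norm_zmod_two)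
      (fun _ => HasCurve.of_sq_zmod_two))
    exact map_injective _ E.injective (by rw [h, map_zero])
  · exact HasCurve.of_quadForm_cases h2 hf0 hs hf hg (fun _ => HasCurve.of_conic_of_card_eq_four hq h2)
      (fun _ => HasCurve.of_mul_of_card_eq_four hq h2) (fun _ _ => HasCurve.of_norm_of_card_eq_four hq h2)
      (fun _ => HasCurve.of_sq_of_card_eq_four hq h2)
  · have key : ∀ (P : Fin 3 → k) {f : MvPolynomial (Fin 3) k} (R : Fin 3 → k), aeval R f ≠ 0 →
        f.IsHomogeneous 2 → P ≠ 0 → aeval P f = 0 → ∀ g, SmoothPair f g → g.IsHomogeneous 4 → HasCurve f g :=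
      fun P f R h0 hf hP hfP g hs hg =>
        HasCurve.of_zero_of_eight_le h2 hq hs (fun h => h0 (by rw [h, map_zero])) hf hg hP hfP
    have h1 : (![0, 1, 0] : Fin 3 → k) ≠ 0 := fun h => by simpa using congrFun h 1
    exact HasCurve.of_quadForm_cases h2 hf0 hs hf hg
      (key ![0, 1, 0] ![1, 0, 0] (by simp) isHomogeneous_conic h1 (by simp))
      (key ![0, 1, 0] ![0, 1, 1] (by simp) isHomogeneous_mul h1 (by simp))
      (fun _ g _ => key ![1, 0, 0] ![0, 1, 0] (by simp) isHomogeneous_norm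
        (fun h => by simpa using congrFun h 0) (by simp) g)
      (key ![0, 1, 0] ![1, 0, 0] (by simp)
        (by simpa using (isHomogeneous_X k (0 : Fin 3)).pow 2) h1 (by simp))

theorem exists_algebraicIndependent_of_two_eq_zero {k : Type*} [Field k] [Finite k] (h2 : (2 : k) = 0)
    (g : MvPolynomial (Fin 3) k) :
    ∃ u v ω : FractionRing (MvPolynomial (Fin 2) k), AlgebraicIndependent k ![u, v] ∧
      ω ^ 2 + aeval ![u, v, 1] (0 : MvPolynomial (Fin 3) k) * ω = aeval ![u, v, 1] g := by
  have : CharP k 2 := CharTwo.of_one_ne_zero_of_two_eq_zero one_ne_zero h2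
  let A := FractionRing (MvPolynomial (Fin 2) k)
  have : CharP A 2 := charP_of_injective_algebraMap (algebraMap k A).injective 2
  let x : Fin 2 → A := fun i => algebraMap (MvPolynomial (Fin 2) k) A (X i)
  refine ⟨x 0 ^ 2, x 1 ^ 2, aeval ![x 0, x 1, 1] (map ((frobeniusEquiv k 2).symm : k →+* k) g), ?_, ?_⟩
  · have e : ![x 0 ^ 2, x 1 ^ 2] = fun i => algebraMap (MvPolynomial (Fin 2) k) A (X i ^ 2) := by
      ext1 i; fin_cases i <;> simp [x]
    rw [e]
    have h1 : AlgebraicIndependent k (fun i : Fin 2 => (X i ^ 2 : MvPolynomial (Fin 2) k)) := by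
      rw [algebraicIndependent_iff]
      intro p hp
      refine expand_injective (n := 2) (by norm_num) ?_
      rw [map_zero, ← hp]
      rfl
    exact h1.map' (f := IsScalarTower.toAlgHom k (MvPolynomial (Fin 2) k) A)
      (IsFractionRing.injective _ _)
  · rw [map_zero, zero_mul, add_zero]
    have := map_aeval_of_ringEquiv (frobeniusEquiv k 2) (frobenius A 2)
      (fun x => by simp [frobenius_def]) ![x 0, x 1, 1] (map ((frobeniusEquiv k 2).symm : k →+* k) g)
    rw [map_map] at this
    have e : ((frobeniusEquiv k 2 : k →+* k).comp ((frobeniusEquiv k 2).symm : k →+* k)) = RingHom.id k := by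
      ext; simp
    rw [e, map_id, frobenius_def] at this
    rw [this]
    congr 2
    ext1 i; fin_cases i <;> simp [frobenius_def]

theorem delPezzo_deg_two_unirational_over_finite_field
    (k : Type*) [Field k] [Finite k]
    (f g : MvPolynomial (Fin 3) k)
    (hf : f.IsHomogeneous 2) (hg : g.IsHomogeneous 4)
    (F : MvPolynomial (Fin 4) (AlgebraicClosure k))
    (hF : F = (X 3) ^ 2
        + (aeval (fun i : Fin 3 => (X (Fin.castSucc i) : MvPolynomial (Fin 4) (AlgebraicClosure k)))) f * X 3
        - (aeval (fun i : Fin 3 => (X (Fin.castSucc i) : MvPolynomial (Fin 4) (AlgebraicClosure k)))) g)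
    (hsmooth : ¬ ∃ P : Fin 4 → AlgebraicClosure k,
        ¬ (P 0 = 0 ∧ P 1 = 0 ∧ P 2 = 0) ∧
        eval P F = 0 ∧ ∀ i : Fin 4, eval P (pderiv i F) = 0) :
    ∃ u v ω : FractionRing (MvPolynomial (Fin 2) k),
      AlgebraicIndependent k ![u, v] ∧
      ω ^ 2 + aeval ![u, v, 1] f * ω = aeval ![u, v, 1] g := by
  have hs := SmoothPair.of_closure hF hsmooth
  have := Fintype.ofFinite k
  by_cases h2 : (2 : k) = 0
  · by_cases hf0 : f = 0
    · subst hf0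
      exact exists_algebraicIndependent_of_two_eq_zero h2 g
    · exact DominantPair.exists_algebraicIndependent hf hg
        (DominantPair.of_curve hf hg hs (HasCurve.of_two_eq_zero h2 hf0 hs hf hg))
  · exact DominantPair.exists_algebraicIndependent hf hg
      (DominantPair.of_curve hf hg hs (HasCurve.of_two_ne_zero h2 hs hf hg))
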